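/- Let n > q ≥ 2. Let Π be a holomorphic Nambu structure of order q on an open neighborhood U of 0 in ℂⁿ with Π(0) = 0 whose linear part at 0 equals the complex nondegenerate Type 1 model Π_q^ℂ(x) = ∑_{j=1}^{q+1} (−1)^{j−1} x_j e₁ ∧ ⋯ ∧ ê_j ∧ ⋯ ∧ e_{q+1}. Then Π is locally holomorphically linearizable at 0: there exist an open neighborhood W ⊆ U of 0 and a biholomorphism φ from W onto an open neighborhood of 0 in ℂⁿ with φ(0) = 0 such that (φ_*Π)(y) = Π_q^ℂ(y) for all y ∈ φ(W). -/

import Mathlib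

namespace NambuLinC

/-- Index set for the standard basis of the `q`-th exterior power of `ℂⁿ`:
increasing multi-indices, encoded as `q`-element subsets of `Fin n`. -/
abbrev Idx (n q : ℕ) := {s : Finset (Fin n) // s.card = q}

/-- A `q`-vector of `ℂⁿ`, given by its coordinates in the standard basis
`{e_{i₁} ∧ ⋯ ∧ e_{i_q}}` of `⋀^q(ℂⁿ)`. -/
abbrev MultiVecC (n q : ℕ) := Idx n q → ℂ

/-- The complex Jacobian matrix of a map `φ : ℂⁿ → ℂⁿ` at a point `x`. -/
noncomputable def jacC {n : ℕ} (φ : (Fin n → ℂ) → (Fin n → ℂ)) (x : Fin n → ℂ) :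
    Matrix (Fin n) (Fin n) ℂ :=
  Matrix.of fun i j => fderiv ℂ φ x (Pi.single j 1) i

/-- The `q`-th exterior power `⋀^q A` of a complex matrix `A`, acting on
`q`-vectors in coordinates: `((⋀^q A) w)_J = ∑_I det(A[J,I]) w_I`. -/
noncomputable def extPowC (n q : ℕ) (A : Matrix (Fin n) (Fin n) ℂ) (w : MultiVecC n q) :
    MultiVecC n q :=
  fun J => ∑ I : Idx n q,
    (A.submatrix (J.1.orderEmbOfFin J.2) (I.1.orderEmbOfFin I.2)).det * w I

/-- The constant `q`-vector `e₁ ∧ ⋯ ∧ e_q` in coordinates. -/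
noncomputable def stdVecC (n q : ℕ) : MultiVecC n q :=
  fun J => if (J : Finset (Fin n)) = Finset.univ.filter (fun i : Fin n => (i : ℕ) < q) then 1 else 0

/-- `φ` is a biholomorphism from the open set `W` onto the open set `φ '' W`
(with holomorphic inverse). -/
def IsBiholoOn {n : ℕ} (φ : (Fin n → ℂ) → (Fin n → ℂ)) (W : Set (Fin n → ℂ)) : Prop :=
  IsOpen W ∧ IsOpen (φ '' W) ∧ AnalyticOnNhd ℂ φ W ∧
    ∃ ψ : (Fin n → ℂ) → (Fin n → ℂ), AnalyticOnNhd ℂ ψ (φ '' W) ∧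
      (∀ x ∈ W, ψ (φ x) = x) ∧ (∀ y ∈ φ '' W, φ (ψ y) = y)

/-- `P` is a holomorphic Nambu structure of order `q` on `U`: it is a holomorphic
`q`-vector field, and around every point where it does not vanish there is a
local biholomorphic coordinate system in which it becomes the constant
`q`-vector `e₁ ∧ ⋯ ∧ e_q`. -/
def IsNambuC (n q : ℕ) (P : (Fin n → ℂ) → MultiVecC n q) (U : Set (Fin n → ℂ)) : Prop :=
  AnalyticOnNhd ℂ P U ∧
    ∀ p ∈ U, P p ≠ 0 →
      ∃ W, p ∈ W ∧ W ⊆ U ∧ ∃ φ, IsBiholoOn φ W ∧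
        ∀ x ∈ W, extPowC n q (jacC φ x) (P x) = stdVecC n q

/-- The complex nondegenerate Type 1 linear Nambu structure of order `q`:
`Π_q^ℂ(x) = ∑_{j=1}^{q+1} (−1)^{j−1} x_j e₁ ∧ ⋯ ∧ ê_j ∧ ⋯ ∧ e_{q+1}`
(here written with `0`-based indices `j`, whence the sign `(−1)^j`). -/
noncomputable def modelPiC (n q : ℕ) (x : Fin n → ℂ) : MultiVecC n q :=
  fun J => ∑ j : Fin n,
    if ((j : ℕ) < q + 1 ∧
        (J : Finset (Fin n)) = (Finset.univ.filter (fun i : Fin n => (i : ℕ) < q + 1)).erase j)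
    then (-1 : ℂ) ^ (j : ℕ) * x j else 0

open Set Filter Topology Metric MeasureTheory
open scoped Real


section Osgood
universe u
variable {F : Type u} [NormedAddCommGroup F] [NormedSpace ℂ F] [CompleteSpace F]

lemma curry1 {K : Type} [TopologicalSpace K] [CompactSpace K] (Φ : ℂ → C(K, F))
    (hc : Continuous Φ) {c : ℂ} {R : ℝ} (hR : 0 < R)
    (hd : ∀ k, ∀ t ∈ ball c R, DifferentiableAt ℂ (fun t => Φ t k) t) :
    DifferentiableAt ℂ Φ c := by
  have hr : 0 < R / 2 := by positivity
  obtain ⟨r, hrr⟩ : ∃ r : NNReal, (r : ℝ) = R / 2 := ⟨(R/2).toNNReal, Real.coe_toNNReal _ hr.le⟩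
  have hr' : 0 < r := by rw [← NNReal.coe_pos, hrr]; exact hr
  have hi : CircleIntegrable Φ c r := hc.continuousOn.circleIntegrable r.coe_nonneg
  have h := hasFPowerSeriesOn_cauchy_integral hi hr'
  have h2 : (fun w => (2 * π * Complex.I : ℂ)⁻¹ • ∮ z in C(c, r), (z - w)⁻¹ • Φ z) =ᶠ[𝓝 c] Φ := by
    filter_upwards [ball_mem_nhds c hr] with w hw
    ext k
    let ev : C(K, F) →L[ℂ] F := ContinuousMap.evalCLM ℂ k
    have e1 : ev (∮ z in C(c, r), (z - w)⁻¹ • Φ z) = ∮ z in C(c, r), (z - w)⁻¹ • Φ z k := by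
      unfold circleIntegral
      rw [← ContinuousLinearMap.intervalIntegral_comp_comm]
      · simp [ev]
      · have : CircleIntegrable (fun z => (z - w)⁻¹ • Φ z) c r := by
          apply ContinuousOn.circleIntegrable r.coe_nonneg
          refine ContinuousOn.fun_smul ?_ hc.continuousOn
          refine ContinuousOn.inv₀ (by fun_prop) ?_
          intro z hz h0
          have : z = w := by linear_combination h0
          subst this
          have h1 := mem_sphere.1 hz
          have h2 := mem_ball.1 hw
          rw [h1, hrr] at h2
          exact lt_irrefl _ h2
        exact this.out
    have e2 : ((2 * π * Complex.I : ℂ)⁻¹ • ∮ z in C(c, r), (z - w)⁻¹ • Φ z) k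
      = (2 * π * Complex.I : ℂ)⁻¹ • ev (∮ z in C(c, r), (z - w)⁻¹ • Φ z) := rfl
    rw [e2, e1]
    refine Complex.two_pi_I_inv_smul_circleIntegral_sub_inv_smul_of_differentiable_on_off_countable
      (s := ∅) countable_empty (by rw [hrr]; exact hw) ?_ ?_
    · exact (ev.continuous.comp hc).continuousOn
    · intro x hx
      exact hd k x (ball_subset_ball (by rw [hrr]; linarith) hx.1)
  exact (h.analyticAt.congr h2).differentiableAt

lemma osgood_aux (n : ℕ) : ∀ (F : Type u) [NormedAddCommGroup F] [NormedSpace ℂ F] [CompleteSpace F]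
    (f : (Fin n → ℂ) → F) (_ : Continuous f) (x0 : Fin n → ℂ) (r : ℝ) (_ : 0 < r)
    (_ : ∀ x ∈ ball x0 r, ∀ i, DifferentiableAt ℂ (fun t => f (Function.update x i t)) (x i)),
    AnalyticAt ℂ f x0 := by
  induction n with
  | zero =>
    intro F _ _ _ f hf x0 r hr hd
    have : f = fun _ => f x0 := by ext x; congr 1; exact Subsingleton.elim _ _
    rw [this]; exact analyticAt_const
  | succ n ih =>
    intro F _ _ _ f hf x0 r hr hd
    let S : Set ℂ := sphere (x0 0) (r/2)
    have : CompactSpace S := isCompact_iff_compactSpace.1 (isCompact_sphere _ _)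
    let c := x0 0
    have hr2 : 0 < r / 2 := by positivity
    let g : (Fin n → ℂ) → C(S, F) := fun x' => ⟨fun k => f (Fin.cons (k : ℂ) x'), by fun_prop⟩
    have hg : Continuous g := by
      apply ContinuousMap.continuous_of_continuous_uncurry
      change Continuous (fun p : (Fin n → ℂ) × S => f (Fin.cons (p.2 : ℂ) p.1))
      fun_prop
    have hga : AnalyticAt ℂ g (Fin.tail x0) := by
      refine ih _ g hg _ (r/2) hr2 ?_
      intro x hx i
      have hx' : dist x (Fin.tail x0) < r/2 := hx
      refine curry1 (fun t => g (Function.update x i t)) (hg.comp (by fun_prop))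
        (R := r/2) hr2 ?_
      intro k t ht
      have ht' : dist t (x i) < r/2 := ht
      have hm : (Fin.cons (k:ℂ) (Function.update x i t) : Fin (n+1) → ℂ) ∈ ball x0 r := by
        rw [mem_ball, dist_pi_lt_iff hr]
        intro j
        refine Fin.cases ?_ (fun j => ?_) j
        · have := mem_sphere.1 k.2
          simp only [Fin.cons_zero]
          rw [this]; linarith
        · simp only [Fin.cons_succ]
          have h1 := (dist_pi_lt_iff hr2).1 hx' j
          change dist (x j) (x0 j.succ) < r/2 at h1
          by_cases hj : j = i
          · subst hj
            simp only [Function.update_self]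
            calc dist t (x0 j.succ) ≤ dist t (x j) + dist (x j) (x0 j.succ) := dist_triangle _ _ _
              _ < r := by linarith
          · rw [Function.update_of_ne hj]; linarith
      have := hd _ hm i.succ
      simp only [Fin.cons_succ, Function.update_self] at this
      convert this using 2 with s
      change f (Fin.cons (k:ℂ) (Function.update x i s)) = _
      congr 1
      rw [← Fin.cons_update, Function.update_idem]
    -- kernel
    let Z : C(S, ℂ) := ⟨fun k => (k:ℂ), by fun_prop⟩
    have hZ : ∀ z ∈ ball c (r/2), IsUnit (Z - algebraMap ℂ C(S, ℂ) z) := by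
      intro z hz
      rw [ContinuousMap.isUnit_iff_forall_ne_zero]
      intro k h0
      have h0' : (k:ℂ) - z = 0 := h0
      have h1 : (k:ℂ) = z := by linear_combination h0'
      have h2 := mem_sphere.1 k.2
      rw [h1] at h2
      have := mem_ball.1 hz
      linarith
    let κ : ℂ → C(S, ℂ) := fun z => Ring.inverse (Z - algebraMap ℂ C(S, ℂ) z)
    have hκ : AnalyticAt ℂ κ c := by
      obtain ⟨w, hw⟩ := hZ c (mem_ball_self hr2)
      have h1 : AnalyticAt ℂ (Ring.inverse : C(S, ℂ) → C(S, ℂ)) (Z - algebraMap ℂ C(S, ℂ) c) := by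
        rw [← hw]; exact analyticAt_inverse w
      refine AnalyticAt.comp (f := fun z => Z - algebraMap ℂ C(S, ℂ) z) h1 ?_
      have : AnalyticAt ℂ (fun z => Z - (Algebra.linearMap ℂ C(S, ℂ)).toContinuousLinearMap z) c :=
        analyticAt_const.sub (ContinuousLinearMap.analyticAt _ _)
      exact this
    have hκe : ∀ z ∈ ball c (r/2), ∀ k : S, κ z k = ((k:ℂ) - z)⁻¹ := by
      intro z hz k
      have := Ring.inverse_mul_cancel _ (hZ z hz)
      have h2 := congrArg (fun a : C(S, ℂ) => a k) this
      have h3 : κ z k * ((k:ℂ) - z) = 1 := h2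
      exact eq_inv_of_mul_eq_one_left h3
    let B : C(S, ℂ) →L[ℂ] C(S, F) →L[ℂ] C(S, F) := LinearMap.mkContinuous₂
      (LinearMap.mk₂ ℂ (fun (a : C(S, ℂ)) (b : C(S, F)) => (⟨fun k => a k • b k, by fun_prop⟩ : C(S, F)))
        (by intros; ext; simp [add_smul]) (by intros; ext; simp [smul_smul])
        (by intros; ext; simp) (by intro c a b; ext k; exact smul_comm (a k) c (b k))) 1 (by
          intro a b
          rw [ContinuousMap.norm_le _ (by positivity)]
          intro k
          simp only [LinearMap.mk₂_apply, ContinuousMap.coe_mk, norm_smul, one_mul]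
          gcongr
          · exact a.norm_coe_le_norm k
          · exact b.norm_coe_le_norm k)
    let cm : C(ℝ, S) := ⟨fun θ => ⟨circleMap c (r/2) θ, circleMap_mem_sphere _ hr2.le _⟩, by fun_prop⟩
    let L : C(S, F) →L[ℂ] F := LinearMap.mkContinuous
      { toFun := fun b => ∫ θ in (0:ℝ)..2*π, deriv (circleMap c (r/2)) θ • b (cm θ)
        map_add' := by
          intro a b
          simp only [ContinuousMap.add_apply, smul_add]
          apply intervalIntegral.integral_add <;> apply Continuous.intervalIntegrable <;>
          · simp only [deriv_circleMap]; fun_prop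
        map_smul' := by
          intro a b
          simp only [ContinuousMap.smul_apply, smul_comm _ a, RingHom.id_apply]
          exact intervalIntegral.integral_smul _ _ } (r/2 * |2*π - 0|) (by
        intro b
        calc _ ≤ (r/2 * ‖b‖) * |2*π - 0| := by
              apply intervalIntegral.norm_integral_le_of_norm_le_const
              intro θ _
              rw [norm_smul]
              gcongr
              · simp [deriv_circleMap, abs_of_pos hr2]
              · exact b.norm_coe_le_norm _
          _ = _ := by ring)
    have hmain : AnalyticAt ℂ (fun x : Fin (n+1) → ℂ =>
        (2 * π * Complex.I : ℂ)⁻¹ • L (B (κ (x 0)) (g (Fin.tail x)))) x0 := by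
      apply AnalyticAt.const_smul
      apply (L.analyticAt _).comp
      have h1 : AnalyticAt ℂ (fun x : Fin (n+1) → ℂ => κ (x 0)) x0 := by
        apply AnalyticAt.comp (f := fun x : Fin (n+1) → ℂ => x 0) hκ
        exact (ContinuousLinearMap.proj (R := ℂ) (φ := fun _ : Fin (n+1) => ℂ) 0).analyticAt _
      have h2 : AnalyticAt ℂ (fun x : Fin (n+1) → ℂ => g (Fin.tail x)) x0 := by
        apply AnalyticAt.comp (f := fun x : Fin (n+1) → ℂ => Fin.tail x) hga
        rw [analyticAt_pi_iff]
        intro i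
        exact (ContinuousLinearMap.proj (R := ℂ) (φ := fun _ : Fin (n+1) => ℂ) i.succ).analyticAt _
      exact (B.analyticAt_bilinear _).comp₂ h1 h2
    refine hmain.congr ?_
    filter_upwards [ball_mem_nhds x0 hr2] with x hx
    have hx0 : x 0 ∈ ball c (r/2) := (dist_le_pi_dist x x0 0).trans_lt hx
    have e1 : L (B (κ (x 0)) (g (Fin.tail x))) =
        ∮ z in C(c, r/2), (z - x 0)⁻¹ • f (Fin.cons z (Fin.tail x)) := by
      unfold circleIntegral
      change (∫ θ in (0:ℝ)..2*π, deriv (circleMap c (r/2)) θ • (κ (x 0) (cm θ) • g (Fin.tail x) (cm θ))) = _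
      congr 1
      ext θ
      rw [hκe _ hx0]
      rfl
    rw [e1]
    have := Complex.two_pi_I_inv_smul_circleIntegral_sub_inv_smul_of_differentiable_on_off_countable
      (s := ∅) countable_empty hx0 (f := fun z => f (Fin.cons z (Fin.tail x)))
      (by apply Continuous.continuousOn; fun_prop) (by
        intro z hz
        have hm : (Fin.cons z (Fin.tail x) : Fin (n+1) → ℂ) ∈ ball x0 r := by
          rw [mem_ball, dist_pi_lt_iff hr]
          intro j
          refine Fin.cases ?_ (fun j => ?_) j
          · have := mem_ball.1 hz.1
            simp only [Fin.cons_zero]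
            linarith
          · simp only [Fin.cons_succ]
            have := (dist_le_pi_dist x x0 j.succ).trans_lt hx
            change dist (x j.succ) _ < _
            linarith
        have := hd _ hm 0
        simpa only [Fin.update_cons_zero, Fin.cons_zero] using this)
    rw [this, Fin.cons_self_tail]

end Osgood
section Osgood2
universe u
variable {F : Type u} [NormedAddCommGroup F] [NormedSpace ℂ F] [CompleteSpace F]
variable {E : Type*} [NormedAddCommGroup E] [NormedSpace ℂ E]

/-- radial retraction onto a closed ball -/
noncomputable def retr (x0 : E) (r : ℝ) (x : E) : E :=
  x0 + ((r / max r ‖x - x0‖ : ℝ) : ℂ) • (x - x0)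

lemma retr_continuous (x0 : E) {r : ℝ} (hr : 0 < r) : Continuous (retr x0 r) := by
  unfold retr
  have : Continuous fun x : E => (r / max r ‖x - x0‖ : ℝ) := by
    apply Continuous.div (by fun_prop) (by fun_prop)
    intro x; have := le_max_left r ‖x - x0‖; linarith
  fun_prop

lemma retr_eq (x0 : E) {r : ℝ} (hr : 0 < r) {x : E} (hx : x ∈ closedBall x0 r) : retr x0 r x = x := by
  unfold retr
  rw [mem_closedBall, dist_eq_norm] at hx
  rw [max_eq_left hx, div_self hr.ne']
  simp

lemma retr_mem (x0 : E) {r : ℝ} (hr : 0 < r) (x : E) : retr x0 r x ∈ closedBall x0 r := by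
  unfold retr
  rw [mem_closedBall, dist_eq_norm, add_sub_cancel_left, norm_smul, Complex.norm_real,
    Real.norm_of_nonneg (by positivity)]
  have h1 := le_max_left r ‖x - x0‖
  have h2 := le_max_right r ‖x - x0‖
  rw [div_mul_eq_mul_div, div_le_iff₀ (by linarith)]
  gcongr

lemma osgood_pi {n : ℕ} {f : (Fin n → ℂ) → F} {U : Set (Fin n → ℂ)} (hU : IsOpen U)
    (hf : ContinuousOn f U)
    (hd : ∀ x ∈ U, ∀ v, DifferentiableAt ℂ (fun t : ℂ => f (x + t • v)) 0) :
    AnalyticOnNhd ℂ f U := by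
  intro x0 hx0
  obtain ⟨r, hr, hrU⟩ := (nhds_basis_closedBall.mem_iff).1 (hU.mem_nhds hx0)
  have key : AnalyticAt ℂ (f ∘ retr x0 r) x0 := by
    refine osgood_aux n F _ ?_ x0 r hr ?_
    · exact hf.comp_continuous (retr_continuous x0 hr) (fun x => hrU (retr_mem x0 hr x))
    · intro x hx i
      have h1 := hd x (hrU (ball_subset_closedBall hx)) (Pi.single i 1)
      have h2 : DifferentiableAt ℂ (fun s : ℂ => f (x + (s - x i) • Pi.single i 1)) (x i) := by
        have := DifferentiableAt.comp (x i) (f := fun s : ℂ => s - x i)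
          (g := fun t : ℂ => f (x + t • Pi.single i 1)) (by simpa using h1) (by fun_prop)
        exact this
      refine h2.congr_of_eventuallyEq ?_
      have hcont : Continuous (fun s : ℂ => Function.update x i s) := by fun_prop
      have hn : ∀ᶠ s in 𝓝 (x i), Function.update x i s ∈ ball x0 r := by
        apply hcont.continuousAt.eventually_mem
        rw [Function.update_eq_self]; exact isOpen_ball.mem_nhds hx
      filter_upwards [hn] with s hs
      simp only [Function.comp]
      rw [retr_eq x0 hr (ball_subset_closedBall hs)]
      congr 1
      ext j
      by_cases hj : j = i
      · subst hj; simp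
      · simp [hj]
  refine key.congr ?_
  filter_upwards [closedBall_mem_nhds x0 hr] with x hx
  simp [retr_eq x0 hr hx]

lemma osgood [FiniteDimensional ℂ E] {f : E → F} {U : Set E} (hU : IsOpen U)
    (hf : ContinuousOn f U)
    (hd : ∀ x ∈ U, ∀ v, DifferentiableAt ℂ (fun t : ℂ => f (x + t • v)) 0) :
    AnalyticOnNhd ℂ f U := by
  let e : E ≃L[ℂ] (Fin (Module.finrank ℂ E) → ℂ) := (Module.finBasis ℂ E).equivFunL
  have h := osgood_pi (f := f ∘ e.symm) (U := e.symm ⁻¹' U) (hU.preimage e.symm.continuous)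
    (hf.comp e.symm.continuous.continuousOn (fun x hx => hx)) (by
      intro x hx v
      simpa using hd (e.symm x) hx (e.symm v))
  intro x hx
  have h1 := h (e x) (by simpa using hx)
  have h2 := h1.comp (e.toContinuousLinearMap.analyticAt x)
  convert h2 using 1
  ext y; simp

lemma line_diff {f : E → F} {x : E} (h : AnalyticAt ℂ f x) (v : E) :
    DifferentiableAt ℂ (fun t : ℂ => f (x + t • v)) 0 := by
  have h1 : DifferentiableAt ℂ f (x + (0:ℂ) • v) := by simpa using h.differentiableAt
  exact DifferentiableAt.comp (0:ℂ) (f := fun t : ℂ => x + t • v) h1 (by fun_prop)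

lemma analytic_integral_aux [FiniteDimensional ℂ E] {Φ : E → ℝ → F} {x0 : E} {r a b : ℝ}
    (hab : a ≤ b) (hr : 0 < r)
    (hc : Continuous (fun p : E × (Icc a b) => Φ p.1 p.2))
    (hd : ∀ τ ∈ Icc a b, AnalyticOnNhd ℂ (fun x => Φ x τ) (ball x0 r)) :
    AnalyticOnNhd ℂ (fun x => ∫ τ in a..b, Φ x τ) (ball x0 r) := by
  let g : E → C(Icc a b, F) := fun x => ⟨fun τ => Φ x τ, hc.comp (f := fun τ => (x, τ)) (by fun_prop)⟩
  have hg : Continuous g := ContinuousMap.continuous_of_continuous_uncurry _ hc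
  let L : C(Icc a b, F) →L[ℂ] F := LinearMap.mkContinuous
      { toFun := fun c => ∫ τ in a..b, c (projIcc a b hab τ)
        map_add' := by
          intro c d
          simp only [ContinuousMap.add_apply]
          apply intervalIntegral.integral_add <;> apply Continuous.intervalIntegrable <;>
          · have := continuous_projIcc (a := a) (b := b) (h := hab)
            fun_prop
        map_smul' := by
          intro s c
          simp only [ContinuousMap.smul_apply, RingHom.id_apply]
          exact intervalIntegral.integral_smul _ _ } |b - a| (by
        intro c
        calc _ ≤ ‖c‖ * |b - a| := by
              apply intervalIntegral.norm_integral_le_of_norm_le_const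
              intro θ _
              exact c.norm_coe_le_norm _
          _ = _ := by ring)
  have hL : (fun x => ∫ τ in a..b, Φ x τ) = fun x => L (g x) := by
    ext x
    change _ = ∫ τ in a..b, Φ x (projIcc a b hab τ)
    apply intervalIntegral.integral_congr
    intro τ hτ
    rw [uIcc_of_le hab] at hτ
    simp [projIcc_of_mem hab hτ]
  rw [hL]
  apply osgood isOpen_ball
  · exact (L.continuous.comp hg).continuousOn
  · intro x hx v
    have hcont : Continuous (fun t : ℂ => x + t • v) := by fun_prop
    have hnb : ∀ᶠ t in 𝓝 (0:ℂ), x + t • v ∈ ball x0 r := by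
      apply hcont.continuousAt.eventually_mem
      simpa using isOpen_ball.mem_nhds hx
    obtain ⟨R, hR, hRb⟩ := Metric.eventually_nhds_iff_ball.1 hnb
    have := curry1 (fun t : ℂ => g (x + t • v)) (hg.comp hcont) hR (by
      intro k t ht
      have h1 := line_diff (hd k k.2 _ (hRb t ht)) v
      have h2 := DifferentiableAt.comp t (f := fun s : ℂ => s - t)
          (g := fun s : ℂ => Φ (x + t • v + s • v) k) (by simpa using h1) (by fun_prop)
      refine h2.congr_of_eventuallyEq (Eventually.of_forall fun s => ?_)
      change Φ (x + s • v) k = Φ (x + t • v + (s - t) • v) k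
      congr 1; module)
    exact (L.differentiableAt).comp (0:ℂ) this

lemma analytic_integral [FiniteDimensional ℂ E] {Φ : E → ℝ → F} {U : Set E} {a b : ℝ}
    (hab : a ≤ b) (hU : IsOpen U)
    (hc : ContinuousOn (fun p : E × ℝ => Φ p.1 p.2) (U ×ˢ Icc a b))
    (hd : ∀ τ ∈ Icc a b, AnalyticOnNhd ℂ (fun x => Φ x τ) U) :
    AnalyticOnNhd ℂ (fun x => ∫ τ in a..b, Φ x τ) U := by
  intro x0 hx0
  obtain ⟨r, hr, hrU⟩ := (nhds_basis_closedBall.mem_iff).1 (hU.mem_nhds hx0)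
  have key := analytic_integral_aux (Φ := fun x τ => Φ (retr x0 r x) τ) (x0 := x0) hab hr (by
      refine hc.comp_continuous (f := fun p : E × (Icc a b) => (retr x0 r p.1, (p.2 : ℝ))) ?_ ?_
      · have := retr_continuous x0 hr
        fun_prop
      · intro p; exact ⟨hrU (retr_mem x0 hr _), p.2.2⟩) (by
      intro τ hτ x hx
      refine (hd τ hτ x (hrU (ball_subset_closedBall hx))).congr ?_
      filter_upwards [isOpen_ball.mem_nhds hx] with y hy
      rw [retr_eq x0 hr (ball_subset_closedBall hy)])
  refine (key x0 (mem_ball_self hr)).congr ?_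
  filter_upwards [closedBall_mem_nhds x0 hr] with x hx
  simp [retr_eq x0 hr hx]

lemma analytic_limit [FiniteDimensional ℂ E] {f : ℕ → E → F} {g : E → F} {U : Set E}
    (hU : IsOpen U) (hf : ∀ k, AnalyticOnNhd ℂ (f k) U) (hl : TendstoUniformlyOn f g atTop U) :
    AnalyticOnNhd ℂ g U := by
  apply osgood hU
  · exact hl.continuousOn (Eventually.of_forall fun k => (hf k).continuousOn).frequently
  · intro x hx v
    have hcont : Continuous (fun t : ℂ => x + t • v) := by fun_prop
    set V := (fun t : ℂ => x + t • v) ⁻¹' U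
    have hV : IsOpen V := hU.preimage hcont
    have h1 : TendstoUniformlyOn (fun k t => f k (x + t • v)) (fun t : ℂ => g (x + t • v)) atTop V :=
      hl.comp _
    have h2 := h1.tendstoLocallyUniformlyOn.differentiableOn (Eventually.of_forall (by
      intro k t ht
      apply DifferentiableAt.differentiableWithinAt
      exact DifferentiableAt.comp t (f := fun t : ℂ => x + t • v) ((hf k _ ht).differentiableAt)
        (by fun_prop))) hV
    exact h2.differentiableAt (hV.mem_nhds (by simpa [V] using hx))

/-- fixed points in spaces of bounded analytic functions -/
lemma analytic_fp [FiniteDimensional ℂ E] {U : Set E} (hU : IsOpen U) {δ : ℝ} (hδ : 0 ≤ δ)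
    (T : (E → F) → (E → F))
    (hT : ∀ f, AnalyticOnNhd ℂ f U → (∀ x ∈ U, ‖f x‖ ≤ δ) →
      AnalyticOnNhd ℂ (T f) U ∧ ∀ x ∈ U, ‖T f x‖ ≤ δ)
    (hL : ∀ f g, AnalyticOnNhd ℂ f U → (∀ x ∈ U, ‖f x‖ ≤ δ) →
      AnalyticOnNhd ℂ g U → (∀ x ∈ U, ‖g x‖ ≤ δ) → ∀ c : ℝ, (∀ x ∈ U, ‖f x - g x‖ ≤ c) →
      ∀ x ∈ U, ‖T f x - T g x‖ ≤ c / 2) :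
    ∃ f, AnalyticOnNhd ℂ f U ∧ (∀ x ∈ U, ‖f x‖ ≤ δ) ∧ ∀ x ∈ U, T f x = f x := by
  let s : ℕ → E → F := fun k => T^[k] 0
  have hs : ∀ k, s (k+1) = T (s k) := fun k => Function.iterate_succ_apply' T k 0
  have hS : ∀ k, AnalyticOnNhd ℂ (s k) U ∧ ∀ x ∈ U, ‖s k x‖ ≤ δ := by
    intro k
    induction k with
    | zero => exact ⟨analyticOnNhd_const, by intro x _; simpa [s] using hδ⟩
    | succ k ih => rw [hs]; exact hT _ ih.1 ih.2
  have hstep : ∀ k, ∀ x ∈ U, ‖s (k+1) x - s k x‖ ≤ (2*δ) / 2 / 2^k := by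
    intro k
    induction k with
    | zero =>
      intro x hx
      have : s 0 x = 0 := rfl
      rw [this, sub_zero]; simpa using (hS 1).2 x hx
    | succ k ih =>
      intro x hx
      rw [hs, hs k]
      have := hL _ _ (hS (k+1)).1 (hS (k+1)).2 (hS k).1 (hS k).2 _ ih x hx
      rw [hs] at this
      refine this.trans (le_of_eq ?_)
      rw [pow_succ]; field_simp
  have hcau : ∀ x ∈ U, CauchySeq (fun k => s k x) := by
    intro x hx
    apply cauchySeq_of_le_geometric_two (C := 2*δ)
    intro k
    rw [dist_comm, dist_eq_norm]; exact hstep k x hx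
  choose! g hg using fun x hx => cauchySeq_tendsto_of_complete (hcau x hx)
  have hd : ∀ k, ∀ x ∈ U, ‖s k x - g x‖ ≤ (2*δ) / 2^k := by
    intro k x hx
    rw [← dist_eq_norm]
    apply dist_le_of_le_geometric_two_of_tendsto (fun k => ?_) (hg x hx)
    rw [dist_comm, dist_eq_norm]; exact hstep k x hx
  have hlim : Tendsto (fun k : ℕ => (2*δ) / 2^k) atTop (𝓝 0) := by
    have := (tendsto_pow_atTop_nhds_zero_of_lt_one (r := (1/2:ℝ)) (by norm_num) (by norm_num)).const_mul (2*δ)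
    simpa [div_eq_mul_inv] using this
  have hgA : AnalyticOnNhd ℂ g U := by
    apply analytic_limit hU (fun k => (hS k).1)
    rw [Metric.tendstoUniformlyOn_iff]
    intro ε hε
    filter_upwards [hlim.eventually (gt_mem_nhds hε)] with k hk x hx
    rw [dist_comm, dist_eq_norm]
    exact (hd k x hx).trans_lt hk
  have hgB : ∀ x ∈ U, ‖g x‖ ≤ δ := by
    intro x hx
    exact le_of_tendsto (hg x hx).norm (Eventually.of_forall fun k => (hS k).2 x hx)
  refine ⟨g, hgA, hgB, ?_⟩
  intro x hx
  have h1 : Tendsto (fun k => s (k+1) x) atTop (𝓝 (g x)) := (hg x hx).comp (tendsto_add_atTop_nat 1)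
  have h2 : Tendsto (fun k => s (k+1) x) atTop (𝓝 (T g x)) := by
    rw [tendsto_iff_norm_sub_tendsto_zero]
    refine squeeze_zero (fun _ => norm_nonneg _) (fun k => ?_) (by simpa using hlim.div_const 2)
    rw [hs]
    exact hL _ _ (hS k).1 (hS k).2 hgA hgB _ (hd k) x hx
  exact tendsto_nhds_unique h2 h1

end Osgood2
section Tensor
variable {n q : ℕ}

abbrev Idx.emb (J : Idx n q) : Fin q ↪o Fin n := J.1.orderEmbOfFin J.2

/-- the alternating form on covectors attached to a multivector -/
noncomputable def om (w : MultiVecC n q) : (Fin n → ℂ) [⋀^Fin q]→ₗ[ℂ] ℂ :=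
  ∑ J : Idx n q, w J • (Matrix.detRowAlternating.compLinearMap (LinearMap.funLeft ℂ ℂ J.emb))

lemma om_apply (w : MultiVecC n q) (M : Fin q → Fin n → ℂ) :
    om w M = ∑ J : Idx n q, w J * Matrix.det (Matrix.of fun a b => M a (J.emb b)) := by
  have aux : ∀ (s : Finset (Idx n q)) (g : Idx n q → (Fin n → ℂ) [⋀^Fin q]→ₗ[ℂ] ℂ),
      (∑ J ∈ s, g J) M = ∑ J ∈ s, g J M := by
    intro s g
    classical
    induction s using Finset.induction_on with
    | empty => simp
    | insert i s hi ih => rw [Finset.sum_insert hi, Finset.sum_insert hi, AlternatingMap.add_apply, ih]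
  unfold om
  rw [aux]
  rfl

lemma om_basis (w : MultiVecC n q) (J : Idx n q) :
    om w (fun a => Pi.single (J.emb a) 1) = w J := by
  rw [om_apply, Finset.sum_eq_single J]
  · have : (Matrix.of fun a b => (Pi.single (J.emb a) (1:ℂ) : Fin n → ℂ) (J.emb b)) = 1 := by
      ext a b
      simp only [Matrix.of_apply, Pi.single_apply, Matrix.one_apply]
      congr 1
      simp only [J.emb.injective.eq_iff, eq_comm]
    rw [this]; simp
  · intro I _ hI
    have : ∃ a, J.emb a ∉ I.1 := by
      by_contra h
      push Not at h
      apply hI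
      have hsub : J.1 ⊆ I.1 := by
        intro x hx
        have : x ∈ Set.range (J.1.orderEmbOfFin J.2) := by rw [Finset.range_orderEmbOfFin]; exact hx
        obtain ⟨a, rfl⟩ := this
        exact h a
      exact Subtype.ext (Finset.eq_of_subset_of_card_le hsub (by rw [I.2, J.2])).symm
    obtain ⟨a, ha⟩ := this
    rw [Matrix.det_eq_zero_of_row_eq_zero a, mul_zero]
    intro b
    simp only [Matrix.of_apply, Pi.single_apply, ite_eq_right_iff, one_ne_zero, imp_false]
    intro h
    apply ha
    rw [← h]
    exact Finset.orderEmbOfFin_mem _ _ _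
  · simp

lemma alt_ext {f g : (Fin n → ℂ) [⋀^Fin q]→ₗ[ℂ] ℂ}
    (h : ∀ J : Idx n q, f (fun a => Pi.single (J.emb a) 1) = g (fun a => Pi.single (J.emb a) 1)) :
    f = g := by
  refine Module.Basis.ext_alternating (Pi.basisFun ℂ (Fin n)) ?_
  intro v hv
  let J : Idx n q := ⟨Finset.univ.image v, by rw [Finset.card_image_of_injective _ hv]; simp⟩
  have hm : ∀ a, v a ∈ J.1 := fun a => Finset.mem_image_of_mem _ (Finset.mem_univ _)
  let σ0 : Fin q → Fin q := fun a => (J.1.orderIsoOfFin J.2).symm ⟨v a, hm a⟩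
  have hσ : ∀ a, J.emb (σ0 a) = v a := by
    intro a
    have := (J.1.orderIsoOfFin J.2).apply_symm_apply ⟨v a, hm a⟩
    have h2 := congrArg Subtype.val this
    exact h2
  have hinj : Function.Injective σ0 := by
    intro a b hab
    apply hv
    rw [← hσ a, ← hσ b, hab]
  let σ : Equiv.Perm (Fin q) := Equiv.ofBijective σ0 (Finite.injective_iff_bijective.1 hinj)
  have e : (fun i => (Pi.basisFun ℂ (Fin n)) (v i)) =
      (fun a => (Pi.single (J.emb a) 1 : Fin n → ℂ)) ∘ σ := by
    ext1 a
    simp only [Pi.basisFun_apply, Function.comp]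
    rw [← hσ a]; rfl
  rw [e, AlternatingMap.map_perm, AlternatingMap.map_perm, h]

lemma om_inj {w w' : MultiVecC n q} (h : ∀ M, om w M = om w' M) : w = w' := by
  ext J
  rw [← om_basis w J, ← om_basis w' J, h]

lemma om_smul (c : ℂ) (w : MultiVecC n q) (M) : om (c • w) M = c * om w M := by
  simp only [om_apply, Pi.smul_apply, smul_eq_mul, Finset.mul_sum, mul_assoc]

/-- Cauchy–Binet -/
lemma om_extPow (A : Matrix (Fin n) (Fin n) ℂ) (w : MultiVecC n q) (M : Fin q → Fin n → ℂ) :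
    om (extPowC n q A w) M = om w (fun a => Matrix.vecMul (M a) A) := by
  have : om (extPowC n q A w) = (om w).compLinearMap (Matrix.vecMulLinear A) := by
    apply alt_ext
    intro J
    rw [om_basis, AlternatingMap.compLinearMap_apply, om_apply]
    unfold extPowC
    refine Finset.sum_congr rfl fun I _ => ?_
    rw [mul_comm]
    congr 2
    ext a b
    simp
  rw [this]; rfl

lemma extPow_mul (A B : Matrix (Fin n) (Fin n) ℂ) (w : MultiVecC n q) :
    extPowC n q (A * B) w = extPowC n q A (extPowC n q B w) := by
  apply om_inj
  intro M
  simp only [om_extPow, Matrix.vecMul_vecMul]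

lemma extPow_one (w : MultiVecC n q) : extPowC n q 1 w = w := by
  apply om_inj
  intro M
  simp only [om_extPow, Matrix.vecMul_one]

lemma extPow_smul (A : Matrix (Fin n) (Fin n) ℂ) (c : ℂ) (w : MultiVecC n q) :
    extPowC n q A (c • w) = c • extPowC n q A w := by
  apply om_inj
  intro M
  simp only [om_extPow, om_smul]

lemma om_model (h : q + 1 ≤ n) (v : Fin n → ℂ) (M : Fin q → Fin n → ℂ) :
    om (modelPiC n q v) M = Matrix.det (Matrix.of fun a b : Fin (q+1) =>
      (Fin.cons v M : Fin (q+1) → Fin n → ℂ) a (Fin.castLE h b)) := by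
  have hS : ∀ j : Fin (q+1), ((Finset.univ.filter (fun i : Fin n => (i : ℕ) < q + 1)).erase
      (Fin.castLE h j)).card = q := by
    intro j
    rw [Finset.card_erase_of_mem (by simp; omega)]
    have : (Finset.univ.filter (fun i : Fin n => (i : ℕ) < q + 1)) =
      Finset.univ.map (Fin.castLEEmb h) := by
      ext i
      simp only [Finset.mem_filter, Finset.mem_univ, true_and, Finset.mem_map, Fin.castLEEmb_apply]
      constructor
      · intro hi; exact ⟨⟨i, hi⟩, rfl⟩
      · rintro ⟨k, rfl⟩; exact k.2
    rw [this]; simp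
  let S : Fin (q+1) → Idx n q := fun j => ⟨_, hS j⟩
  have hemb : ∀ j b, (S j).emb b = Fin.castLE h (j.succAbove b) := by
    intro j
    have := Finset.orderEmbOfFin_unique (hS j) (f := fun b => Fin.castLE h (j.succAbove b)) (by
      intro b
      simp only [Finset.mem_erase, Finset.mem_filter, Finset.mem_univ, true_and, Fin.val_castLE]
      refine ⟨?_, (j.succAbove b).2⟩
      rw [Ne, (Fin.castLE_injective h).eq_iff]
      exact Fin.succAbove_ne j b) (by
      exact (Fin.strictMono_castLE h).comp (Fin.strictMono_succAbove j))
    intro b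
    exact (congrFun this b).symm
  rw [om_apply, Matrix.det_succ_row_zero]
  have e1 : ∀ J : Idx n q, modelPiC n q v J = ∑ j : Fin (q+1), if J = S j then
      (-1:ℂ)^(j:ℕ) * v (Fin.castLE h j) else 0 := by
    intro J
    unfold modelPiC
    rw [← Finset.sum_subset (Finset.subset_univ (Finset.univ.map (Fin.castLEEmb h)))]
    · rw [Finset.sum_map]
      refine Finset.sum_congr rfl fun j _ => ?_
      simp only [Fin.castLEEmb_apply, Fin.val_castLE, j.2, true_and]
      congr 1
      simp only [S, Subtype.ext_iff]
    · intro i _ hi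
      rw [if_neg]
      rintro ⟨h1, -⟩
      apply hi
      simp only [Finset.mem_map, Finset.mem_univ, true_and, Fin.castLEEmb_apply]
      exact ⟨⟨i, h1⟩, rfl⟩
  simp only [e1, Finset.sum_mul]
  rw [Finset.sum_comm]
  refine Finset.sum_congr rfl fun j _ => ?_
  simp only [ite_mul, zero_mul, Finset.sum_ite_eq', Finset.mem_univ, if_true]
  simp only [Matrix.of_apply, Fin.cons_zero]
  congr 2
  ext a b
  simp only [Matrix.of_apply, Matrix.submatrix_apply, Fin.cons_succ, hemb]

/-- a covector annihilates a multivector -/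
def Kills (l : Fin n → ℂ) (w : MultiVecC n q) : Prop :=
  ∀ (M : Fin q → Fin n → ℂ) (a : Fin q), M a = l → om w M = 0

lemma Kills.extPow {l : Fin n → ℂ} {w : MultiVecC n q} {A : Matrix (Fin n) (Fin n) ℂ}
    (h : Kills (Matrix.vecMul l A) w) : Kills l (extPowC n q A w) := by
  intro M a ha
  rw [om_extPow]
  exact h _ a (by rw [ha])

lemma kills_iff {l : Fin n → ℂ} {w : MultiVecC n q} :
    Kills l w ↔ ∀ (M : Fin q → Fin n → ℂ) (a : Fin q), om w (Function.update M a l) = 0 := by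
  constructor
  · intro h M a; exact h _ a (by simp)
  · intro h M a ha
    have := h M a
    rwa [← ha, Function.update_eq_self] at this

lemma Kills.add {l l' : Fin n → ℂ} {w : MultiVecC n q} (h : Kills l w) (h' : Kills l' w) :
    Kills (l + l') w := by
  rw [kills_iff] at *
  intro M a
  rw [AlternatingMap.map_update_add, h, h', add_zero]

lemma Kills.smul {l : Fin n → ℂ} {w : MultiVecC n q} (h : Kills l w) (c : ℂ) :
    Kills (c • l) w := by
  rw [kills_iff] at *
  intro M a
  rw [AlternatingMap.map_update_smul, h, smul_zero]

lemma Kills.zero {w : MultiVecC n q} : Kills 0 w := by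
  rw [kills_iff]
  intro M a
  exact AlternatingMap.map_update_zero _ _ _

lemma Kills.sum {ι : Type*} {s : Finset ι} {l : ι → Fin n → ℂ} {w : MultiVecC n q}
    (h : ∀ i ∈ s, Kills (l i) w) : Kills (∑ i ∈ s, l i) w := by
  classical
  induction s using Finset.induction_on with
  | empty => simpa using Kills.zero
  | insert i s hi ih =>
    rw [Finset.sum_insert hi]
    exact (h i (by simp)).add (ih fun j hj => h j (by simp [hj]))

lemma Kills.smul_right {l : Fin n → ℂ} {w : MultiVecC n q} (h : Kills l w) (c : ℂ) :
    Kills l (c • w) := by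
  intro M a ha
  rw [om_smul, h M a ha, mul_zero]

/-- minor lemma -/
lemma extPow_model (h : q + 1 ≤ n) (A : Matrix (Fin n) (Fin n) ℂ) (v v' : Fin n → ℂ)
    (B : Matrix (Fin (q+1)) (Fin (q+1)) ℂ)
    (hB : ∀ i j, B i j = A (Fin.castLE h i) (Fin.castLE h j))
    (hA : ∀ l : Fin n, q + 1 ≤ (l : ℕ) → ∀ j, A l (Fin.castLE h j) = 0)
    (hv : ∀ j, v (Fin.castLE h j) = ∑ i, v' (Fin.castLE h i) * B i j) :
    extPowC n q A (modelPiC n q v) = B.det • modelPiC n q v' := by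
  apply om_inj
  intro M
  rw [om_extPow, om_smul, om_model h, om_model h, mul_comm, ← Matrix.det_mul]
  congr 1
  ext a b
  have key : ∀ l : Fin n → ℂ, Matrix.vecMul l A (Fin.castLE h b) = ∑ i, l (Fin.castLE h i) * B i b := by
    intro l
    rw [Matrix.vecMul_eq_sum, Finset.sum_apply]
    rw [← Finset.sum_subset (Finset.subset_univ (Finset.univ.map (Fin.castLEEmb h)))]
    · rw [Finset.sum_map]
      refine Finset.sum_congr rfl fun j _ => ?_
      simp [hB]
    · intro i _ hi
      have : q + 1 ≤ (i : ℕ) := by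
        by_contra hlt
        apply hi
        simp only [Finset.mem_map, Finset.mem_univ, true_and, Fin.castLEEmb_apply]
        exact ⟨⟨i, by omega⟩, rfl⟩
      simp [hA i this]
  rw [Matrix.mul_apply]
  refine Fin.cases ?_ (fun a => ?_) a
  · simp only [Matrix.of_apply, Fin.cons_zero]; exact hv b
  · simp only [Matrix.of_apply, Fin.cons_succ]; exact key _

/-- decomposable multivectors -/
def Decomp (w : MultiVecC n q) : Prop :=
  ∃ (s : ℂ) (η : Fin q → Fin n → ℂ), ∀ M, om w M = s * Matrix.det (Matrix.of fun a b => M a ⬝ᵥ η b)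

end Tensor
section Tensor2
variable {n q : ℕ}

lemma om_std (h : q ≤ n) (M : Fin q → Fin n → ℂ) :
    om (stdVecC n q) M = Matrix.det (Matrix.of fun a b : Fin q => M a (Fin.castLE h b)) := by
  have hS : (Finset.univ.filter (fun i : Fin n => (i : ℕ) < q)).card = q := by
    have : (Finset.univ.filter (fun i : Fin n => (i : ℕ) < q)) =
      Finset.univ.map (Fin.castLEEmb h) := by
      ext i
      simp only [Finset.mem_filter, Finset.mem_univ, true_and, Finset.mem_map, Fin.castLEEmb_apply]
      constructor
      · intro hi; exact ⟨⟨i, hi⟩, rfl⟩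
      · rintro ⟨k, rfl⟩; exact k.2
    rw [this]; simp
  let S : Idx n q := ⟨_, hS⟩
  have hemb : ∀ b, S.emb b = Fin.castLE h b := by
    have := Finset.orderEmbOfFin_unique hS (f := fun b => Fin.castLE h b) (by
      intro b
      simp only [Finset.mem_filter, Finset.mem_univ, true_and, Fin.val_castLE]
      exact b.2) (Fin.strictMono_castLE h)
    intro b
    exact (congrFun this b).symm
  rw [om_apply, Finset.sum_eq_single S]
  · simp only [stdVecC, S, if_true, one_mul]
    congr 1
    ext a b
    simp only [Matrix.of_apply]
    congr 1
    exact hemb b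
  · intro I _ hI
    unfold stdVecC
    rw [if_neg, zero_mul]
    intro h; apply hI; exact Subtype.ext h
  · simp

variable {w : MultiVecC n q}

/-- structure coming from a chart -/
lemma chart_struct (h : q ≤ n) {J K : Matrix (Fin n) (Fin n) ℂ} (hKJ : K * J = 1) {c : ℂ}
    (hw : extPowC n q J w = c • stdVecC n q) (M : Fin q → Fin n → ℂ) :
    om w M = c * Matrix.det (Matrix.of fun a b => M a ⬝ᵥ (fun i => K i (Fin.castLE h b))) := by
  have : w = extPowC n q K (c • stdVecC n q) := by
    rw [← hw, ← extPow_mul, hKJ, extPow_one]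
  rw [this, om_extPow, om_smul, om_std h]
  rfl

lemma chart_kills (h : q ≤ n) {J K : Matrix (Fin n) (Fin n) ℂ} (hKJ : K * J = 1) {c : ℂ}
    (hw : extPowC n q J w = c • stdVecC n q) (l : Fin n) (hl : q ≤ (l : ℕ)) :
    Kills (J l) w := by
  intro M a ha
  rw [chart_struct h hKJ hw, Matrix.det_eq_zero_of_row_eq_zero a, mul_zero]
  intro b
  have hJK : J * K = 1 := mul_eq_one_comm.1 hKJ
  have : (J * K) l (Fin.castLE h b) = 0 := by
    rw [hJK, Matrix.one_apply_ne]
    intro he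
    have := congrArg Fin.val he
    simp at this
    omega
  rw [Matrix.of_apply, ha, ← this]
  rfl

variable (w) in
/-- horizontal lift coefficients -/
noncomputable def Yc (N : Fin n → Fin n → ℂ) (s : Fin q → Fin n) (k : Fin q) (j : Fin n) : ℂ :=
  om w (Function.update (N ∘ s) k (N j)) / om w (N ∘ s)

lemma Yc_base {N : Fin n → Fin n → ℂ} {s : Fin q → Fin n}
    (hpi : om w (N ∘ s) ≠ 0) (k k' : Fin q) : Yc w N s k (s k') = if k' = k then 1 else 0 := by
  unfold Yc
  split_ifs with h
  · subst h
    have : Function.update (N ∘ s) k' (N (s k')) = N ∘ s := Function.update_eq_self k' (N ∘ s)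
    rw [this, div_self hpi]
  · rw [AlternatingMap.map_eq_zero_of_eq _ _ (i := k') (j := k) _ h, zero_div]
    simp [h]

lemma om_update_sum (M : Fin q → Fin n → ℂ) (k : Fin q) (c : Fin n → ℂ) (N : Fin n → Fin n → ℂ) :
    om w (Function.update M k (∑ j, c j • N j)) = ∑ j, c j * om w (Function.update M k (N j)) := by
  rw [AlternatingMap.map_update_sum]
  simp [AlternatingMap.map_update_smul]

lemma Yc_of_kills {N : Fin n → Fin n → ℂ} {s : Fin q → Fin n} {c : Fin n → ℂ}
    (hl : Kills (∑ j, c j • N j) w) (k : Fin q) : ∑ j, c j * Yc w N s k j = 0 := by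
  have := kills_iff.1 hl (N ∘ s) k
  rw [om_update_sum] at this
  unfold Yc
  simp_rw [mul_div_assoc']
  rw [← Finset.sum_div, this, zero_div]

lemma kills_of_Yc {N : Fin n → Fin n → ℂ} {s : Fin q → Fin n} {c : Fin n → ℂ} (hd : Decomp w)
    (hpi : om w (N ∘ s) ≠ 0) (h : ∀ k, ∑ j, c j * Yc w N s k j = 0) :
    Kills (∑ j, c j • N j) w := by
  obtain ⟨t, η, hη⟩ := hd
  set l := ∑ j, c j • N j with hl
  have h1 : ∀ k, om w (Function.update (N ∘ s) k l) = 0 := by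
    intro k
    rw [hl, om_update_sum]
    have := h k
    unfold Yc at this
    simp_rw [mul_div_assoc'] at this
    rw [← Finset.sum_div, div_eq_zero_iff] at this
    exact this.resolve_right hpi
  set D : Matrix (Fin q) (Fin q) ℂ := Matrix.of fun a b => (N ∘ s) a ⬝ᵥ η b
  rw [hη] at hpi
  have ht : t ≠ 0 := left_ne_zero_of_mul hpi
  have hD : D.det ≠ 0 := right_ne_zero_of_mul hpi
  let r : Fin q → ℂ := fun b => l ⬝ᵥ η b
  have h2 : Matrix.cramer D.transpose r = 0 := by
    ext k
    rw [Matrix.cramer_transpose_apply]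
    have := h1 k
    rw [hη] at this
    have := (mul_eq_zero.1 this).resolve_left ht
    rw [Pi.zero_apply, ← this]
    congr 1
    ext a b
    by_cases hak : a = k
    · subst hak; simp [r]
    · simp [hak, D]
  have h3 := Matrix.mulVec_cramer D.transpose r
  rw [h2, Matrix.mulVec_zero, Matrix.det_transpose] at h3
  have h4 : r = 0 := by
    have := h3.symm
    exact (smul_eq_zero.1 this).resolve_left hD
  intro M a ha
  rw [hη, Matrix.det_eq_zero_of_row_eq_zero a, mul_zero]
  intro b
  rw [Matrix.of_apply, ha]
  exact congrFun h4 b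

lemma fibre_inj (h : q ≤ n) {J K : Matrix (Fin n) (Fin n) ℂ} (hKJ : K * J = 1) {c : ℂ}
    (hw : extPowC n q J w = c • stdVecC n q) {Ns : Fin q → Fin n → ℂ} (hpi : om w Ns ≠ 0)
    {X : Fin n → ℂ} (hX : ∀ k, Ns k ⬝ᵥ X = 0) (hJ : ∀ l : Fin n, q ≤ (l : ℕ) → J l ⬝ᵥ X = 0) :
    X = 0 := by
  rw [chart_struct h hKJ hw] at hpi
  have hD := right_ne_zero_of_mul hpi
  have hXe : X = K.mulVec (J.mulVec X) := by rw [Matrix.mulVec_mulVec, hKJ, Matrix.one_mulVec]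
  have hXs : ∀ i, X i = ∑ b : Fin q, K i (Fin.castLE h b) * (J.mulVec X) (Fin.castLE h b) := by
    intro i
    conv_lhs => rw [hXe]
    rw [Matrix.mulVec, dotProduct]
    rw [← Finset.sum_subset (Finset.subset_univ (Finset.univ.map (Fin.castLEEmb h)))]
    · rw [Finset.sum_map]; rfl
    · intro l _ hl
      have : q ≤ (l : ℕ) := by
        by_contra hlt
        apply hl
        simp only [Finset.mem_map, Finset.mem_univ, true_and, Fin.castLEEmb_apply]
        exact ⟨⟨l, by omega⟩, rfl⟩
      have := hJ l this
      rw [Matrix.mulVec, this, mul_zero]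
  have ht : (fun b => (J.mulVec X) (Fin.castLE h b)) = 0 := by
    apply Matrix.eq_zero_of_mulVec_eq_zero hD
    ext k
    rw [Pi.zero_apply, ← hX k]
    simp only [Matrix.mulVec, dotProduct, Matrix.of_apply]
    simp_rw [Finset.sum_mul]
    rw [Finset.sum_comm]
    refine Finset.sum_congr rfl fun i _ => ?_
    rw [hXs i, Finset.mul_sum]
    refine Finset.sum_congr rfl fun b _ => ?_
    simp only [Matrix.mulVec, dotProduct]
    ring
  ext i
  rw [hXs i]
  apply Finset.sum_eq_zero
  intro b _
  rw [congrFun ht b]; simp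

/-- killing the model: proportionality -/
lemma kills_model (h : q + 1 ≤ n) {a X : Fin n → ℂ} (hk : Kills X (modelPiC n q a))
    (i j : Fin (q+1)) :
    a (Fin.castLE h i) * X (Fin.castLE h j) = a (Fin.castLE h j) * X (Fin.castLE h i) := by
  by_cases hij : i = j
  · subst hij; ring
  by_contra hne
  -- rows: identity with row `i` replaced by `X` and row `j` by `a`
  let R : Fin (q+1) → Fin n → ℂ := Function.update (Function.update
    (fun k => Pi.single (Fin.castLE h k) 1) i X) j a
  let B : Matrix (Fin (q+1)) (Fin (q+1)) ℂ := Matrix.of fun k l => R k (Fin.castLE h l)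
  have hdet : B.det ≠ 0 := by
    intro h0
    obtain ⟨v, hv0, hv⟩ := Matrix.exists_vecMul_eq_zero_iff.2 h0
    apply hv0
    have hcol : ∀ l, ∑ k, v k * B k l = 0 := fun l => congrFun hv l
    have hexp : ∀ l, v i * X (Fin.castLE h l) + v j * a (Fin.castLE h l) +
        (if l = i ∨ l = j then 0 else v l) = 0 := by
      intro l
      refine Eq.trans ?_ (hcol l)
      have e : ∀ k, v k * B k l = (if k = i then v i * X (Fin.castLE h l) else 0) +
          (if k = j then v j * a (Fin.castLE h l) else 0) +
          (if k = l then (if l = i ∨ l = j then 0 else v l) else 0) := by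
        intro k
        by_cases hkj : k = j
        · subst hkj
          simp only [B, R, Matrix.of_apply, Function.update_self, if_neg (Ne.symm hij), if_true, zero_add]
          by_cases hkl : k = l
          · subst hkl; simp
          · simp [hkl]
        · by_cases hki : k = i
          · subst hki
            simp only [B, R, Matrix.of_apply, Function.update_of_ne hkj, Function.update_self, if_true, if_neg hkj, add_zero]
            by_cases hkl : k = l
            · subst hkl; simp
            · simp [hkl]
          · simp only [B, R, Matrix.of_apply, Function.update_of_ne hkj, Function.update_of_ne hki, if_neg hkj, if_neg hki, Pi.single_apply, (Fin.castLE_injective h).eq_iff, zero_add]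
            by_cases hkl : k = l
            · subst hkl; simp [hkj, hki]
            · simp [hkl, Ne.symm hkl]
      simp_rw [e]
      rw [Finset.sum_add_distrib, Finset.sum_add_distrib]
      simp
    have hi := hexp i
    have hj := hexp j
    simp only [true_or, or_true, if_true, add_zero] at hi hj
    have hvi : v i = 0 := by
      have : v i * (a (Fin.castLE h i) * X (Fin.castLE h j) - a (Fin.castLE h j) * X (Fin.castLE h i)) = 0 := by
        linear_combination a (Fin.castLE h i) * hj - a (Fin.castLE h j) * hi
      exact (mul_eq_zero.1 this).resolve_right (sub_ne_zero.2 hne)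
    have hvj : v j = 0 := by
      have : v j * (a (Fin.castLE h i) * X (Fin.castLE h j) - a (Fin.castLE h j) * X (Fin.castLE h i)) = 0 := by
        linear_combination X (Fin.castLE h j) * hi - X (Fin.castLE h i) * hj
      exact (mul_eq_zero.1 this).resolve_right (sub_ne_zero.2 hne)
    ext l
    have := hexp l
    rw [hvi, hvj] at this
    by_cases hl : l = i ∨ l = j
    · rcases hl with rfl | rfl <;> assumption
    · simpa [hl] using this
  obtain ⟨b, hb⟩ := Fin.exists_succAbove_eq hij
  have h1 := hk (fun b => R (j.succAbove b)) b (by simp [hb, R, hij])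
  rw [om_model h] at h1
  apply hdet
  have h2 : (Matrix.of fun c d : Fin (q+1) =>
      (Fin.cons a (fun b => R (j.succAbove b)) : Fin (q+1) → Fin n → ℂ) c (Fin.castLE h d)) =
      B.submatrix (j.cycleRange.symm) id := by
    ext c d
    refine Fin.cases ?_ (fun c => ?_) c
    · simp [B, R]
    · simp [B]
  rw [h2, Matrix.det_permute] at h1
  have := (mul_eq_zero.1 h1).resolve_left (by simp)
  exact this

/-- multivectors killed by `e_l`, `l > q` -/
lemma eq_model_of_kills (h : q + 1 ≤ n)
    (hk : ∀ l : Fin n, q + 1 ≤ (l : ℕ) → Kills (Pi.single l 1) w) :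
    w = modelPiC n q (fun j => (-1)^(j:ℕ) * om w (fun b => if hj : (j:ℕ) < q + 1 then
      Pi.single (Fin.castLE h ((⟨j, hj⟩ : Fin (q+1)).succAbove b)) 1 else 0)) := by
  apply om_inj
  have : om w = om (modelPiC n q (fun j => (-1)^(j:ℕ) * om w (fun b => if hj : (j:ℕ) < q + 1 then
      Pi.single (Fin.castLE h ((⟨j, hj⟩ : Fin (q+1)).succAbove b)) 1 else 0))) := by
    apply alt_ext
    intro J
    by_cases hJ : ∀ a, (J.emb a : ℕ) < q + 1
    · -- J = castLE ∘ succAbove j0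
      let e : Fin q → Fin (q+1) := fun a => ⟨J.emb a, hJ a⟩
      have he : StrictMono e := by
        intro a b hab
        exact (J.emb.strictMono hab : J.emb a < J.emb b)
      have hej : ∃ j0, ∀ a, j0 ≠ e a := by
        by_contra hcon
        push Not at hcon
        have hsurj : Function.Surjective e := fun j => by
          obtain ⟨a, ha⟩ := hcon j; exact ⟨a, ha.symm⟩
        have := Fintype.card_le_of_surjective e hsurj
        simp at this
      obtain ⟨j0, hj0⟩ := hej
      have hsa : ∀ a, e a = j0.succAbove a := by
        have h1 : Set.range e = Set.range j0.succAbove := by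
          rw [Fin.range_succAbove]
          refine Set.eq_of_subset_of_ncard_le ?_ ?_ (Set.toFinite _)
          · rintro _ ⟨a, rfl⟩; exact (hj0 a).symm
          · rw [Set.ncard_compl, ← Set.image_univ, Set.ncard_image_of_injective _ he.injective]
            simp
        have := (StrictMono.range_inj he (Fin.strictMono_succAbove j0)).1 h1
        exact fun a => congrFun this a
      have hJe : ∀ a, J.emb a = Fin.castLE h (j0.succAbove a) := by
        intro a; rw [← hsa a]; rfl
      simp_rw [hJe]
      rw [om_model h, Matrix.det_succ_row_zero, Finset.sum_eq_single j0]
      · simp only [Matrix.of_apply, Fin.cons_zero, Fin.val_castLE, j0.2, dif_pos, Fin.eta]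
        have : (Matrix.submatrix (Matrix.of fun a b : Fin (q+1) => (Fin.cons (fun j : Fin n => (-1)^(j:ℕ) * om w (fun b => if hj : (j:ℕ) < q + 1 then
      Pi.single (Fin.castLE h ((⟨j, hj⟩ : Fin (q+1)).succAbove b)) (1:ℂ) else 0)) (fun a => (Pi.single (Fin.castLE h (j0.succAbove a)) 1 : Fin n → ℂ)) : Fin (q+1) → Fin n → ℂ) a (Fin.castLE h b)) Fin.succ j0.succAbove) = 1 := by
          ext a b
          simp only [Matrix.submatrix_apply, Matrix.of_apply, Fin.cons_succ, Pi.single_apply,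
            Matrix.one_apply, (Fin.castLE_injective h).eq_iff, Fin.succAbove_right_inj]
          congr 1
          exact propext eq_comm
        rw [this, Matrix.det_one, mul_one, ← mul_assoc, ← pow_add, ← two_mul, pow_mul]
        simp
      · intro j _ hj
        obtain ⟨b, hb⟩ := Fin.exists_succAbove_eq (x := j) (y := j0) hj
        rw [Matrix.det_eq_zero_of_row_eq_zero b, mul_zero]
        intro c
        simp only [Matrix.submatrix_apply, Matrix.of_apply, Fin.cons_succ, Pi.single_apply, hb,
          (Fin.castLE_injective h).eq_iff, ite_eq_right_iff, one_ne_zero, imp_false]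
        exact Fin.succAbove_ne j c
      · simp
    · push Not at hJ
      obtain ⟨a, ha⟩ := hJ
      rw [hk _ ha _ a rfl, om_model h, Matrix.det_eq_zero_of_row_eq_zero a.succ]
      intro c
      simp only [Matrix.of_apply, Fin.cons_succ, Pi.single_apply, ite_eq_right_iff, one_ne_zero, imp_false]
      intro hc
      have := congrArg Fin.val hc
      simp at this
      have := c.2
      omega
  intro M
  exact congrArg (fun f => f M) this

lemma model_add (u v : Fin n → ℂ) : modelPiC n q (u + v) = modelPiC n q u + modelPiC n q v := by
  ext J
  simp only [modelPiC, Pi.add_apply, ← Finset.sum_add_distrib]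
  refine Finset.sum_congr rfl fun j _ => ?_
  split_ifs <;> ring

lemma model_smul (c : ℂ) (v : Fin n → ℂ) : modelPiC n q (c • v) = c • modelPiC n q v := by
  ext J
  simp only [modelPiC, Pi.smul_apply, smul_eq_mul, Finset.mul_sum]
  refine Finset.sum_congr rfl fun j _ => ?_
  split_ifs <;> ring

end Tensor2
section FB
variable {n : ℕ}

/-- coordinate projection -/
noncomputable def bp (S : Finset (Fin n)) : (Fin n → ℂ) →L[ℂ] (Fin n → ℂ) :=
  ContinuousLinearMap.pi fun i => if i ∈ S then ContinuousLinearMap.proj i else 0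

lemma bp_apply (S : Finset (Fin n)) (z : Fin n → ℂ) (i : Fin n) :
    bp S z i = if i ∈ S then z i else 0 := by
  unfold bp
  rw [ContinuousLinearMap.coe_pi']
  split_ifs <;> simp [*]

lemma bp_norm (S : Finset (Fin n)) (z : Fin n → ℂ) : ‖bp S z‖ ≤ ‖z‖ := by
  rw [pi_norm_le_iff_of_nonneg (norm_nonneg _)]
  intro i
  rw [bp_apply]
  split_ifs
  · exact norm_le_pi_norm z i
  · simp

lemma bp_add_compl (S : Finset (Fin n)) (z : Fin n → ℂ) : bp S z + bp Sᶜ z = z := by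
  ext i
  simp only [Pi.add_apply, bp_apply, Finset.mem_compl]
  by_cases h : i ∈ S <;> simp [h]

@[simp] lemma bp_bp (S : Finset (Fin n)) (z : Fin n → ℂ) : bp S (bp S z) = bp S z := by
  ext i
  simp only [bp_apply]
  split_ifs <;> rfl

@[simp] lemma bp_bpc (S : Finset (Fin n)) (z : Fin n → ℂ) : bp S (bp Sᶜ z) = 0 := by
  ext i
  simp only [bp_apply, Finset.mem_compl]
  by_cases h : i ∈ S <;> simp [h]

@[simp] lemma bpc_bp (S : Finset (Fin n)) (z : Fin n → ℂ) : bp Sᶜ (bp S z) = 0 := by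
  ext i
  simp only [bp_apply, Finset.mem_compl]
  by_cases h : i ∈ S <;> simp [h]

lemma fb_lip {F : Type*} [NormedAddCommGroup F] [NormedSpace ℂ F]
    {g : (Fin n → ℂ) → F} {p d : Fin n → ℂ} {r C : ℝ} (hr : 0 < r)
    (hd : ∀ s : ℂ, ‖s • d‖ < r → DifferentiableAt ℂ g (p + s • d))
    (hb : ∀ s : ℂ, ‖s • d‖ < r → ‖g (p + s • d)‖ < C) (hdr : ‖d‖ < r) :
    ‖g (p + d) - g p‖ ≤ 2 * C / r * ‖d‖ := by
  by_cases hd0 : d = 0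
  · simp [hd0]
  have hdp : 0 < ‖d‖ := norm_pos_iff.2 hd0
  have hC : ‖g p‖ < C := by have := hb 0 (by simpa using hr); simpa using this
  have hs : ∀ s ∈ ball (0:ℂ) (r / ‖d‖), ‖s • d‖ < r := by
    intro s hs
    rw [mem_ball_zero_iff, lt_div_iff₀ hdp] at hs
    rw [norm_smul]; exact hs
  have := Complex.dist_le_div_mul_dist_of_mapsTo_ball (f := fun s : ℂ => g (p + s • d)) (c := 0)
    (R₁ := r / ‖d‖) (R₂ := 2 * C) (z := 1) (by
      intro s hs'
      apply DifferentiableAt.differentiableWithinAt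
      exact DifferentiableAt.comp s (f := fun s : ℂ => p + s • d) (hd s (hs s hs')) (by fun_prop)) (by
      intro s hs'
      rw [mem_closedBall, dist_eq_norm]
      refine (norm_sub_le _ _).trans ?_
      have h1 := hb s (hs s hs')
      simp only [zero_smul, add_zero]
      linarith) (by
      rw [mem_ball, dist_zero_right, norm_one, lt_div_iff₀ hdp, one_mul]; exact hdr)
  simp only [one_smul, zero_smul, add_zero, sub_zero, norm_one, mul_one, dist_eq_norm] at this
  refine this.trans (le_of_eq ?_)
  field_simp

set_option maxHeartbeats 800000 in
lemma flowbox (S : Finset (Fin n)) (A : (Fin n → ℂ) → (Fin n → ℂ) →L[ℂ] (Fin n → ℂ))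
    {ρ κ η : ℝ} (hρ : 0 < ρ) (hκ : 0 < κ) (hη : 0 < η) (h100 : 100 * η * ρ ≤ κ)
    (hA : AnalyticOnNhd ℂ A {z | ‖bp S z‖ < 3 * ρ ∧ ‖bp Sᶜ z‖ < κ})
    (hAf : ∀ z, ‖bp S z‖ < 3 * ρ → ‖bp Sᶜ z‖ < κ → ∀ σ, bp S (A z σ) = 0)
    (hAb : ∀ z, ‖bp S z‖ < 3 * ρ → ‖bp Sᶜ z‖ < κ → ∀ σ, ‖A z σ‖ ≤ η * ‖σ‖) :
    ∃ G : (Fin n → ℂ) → (Fin n → ℂ),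
      AnalyticOnNhd ℂ G {z | ‖bp S z‖ < ρ ∧ ‖bp Sᶜ z‖ < κ / 2} ∧
      (∀ z, bp S (G z) = 0) ∧
      (∀ z, ‖bp S z‖ < ρ → ‖bp Sᶜ z‖ < κ / 2 → ‖G z - bp Sᶜ z‖ ≤ η * ‖bp S z‖) ∧
      ∀ f : (Fin n → ℂ) → (Fin n → ℂ), (∀ᶠ z in 𝓝 0, DifferentiableAt ℂ f z ∧
        ∀ σ, fderiv ℂ f z (bp S σ + A z (bp S σ)) = 0) → ∀ᶠ z in 𝓝 0, f z = f (G z) := by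
  set b := bp S with hb
  set fb := bp Sᶜ with hfb
  have hbf : ∀ z, b z + fb z = z := bp_add_compl S
  have bb : ∀ z, b (b z) = b z := bp_bp S
  have bf : ∀ z, b (fb z) = 0 := bp_bpc S
  have fbb : ∀ z, fb (b z) = 0 := bpc_bp S
  have ff : ∀ z, fb (fb z) = fb z := bp_bp Sᶜ
  have nb : ∀ z, ‖b z‖ ≤ ‖z‖ := bp_norm S
  have nf : ∀ z, ‖fb z‖ ≤ ‖z‖ := bp_norm Sᶜ
  set Ω : Set (ℂ × (Fin n → ℂ)) := {p | ‖p.1‖ < 2 ∧ ‖b p.2‖ < ρ ∧ ‖fb p.2‖ < κ / 2} with hΩ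
  have hΩo : IsOpen Ω := by
    have o1 : IsOpen {p : ℂ × (Fin n → ℂ) | ‖p.1‖ < 2} := isOpen_lt (by fun_prop) (by fun_prop)
    have o2 : IsOpen {p : ℂ × (Fin n → ℂ) | ‖b p.2‖ < ρ} := isOpen_lt (by fun_prop) (by fun_prop)
    have o3 : IsOpen {p : ℂ × (Fin n → ℂ) | ‖fb p.2‖ < κ / 2} :=
      isOpen_lt (by fun_prop) (by fun_prop)
    exact o1.inter (o2.inter o3)
  set dom : Set (Fin n → ℂ) := {z | ‖b z‖ < 3 * ρ ∧ ‖fb z‖ < κ} with hdom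
  let c : (ℂ × (Fin n → ℂ) → (Fin n → ℂ)) → ℂ × (Fin n → ℂ) → ℝ → (Fin n → ℂ) :=
    fun D p τ => p.2 - ((τ:ℂ) * p.1) • b p.2 + fb (D ((τ:ℂ) * p.1, p.2))
  have hsc : ∀ p ∈ Ω, ∀ τ ∈ Icc (0:ℝ) 1, ((τ:ℂ) * p.1, p.2) ∈ Ω := by
    intro p hp τ hτ
    refine ⟨?_, hp.2.1, hp.2.2⟩
    simp only [norm_mul, Complex.norm_real, Real.norm_of_nonneg hτ.1]
    have := hp.1
    nlinarith [norm_nonneg p.1, hτ.2, hτ.1]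
  have hcb : ∀ D p τ, b (c D p τ) = (1 - (τ:ℂ) * p.1) • b p.2 := by
    intro D p τ
    simp only [c, map_add, map_sub, map_smul, bb, bf]
    module
  have hcf : ∀ D p τ, fb (c D p τ) = fb p.2 + fb (D ((τ:ℂ) * p.1, p.2)) := by
    intro D p τ
    simp only [c, map_add, map_sub, map_smul, fbb, ff]
    module
  have hcbn : ∀ D, ∀ p ∈ Ω, ∀ τ ∈ Icc (0:ℝ) 1, ‖b (c D p τ)‖ < 3 * ρ := by
    intro D p hp τ hτ
    rw [hcb, norm_smul]
    have h1 : ‖1 - (τ:ℂ) * p.1‖ ≤ 3 := by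
      refine (norm_sub_le _ _).trans ?_
      have := (hsc p hp τ hτ).1
      simp only [norm_one] at this ⊢
      linarith
    have := hp.2.1
    nlinarith [norm_nonneg (b p.2)]
  have hcdom : ∀ D, (∀ p ∈ Ω, ‖D p‖ ≤ κ / 16) → ∀ p ∈ Ω, ∀ τ ∈ Icc (0:ℝ) 1, c D p τ ∈ dom := by
    intro D hD p hp τ hτ
    refine ⟨hcbn D p hp τ hτ, ?_⟩
    rw [hcf]
    have h1 := hD _ (hsc p hp τ hτ)
    have h2 := nf (D ((τ:ℂ) * p.1, p.2))
    have := norm_add_le (fb p.2) (fb (D ((τ:ℂ) * p.1, p.2)))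
    have := hp.2.2
    linarith
  let T : (ℂ × (Fin n → ℂ) → (Fin n → ℂ)) → ℂ × (Fin n → ℂ) → (Fin n → ℂ) :=
    fun D p => -(p.1 • ∫ τ in (0:ℝ)..1, A (c D p τ) (b p.2))
  have hTb : ∀ D, (∀ p ∈ Ω, ‖D p‖ ≤ κ / 16) → ∀ p ∈ Ω, ‖T D p‖ ≤ ‖p.1‖ * (η * ‖b p.2‖) := by
    intro D hD p hp
    simp only [T, norm_neg, norm_smul]
    gcongr
    refine (intervalIntegral.norm_integral_le_of_norm_le_const (C := η * ‖b p.2‖) ?_).trans (by simp)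
    intro τ hτ
    rw [uIoc_of_le zero_le_one] at hτ
    have := hcdom D hD p hp τ ⟨hτ.1.le, hτ.2⟩
    exact hAb _ this.1 this.2 _
  have hηρ : η * ρ ≤ κ / 100 := by linarith
  obtain ⟨D, hDa, hDb, hDT⟩ := analytic_fp hΩo (δ := κ / 16) (by positivity) T (by
      intro D hDa hDb
      constructor
      · have := analytic_integral (Φ := fun p τ => A (c D p τ) (b p.2)) (zero_le_one (α := ℝ)) hΩo (by
          have hcc : ContinuousOn (fun q : (ℂ × (Fin n → ℂ)) × ℝ => c D q.1 q.2) (Ω ×ˢ Icc 0 1) := by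
            have h1 : ContinuousOn (fun q : (ℂ × (Fin n → ℂ)) × ℝ => D ((q.2:ℂ) * q.1.1, q.1.2))
                (Ω ×ˢ Icc 0 1) := by
              refine hDa.continuousOn.comp (by fun_prop) ?_
              intro q hq
              exact hsc q.1 hq.1 q.2 hq.2
            simp only [c]
            have h2 := fb.continuous.comp_continuousOn h1
            have h3 : ContinuousOn (fun q : (ℂ × (Fin n → ℂ)) × ℝ =>
                q.1.2 - ((q.2:ℂ) * q.1.1) • b q.1.2) (Ω ×ˢ Icc 0 1) := by fun_prop
            exact h3.add h2
          have hAc := hA.continuousOn.comp hcc (fun q hq => hcdom D hDb q.1 hq.1 q.2 hq.2)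
          exact hAc.clm_apply (by fun_prop)) (by
          intro τ hτ p hp
          have h1 : AnalyticAt ℂ (fun p : ℂ × (Fin n → ℂ) => D ((τ:ℂ) * p.1, p.2)) p := by
            refine (hDa _ (hsc p hp τ hτ)).comp
              (f := fun p : ℂ × (Fin n → ℂ) => ((τ:ℂ) * p.1, p.2)) ?_
            exact (analyticAt_const.mul analyticAt_fst).prod analyticAt_snd
          have h2 : AnalyticAt ℂ (fun p => c D p τ) p := by
            simp only [c]
            refine AnalyticAt.add (AnalyticAt.sub analyticAt_snd ?_) ?_
            · exact (analyticAt_const.mul analyticAt_fst).smul ((b.analyticAt _).comp analyticAt_snd)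
            · exact (fb.analyticAt _).comp h1
          have h3 := (hA _ (hcdom D hDb p hp τ hτ)).comp (f := fun p => c D p τ) h2
          exact ((ContinuousLinearMap.id ℂ ((Fin n → ℂ) →L[ℂ] (Fin n → ℂ))).analyticAt_bilinear
            (A (c D p τ), b p.2)).comp₂ h3 ((b.analyticAt _).comp analyticAt_snd))
        intro p hp
        exact ((analyticAt_fst).smul (this p hp)).neg
      · intro p hp
        refine (hTb D hDb p hp).trans ?_
        have h1 := hp.1
        have h2 := hp.2.1
        have h3 : η * ‖b p.2‖ ≤ η * ρ := by gcongr
        have h4 : 0 ≤ η * ‖b p.2‖ := by positivity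
        nlinarith [norm_nonneg p.1]) (by
      intro D1 D2 hD1a hD1b hD2a hD2b C hC p hp
      have hC0 : 0 ≤ C := (norm_nonneg _).trans (hC p hp)
      have hcont : ∀ D, AnalyticOnNhd ℂ D Ω → (∀ x ∈ Ω, ‖D x‖ ≤ κ / 16) →
          ContinuousOn (fun τ => A (c D p τ) (b p.2)) (Icc 0 1) := by
        intro D hDa hDb
        have h1 : ContinuousOn (fun τ : ℝ => D ((τ:ℂ) * p.1, p.2)) (Icc 0 1) := by
          refine hDa.continuousOn.comp (by fun_prop) ?_
          intro τ hτ
          exact hsc p hp τ hτ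
        have h2 := fb.continuous.comp_continuousOn h1
        have h3 : ContinuousOn (fun τ : ℝ => p.2 - ((τ:ℂ) * p.1) • b p.2) (Icc 0 1) := by fun_prop
        have hAc := hA.continuousOn.comp (h3.add h2) (fun τ hτ => hcdom D hDb p hp τ hτ)
        exact hAc.clm_apply (by fun_prop)
      have e : T D1 p - T D2 p = -(p.1 • ∫ τ in (0:ℝ)..1, (A (c D1 p τ) (b p.2) - A (c D2 p τ) (b p.2))) := by
        simp only [T]
        rw [intervalIntegral.integral_sub]
        · module
        · apply ContinuousOn.intervalIntegrable; rw [uIcc_of_le zero_le_one]; exact hcont D1 hD1a hD1b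
        · apply ContinuousOn.intervalIntegrable; rw [uIcc_of_le zero_le_one]; exact hcont D2 hD2a hD2b
      rw [e, norm_neg, norm_smul]
      have hlip : ∀ τ ∈ Icc (0:ℝ) 1, ‖A (c D1 p τ) (b p.2) - A (c D2 p τ) (b p.2)‖ ≤ C / 10 := by
        intro τ hτ
        set d := fb (D1 ((τ:ℂ) * p.1, p.2) - D2 ((τ:ℂ) * p.1, p.2)) with hd
        have hc12 : c D1 p τ = c D2 p τ + d := by
          simp only [c, hd, map_sub]; module
        have hdn : ‖d‖ ≤ C := (nf _).trans (hC _ (hsc p hp τ hτ))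
        have hdn2 : ‖d‖ ≤ κ / 8 := by
          refine (nf _).trans ((norm_sub_le _ _).trans ?_)
          have h1 := hD1b _ (hsc p hp τ hτ)
          have h2 := hD2b _ (hsc p hp τ hτ)
          linarith
        have hmem : ∀ s : ℂ, ‖s • d‖ < κ / 4 → c D2 p τ + s • d ∈ dom := by
          intro s hs
          constructor
          · have : b (c D2 p τ + s • d) = b (c D2 p τ) := by
              simp only [map_add, map_smul, hd, bf, smul_zero, add_zero]
            rw [this]; exact hcbn D2 p hp τ hτ
          · have h1 : fb (c D2 p τ + s • d) = fb p.2 + fb (D2 ((τ:ℂ) * p.1, p.2)) + s • d := by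
              rw [map_add, hcf, map_smul, hd, ff]
            rw [h1]
            have h2 := norm_add_le (fb p.2 + fb (D2 ((τ:ℂ) * p.1, p.2))) (s • d)
            have h3 := norm_add_le (fb p.2) (fb (D2 ((τ:ℂ) * p.1, p.2)))
            have h4 := nf (D2 ((τ:ℂ) * p.1, p.2))
            have h5 := hD2b _ (hsc p hp τ hτ)
            have h6 := hp.2.2
            linarith
        have := fb_lip (g := fun z => A z (b p.2)) (p := c D2 p τ) (d := d) (r := κ / 4) (C := η * ρ)
          (by positivity) (by
            intro s hs
            exact ((hA _ (hmem s hs)).differentiableAt).clm_apply (by fun_prop)) (by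
            intro s hs
            have h1 := hmem s hs
            refine (hAb _ h1.1 h1.2 _).trans_lt ?_
            have := hp.2.1
            gcongr) (by linarith)
        rw [hc12]
        refine this.trans ?_
        calc 2 * (η * ρ) / (κ / 4) * ‖d‖ ≤ 2 * (κ / 100) / (κ / 4) * C := by gcongr
          _ ≤ C / 10 := by field_simp; nlinarith
      have h1 : ‖∫ τ in (0:ℝ)..1, (A (c D1 p τ) (b p.2) - A (c D2 p τ) (b p.2))‖ ≤ C / 10 := by
        refine (intervalIntegral.norm_integral_le_of_norm_le_const (C := C / 10) ?_).trans (by simp)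
        intro τ hτ
        rw [uIoc_of_le zero_le_one] at hτ
        exact hlip τ ⟨hτ.1.le, hτ.2⟩
      have h2 := hp.1
      nlinarith [norm_nonneg p.1])
  refine ⟨fun z => fb z + fb (D (1, z)), ?_, ?_, ?_, ?_⟩
  · intro z hz
    refine (fb.analyticAt z).add ((fb.analyticAt _).comp ?_)
    refine (hDa (1, z) ⟨by simp, hz.1, hz.2⟩).comp (f := fun z => ((1:ℂ), z)) ?_
    exact analyticAt_const.prod analyticAt_id
  · intro z; simp only [map_add, bf, add_zero]
  · intro z h1 h2
    rw [add_sub_cancel_left]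
    have hz : ((1:ℂ), z) ∈ Ω := ⟨by simp, h1, h2⟩
    refine (nf _).trans ?_
    rw [← hDT _ hz]
    refine (hTb D hDb _ hz).trans ?_
    simp only [norm_one, one_mul]
    exact le_rfl
  · intro f hf
    obtain ⟨r, hr, hrf⟩ := Metric.eventually_nhds_iff_ball.1 hf
    have hr' : 0 < min (min ρ (κ/2)) (r / (2 + η)) := by positivity
    filter_upwards [ball_mem_nhds (0 : Fin n → ℂ) hr'] with z hz
    rw [mem_ball_zero_iff, lt_min_iff, lt_min_iff] at hz
    obtain ⟨⟨hz1, hz2⟩, hz3⟩ := hz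
    rw [lt_div_iff₀ (by positivity)] at hz3
    have hΩz : ∀ t : ℝ, t ∈ Ioo (-2:ℝ) 2 → ((t:ℂ), z) ∈ Ω := by
      intro t ht
      refine ⟨?_, (nb z).trans_lt hz1, (nf z).trans_lt hz2⟩
      simp only [Complex.norm_real, Real.norm_eq_abs]
      exact abs_lt.2 ht
    let γ : ℝ → (Fin n → ℂ) := fun t => z - (t:ℂ) • b z + fb (D ((t:ℂ), z))
    let h : ℝ → (Fin n → ℂ) := fun t => A (γ t) (b z)
    have hγdom : ∀ t ∈ Ioo (-2:ℝ) 2, γ t ∈ dom := by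
      intro t ht
      have := hcdom D hDb _ (hΩz t ht) 1 ⟨zero_le_one, le_rfl⟩
      simpa [c, γ] using this
    have hDc : ContinuousOn (fun t : ℝ => D ((t:ℂ), z)) (Ioo (-2) 2) := by
      refine hDa.continuousOn.comp (by fun_prop) ?_
      intro t ht; exact hΩz t ht
    have hγc : ContinuousOn γ (Ioo (-2) 2) := by
      have h2 := fb.continuous.comp_continuousOn hDc
      have h3 : ContinuousOn (fun t : ℝ => z - (t:ℂ) • b z) (Ioo (-2) 2) := by fun_prop
      exact h3.add h2
    have hhc : ContinuousOn h (Ioo (-2) 2) :=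
      (hA.continuousOn.comp hγc hγdom).clm_apply continuousOn_const
    have hDi : ∀ t ∈ Ioo (-2:ℝ) 2, D ((t:ℂ), z) = -∫ σ in (0:ℝ)..t, h σ := by
      intro t ht
      rw [← hDT _ (hΩz t ht)]
      simp only [T]
      congr 1
      have := intervalIntegral.smul_integral_comp_mul_right (a := 0) (b := 1) h t
      rw [zero_mul, one_mul] at this
      rw [← this, ← Complex.coe_smul]
      congr 1
      apply intervalIntegral.integral_congr
      intro τ _
      simp only [c, h, γ, Complex.ofReal_mul]
    have hDd : ∀ t ∈ Ioo (-2:ℝ) 2, HasDerivAt (fun t : ℝ => D ((t:ℂ), z)) (-(h t)) t := by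
      intro t ht
      have hsub : uIcc 0 t ⊆ Ioo (-2:ℝ) 2 := by
        intro s hs
        rcases uIcc_eq_union (a := (0:ℝ)) (b := t) ▸ hs with h | h
        · exact ⟨by linarith [h.1], by linarith [h.2, ht.2]⟩
        · exact ⟨by linarith [h.1, ht.1], by linarith [h.2]⟩
      have h1 := intervalIntegral.integral_hasDerivAt_right (a := 0) (b := t) (f := h)
        ((hhc.mono hsub).intervalIntegrable)
        (hhc.stronglyMeasurableAtFilter isOpen_Ioo t ht)
        (hhc.continuousAt (isOpen_Ioo.mem_nhds ht))
      refine h1.neg.congr_of_eventuallyEq ?_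
      filter_upwards [isOpen_Ioo.mem_nhds ht] with s hs
      exact hDi s hs
    have hγd : ∀ t ∈ Ioo (-2:ℝ) 2, HasDerivAt γ (-(b (b z) + A (γ t) (b (b z)))) t := by
      intro t ht
      have h1 : HasDerivAt (fun t : ℝ => fb (D ((t:ℂ), z))) (fb (-(h t))) t :=
        ((fb.restrictScalars ℝ).hasFDerivAt).comp_hasDerivAt t (hDd t ht)
      have h2 : HasDerivAt (fun t : ℝ => z - (t:ℂ) • b z) (-(b z)) t := by
        have : HasDerivAt (fun t : ℝ => (t:ℂ)) 1 t := Complex.ofRealCLM.hasDerivAt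
        have h3 := (this.smul_const (b z)).const_sub z
        simpa using h3
      have h4 := h2.add h1
      have h5 : fb (h t) = h t := by
        have := hbf (h t)
        rw [hAf _ (hγdom t ht).1 (hγdom t ht).2, zero_add] at this
        exact this
      have : -(b (b z) + A (γ t) (b (b z))) = -(b z) + fb (-(h t)) := by
        rw [map_neg, h5, bb]
        simp only [h]; abel
      rw [this]; exact h4
    have hγn : ∀ t ∈ Icc (0:ℝ) 1, γ t ∈ ball (0 : Fin n → ℂ) r := by
      intro t ht
      have ht' : t ∈ Ioo (-2:ℝ) 2 := ⟨by linarith [ht.1], by linarith [ht.2]⟩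
      rw [mem_ball_zero_iff]
      have h1 : ‖(t:ℂ) • b z‖ ≤ ‖z‖ := by
        rw [norm_smul, Complex.norm_real, Real.norm_of_nonneg ht.1]
        have := nb z
        nlinarith [norm_nonneg (b z), ht.2]
      have h2 : ‖fb (D ((t:ℂ), z))‖ ≤ η * ‖z‖ := by
        refine (nf _).trans ?_
        rw [← hDT _ (hΩz t ht')]
        refine (hTb D hDb _ (hΩz t ht')).trans ?_
        simp only [Complex.norm_real, Real.norm_of_nonneg ht.1]
        have h3 : η * ‖b z‖ ≤ η * ‖z‖ := by gcongr; exact nb z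
        have h4 : 0 ≤ η * ‖b z‖ := by positivity
        nlinarith [ht.2]
      calc ‖γ t‖ ≤ ‖z - (t:ℂ) • b z‖ + ‖fb (D ((t:ℂ), z))‖ := norm_add_le _ _
        _ ≤ (‖z‖ + ‖z‖) + η * ‖z‖ := by
            have := norm_sub_le z ((t:ℂ) • b z); linarith
        _ < r := by linarith
    have hconst := constant_of_has_deriv_right_zero (f := fun t => f (γ t)) (a := 0) (b := 1) (by
        intro t ht
        have ht' : t ∈ Ioo (-2:ℝ) 2 := ⟨by linarith [ht.1], by linarith [ht.2]⟩
        exact ((hrf _ (hγn t ht)).1.continuousAt.comp (hγd t ht').continuousAt).continuousWithinAt) (by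
        intro t ht
        have ht' : t ∈ Ioo (-2:ℝ) 2 := ⟨by linarith [ht.1], by linarith [ht.2]⟩
        have h1 := hrf _ (hγn t ⟨ht.1, ht.2.le⟩)
        have h2 := (h1.1.hasFDerivAt.restrictScalars ℝ).comp_hasDerivAt t (hγd t ht')
        have h3 : (fderiv ℂ f (γ t)).restrictScalars ℝ (-(b (b z) + A (γ t) (b (b z)))) = 0 := by
          change fderiv ℂ f (γ t) (-(b (b z) + A (γ t) (b (b z)))) = 0
          rw [map_neg, h1.2 (b z), neg_zero]
        rw [h3] at h2
        exact h2.hasDerivWithinAt) 1 ⟨zero_le_one, le_rfl⟩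
    have hD0 : D (0, z) = 0 := by
      have := hDi 0 ⟨by norm_num, by norm_num⟩
      simpa using this
    have e0 : γ 0 = z := by simp [γ, hD0]
    have e1 : γ 1 = fb z + fb (D (1, z)) := by
      simp only [γ, Complex.ofReal_one, one_smul]
      congr 1
      conv_lhs => rw [← hbf z]
      simp [bb, bf]
    simp only [e0, e1] at hconst
    exact hconst.symm
end FB
section Chart
variable {n q : ℕ}

lemma jac_mulVec (f : (Fin n → ℂ) → (Fin n → ℂ)) (x v : Fin n → ℂ) :
    Matrix.mulVec (jacC f x) v = fderiv ℂ f x v := by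
  conv_rhs => rw [← Finset.univ_sum_single v]
  ext i
  simp only [map_sum, Finset.sum_apply, Matrix.mulVec, dotProduct, jacC, Matrix.of_apply]
  refine Finset.sum_congr rfl fun j _ => ?_
  have : (Pi.single j (v j) : Fin n → ℂ) = v j • Pi.single j (1:ℂ) := by
    rw [← Pi.single_smul]; simp
  rw [this, map_smul, Pi.smul_apply, smul_eq_mul, mul_comm]

lemma jac_dot (f : (Fin n → ℂ) → (Fin n → ℂ)) (x v : Fin n → ℂ) (a : Fin n) :
    jacC f x a ⬝ᵥ v = fderiv ℂ f x v a := by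
  rw [← jac_mulVec]; rfl

lemma mat_ext_mulVec {A B : Matrix (Fin n) (Fin n) ℂ} (h : ∀ v, A.mulVec v = B.mulVec v) : A = B := by
  ext i j
  have := congrFun (h (Pi.single j 1)) i
  simpa using this

lemma jac_comp {f g : (Fin n → ℂ) → (Fin n → ℂ)} {x : Fin n → ℂ}
    (hg : DifferentiableAt ℂ g (f x)) (hf : DifferentiableAt ℂ f x) :
    jacC (fun y => g (f y)) x = jacC g (f x) * jacC f x := by
  apply mat_ext_mulVec
  intro v
  rw [← Matrix.mulVec_mulVec, jac_mulVec, jac_mulVec, jac_mulVec]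
  have := fderiv_comp x hg hf
  change fderiv ℂ (g ∘ f) x v = _
  rw [this]; rfl

lemma jac_id (x : Fin n → ℂ) : jacC (fun y => y) x = 1 := by
  apply mat_ext_mulVec
  intro v
  rw [jac_mulVec]; simp

lemma jac_congr {f g : (Fin n → ℂ) → (Fin n → ℂ)} {x : Fin n → ℂ} (h : f =ᶠ[𝓝 x] g) :
    jacC f x = jacC g x := by
  unfold jacC; rw [h.fderiv_eq]

lemma om_analytic {X : Type*} [NormedAddCommGroup X] [NormedSpace ℂ X] {w : X → MultiVecC n q}
    {M : X → Fin q → Fin n → ℂ} {x : X} (hw : AnalyticAt ℂ w x)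
    (hM : ∀ a i, AnalyticAt ℂ (fun x => M x a i) x) : AnalyticAt ℂ (fun x => om (w x) (M x)) x := by
  simp only [om_apply, Matrix.det_apply', Matrix.of_apply]
  refine Finset.analyticAt_fun_sum _ fun J _ => ?_
  refine AnalyticAt.mul (analyticAt_pi_iff.1 hw J) ?_
  refine Finset.analyticAt_fun_sum _ fun σ _ => ?_
  refine analyticAt_const.mul ?_
  exact Finset.analyticAt_fun_prod _ fun i _ => hM _ _

set_option maxHeartbeats 800000 in
lemma chart_lemma (hqn : q ≤ n) (s : Fin q → Fin n) (S : Finset (Fin n))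
    (hS : S = Finset.univ.image s) (hsi : Function.Injective s)
    {ρ κ η : ℝ} (hρ : 0 < ρ) (hκ : 0 < κ) (hη : 0 < η) (h100 : 100 * η * ρ ≤ κ)
    (P : (Fin n → ℂ) → MultiVecC n q) (Φ : (Fin n → ℂ) → (Fin n → ℂ))
    (N : (Fin n → ℂ) → Fin n → Fin n → ℂ)
    (hP : ∀ z, ‖bp S z‖ < 3 * ρ → ‖bp Sᶜ z‖ < κ → AnalyticAt ℂ P (Φ z))
    (hΦ : ∀ z, AnalyticAt ℂ Φ z) (hN : ∀ z, AnalyticAt ℂ N z)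
    (hNΦ : ∀ z j v, N z j ⬝ᵥ fderiv ℂ Φ z v = v j)
    (hpi : ∀ z, ‖bp S z‖ < 3 * ρ → ‖bp Sᶜ z‖ < κ → om (P (Φ z)) (N z ∘ s) ≠ 0)
    (hY : ∀ z, ‖bp S z‖ < 3 * ρ → ‖bp Sᶜ z‖ < κ → ∀ k, ∀ j ∉ S,
      q * ‖Yc (P (Φ z)) (N z) s k j‖ ≤ η)
    (ψ : (Fin n → ℂ) → (Fin n → ℂ)) (c : ℂ)
    (hψ : ∀ᶠ x in 𝓝 (Φ 0), DifferentiableAt ℂ ψ x ∧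
      (∃ K, K * jacC ψ x = 1) ∧ extPowC n q (jacC ψ x) (P x) = c • stdVecC n q) :
    ∃ G : (Fin n → ℂ) → (Fin n → ℂ),
      AnalyticOnNhd ℂ G {z | ‖bp S z‖ < ρ ∧ ‖bp Sᶜ z‖ < κ / 2} ∧
      (∀ z, bp S (G z) = 0) ∧
      (∀ z, ‖bp S z‖ < ρ → ‖bp Sᶜ z‖ < κ / 2 → ‖G z - bp Sᶜ z‖ ≤ η * ‖bp S z‖) ∧
      (∀ f : (Fin n → ℂ) → (Fin n → ℂ), (∀ᶠ x in 𝓝 (Φ 0), DifferentiableAt ℂ f x ∧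
        ∀ a, Kills (jacC f x a) (P x)) → ∀ᶠ z in 𝓝 0, f (Φ z) = f (Φ (G z))) ∧
      ∀ Ξ : (Fin n → ℂ) → (Fin n → ℂ), Ξ (Φ 0) = 0 → (∀ᶠ x in 𝓝 (Φ 0), DifferentiableAt ℂ Ξ x ∧
        Φ (Ξ x) = x) → ∀ᶠ x in 𝓝 (Φ 0), ∀ a, Kills (jacC (fun y => G (Ξ y)) x a) (P x) := by
  set y : (Fin n → ℂ) → Fin q → Fin n → ℂ := fun z k j => Yc (P (Φ z)) (N z) s k j with hy
  let L : Fin q → Fin n → (Fin n → ℂ) →L[ℂ] (Fin n → ℂ) := fun k j =>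
    (ContinuousLinearMap.single ℂ (fun _ : Fin n => ℂ) j).comp (ContinuousLinearMap.proj (s k))
  have hL : ∀ k j σ i, L k j σ i = if i = j then σ (s k) else 0 := by
    intro k j σ i
    simp [L, Pi.single_apply]
  let A : (Fin n → ℂ) → (Fin n → ℂ) →L[ℂ] (Fin n → ℂ) := fun z =>
    ∑ k, ∑ j ∈ Sᶜ, y z k j • L k j
  have hAapp : ∀ z σ i, A z σ i = if i ∈ S then 0 else ∑ k, σ (s k) * y z k i := by
    intro z σ i
    simp only [A, _root_.sum_apply, _root_.smul_apply, Finset.sum_apply,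
      Pi.smul_apply, hL, smul_eq_mul, mul_ite, mul_zero, Finset.sum_ite_eq, Finset.mem_compl]
    split_ifs with h
    · simp
    · refine Finset.sum_congr rfl fun k _ => mul_comm _ _
  have hmemS : ∀ k, s k ∈ S := fun k => by rw [hS]; simp
  have hlift : ∀ z, ‖bp S z‖ < 3 * ρ → ‖bp Sᶜ z‖ < κ → ∀ σ,
      bp S σ + A z (bp S σ) = ∑ k, σ (s k) • y z k := by
    intro z h1 h2 σ
    ext i
    simp only [Pi.add_apply, hAapp, Finset.sum_apply, Pi.smul_apply, smul_eq_mul]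
    have e : ∀ k, bp S σ (s k) = σ (s k) := fun k => by rw [bp_apply, if_pos (hmemS k)]
    simp only [e]
    rw [bp_apply]
    split_ifs with h
    · rw [hS] at h
      obtain ⟨k', -, rfl⟩ := Finset.mem_image.1 h
      simp only [hy, Yc_base (hpi z h1 h2)]
      simp
    · simp
  have hAa : ∀ z, ‖bp S z‖ < 3 * ρ → ‖bp Sᶜ z‖ < κ → AnalyticAt ℂ A z := by
    intro z h1 h2
    refine Finset.analyticAt_fun_sum _ fun k _ => Finset.analyticAt_fun_sum _ fun j _ => ?_
    refine AnalyticAt.fun_smul (f := fun z => y z k j) (g := fun _ => L k j) ?_ analyticAt_const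
    have hNa : ∀ j i, AnalyticAt ℂ (fun z => N z j i) z := fun j i =>
      analyticAt_pi_iff.1 (analyticAt_pi_iff.1 (hN z) j) i
    have hPa : AnalyticAt ℂ (fun z => P (Φ z)) z := (hP z h1 h2).comp (hΦ z)
    refine AnalyticAt.div (om_analytic hPa ?_) (om_analytic hPa ?_) (hpi z h1 h2)
    · intro a i
      by_cases h : a = k
      · subst h; simpa using hNa j i
      · simpa [Function.update_of_ne h] using hNa (s a) i
    · intro a i; exact hNa (s a) i
  obtain ⟨G, hGa, hG0, hGb, hGf⟩ := flowbox S A hρ hκ hη h100 (fun z hz => hAa z hz.1 hz.2) (by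
      intro z h1 h2 σ
      ext i
      rw [bp_apply, hAapp]
      simp only [Pi.zero_apply]
      split_ifs <;> rfl) (by
      intro z h1 h2 σ
      rw [pi_norm_le_iff_of_nonneg (by positivity)]
      intro i
      rw [hAapp]
      split_ifs with h
      · simp; positivity
      · refine (norm_sum_le _ _).trans ?_
        have : ∀ k ∈ (Finset.univ : Finset (Fin q)), ‖σ (s k) * y z k i‖ ≤ ‖σ‖ * (η / q) := by
          intro k _
          have hq : (0:ℝ) < q := by exact_mod_cast k.pos
          rw [norm_mul]
          have := hY z h1 h2 k i h
          gcongr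
          · exact norm_le_pi_norm σ _
          · rw [le_div_iff₀ hq, mul_comm]; exact this
        refine (Finset.sum_le_card_nsmul _ _ _ this).trans ?_
        rcases Nat.eq_zero_or_pos q with rfl | hq
        · simp; positivity
        · have hq : (0:ℝ) < q := by exact_mod_cast hq
          simp only [Finset.card_univ, Fintype.card_fin, nsmul_eq_mul]
          apply le_of_eq; field_simp)
  have hdom0 : ∀ᶠ z : Fin n → ℂ in 𝓝 0, ‖bp S z‖ < ρ ∧ ‖bp Sᶜ z‖ < κ / 2 := by
    have h1 : ∀ᶠ z : Fin n → ℂ in 𝓝 0, ‖bp S z‖ < ρ :=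
      (continuous_norm.comp (bp S).continuous).continuousAt.eventually_lt_const (by simpa using hρ)
    have h2 : ∀ᶠ z : Fin n → ℂ in 𝓝 0, ‖bp Sᶜ z‖ < κ / 2 :=
      (continuous_norm.comp (bp Sᶜ).continuous).continuousAt.eventually_lt_const
        (by simpa using half_pos hκ)
    exact h1.and h2
  have hGz : G 0 = 0 := by
    have := hGb 0 (by simpa using hρ) (by simpa using half_pos hκ)
    simpa using this
  have hinv : ∀ z, (Matrix.of (N z)) * jacC Φ z = 1 := by
    intro z
    apply mat_ext_mulVec
    intro v
    rw [← Matrix.mulVec_mulVec, jac_mulVec, Matrix.one_mulVec]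
    ext j
    exact hNΦ z j v
  have hinv' : ∀ z, jacC Φ z * (Matrix.of (N z)) = 1 := fun z => mul_eq_one_comm.1 (hinv z)
  have hΦc : Tendsto Φ (𝓝 0) (𝓝 (Φ 0)) := (hΦ 0).continuousAt
  -- first integrals pulled back
  have key : ∀ f : (Fin n → ℂ) → (Fin n → ℂ), ∀ z, ‖bp S z‖ < 3 * ρ → ‖bp Sᶜ z‖ < κ →
      DifferentiableAt ℂ f (Φ z) → (∀ a, Kills (jacC f (Φ z) a) (P (Φ z))) →
      ∀ k, fderiv ℂ (fun z => f (Φ z)) z (y z k) = 0 := by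
    intro f z h1 h2 hf hk k
    ext a
    rw [← jac_dot, jac_comp (f := Φ) hf (hΦ z).differentiableAt]
    have e : jacC f (Φ z) a = ∑ j, (jacC f (Φ z) * jacC Φ z) a j • N z j := by
      have h3 : jacC f (Φ z) = (jacC f (Φ z) * jacC Φ z) * Matrix.of (N z) := by
        rw [Matrix.mul_assoc, hinv', Matrix.mul_one]
      conv_lhs => rw [h3]
      ext i
      rw [Matrix.mul_apply]
      simp
    have := Yc_of_kills (s := s) (c := fun j => (jacC f (Φ z) * jacC Φ z) a j)
      (N := N z) (w := P (Φ z)) (by rw [← e]; exact hk a) k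
    exact this
  have hfi : ∀ f : (Fin n → ℂ) → (Fin n → ℂ), (∀ᶠ x in 𝓝 (Φ 0), DifferentiableAt ℂ f x ∧
        ∀ a, Kills (jacC f x a) (P x)) → ∀ᶠ z in 𝓝 0, f (Φ z) = f (Φ (G z)) := by
    intro f hf
    apply hGf (fun z => f (Φ z))
    filter_upwards [hΦc.eventually hf, hdom0] with z hz hd
    refine ⟨DifferentiableAt.comp z hz.1 (hΦ z).differentiableAt, fun σ => ?_⟩
    have h1 : ‖bp S z‖ < 3 * ρ := by linarith [hd.1]
    have h2 : ‖bp Sᶜ z‖ < κ := by linarith [hd.2]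
    rw [hlift z h1 h2, map_sum]
    refine Finset.sum_eq_zero fun k _ => ?_
    rw [map_smul, key f z h1 h2 hz.1 hz.2, smul_zero]
  refine ⟨G, hGa, hG0, hGb, hfi, ?_⟩
  -- integrability
  let f0 : (Fin n → ℂ) → (Fin n → ℂ) := fun x l => if q ≤ (l:ℕ) then ψ x l else 0
  have hf0 : ∀ x, DifferentiableAt ℂ ψ x → DifferentiableAt ℂ f0 x ∧
      ∀ l, jacC f0 x l = if q ≤ (l:ℕ) then jacC ψ x l else 0 := by
    intro x hx
    have hx' := differentiableAt_pi.1 hx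
    have hd : DifferentiableAt ℂ f0 x := by
      rw [differentiableAt_pi]
      intro l
      simp only [f0]
      split_ifs
      · exact hx' l
      · exact differentiableAt_const _
    refine ⟨hd, fun l => ?_⟩
    ext j
    have e1 : jacC f0 x l j = fderiv ℂ (fun x => f0 x l) x (Pi.single j 1) := by
      rw [fderiv_apply hd]; rfl
    have e2 : jacC ψ x l j = fderiv ℂ (fun x => ψ x l) x (Pi.single j 1) := by
      rw [fderiv_apply hx]; rfl
    rw [e1]
    by_cases h : q ≤ (l:ℕ)
    · simp only [f0, h, if_true]; exact e2.symm
    · simp [f0, h]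
  have hf0k : ∀ᶠ x in 𝓝 (Φ 0), DifferentiableAt ℂ f0 x ∧ ∀ a, Kills (jacC f0 x a) (P x) := by
    filter_upwards [hψ] with x ⟨hx, ⟨K, hK⟩, hw⟩
    refine ⟨(hf0 x hx).1, fun a => ?_⟩
    rw [(hf0 x hx).2]
    split_ifs with h
    · exact chart_kills hqn hK hw a h
    · exact Kills.zero
  have hGc : Tendsto G (𝓝 0) (𝓝 0) := by
    have := (hGa 0 ⟨by simpa using hρ, by simpa using half_pos hκ⟩).continuousAt
    rw [ContinuousAt, hGz] at this
    exact this
  have hG' : ∀ᶠ z in 𝓝 0, ∀ k, fderiv ℂ G z (y z k) = 0 := by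
    have h1 := (hfi f0 hf0k).eventually_nhds
    filter_upwards [h1, hΦc.eventually hf0k, hΦc.eventually hψ, (hΦc.comp hGc).eventually hf0k,
      (hΦc.comp hGc).eventually hψ, hdom0, hGc.eventually hdom0] with z he hk1 hp1 hk2 hp2 hd1 hd2 k
    have d1 : ‖bp S z‖ < 3 * ρ := by linarith [hd1.1]
    have d2 : ‖bp Sᶜ z‖ < κ := by linarith [hd1.2]
    have d3 : ‖bp S (G z)‖ < 3 * ρ := by linarith [hd2.1]
    have d4 : ‖bp Sᶜ (G z)‖ < κ := by linarith [hd2.2]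
    have hGd : DifferentiableAt ℂ G z := (hGa z hd1).differentiableAt
    have h2 := key f0 z d1 d2 hk1.1 hk1.2 k
    rw [(show (fun z => f0 (Φ z)) =ᶠ[𝓝 z] fun z => f0 (Φ (G z)) from he).fderiv_eq] at h2
    set X := fderiv ℂ Φ (G z) (fderiv ℂ G z (y z k)) with hX
    have hΦG : DifferentiableAt ℂ (fun z => Φ (G z)) z :=
      DifferentiableAt.comp z (hΦ (G z)).differentiableAt hGd
    have h3 : fderiv ℂ f0 (Φ (G z)) X = 0 := by
      rw [← h2]
      have e1 := fderiv_comp (𝕜 := ℂ) z (g := f0) (f := fun z => Φ (G z)) hk2.1 hΦG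
      have e2 := fderiv_comp (𝕜 := ℂ) z (g := Φ) (f := G) (hΦ (G z)).differentiableAt hGd
      change _ = fderiv ℂ (f0 ∘ fun z => Φ (G z)) z _
      rw [e1]
      change _ = fderiv ℂ f0 (Φ (G z)) (fderiv ℂ (Φ ∘ G) z _)
      rw [e2]; rfl
    obtain ⟨hp2d, ⟨K, hK⟩, hw⟩ := hp2
    have h4 : ∀ l : Fin n, q ≤ (l:ℕ) → jacC ψ (Φ (G z)) l ⬝ᵥ X = 0 := by
      intro l hl
      have := (hf0 (Φ (G z)) hp2d).2 l
      rw [if_pos hl] at this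
      rw [← this, jac_dot, h3]; rfl
    have h5 : ∀ k', N (G z) (s k') ⬝ᵥ X = 0 := by
      intro k'
      rw [hX, hNΦ]
      have e : (fun z => bp S (G z)) = fun _ => 0 := funext hG0
      have e1 := fderiv_comp (𝕜 := ℂ) z (g := bp S) (f := G) (bp S).differentiableAt hGd
      have e2 : fderiv ℂ (bp S ∘ G) z (y z k) = 0 := by
        change fderiv ℂ (fun z => bp S (G z)) z (y z k) = 0
        rw [e]; simp
      rw [e1, ContinuousLinearMap.fderiv] at e2
      have := congrFun e2 (s k')
      simp only [ContinuousLinearMap.comp_apply, bp_apply, hmemS, if_true] at this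
      exact this
    have hX0 := fibre_inj hqn hK hw (Ns := N (G z) ∘ s) (hpi _ d3 d4) h5 h4
    ext j
    have := hNΦ (G z) j (fderiv ℂ G z (y z k))
    rw [← hX, hX0] at this
    rw [← this]; simp
  intro Ξ hΞ0 hΞ
  have hΞc : Tendsto Ξ (𝓝 (Φ 0)) (𝓝 0) := by
    have := hΞ.self_of_nhds.1.continuousAt
    rw [ContinuousAt, hΞ0] at this; exact this
  filter_upwards [hΞ.eventually_nhds, hΞc.eventually hG', hΞc.eventually hdom0, hψ] with x hx hg hd hp a
  set z := Ξ x with hz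
  have d1 : ‖bp S z‖ < 3 * ρ := by linarith [hd.1]
  have d2 : ‖bp Sᶜ z‖ < κ := by linarith [hd.2]
  have hΞd : DifferentiableAt ℂ Ξ x := hx.self_of_nhds.1
  have hΦx : Φ z = x := hx.self_of_nhds.2
  have hGd : DifferentiableAt ℂ G z := (hGa z hd).differentiableAt
  have hjΞ : jacC Ξ x = Matrix.of (N z) := by
    have h1 : jacC (fun y => Φ (Ξ y)) x = 1 := by
      rw [jac_congr (g := fun y => y) (hx.mono fun _ h => h.2), jac_id]
    rw [jac_comp (hΦ _).differentiableAt hΞd] at h1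
    calc jacC Ξ x = (Matrix.of (N z) * jacC Φ z) * jacC Ξ x := by rw [hinv, Matrix.one_mul]
      _ = Matrix.of (N z) := by rw [Matrix.mul_assoc, h1, Matrix.mul_one]
  have e : jacC (fun y => G (Ξ y)) x a = ∑ j, jacC G z a j • N z j := by
    rw [jac_comp hGd hΞd, hjΞ]
    ext i
    rw [Matrix.mul_apply]
    simp [hz]
  rw [e, ← hΦx]
  obtain ⟨hpd, ⟨K, hK⟩, hw⟩ := hp
  rw [← hΦx] at hw hK
  apply kills_of_Yc (s := s) ⟨c, _, chart_struct hqn hK hw⟩ (hpi z d1 d2)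
  intro k
  have := congrFun (hg k) a
  rw [← jac_dot] at this
  exact this
end Chart
section Small
variable {n q : ℕ}

noncomputable def omB (q : ℕ) (M : Fin q → Fin n → ℂ) : ℝ :=
  ∑ J : Idx n q, ‖Matrix.det (Matrix.of fun a b => M a (J.emb b))‖

lemma omB_nonneg (M : Fin q → Fin n → ℂ) : 0 ≤ omB q M :=
  Finset.sum_nonneg fun _ _ => norm_nonneg _

lemma omB_cont : Continuous (omB (n := n) q) := by
  unfold omB
  refine continuous_finsetSum _ fun J _ => Continuous.norm ?_
  refine Continuous.matrix_det ?_
  refine continuous_matrix fun a b => ?_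
  simp only [Matrix.of_apply]
  fun_prop

lemma om_sub_bound (w w' : MultiVecC n q) (M : Fin q → Fin n → ℂ) :
    ‖om w M - om w' M‖ ≤ ‖w - w'‖ * omB q M := by
  rw [om_apply, om_apply, ← Finset.sum_sub_distrib, omB, Finset.mul_sum]
  refine norm_sum_le_of_le _ fun J _ => ?_
  rw [← sub_mul, norm_mul]
  gcongr
  exact norm_le_pi_norm (w - w') J

lemma model_cont : Continuous (modelPiC n q) := by
  unfold modelPiC
  refine continuous_pi fun J => continuous_finsetSum _ fun j _ => ?_
  split_ifs <;> fun_prop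

lemma om_cont {X : Type*} [TopologicalSpace X] {w : X → MultiVecC n q}
    {M : X → Fin q → Fin n → ℂ} (hw : Continuous w)
    (hM : Continuous M) : Continuous (fun x => om (w x) (M x)) := by
  simp only [om_apply]
  refine continuous_finsetSum _ fun J _ => Continuous.mul (by fun_prop) ?_
  refine Continuous.matrix_det ?_
  refine continuous_matrix fun a b => ?_
  simp only [Matrix.of_apply]
  fun_prop

lemma chart_small (s : Fin q → Fin n) (S : Finset (Fin n))
    {ρ κ η : ℝ} (hη : 0 < η) (Φ : (Fin n → ℂ) → (Fin n → ℂ))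
    (N : (Fin n → ℂ) → Fin n → Fin n → ℂ) (hΦ : Continuous Φ) (hN : Continuous N)
    (hpi : ∀ z, ‖bp S z‖ ≤ 3 * ρ → ‖bp Sᶜ z‖ ≤ κ → om (modelPiC n q (Φ z)) (N z ∘ s) ≠ 0)
    (hY : ∀ z, ‖bp S z‖ ≤ 3 * ρ → ‖bp Sᶜ z‖ ≤ κ → ∀ k, ∀ j ∉ S,
      q * ‖Yc (modelPiC n q (Φ z)) (N z) s k j‖ ≤ η / 2) :
    ∃ R μ : ℝ, 0 < R ∧ 0 < μ ∧ ∀ P : (Fin n → ℂ) → MultiVecC n q,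
      (∀ x ∈ closedBall (0 : Fin n → ℂ) R, ‖P x - modelPiC n q x‖ ≤ μ) →
      ∀ z, ‖bp S z‖ < 3 * ρ → ‖bp Sᶜ z‖ < κ → Φ z ∈ closedBall (0 : Fin n → ℂ) R ∧
        om (P (Φ z)) (N z ∘ s) ≠ 0 ∧ ∀ k, ∀ j ∉ S, q * ‖Yc (P (Φ z)) (N z) s k j‖ ≤ η := by
  set K : Set (Fin n → ℂ) := {z | ‖bp S z‖ ≤ 3 * ρ ∧ ‖bp Sᶜ z‖ ≤ κ} with hK
  have hKc : IsCompact K := by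
    apply Metric.isCompact_of_isClosed_isBounded
    · have o1 : IsClosed {z : Fin n → ℂ | ‖bp S z‖ ≤ 3 * ρ} := isClosed_le (by fun_prop) (by fun_prop)
      have o2 : IsClosed {z : Fin n → ℂ | ‖bp Sᶜ z‖ ≤ κ} := isClosed_le (by fun_prop) (by fun_prop)
      exact o1.inter o2
    · refine (Metric.isBounded_iff_subset_closedBall 0).2 ⟨3 * ρ + κ, fun z hz => ?_⟩
      rw [mem_closedBall_zero_iff, ← bp_add_compl S z]
      exact (norm_add_le _ _).trans (add_le_add hz.1 hz.2)
  obtain ⟨R, hR⟩ := hKc.exists_bound_of_continuousOn hΦ.continuousOn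
  have hbc : Continuous (fun z => omB q (N z ∘ s) + ∑ k, ∑ j, omB q (Function.update (N z ∘ s) k (N z j))) := by
    have h1 : Continuous (fun z => N z ∘ s) := continuous_pi fun k => by
      simp only [Function.comp]; fun_prop
    refine Continuous.add (omB_cont.comp h1) ?_
    refine continuous_finsetSum _ fun k _ => continuous_finsetSum _ fun j _ => omB_cont.comp ?_
    exact h1.update k (by fun_prop)
  obtain ⟨C, hC⟩ := hKc.exists_bound_of_continuousOn hbc.continuousOn
  have hπc : Continuous fun z => ‖om (modelPiC n q (Φ z)) (N z ∘ s)‖ := by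
    refine (om_cont (model_cont.comp hΦ) ?_).norm
    exact continuous_pi fun k => by simp only [Function.comp]; fun_prop
  obtain ⟨c0, hc0, hc0'⟩ : ∃ c0 > 0, ∀ z ∈ K, c0 ≤ ‖om (modelPiC n q (Φ z)) (N z ∘ s)‖ := by
    rcases K.eq_empty_or_nonempty with he | hne
    · exact ⟨1, one_pos, by simp [he]⟩
    · obtain ⟨z0, hz0, hmin⟩ := hKc.exists_isMinOn hne hπc.continuousOn
      exact ⟨_, norm_pos_iff.2 (hpi z0 hz0.1 hz0.2), fun z hz => hmin hz⟩
  set C' := max C 1 with hC'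
  have hC'1 : 1 ≤ C' := le_max_right _ _
  set μ := (min (η / 2) (1/2) * c0) / ((q + η + 1) * C') with hμ
  have hμ0 : 0 < μ := by positivity
  have hμ1 : (q + η + 1) * (μ * C') = min (η / 2) (1/2) * c0 := by
    rw [hμ]; field_simp
  refine ⟨max R 1, μ, by positivity, hμ0, fun P hP z h1 h2 => ?_⟩
  have hz : z ∈ K := ⟨h1.le, h2.le⟩
  have hΦz : Φ z ∈ closedBall (0 : Fin n → ℂ) (max R 1) := by
    rw [mem_closedBall_zero_iff]; exact (hR z hz).trans (le_max_left _ _)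
  have hd := hP _ hΦz
  have hCz := hC z hz
  rw [Real.norm_of_nonneg (by
    have := omB_nonneg (N z ∘ s)
    have : 0 ≤ ∑ k, ∑ j, omB q (Function.update (N z ∘ s) k (N z j)) :=
      Finset.sum_nonneg fun k _ => Finset.sum_nonneg fun j _ => omB_nonneg _
    linarith)] at hCz
  have hsum : 0 ≤ ∑ k, ∑ j, omB q (Function.update (N z ∘ s) k (N z j)) :=
      Finset.sum_nonneg fun k _ => Finset.sum_nonneg fun j _ => omB_nonneg _
  have hC1 : omB q (N z ∘ s) ≤ C' := by
    have := le_max_left C 1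
    linarith
  have hC2 : ∀ k j, omB q (Function.update (N z ∘ s) k (N z j)) ≤ C' := by
    intro k j
    have e1 := Finset.single_le_sum (f := fun k => ∑ j, omB q (Function.update (N z ∘ s) k (N z j)))
      (fun k _ => Finset.sum_nonneg fun j _ => omB_nonneg _) (Finset.mem_univ k)
    have e2 := Finset.single_le_sum (f := fun j => omB q (Function.update (N z ∘ s) k (N z j)))
      (fun j _ => omB_nonneg _) (Finset.mem_univ j)
    have := le_max_left C 1
    have := omB_nonneg (N z ∘ s)
    linarith
  have hb : ∀ M, omB q M ≤ C' → ‖om (P (Φ z)) M - om (modelPiC n q (Φ z)) M‖ ≤ μ * C' := by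
    intro M hM
    refine (om_sub_bound _ _ _).trans ?_
    gcongr
    exact omB_nonneg M
  have hπ0 := hc0' z hz
  have hπ1 := hb _ hC1
  set π0 := om (modelPiC n q (Φ z)) (N z ∘ s)
  set π1 := om (P (Φ z)) (N z ∘ s) with hπ1'
  have hπn : ‖π0‖ - μ * C' ≤ ‖π1‖ := by
    have := norm_sub_norm_le π0 π1
    rw [norm_sub_rev] at this
    linarith
  have hq0 : (0:ℝ) ≤ q := Nat.cast_nonneg q
  have hm : 0 < μ * C' := by positivity
  have hm1 : μ * C' ≤ c0 / 2 := by
    have := min_le_right (η / 2) (1/2)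
    nlinarith
  have hm2 : (q + η) * (μ * C') ≤ η / 2 * c0 := by
    have := min_le_left (η / 2) (1/2)
    nlinarith
  have hπne : π1 ≠ 0 := by
    rw [← norm_pos_iff]; linarith
  refine ⟨hΦz, hπne, fun k j hj => ?_⟩
  have hy := hY z hz.1 hz.2 k j hj
  have hn := hb _ (hC2 k j)
  unfold Yc at hy ⊢
  rw [norm_div, ← mul_div_assoc, div_le_iff₀ (by linarith)] at hy
  rw [← hπ1', norm_div, ← mul_div_assoc, div_le_iff₀ (norm_pos_iff.2 hπne)]
  set a0 := om (modelPiC n q (Φ z)) (Function.update (N z ∘ s) k (N z j))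
  set a1 := om (P (Φ z)) (Function.update (N z ∘ s) k (N z j))
  have hn' : ‖a1‖ ≤ ‖a0‖ + μ * C' := by
    have := norm_sub_norm_le a1 a0
    linarith
  calc (q:ℝ) * ‖a1‖ ≤ q * (‖a0‖ + μ * C') := by gcongr
    _ ≤ η / 2 * ‖π0‖ + q * (μ * C') := by rw [mul_add]; gcongr
    _ ≤ η * (‖π0‖ - μ * C') := by nlinarith
    _ ≤ η * ‖π1‖ := by gcongr
end Small
section Charts

lemma kills_model_of {n q : ℕ} (h : q + 1 ≤ n) {l v : Fin n → ℂ} (t : ℂ)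
    (hl : ∀ i : Fin n, (i:ℕ) < q + 1 → l i = t * v i) : Kills l (modelPiC n q v) := by
  intro M a ha
  rw [om_model h]
  have : (Matrix.of fun (a b : Fin (q+1)) => (Fin.cons v M : Fin (q+1) → Fin n → ℂ) a (Fin.castLE h b)) a.succ
      = t • (fun b => v (Fin.castLE h b)) := by
    ext b
    simp only [Matrix.of_apply, Fin.cons_succ, ha, Pi.smul_apply, smul_eq_mul]
    exact hl _ (by simpa using b.2)
  set W := (Matrix.of fun (a b : Fin (q+1)) => (Fin.cons v M : Fin (q+1) → Fin n → ℂ) a (Fin.castLE h b)) with hW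
  have e : W = W.updateRow a.succ (t • (fun b => v (Fin.castLE h b))) := by
    rw [← this, Matrix.updateRow_eq_self]
  rw [e, Matrix.det_updateRow_smul]
  have : (W.updateRow a.succ fun b => v (Fin.castLE h b)).det = 0 := by
    apply Matrix.det_zero_of_row_eq (i := 0) (j := a.succ) (Fin.succ_ne_zero a).symm
    rw [Matrix.updateRow_self, Matrix.updateRow_ne (Fin.succ_ne_zero a).symm]
    ext b; simp [hW]
  rw [this, mul_zero]

lemma om_model_ne {n q : ℕ} (h : q + 1 ≤ n) {v : Fin n → ℂ} {M : Fin q → Fin n → ℂ}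
    (hX : ∀ X : Fin n → ℂ, (∀ i : Fin n, q + 1 ≤ (i:ℕ) → X i = 0) → v ⬝ᵥ X = 0 →
      (∀ k, M k ⬝ᵥ X = 0) → X = 0) : om (modelPiC n q v) M ≠ 0 := by
  rw [om_model h]
  intro h0
  obtain ⟨Y, hY0, hY⟩ := Matrix.exists_mulVec_eq_zero_iff.2 h0
  apply hY0
  let X : Fin n → ℂ := fun i => if hi : (i:ℕ) < q + 1 then Y ⟨i, hi⟩ else 0
  have hdot : ∀ l : Fin n → ℂ, l ⬝ᵥ X = ∑ b : Fin (q+1), l (Fin.castLE h b) * Y b := by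
    intro l
    have e : ∀ b : Fin (q+1), l (Fin.castLE h b) * Y b = (fun i => l i * X i) (Fin.castLE h b) := by
      intro b
      have h2 : X (Fin.castLE h b) = Y b := dif_pos b.2
      show _ = l (Fin.castLE h b) * X (Fin.castLE h b)
      rw [h2]
    simp only [e]
    rw [dotProduct]
    symm
    have := Finset.sum_map Finset.univ (Fin.castLEEmb h) (fun i => l i * X i)
    refine Eq.trans this.symm ?_
    apply Finset.sum_subset (Finset.subset_univ _)
    intro i _ hi
    have : ¬ (i:ℕ) < q + 1 := by
      intro hlt
      apply hi
      rw [Finset.mem_map]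
      exact ⟨⟨i, hlt⟩, Finset.mem_univ _, rfl⟩
    have : X i = 0 := dif_neg this
    simp [this]
  have := hX X (fun i hi => dif_neg (Nat.not_lt.2 hi)) (by
      rw [hdot]; exact congrFun hY 0) (by
      intro k
      rw [hdot]; exact congrFun hY k.succ)
  ext b
  have h1 := congrFun this (Fin.castLE h b)
  have h2 : X (Fin.castLE h b) = Y b := dif_pos b.2
  rw [h2] at h1; exact h1

lemma bp_le {n : ℕ} {S : Finset (Fin n)} {z : Fin n → ℂ} {r : ℝ} (h : ‖bp S z‖ ≤ r) {i : Fin n} (hi : i ∈ S) :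
    ‖z i‖ ≤ r := by
  refine le_trans ?_ h
  have := norm_le_pi_norm (bp S z) i
  rwa [bp_apply, if_pos hi] at this

lemma bp_lt {n : ℕ} {S : Finset (Fin n)} {z : Fin n → ℂ} {r : ℝ} (hr : 0 < r)
    (h : ∀ i ∈ S, ‖z i‖ < r) : ‖bp S z‖ < r := by
  rw [pi_norm_lt_iff hr]
  intro i
  rw [bp_apply]
  split_ifs with hi
  · exact h i hi
  · simpa using hr

lemma dot_fderiv {n : ℕ} {Φ : (Fin n → ℂ) → (Fin n → ℂ)} {z : Fin n → ℂ} (hΦ : DifferentiableAt ℂ Φ z)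
    (a v : Fin n → ℂ) : a ⬝ᵥ fderiv ℂ Φ z v = fderiv ℂ (fun z => a ⬝ᵥ Φ z) z v := by
  have h1 := hasFDerivAt_pi'.1 hΦ.hasFDerivAt
  have : HasFDerivAt (fun z => ∑ i, a i * Φ z i)
      (∑ i, a i • (ContinuousLinearMap.proj i ∘L fderiv ℂ Φ z)) z :=
    HasFDerivAt.fun_sum fun i _ => (h1 i).const_mul (a i)
  have h2 : fderiv ℂ (fun z => a ⬝ᵥ Φ z) z = _ := this.fderiv
  rw [h2]
  simp [dotProduct]

variable {k p : ℕ}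

/-- base indices -/
def sIdx (hpk : p ≤ k) : Fin (p+2) → Fin (k+3) :=
  Fin.cons 0 (fun b : Fin (p+1) => ⟨b + 2, by omega⟩)

def SIdx (hpk : p ≤ k) : Finset (Fin (k+3)) := Finset.univ.image (sIdx hpk)

lemma sIdx_inj (hpk : p ≤ k) : Function.Injective (sIdx hpk) := by
  intro a b
  refine Fin.cases ?_ (fun a => ?_) a <;> refine Fin.cases ?_ (fun b => ?_) b
  · simp
  · intro h; have := congrArg Fin.val h; simp [sIdx] at this
  · intro h; have := congrArg Fin.val h; simp [sIdx] at this
  · intro h; have := congrArg Fin.val h; simp [sIdx] at this; simp [Fin.ext_iff, this]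

lemma mem_SIdx (hpk : p ≤ k) (i : Fin (k+3)) : i ∈ SIdx hpk ↔ i ≠ 1 ∧ (i:ℕ) < p + 3 := by
  simp only [SIdx, Finset.mem_image, Finset.mem_univ, true_and]
  constructor
  · rintro ⟨a, rfl⟩
    refine Fin.cases ?_ (fun b => ?_) a
    · simp [sIdx, Fin.ext_iff]
    · have := b.2
      refine ⟨?_, ?_⟩
      · simp only [sIdx, Fin.cons_succ, ne_eq, Fin.ext_iff]
        simp
      · simp [sIdx]; omega
  · rintro ⟨h1, h2⟩
    by_cases h0 : i = 0
    · exact ⟨0, by simp [sIdx, h0]⟩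
    · have e0 : (i:ℕ) ≠ 0 := fun h => h0 (Fin.ext h)
      have e1 : (i:ℕ) ≠ 1 := fun h => h1 (Fin.ext (by simpa using h))
      refine ⟨Fin.succ ⟨i - 2, by omega⟩, ?_⟩
      simp only [sIdx, Fin.cons_succ, Fin.ext_iff]
      omega

/-- sum of squares of the coordinates 2,…,p+2 -/
noncomputable def T2 (p : ℕ) (x : Fin (k+3) → ℂ) : ℂ :=
  ∑ j : Fin (k+1), if (j:ℕ) < p + 1 then x j.succ.succ ^ 2 else 0

noncomputable def linX (X : Fin (k+3) → ℂ) : Fin (k+3) → ℂ :=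
  Matrix.vecCons ((X 0 + X 1) / 2) (Matrix.vecCons ((X 0 - X 1) / (2 * Complex.I))
    (fun j => X j.succ.succ))

noncomputable def Lx (x : Fin (k+3) → ℂ) : Fin (k+3) → ℂ :=
  Matrix.vecCons (x 0 + Complex.I * x 1) (Matrix.vecCons (x 0 - Complex.I * x 1)
    (fun j => x j.succ.succ))

lemma vc_ss {α : Type*} (a b : α) (f : Fin (k+1) → α) (j : Fin (k+1)) :
    Matrix.vecCons a (Matrix.vecCons b f) j.succ.succ = f j := rfl
lemma vc_0 {α : Type*} (a b : α) (f : Fin (k+1) → α) :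
    Matrix.vecCons a (Matrix.vecCons b f) 0 = a := rfl
lemma vc_1 {α : Type*} (a b : α) (f : Fin (k+1) → α) :
    Matrix.vecCons a (Matrix.vecCons b f) 1 = b := rfl

lemma ext3 {α : Type*} {f g : Fin (k+3) → α} (h0 : f 0 = g 0) (h1 : f 1 = g 1)
    (h2 : ∀ j : Fin (k+1), f j.succ.succ = g j.succ.succ) : f = g := by
  funext i
  refine Fin.cases h0 (fun i => ?_) i
  refine Fin.cases h1 (fun i => h2 i) i

lemma forall3 {Q : Fin (k+3) → Prop} (h0 : Q 0) (h1 : Q 1)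
    (h2 : ∀ j : Fin (k+1), Q j.succ.succ) : ∀ i, Q i := by
  intro i
  refine Fin.cases h0 (fun i => ?_) i
  exact Fin.cases h1 (fun i => h2 i) i

lemma linX_Lx (x : Fin (k+3) → ℂ) : linX (Lx x) = x := by
  apply ext3
  · simp only [linX, Lx, vc_0, vc_1]; ring
  · simp only [linX, Lx, vc_0, vc_1]; field_simp; ring
  · intro j; simp only [linX, Lx, vc_ss]

lemma Lx_linX (x : Fin (k+3) → ℂ) : Lx (linX x) = x := by
  apply ext3
  · simp only [linX, Lx, vc_0, vc_1]; field_simp; ring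
  · simp only [linX, Lx, vc_0, vc_1]; field_simp; ring
  · intro j; simp only [linX, Lx, vc_ss]

noncomputable def du : Fin (k+3) → ℂ := Pi.single 0 1 + Complex.I • Pi.single 1 1
noncomputable def dw : Fin (k+3) → ℂ := Pi.single 0 1 - Complex.I • Pi.single 1 1

lemma du_dot (x : Fin (k+3) → ℂ) : du ⬝ᵥ x = x 0 + Complex.I * x 1 := by
  simp [du, add_dotProduct, smul_dotProduct]
lemma dw_dot (x : Fin (k+3) → ℂ) : dw ⬝ᵥ x = x 0 - Complex.I * x 1 := by
  simp [dw, sub_dotProduct, smul_dotProduct]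

/-- gradient of Q2 -/
noncomputable def dQ (p : ℕ) (x : Fin (k+3) → ℂ) : Fin (k+3) → ℂ :=
  fun i => if (i:ℕ) < p + 3 then 2 * x i else 0

noncomputable def Q2 (p : ℕ) (x : Fin (k+3) → ℂ) : ℂ := ∑ i : Fin (k+3), if (i:ℕ) < p + 3 then x i ^ 2 else 0

lemma Q2_eq (x : Fin (k+3) → ℂ) : Q2 p x = x 0 ^ 2 + x 1 ^ 2 + T2 p x := by
  rw [Q2, Fin.sum_univ_succ, Fin.sum_univ_succ, T2]
  simp [add_assoc]

lemma Q2_linX (X : Fin (k+3) → ℂ) : Q2 p (linX X) = X 0 * X 1 + T2 p X := by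
  rw [Q2_eq]
  have : T2 p (linX X) = T2 p X := by
    unfold T2; simp only [linX, vc_ss]
  rw [this]
  simp only [linX, vc_0, vc_1]
  have hI : Complex.I ^ 2 = -1 := Complex.I_sq
  field_simp
  rw [hI]
  ring

lemma Q2_hasFDeriv {Φ : (Fin (k+3) → ℂ) → (Fin (k+3) → ℂ)} {z : Fin (k+3) → ℂ}
    (hΦ : DifferentiableAt ℂ Φ z) (v : Fin (k+3) → ℂ) :
    dQ p (Φ z) ⬝ᵥ fderiv ℂ Φ z v = fderiv ℂ (fun z => Q2 p (Φ z)) z v := by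
  have h1 := hasFDerivAt_pi'.1 hΦ.hasFDerivAt
  have : HasFDerivAt (fun z => Q2 p (Φ z))
      (∑ i, (dQ p (Φ z) i) • (ContinuousLinearMap.proj i ∘L fderiv ℂ Φ z)) z := by
    refine HasFDerivAt.fun_sum fun i _ => ?_
    unfold dQ
    split_ifs
    · have := (h1 i).pow 2
      simpa using this
    · refine (hasFDerivAt_const (𝕜 := ℂ) (0:ℂ) z).congr_fderiv ?_
      ext v; simp
  rw [this.fderiv]
  simp [dotProduct]

end Charts
section ChartAB

/-- conclusion of the chart lemma -/
def ChartC {n q : ℕ} (S : Finset (Fin n)) (ρ κ η : ℝ) (P : (Fin n → ℂ) → MultiVecC n q)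
    (Φ G : (Fin n → ℂ) → (Fin n → ℂ)) : Prop :=
  AnalyticOnNhd ℂ G {z | ‖bp S z‖ < ρ ∧ ‖bp Sᶜ z‖ < κ / 2} ∧
      (∀ z, bp S (G z) = 0) ∧
      (∀ z, ‖bp S z‖ < ρ → ‖bp Sᶜ z‖ < κ / 2 → ‖G z - bp Sᶜ z‖ ≤ η * ‖bp S z‖) ∧
      (∀ f : (Fin n → ℂ) → (Fin n → ℂ), (∀ᶠ x in 𝓝 (Φ 0), DifferentiableAt ℂ f x ∧
        ∀ a, Kills (jacC f x a) (P x)) → ∀ᶠ z in 𝓝 0, f (Φ z) = f (Φ (G z))) ∧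
      ∀ Ξ : (Fin n → ℂ) → (Fin n → ℂ), Ξ (Φ 0) = 0 → (∀ᶠ x in 𝓝 (Φ 0), DifferentiableAt ℂ Ξ x ∧
        Φ (Ξ x) = x) → ∀ᶠ x in 𝓝 (Φ 0), ∀ a, Kills (jacC (fun y => G (Ξ y)) x a) (P x)

/-- existence of a chart at a point -/
def HasChart {n q : ℕ} (P : (Fin n → ℂ) → MultiVecC n q) (x₀ : Fin n → ℂ) : Prop :=
  ∃ (ψ : (Fin n → ℂ) → (Fin n → ℂ)) (c : ℂ), ∀ᶠ x in 𝓝 x₀, DifferentiableAt ℂ ψ x ∧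
      (∃ K, K * jacC ψ x = 1) ∧ extPowC n q (jacC ψ x) (P x) = c • stdVecC n q

lemma chart_comb {n q : ℕ} (hqn : q ≤ n) (s : Fin q → Fin n) (S : Finset (Fin n))
    (hS : S = Finset.univ.image s) (hsi : Function.Injective s)
    {ρ κ η : ℝ} (hρ : 0 < ρ) (hκ : 0 < κ) (hη : 0 < η) (h100 : 100 * η * ρ ≤ κ)
    (Φ : (Fin n → ℂ) → (Fin n → ℂ))
    (N : (Fin n → ℂ) → Fin n → Fin n → ℂ)
    (hΦ : ∀ z, AnalyticAt ℂ Φ z) (hN : ∀ z, AnalyticAt ℂ N z)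
    (hNΦ : ∀ z j v, N z j ⬝ᵥ fderiv ℂ Φ z v = v j)
    (hpi : ∀ z, ‖bp S z‖ ≤ 3 * ρ → ‖bp Sᶜ z‖ ≤ κ → om (modelPiC n q (Φ z)) (N z ∘ s) ≠ 0)
    (hY : ∀ z, ‖bp S z‖ ≤ 3 * ρ → ‖bp Sᶜ z‖ ≤ κ → ∀ k, ∀ j ∉ S,
      q * ‖Yc (modelPiC n q (Φ z)) (N z) s k j‖ ≤ η / 2) :
    ∃ R μ : ℝ, 0 < R ∧ 0 < μ ∧ ∀ P : (Fin n → ℂ) → MultiVecC n q,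
      (∀ x ∈ closedBall (0 : Fin n → ℂ) R, AnalyticAt ℂ P x ∧ ‖P x - modelPiC n q x‖ ≤ μ) →
      HasChart P (Φ 0) → ∃ G, ChartC S ρ κ η P Φ G := by
  obtain ⟨R, μ, hR, hμ, h⟩ := chart_small s S hη Φ N
    (continuous_iff_continuousAt.2 fun z => (hΦ z).continuousAt)
    (continuous_iff_continuousAt.2 fun z => (hN z).continuousAt) hpi hY
  refine ⟨R, μ, hR, hμ, fun P hP hψ => ?_⟩
  obtain ⟨ψ, c, hψ⟩ := hψ
  have h' := h P (fun x hx => (hP x hx).2)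
  exact chart_lemma hqn s S hS hsi hρ hκ hη h100 P Φ N (fun z h1 h2 => (hP _ (h' z h1 h2).1).1) hΦ hN hNΦ
    (fun z h1 h2 => (h' z h1 h2).2.1) (fun z h1 h2 => (h' z h1 h2).2.2) ψ c hψ

variable {k p : ℕ}

lemma analyticAt3 {E F : Type*} [NormedAddCommGroup E] [NormedSpace ℂ E] [NormedAddCommGroup F] [NormedSpace ℂ F]
    {f : E → Fin (k+3) → F} {x : E}
    (h0 : AnalyticAt ℂ (fun z => f z 0) x) (h1 : AnalyticAt ℂ (fun z => f z 1) x)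
    (h2 : ∀ j : Fin (k+1), AnalyticAt ℂ (fun z => f z j.succ.succ) x) : AnalyticAt ℂ f x :=
  analyticAt_pi_iff.2 (forall3 h0 h1 h2)

lemma an_coord {n : ℕ} (i : Fin n) (x : Fin n → ℂ) : AnalyticAt ℂ (fun z : Fin n → ℂ => z i) x :=
  (ContinuousLinearMap.proj (R := ℂ) (φ := fun _ : Fin n => ℂ) i).analyticAt x

lemma an_T2 {E : Type*} [NormedAddCommGroup E] [NormedSpace ℂ E] {f : E → Fin (k+3) → ℂ} {x : E}
    (h : ∀ i, AnalyticAt ℂ (fun z => f z i) x) : AnalyticAt ℂ (fun z => T2 p (f z)) x := by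
  unfold T2
  refine Finset.analyticAt_fun_sum _ fun j _ => ?_
  split_ifs
  · exact (h _).pow 2
  · exact analyticAt_const

lemma an_linX {E : Type*} [NormedAddCommGroup E] [NormedSpace ℂ E] {f : E → Fin (k+3) → ℂ} {x : E}
    (h : AnalyticAt ℂ f x) : AnalyticAt ℂ (fun z => linX (f z)) x := by
  have h := analyticAt_pi_iff.1 h
  apply analyticAt3
  · simp only [linX, vc_0]; exact ((h 0).add (h 1)).div_const
  · simp only [linX, vc_1]; exact ((h 0).sub (h 1)).div_const
  · intro j; simp only [linX, vc_ss]; exact h _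

lemma an_Lx {E : Type*} [NormedAddCommGroup E] [NormedSpace ℂ E] {f : E → Fin (k+3) → ℂ} {x : E}
    (h : AnalyticAt ℂ f x) : AnalyticAt ℂ (fun z => Lx (f z)) x := by
  have h := analyticAt_pi_iff.1 h
  apply analyticAt3
  · simp only [Lx, vc_0]; exact (h 0).add (analyticAt_const.mul (h 1))
  · simp only [Lx, vc_1]; exact (h 0).sub (analyticAt_const.mul (h 1))
  · intro j; simp only [Lx, vc_ss]; exact h _

lemma dot3 (v X : Fin (k+3) → ℂ) : v ⬝ᵥ X = v 0 * X 0 + v 1 * X 1 + ∑ j : Fin (k+1), v j.succ.succ * X j.succ.succ := by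
  rw [dotProduct, Fin.sum_univ_succ, Fin.sum_univ_succ, ← add_assoc]; rfl


noncomputable def sh2 (z : Fin (k+3) → ℂ) (j : Fin (k+1)) : ℂ := z j.succ.succ + if j = 0 then 1 else 0

noncomputable def AA (p : ℕ) (z : Fin (k+3) → ℂ) : Fin (k+3) → ℂ :=
  Matrix.vecCons (Complex.exp (Complex.I * z 0))
    (Matrix.vecCons ((1 + z 1 - T2 p (Matrix.vecCons 0 (Matrix.vecCons 0 (sh2 z)))) * Complex.exp (-(Complex.I * z 0))) (sh2 z))

noncomputable def PhiA (p : ℕ) (z : Fin (k+3) → ℂ) : Fin (k+3) → ℂ := linX (AA p z)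

noncomputable def NA (p : ℕ) (z : Fin (k+3) → ℂ) : Fin (k+3) → Fin (k+3) → ℂ :=
  Matrix.vecCons ((-Complex.I * Complex.exp (-(Complex.I * z 0))) • du)
    (Matrix.vecCons (dQ p (PhiA p z)) (fun j => Pi.single j.succ.succ 1))

lemma an_AA (z : Fin (k+3) → ℂ) : AnalyticAt ℂ (AA p) z := by
  have hs : ∀ j, AnalyticAt ℂ (fun z : Fin (k+3) → ℂ => sh2 z j) z := fun j => (an_coord _ z).add analyticAt_const
  have h0 := (analyticAt_const (v := Complex.I)).mul (an_coord (0 : Fin (k+3)) z)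
  apply analyticAt3
  · simp only [AA, vc_0]
    exact h0.cexp
  · simp only [AA, vc_1]
    refine AnalyticAt.mul (AnalyticAt.sub (analyticAt_const.add (an_coord _ z)) (an_T2 ?_)) h0.neg.cexp
    exact forall3 analyticAt_const analyticAt_const hs
  · intro j; simp only [AA, vc_ss]; exact hs j

lemma an_PhiA (z : Fin (k+3) → ℂ) : AnalyticAt ℂ (PhiA p) z := an_linX (an_AA z)

lemma an_NA (z : Fin (k+3) → ℂ) : AnalyticAt ℂ (NA p) z := by
  have h0 := (analyticAt_const (v := Complex.I)).mul (an_coord (0 : Fin (k+3)) z)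
  apply analyticAt3
  · simp only [NA, vc_0]
    exact (analyticAt_const.mul h0.neg.cexp).smul analyticAt_const
  · simp only [NA, vc_1]
    refine analyticAt_pi_iff.2 fun i => ?_
    unfold dQ
    split_ifs
    · exact analyticAt_const.mul (analyticAt_pi_iff.1 (an_PhiA z) i)
    · exact analyticAt_const
  · intro j; simp only [NA, vc_ss]; exact analyticAt_const

lemma T2_congr {x y : Fin (k+3) → ℂ} (h : ∀ j : Fin (k+1), x j.succ.succ = y j.succ.succ) : T2 p x = T2 p y := by
  unfold T2; simp only [h]

lemma Lx0 (x : Fin (k+3) → ℂ) : x 0 + Complex.I * x 1 = Lx x 0 := rfl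
lemma Lx1 (x : Fin (k+3) → ℂ) : x 0 - Complex.I * x 1 = Lx x 1 := rfl

lemma Q2_PhiA (z : Fin (k+3) → ℂ) : Q2 p (PhiA p z) = 1 + z 1 := by
  rw [PhiA, Q2_linX]
  rw [T2_congr (x := AA p z) (y := Matrix.vecCons 0 (Matrix.vecCons 0 (sh2 z))) (fun j => rfl)]
  simp only [AA, vc_0, vc_1]
  rw [mul_left_comm, ← Complex.exp_add]
  simp

lemma NA_dual (z : Fin (k+3) → ℂ) (j) (v : Fin (k+3) → ℂ) : NA p z j ⬝ᵥ fderiv ℂ (PhiA p) z v = v j := by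
  have hd := (an_PhiA (p := p) z).differentiableAt
  revert j
  apply forall3
  · simp only [NA, vc_0, smul_dotProduct, smul_eq_mul]
    rw [dot_fderiv hd]
    have e : (fun z => du ⬝ᵥ PhiA p z) = fun z : Fin (k+3) → ℂ => Complex.exp (Complex.I * z 0) := by
      funext z
      rw [du_dot, Lx0, PhiA, Lx_linX]; rfl
    rw [e]
    have h1 := ((hasFDerivAt_apply (𝕜 := ℂ) (0 : Fin (k+3)) z).const_mul Complex.I).cexp
    rw [h1.fderiv]
    have : Complex.exp (-(Complex.I * z 0)) * Complex.exp (Complex.I * z 0) = 1 := by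
      rw [← Complex.exp_add]; simp
    simp only [_root_.smul_apply, ContinuousLinearMap.proj_apply, smul_eq_mul]
    linear_combination (-Complex.I * Complex.I * v 0) * this + (- v 0) * Complex.I_sq
  · simp only [NA, vc_1]
    rw [Q2_hasFDeriv hd]
    simp only [Q2_PhiA]
    have h1 := ((hasFDerivAt_apply (𝕜 := ℂ) (1 : Fin (k+3)) z).const_add 1)
    rw [h1.fderiv]; simp
  · intro j
    simp only [NA, vc_ss]
    rw [dot_fderiv hd]
    have e : (fun z => Pi.single j.succ.succ 1 ⬝ᵥ PhiA p z) = fun z : Fin (k+3) → ℂ => z j.succ.succ + if j = 0 then 1 else 0 := by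
      funext z
      rw [single_one_dotProduct]; rfl
    rw [e]
    have h1 := ((hasFDerivAt_apply (𝕜 := ℂ) (j.succ.succ : Fin (k+3)) z).add_const (if j = 0 then (1:ℂ) else 0))
    rw [h1.fderiv]; simp

lemma Yc_zero_of_kills {n q : ℕ} {w : MultiVecC n q} {N : Fin n → Fin n → ℂ} {s : Fin q → Fin n} {j : Fin n}
    (h : Kills (N j) w) (b : Fin q) : Yc w N s b j = 0 := by
  unfold Yc
  rw [h _ b (by simp), zero_div]

lemma sIdx_zero (hpk : p ≤ k) : sIdx hpk 0 = 0 := rfl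
lemma sIdx_succ (hpk : p ≤ k) (b : Fin (p+1)) : sIdx hpk b.succ = (⟨b, by omega⟩ : Fin (k+1)).succ.succ := rfl

lemma chartA (hpk : p ≤ k) {η κ : ℝ} (hη : 0 < η) (hκ : 1000 * η ≤ κ) :
    ∃ R μ : ℝ, 0 < R ∧ 0 < μ ∧ ∀ P : (Fin (k+3) → ℂ) → MultiVecC (k+3) (p+2),
      (∀ x ∈ closedBall (0 : Fin (k+3) → ℂ) R, AnalyticAt ℂ P x ∧ ‖P x - modelPiC (k+3) (p+2) x‖ ≤ μ) →
      HasChart P (PhiA p 0) → ∃ G, ChartC (SIdx hpk) 10 κ η P (PhiA p) G := by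
  refine chart_comb (by omega) (sIdx hpk) (SIdx hpk) rfl (sIdx_inj hpk) (by norm_num) (by linarith) hη (by linarith)
    (PhiA p) (NA p) an_PhiA an_NA NA_dual ?_ ?_
  · intro z _ _
    refine om_model_ne (by omega) fun X hX hv hM => ?_
    have h0 := hM 0
    simp only [Function.comp, sIdx_zero, NA, vc_0, smul_dotProduct, smul_eq_mul, du_dot] at h0
    have h0 : X 0 + Complex.I * X 1 = 0 := by
      rcases mul_eq_zero.1 h0 with h | h
      · simp at h
      · exact h
    have h2 : ∀ j : Fin (k+1), X j.succ.succ = 0 := by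
      intro j
      by_cases hj : (j:ℕ) < p + 1
      · have := hM (Fin.succ ⟨j, hj⟩)
        simp only [Function.comp, sIdx_succ, NA, vc_ss, single_one_dotProduct] at this
        exact this
      · exact hX _ (by simp; omega)
    rw [dot3] at hv
    simp only [h2, mul_zero, Finset.sum_const_zero, add_zero, PhiA, linX, vc_0, vc_1] at hv
    have e1 : X 0 = - Complex.I * X 1 := by linear_combination h0
    have hu : AA p z 0 ≠ 0 := by simp only [AA, vc_0]; exact Complex.exp_ne_zero _
    have h1 : X 1 = 0 := by
      rw [e1] at hv
      have hI : Complex.I ≠ 0 := Complex.I_ne_zero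
      have : AA p z 0 * X 1 = 0 := by
        field_simp at hv
        have h2 := Complex.I_sq
        rw [h2] at hv
        linear_combination hv / 2
      exact (mul_eq_zero.1 this).resolve_left hu
    exact ext3 (by rw [e1, h1]; simp) h1 h2
  · intro z _ _ a j hj
    rw [Yc_zero_of_kills]
    · simp; positivity
    rw [mem_SIdx] at hj
    revert hj
    revert j
    apply forall3
    · intro h; exact absurd h (by simp)
    · intro _
      simp only [NA, vc_1]
      exact kills_model_of (by omega) 2 fun i hi => by simp only [dQ]; rw [if_pos hi]
    · intro j hj
      simp only [NA, vc_ss]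
      refine kills_model_of (by omega) 0 fun i hi => ?_
      have : i ≠ j.succ.succ := by
        rintro rfl
        apply hj
        refine ⟨?_, hi⟩
        intro h; have := congrArg Fin.val h; simp at this
      rw [Pi.single_eq_of_ne this]; simp


noncomputable def BB (p : ℕ) (β : ℂ) (z : Fin (k+3) → ℂ) : Fin (k+3) → ℂ :=
  Matrix.vecCons (1 + z 0) (Matrix.vecCons (β * z (0 : Fin (k+1)).succ.succ)
    (fun j => if j = 0 then 1 + z 1 else if (j:ℕ) < p + 1 then β * z j.succ.succ else z j.succ.succ))

noncomputable def PhiB (p : ℕ) (β : ℂ) (z : Fin (k+3) → ℂ) : Fin (k+3) → ℂ := linX (BB p β z)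

noncomputable def NB (k p : ℕ) (β : ℂ) : Fin (k+3) → Fin (k+3) → ℂ :=
  Matrix.vecCons du (Matrix.vecCons (Pi.single (0 : Fin (k+1)).succ.succ 1)
    (fun j => if j = 0 then β⁻¹ • dw else if (j:ℕ) < p + 1 then β⁻¹ • Pi.single j.succ.succ 1
      else Pi.single j.succ.succ 1))

noncomputable def cB (p : ℕ) (β : ℂ) (X : Fin (k+3) → ℂ) : Fin (k+3) → ℂ :=
  Matrix.vecCons (X 1) (Matrix.vecCons (2 * X (0 : Fin (k+1)).succ.succ)
    (fun j => if j = 0 then β * X 0 else if (j:ℕ) < p + 1 then 2 * β * X j.succ.succ else 0))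

lemma an_BB (β : ℂ) (z : Fin (k+3) → ℂ) : AnalyticAt ℂ (BB p β) z := by
  apply analyticAt3
  · simp only [BB, vc_0]; exact analyticAt_const.add (an_coord _ z)
  · simp only [BB, vc_1]; exact analyticAt_const.mul (an_coord _ z)
  · intro j
    simp only [BB, vc_ss]
    split_ifs
    · exact analyticAt_const.add (an_coord _ z)
    · exact analyticAt_const.mul (an_coord _ z)
    · exact an_coord _ z

lemma an_PhiB (β : ℂ) (z : Fin (k+3) → ℂ) : AnalyticAt ℂ (PhiB p β) z := an_linX (an_BB β z)

lemma NB_dual {β : ℂ} (hβ : β ≠ 0) (z : Fin (k+3) → ℂ) (j) (v : Fin (k+3) → ℂ) :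
    NB k p β j ⬝ᵥ fderiv ℂ (PhiB p β) z v = v j := by
  have hd := (an_PhiB (p := p) β z).differentiableAt
  have key : ∀ (c : ℂ) (i : Fin (k+3)), fderiv ℂ (fun z : Fin (k+3) → ℂ => c + z i) z v = v i := by
    intro c i
    rw [((hasFDerivAt_apply (𝕜 := ℂ) i z).const_add c).fderiv]; simp
  rw [dot_fderiv hd]
  revert j
  apply forall3
  · rw [← key 1]
    congr 2
    funext z
    simp only [NB, vc_0]
    rw [du_dot, Lx0, PhiB, Lx_linX]; rfl
  · rw [← key 1]
    congr 2
    funext z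
    simp only [NB, vc_1]
    rw [single_one_dotProduct]; rfl
  · intro j
    rw [← key 0]
    congr 2
    funext z
    simp only [NB, vc_ss, zero_add]
    split_ifs with h1 h2
    · subst h1
      rw [smul_dotProduct, dw_dot, Lx1, PhiB, Lx_linX]
      simp only [BB, vc_1, smul_eq_mul]
      field_simp
    · rw [smul_dotProduct, single_one_dotProduct]
      simp only [PhiB, linX, vc_ss, BB, smul_eq_mul, h1, h2, if_true, if_false]
      field_simp
    · rw [single_one_dotProduct]
      simp only [PhiB, linX, vc_ss, BB, h1, h2, if_false]

lemma zero_ne_ss (j : Fin (k+1)) : (0 : Fin (k+3)) ≠ j.succ.succ := (Fin.succ_ne_zero _).symm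
lemma one_ne_ss (j : Fin (k+1)) : (1 : Fin (k+3)) ≠ j.succ.succ := by
  intro h; have := congrArg Fin.val h; simp at this

lemma ss_mem (hpk : p ≤ k) (j : Fin (k+1)) (hj : (j:ℕ) < p + 1) : j.succ.succ ∈ SIdx hpk := by
  rw [mem_SIdx]
  exact ⟨(one_ne_ss j).symm, by simp only [Fin.val_succ]; omega⟩

lemma cB_sum {β : ℂ} (hβ : β ≠ 0) (X : Fin (k+3) → ℂ) :
    ∑ j, cB p β X j • NB k p β j = dQ p (linX X) := by
  rw [Fin.sum_univ_succ, Fin.sum_univ_succ, Fin.sum_univ_succ]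
  have e : ∀ j : Fin k, cB p β X j.succ.succ.succ • NB k p β j.succ.succ.succ
      = Pi.single j.succ.succ.succ (dQ p (linX X) j.succ.succ.succ) := by
    intro j
    simp only [cB, NB, vc_ss, Fin.succ_ne_zero, if_false, dQ, linX]
    by_cases h : (j.succ : ℕ) < p + 1
    · have h' : ((j.succ.succ.succ : Fin (k+3)) : ℕ) < p + 3 := by simp at h ⊢; omega
      rw [if_pos h, if_pos h, if_pos h', smul_smul, ← Pi.single_smul]
      congr 1
      simp only [smul_eq_mul, mul_one]
      field_simp
    · have h' : ¬ ((j.succ.succ.succ : Fin (k+3)) : ℕ) < p + 3 := by simp at h ⊢; omega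
      rw [if_neg h, if_neg h, if_neg h', zero_smul, Pi.single_zero]
  simp only [e]
  have h0 : cB p β X 0 • NB k p β 0 = X 1 • du := rfl
  have h1 : cB p β X (Fin.succ 0) • NB k p β (Fin.succ 0) = (2 * X (0 : Fin (k+1)).succ.succ) • Pi.single (0 : Fin (k+1)).succ.succ 1 := rfl
  have h2 : cB p β X (Fin.succ (Fin.succ 0)) • NB k p β (Fin.succ (Fin.succ 0)) = X 0 • dw := by
    simp only [cB, NB, vc_ss, if_true, smul_smul]
    congr 1; field_simp
  have h3 : (dQ p (linX X) (0 : Fin (k+1)).succ.succ) = 2 * X (0 : Fin (k+1)).succ.succ := by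
    simp only [dQ, linX, vc_ss]; rw [if_pos]; show 2 < p + 3; omega
  have hD : (2 * X (0 : Fin (k+1)).succ.succ) • (Pi.single (0 : Fin (k+1)).succ.succ 1 : Fin (k+3) → ℂ) +
      ∑ j : Fin k, Pi.single j.succ.succ.succ (dQ p (linX X) j.succ.succ.succ)
      = ∑ j : Fin (k+1), Pi.single j.succ.succ (dQ p (linX X) j.succ.succ) := by
    rw [Fin.sum_univ_succ, h3]
    congr 1
    rw [← Pi.single_smul]; simp
  have hre : ∀ a b c d : Fin (k+3) → ℂ, a + (b + (c + d)) = a + c + (b + d) := fun a b c d => by ring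
  rw [h0, h1, h2, hre, hD]
  have ds : ∀ i : Fin (k+1), (∑ j : Fin (k+1), (Pi.single j.succ.succ (dQ p (linX X) j.succ.succ) : Fin (k+3) → ℂ)) i.succ.succ
      = dQ p (linX X) i.succ.succ := by
    intro i
    simp only [Finset.sum_apply, Pi.single_apply, Fin.succ_inj, Finset.sum_ite_eq, Finset.mem_univ, if_true]
  have dd0 : (∑ j : Fin (k+1), (Pi.single j.succ.succ (dQ p (linX X) j.succ.succ) : Fin (k+3) → ℂ)) 0 = 0 := by
    simp only [Finset.sum_apply, Pi.single_apply, zero_ne_ss, if_false, Finset.sum_const_zero]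
  have dd1 : (∑ j : Fin (k+1), (Pi.single j.succ.succ (dQ p (linX X) j.succ.succ) : Fin (k+3) → ℂ)) 1 = 0 := by
    simp only [Finset.sum_apply, Pi.single_apply, one_ne_ss, if_false, Finset.sum_const_zero]
  apply ext3
  · rw [Pi.add_apply, dd0]
    simp [du, dw, dQ, linX]; ring
  · rw [Pi.add_apply, dd1]
    simp [du, dw, dQ, linX]; field_simp; rw [Complex.I_sq]; ring
  · intro j
    rw [Pi.add_apply, ds]
    simp only [du, dw, Pi.add_apply, Pi.smul_apply, Pi.sub_apply, Pi.single_apply, (zero_ne_ss j).symm, (one_ne_ss j).symm, if_false]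
    simp

lemma chartB (hpk : p ≤ k) {β : ℝ} (hβ : 0 < β) (hβ' : 36 * (p + 2) * β ≤ 1/600) :
    ∃ R μ : ℝ, 0 < R ∧ 0 < μ ∧ ∀ P : (Fin (k+3) → ℂ) → MultiVecC (k+3) (p+2),
      (∀ x ∈ closedBall (0 : Fin (k+3) → ℂ) R, AnalyticAt ℂ P x ∧ ‖P x - modelPiC (k+3) (p+2) x‖ ≤ μ) →
      HasChart P (PhiB p β 0) → ∃ G, ChartC (SIdx hpk) 3 (1/2) (1/600) P (PhiB p β) G := by
  have hβ0 : (β : ℂ) ≠ 0 := by exact_mod_cast hβ.ne'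
  have h1S : (1 : Fin (k+3)) ∈ (SIdx hpk)ᶜ := by rw [Finset.mem_compl, mem_SIdx]; simp
  have hpi : ∀ z, ‖bp (SIdx hpk)ᶜ z‖ ≤ 1/2 → om (modelPiC (k+3) (p+2) (PhiB p β z)) (NB k p β ∘ sIdx hpk) ≠ 0 := by
    intro z hz
    refine om_model_ne (by omega) fun X hX hv hM => ?_
    have hz1 := bp_le hz h1S
    have h0 := hM 0
    simp only [Function.comp, sIdx_zero, NB, vc_0, du_dot] at h0
    have h1 := hM (Fin.succ ⟨0, by omega⟩)
    have ez : (⟨0, by omega⟩ : Fin (k+1)) = 0 := rfl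
    simp only [Function.comp, sIdx_succ, NB, vc_ss, ez, if_true, smul_dotProduct, dw_dot, smul_eq_mul] at h1
    have h1 := (mul_eq_zero.1 h1).resolve_left (inv_ne_zero hβ0)
    have e0 : X 0 = 0 := by linear_combination (h0 + h1) / 2
    have e1 : X 1 = 0 := by
      have : Complex.I * X 1 = 0 := by linear_combination (h0 - h1) / 2
      exact (mul_eq_zero.1 this).resolve_left Complex.I_ne_zero
    have h2 : ∀ j : Fin (k+1), j ≠ 0 → X j.succ.succ = 0 := by
      intro j hj0
      by_cases hj : (j:ℕ) < p + 1
      · have := hM (Fin.succ ⟨j, hj⟩)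
        simp only [Function.comp, sIdx_succ, NB, vc_ss, Fin.eta, hj0, if_false, hj, if_true, smul_dotProduct, single_one_dotProduct, smul_eq_mul] at this
        exact (mul_eq_zero.1 this).resolve_left (inv_ne_zero hβ0)
      · exact hX _ (by simp; omega)
    have h3 : X (0 : Fin (k+1)).succ.succ = 0 := by
      rw [dot3, e0, e1, Fin.sum_univ_succ, Finset.sum_eq_zero (fun j _ => by rw [h2 _ (Fin.succ_ne_zero j), mul_zero])] at hv
      simp only [PhiB, linX, vc_ss, BB, if_true, mul_zero, zero_add, add_zero] at hv
      refine (mul_eq_zero.1 hv).resolve_left fun h => ?_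
      have : z 1 = -1 := by linear_combination h
      rw [this] at hz1; norm_num at hz1
    refine ext3 e0 e1 fun j => ?_
    by_cases hj : j = 0
    · rw [hj]; exact h3
    · exact h2 j hj
  refine chart_comb (by omega) (sIdx hpk) (SIdx hpk) rfl (sIdx_inj hpk) (by norm_num) (by norm_num) (by norm_num) (by norm_num)
    (PhiB p β) (fun _ => NB k p β) (an_PhiB _) (fun _ => analyticAt_const) (NB_dual hβ0) (fun z _ => hpi z) ?_
  intro z hz1 hz2 a j hj
  have hβ1 : β ≤ 1 := by nlinarith
  rw [mem_SIdx] at hj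
  by_cases hj1 : j = 1
  · subst hj1
    have hk : Kills (∑ j, cB p β (BB p β z) j • NB k p β j) (modelPiC (k+3) (p+2) (PhiB p β z)) := by
      rw [cB_sum hβ0]
      exact kills_model_of (by omega) 2 fun i hi => by simp only [dQ]; rw [if_pos hi]; rfl
    have h1 := Yc_of_kills (s := sIdx hpk) hk a
    have h2 : ∀ j, cB p β (BB p β z) j * Yc (modelPiC (k+3) (p+2) (PhiB p β z)) (NB k p β) (sIdx hpk) a j
       = (if j = 1 then 2 * (1 + z 1) * Yc (modelPiC (k+3) (p+2) (PhiB p β z)) (NB k p β) (sIdx hpk) a 1 else 0) +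
         (if j = sIdx hpk a then cB p β (BB p β z) (sIdx hpk a) else 0) := by
      intro j
      by_cases hS : j ∈ SIdx hpk
      · have hj1 := ((mem_SIdx hpk j).1 hS).1
        rw [if_neg hj1]
        simp only [SIdx, Finset.mem_image, Finset.mem_univ, true_and] at hS
        obtain ⟨b, rfl⟩ := hS
        rw [Yc_base (hpi z hz2)]
        by_cases hb : b = a
        · subst hb; simp
        · rw [if_neg hb, if_neg (fun h => hb (sIdx_inj hpk h))]; simp
      · have : j ≠ sIdx hpk a := by rintro rfl; exact hS (by simp [SIdx])
        rw [if_neg this]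
        rw [mem_SIdx] at hS
        by_cases hj1 : j = 1
        · subst hj1; simp [cB, BB, vc_1, vc_ss]
        · rw [if_neg hj1]
          have hj3 : ¬ (j:ℕ) < p + 3 := fun h => hS ⟨hj1, h⟩
          have : cB p β (BB p β z) j = 0 := by
            revert hj3 hj1
            clear this hS hj
            revert j
            apply forall3
            · intro _ h; simp at h
            · intro h; exact absurd rfl h
            · intro j _ h
              have h' : ¬ (j:ℕ) < p + 1 := by simp at h; omega
              have h0 : j ≠ 0 := by rintro rfl; simp at h'
              simp only [cB, vc_ss, h', h0, if_false]
          rw [this]; simp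
    rw [Finset.sum_congr rfl (fun j _ => h2 j), Finset.sum_add_distrib, Finset.sum_ite_eq' Finset.univ (1 : Fin (k+3)), Finset.sum_ite_eq' Finset.univ (sIdx hpk a)] at h1
    simp only [Finset.mem_univ, if_true] at h1
    set y := Yc (modelPiC (k+3) (p+2) (PhiB p β z)) (NB k p β) (sIdx hpk) a 1
    have hz11 := bp_le hz2 h1S
    have hn : 1 / 2 ≤ ‖1 + z 1‖ := by
      have := norm_sub_le_norm_add (1:ℂ) (z 1)
      rw [norm_one] at this; linarith
    have hS' : ∀ i ∈ SIdx hpk, ‖z i‖ ≤ 9 := fun i hi => (bp_le hz1 hi).trans (by norm_num)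
    have hc : ‖cB p β (BB p β z) (sIdx hpk a)‖ ≤ 18 * β := by
      have nb : ‖(β:ℂ)‖ = β := by simp [abs_of_pos hβ]
      refine Fin.cases ?_ (fun b => ?_) a
      · rw [sIdx_zero]
        simp only [cB, BB, vc_0, vc_1]
        have := hS' (0 : Fin (k+1)).succ.succ (ss_mem hpk _ (by simp))
        rw [norm_mul, nb]; nlinarith
      · rw [sIdx_succ]
        simp only [cB, BB, vc_ss, vc_0]
        split_ifs with hb hb2
        · have h0 := hS' 0 (by rw [mem_SIdx]; simp)
          have := norm_add_le (1:ℂ) (z 0)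
          rw [norm_one] at this
          rw [norm_mul, nb]; nlinarith
        · have h0 := hS' ((⟨b, by omega⟩ : Fin (k+1)).succ.succ) (ss_mem hpk _ hb2)
          rw [norm_mul, norm_mul, norm_mul, nb]
          set y := ‖z ((⟨b, by omega⟩ : Fin (k+1)).succ.succ)‖
          have hy : 0 ≤ y := norm_nonneg _
          have h2 : ‖(2:ℂ)‖ = 2 := by simp
          rw [h2]
          nlinarith [mul_nonneg hβ.le hy, mul_le_mul hβ1 h0 hy zero_le_one]
        · simp; positivity
    have e : 2 * (1 + z 1) * y = - cB p β (BB p β z) (sIdx hpk a) := by linear_combination h1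
    have e2 := congrArg norm e
    rw [norm_mul, norm_mul, norm_neg] at e2
    norm_num at e2
    have hy : ‖y‖ ≤ 18 * β := by nlinarith [norm_nonneg y]
    push_cast
    have : ((p:ℝ) + 2) * ‖y‖ ≤ (p + 2) * (18 * β) := by gcongr
    linarith
  · rw [Yc_zero_of_kills]
    · norm_num
    have hj3 : ¬ (j:ℕ) < p + 3 := fun h => hj ⟨hj1, h⟩
    clear hj
    revert j
    apply forall3
    · intro _ h; simp at h
    · intro h; exact absurd rfl h
    · intro j _ h
      have h' : ¬ (j:ℕ) < p + 1 := by simp at h; omega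
      have h0 : j ≠ 0 := by rintro rfl; simp at h'
      simp only [NB, vc_ss, h', h0, if_false]
      refine kills_model_of (by omega) 0 fun i hi => ?_
      have : i ≠ j.succ.succ := by
        rintro rfl
        exact h hi
      rw [Pi.single_eq_of_ne this]; simp

end ChartAB
section Hart

lemma kills_prop {n q : ℕ} {P : (Fin n → ℂ) → MultiVecC n q} {F : (Fin n → ℂ) → (Fin n → ℂ)}
    {D : Set (Fin n → ℂ)} (hD : IsPreconnected D) (hP : AnalyticOnNhd ℂ P D) (hF : AnalyticOnNhd ℂ F D)
    {x₀ : Fin n → ℂ} (hx₀ : x₀ ∈ D) (h : ∀ᶠ x in 𝓝 x₀, ∀ a, Kills (jacC F x a) (P x)) :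
    ∀ x ∈ D, ∀ a, Kills (jacC F x a) (P x) := by
  intro x hx a
  rw [kills_iff]
  intro M b
  have han : AnalyticOnNhd ℂ (fun x => om (P x) (Function.update M b (jacC F x a))) D := by
    intro y hy
    refine om_analytic (hP y hy) fun c i => ?_
    by_cases hc : c = b
    · subst hc
      simp only [Function.update_self, jacC, Matrix.of_apply]
      have h1 := (hF.fderiv y hy)
      have h2 : AnalyticAt ℂ (fun x => fderiv ℂ F x (Pi.single i 1)) y :=
        ((ContinuousLinearMap.apply ℂ (Fin n → ℂ) (Pi.single i (1:ℂ) : Fin n → ℂ)).analyticAt _).comp h1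
      exact analyticAt_pi_iff.1 h2 a
    · simp only [Function.update_of_ne hc]
      exact analyticAt_const
  have := han.eqOn_of_preconnected_of_eventuallyEq (g := fun _ => 0) (fun y _ => analyticAt_const) hD hx₀
    (by filter_upwards [h] with x hx; exact kills_iff.1 (hx a) M b)
  exact this hx

variable {E : Type*} [NormedAddCommGroup E] [NormedSpace ℂ E] [CompleteSpace E]

noncomputable def Ck (ζ : ℂ) (θ : ℝ) : ℂ := Complex.exp (Complex.I * θ) / (Complex.exp (Complex.I * θ) - ζ)

noncomputable def Cav (h : ℝ → E) (ζ : ℂ) : E := (2 * (π:ℂ))⁻¹ • ∫ θ in (0:ℝ)..2 * π, Ck ζ θ • h θ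

lemma norm_eI (θ : ℝ) : ‖Complex.exp (Complex.I * θ)‖ = 1 := by
  rw [mul_comm]; exact Complex.norm_exp_ofReal_mul_I θ

lemma eI_sub_ne {ζ : ℂ} (hζ : ‖ζ‖ < 1) (θ : ℝ) : Complex.exp (Complex.I * θ) - ζ ≠ 0 := by
  intro h
  have : ζ = Complex.exp (Complex.I * θ) := by linear_combination -h
  rw [this, norm_eI] at hζ; exact lt_irrefl _ hζ

lemma cav_cauchy {f : ℂ → E} (hf : DifferentiableOn ℂ f (closedBall 0 1)) {ζ : ℂ} (hζ : ‖ζ‖ < 1) :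
    Cav (fun θ => f (Complex.exp (Complex.I * θ))) ζ = f ζ := by
  have h := hf.circleIntegral_sub_inv_smul (w := ζ) (by simpa using hζ)
  rw [circleIntegral] at h
  have e : ∀ θ : ℝ, deriv (circleMap 0 1) θ • (circleMap 0 1 θ - ζ)⁻¹ • f (circleMap 0 1 θ)
      = Complex.I • (Ck ζ θ • f (Complex.exp (Complex.I * θ))) := by
    intro θ
    rw [deriv_circleMap]
    have : circleMap 0 1 θ = Complex.exp (Complex.I * θ) := by simp [circleMap, mul_comm]
    rw [this, smul_smul, smul_smul, Ck]
    congr 1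
    rw [div_eq_mul_inv]; ring
  simp only [e] at h
  rw [intervalIntegral.integral_smul] at h
  have h2 : (∫ θ in (0:ℝ)..2 * π, Ck ζ θ • f (Complex.exp (Complex.I * θ))) = (2 * (π:ℂ)) • f ζ := by
    have := congrArg (fun v => (Complex.I)⁻¹ • v) h
    simp only [smul_smul] at this
    rw [inv_mul_cancel₀ Complex.I_ne_zero, one_smul] at this
    rw [this]; congr 1
    field_simp
  rw [Cav, h2, smul_smul, inv_mul_cancel₀, one_smul]
  exact_mod_cast Real.two_pi_pos.ne'

lemma Ck_cont {ζ : ℂ} (hζ : ‖ζ‖ < 1) : Continuous (Ck ζ) := by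
  unfold Ck
  exact Continuous.div (by fun_prop) (by fun_prop) (eI_sub_ne hζ)

lemma cav_bound {h h' : ℝ → E} {ζ : ℂ} (hζ : ‖ζ‖ ≤ 1/2) {c : ℝ} (hc : ∀ θ ∈ Icc 0 (2 * π), ‖h θ - h' θ‖ ≤ c)
    (h1 : ContinuousOn h (Icc 0 (2 * π))) (h2 : ContinuousOn h' (Icc 0 (2 * π))) :
    ‖Cav h ζ - Cav h' ζ‖ ≤ 2 * c := by
  have hζ1 : ‖ζ‖ < 1 := by linarith
  have hpos := Real.two_pi_pos
  have i1 : IntervalIntegrable (fun θ => Ck ζ θ • h θ) volume 0 (2 * π) := by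
    apply ContinuousOn.intervalIntegrable
    rw [uIcc_of_le hpos.le]
    exact (Ck_cont hζ1).continuousOn.smul h1
  have i2 : IntervalIntegrable (fun θ => Ck ζ θ • h' θ) volume 0 (2 * π) := by
    apply ContinuousOn.intervalIntegrable
    rw [uIcc_of_le hpos.le]
    exact (Ck_cont hζ1).continuousOn.smul h2
  rw [Cav, Cav, ← smul_sub, ← intervalIntegral.integral_sub i1 i2, norm_smul]
  have hn : ‖(2 * (π:ℂ))⁻¹‖ = (2 * π)⁻¹ := by
    rw [norm_inv, norm_mul]; simp [abs_of_pos Real.pi_pos]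
  have : ‖∫ θ in (0:ℝ)..2 * π, (Ck ζ θ • h θ - Ck ζ θ • h' θ)‖ ≤ (2 * c) * |2 * π - 0| := by
    apply intervalIntegral.norm_integral_le_of_norm_le_const
    intro θ hθ
    rw [uIoc_of_le hpos.le] at hθ
    rw [← smul_sub, norm_smul]
    have hk : ‖Ck ζ θ‖ ≤ 2 := by
      rw [Ck, norm_div, norm_eI, div_le_iff₀ (norm_pos_iff.2 (eI_sub_ne hζ1 θ))]
      have := norm_sub_norm_le (Complex.exp (Complex.I * θ)) ζ
      rw [norm_eI] at this; linarith
    exact mul_le_mul hk (hc θ ⟨hθ.1.le, hθ.2⟩) (norm_nonneg _) (by norm_num)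
  rw [hn, sub_zero, abs_of_pos hpos] at *
  calc _ ≤ (2 * π)⁻¹ * (2 * c * (2 * π)) := by gcongr
    _ = 2 * c := by field_simp

lemma cav_analytic {X : Type*} [NormedAddCommGroup X] [NormedSpace ℂ X] [FiniteDimensional ℂ X]
    {U : Set X} (hU : IsOpen U) {ζ : X → ℂ} (hζ : AnalyticOnNhd ℂ ζ U) (hζ1 : ∀ x ∈ U, ‖ζ x‖ < 1)
    {h : X → ℝ → E} (hc : ContinuousOn (fun p : X × ℝ => h p.1 p.2) (U ×ˢ Icc 0 (2 * π)))
    (ha : ∀ τ ∈ Icc 0 (2 * π), AnalyticOnNhd ℂ (fun x => h x τ) U) :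
    AnalyticOnNhd ℂ (fun x => Cav (h x) (ζ x)) U := by
  unfold Cav
  refine AnalyticOnNhd.smul (fun x _ => analyticAt_const) ?_
  apply analytic_integral Real.two_pi_pos.le hU
  · refine ContinuousOn.smul ?_ hc
    unfold Ck
    refine ContinuousOn.div (by fun_prop) (ContinuousOn.sub (by fun_prop) ?_) ?_
    · exact hζ.continuousOn.comp continuousOn_fst (fun p hp => hp.1)
    · intro p hp; exact eI_sub_ne (hζ1 _ hp.1) _
  · intro τ hτ x hx
    unfold Ck
    exact AnalyticAt.smul (analyticAt_const.div (analyticAt_const.sub (hζ x hx)) (eI_sub_ne (hζ1 x hx) τ)) (ha τ hτ x hx)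

end Hart
section FI
variable {k p : ℕ}

def PD (T : Set ℂ) (c : Fin (k+3) → ℂ) (r : Fin (k+3) → ℝ) : Set (Fin (k+3) → ℂ) :=
  {X | X 0 ∈ T ∧ ∀ i, i ≠ 0 → X i ∈ ball (c i) (r i)}

lemma PD_eq (T : Set ℂ) (c : Fin (k+3) → ℂ) (r : Fin (k+3) → ℝ) :
    PD T c r = Set.pi univ (fun i => if i = 0 then T else ball (c i) (r i)) := by
  ext X
  simp only [PD, mem_ofPred_eq, Set.mem_pi, mem_univ, true_imp_iff]
  constructor
  · rintro ⟨h0, h⟩ i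
    by_cases hi : i = 0
    · subst hi; simpa using h0
    · rw [if_neg hi]; exact h i hi
  · intro h
    refine ⟨by simpa using h 0, fun i hi => ?_⟩
    have := h i; rwa [if_neg hi] at this

lemma PD_open {T : Set ℂ} (hT : IsOpen T) (c : Fin (k+3) → ℂ) (r : Fin (k+3) → ℝ) : IsOpen (PD T c r) := by
  rw [PD_eq]
  refine isOpen_set_pi finite_univ fun i _ => ?_
  split_ifs
  · exact hT
  · exact isOpen_ball

lemma PD_conv {T : Set ℂ} (hT : Convex ℝ T) (c : Fin (k+3) → ℂ) (r : Fin (k+3) → ℝ) : Convex ℝ (PD T c r) := by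
  rw [PD_eq]
  refine convex_pi fun i _ => ?_
  split_ifs
  · exact hT
  · exact convex_ball _ _

def Strip : Set ℂ := {ζ | |ζ.re| < 8 ∧ |ζ.im| < 1/2}

lemma Strip_open : IsOpen Strip :=
  (isOpen_lt (f := fun ζ : ℂ => |ζ.re|) (g := fun _ => 8) (by fun_prop) (by fun_prop)).inter
    (isOpen_lt (f := fun ζ : ℂ => |ζ.im|) (g := fun _ => 1/2) (by fun_prop) (by fun_prop))

lemma Strip_conv : Convex ℝ Strip := by
  have : Strip = (Complex.reLm ⁻¹' (Ioo (-8) 8)) ∩ (Complex.imLm ⁻¹' (Ioo (-(1/2)) (1/2))) := by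
    ext ζ; simp [Strip, abs_lt]
  rw [this]
  exact ((convex_Ioo _ _).linear_preimage _).inter ((convex_Ioo _ _).linear_preimage _)

lemma Strip_norm {ζ : ℂ} (h : ζ ∈ Strip) : ‖ζ‖ < 10 := by
  have := Complex.norm_le_abs_re_add_abs_im ζ
  have h1 := h.1; have h2 := h.2
  linarith

lemma Strip_exp {ζ : ℂ} (h : ζ ∈ Strip) : ‖Complex.exp (Complex.I * ζ)‖ < 2 := by
  rw [Complex.norm_exp]
  have h2 := (abs_lt.1 h.2).1
  have : (Complex.I * ζ).re = - ζ.im := by simp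
  rw [this]
  calc Real.exp (- ζ.im) ≤ Real.exp (1/2) := Real.exp_le_exp.2 (by linarith)
    _ < 2 := by
      have h3 : Real.exp (1/2) ^ 2 = Real.exp 1 := by rw [← Real.exp_nat_mul]; norm_num
      have h4 := Real.exp_one_lt_d9
      nlinarith [Real.exp_pos (1/2)]


noncomputable def XiA (p : ℕ) (Y : Fin (k+3) → ℂ) : Fin (k+3) → ℂ :=
  Matrix.vecCons (Y 0) (Matrix.vecCons (Complex.exp (Complex.I * Y 0) * Y 1 + T2 p Y - 1)
    (fun j => Y j.succ.succ - if j = 0 then 1 else 0))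

lemma AA_XiA (Y : Fin (k+3) → ℂ) : AA p (XiA p Y) = Function.update Y 0 (Complex.exp (Complex.I * Y 0)) := by
  have hs : ∀ j, sh2 (XiA p Y) j = Y j.succ.succ := by intro j; simp [sh2, XiA, vc_ss]
  apply ext3
  · simp [AA, XiA]
  · rw [Function.update_of_ne (show (1 : Fin (k+3)) ≠ 0 by simp)]
    simp only [AA, vc_1]
    rw [T2_congr (y := Y) (fun j => by rw [vc_ss]; exact hs j)]
    simp only [XiA, vc_1, vc_0]
    have : Complex.exp (Complex.I * Y 0) * Complex.exp (-(Complex.I * Y 0)) = 1 := by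
      rw [← Complex.exp_add]; simp
    linear_combination Y 1 * this
  · intro j
    rw [Function.update_of_ne (zero_ne_ss j).symm]
    simp only [AA, vc_ss]; exact hs j

lemma an_XiA (Y : Fin (k+3) → ℂ) : AnalyticAt ℂ (XiA p) Y := by
  apply analyticAt3
  · simp only [XiA, vc_0]; exact an_coord _ _
  · simp only [XiA, vc_1]
    exact (((analyticAt_const.mul (an_coord _ _)).cexp.mul (an_coord _ _)).add (an_T2 fun i => an_coord _ _)).sub analyticAt_const
  · intro j; simp only [XiA, vc_ss]; exact (an_coord _ _).sub analyticAt_const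

lemma T2_bound {X : Fin (k+3) → ℂ} (hX : ∀ j : Fin (k+1), ‖X j.succ.succ‖ ≤ 2) : ‖T2 p X‖ ≤ 4 * (k + 1) := by
  unfold T2
  refine (norm_sum_le _ _).trans ?_
  have : ∀ j ∈ (Finset.univ : Finset (Fin (k+1))), ‖if (j:ℕ) < p + 1 then X j.succ.succ ^ 2 else 0‖ ≤ (4:ℝ) := by
    intro j _
    split_ifs
    · rw [norm_pow]; nlinarith [hX j, norm_nonneg (X j.succ.succ)]
    · simp
  refine (Finset.sum_le_card_nsmul _ _ _ this).trans ?_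
  simp; linarith

lemma XiA_bounds (hpk : p ≤ k) {Y : Fin (k+3) → ℂ} (h : Y ∈ PD (k := k) Strip 0 (fun _ => 2)) :
    ‖bp (SIdx hpk) (XiA p Y)‖ < 10 ∧ ‖bp (SIdx hpk)ᶜ (XiA p Y)‖ < (1000 + 10 * k) / 2 := by
  have hk : (0:ℝ) ≤ k := by positivity
  have h2 : ∀ i, i ≠ 0 → ‖Y i‖ < 2 := fun i hi => by simpa using h.2 i hi
  have hss : ∀ j : Fin (k+1), ‖XiA p Y j.succ.succ‖ < 10 := by
    intro j
    simp only [XiA, vc_ss]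
    have := norm_sub_le (Y j.succ.succ) (if j = 0 then 1 else 0)
    have h3 : ‖(if j = 0 then 1 else 0 : ℂ)‖ ≤ 1 := by split_ifs <;> simp
    linarith [h2 j.succ.succ (zero_ne_ss j).symm]
  have h0 : ‖XiA p Y 0‖ < 10 := Strip_norm h.1
  constructor
  · refine bp_lt (by norm_num) ?_
    apply forall3
    · intro _; exact h0
    · intro h; exact absurd rfl ((mem_SIdx hpk _).1 h).1
    · intro j _; exact hss j
  · refine bp_lt (by positivity) ?_
    apply forall3
    · intro _; linarith
    · intro _
      simp only [XiA, vc_1]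
      have h3 := T2_bound (p := p) (X := Y) (fun j => (h2 _ (zero_ne_ss j).symm).le)
      have h4 := Strip_exp h.1
      have h5 := norm_sub_le (Complex.exp (Complex.I * Y 0) * Y 1 + T2 p Y) 1
      have h6 := norm_add_le (Complex.exp (Complex.I * Y 0) * Y 1) (T2 p Y)
      rw [norm_mul] at h6
      rw [norm_one] at h5
      have h7 := h2 1 (by simp)
      nlinarith [norm_nonneg (Y 1), norm_nonneg (Complex.exp (Complex.I * Y 0))]
    · intro j _; linarith [hss j]

noncomputable def XiB (p : ℕ) (β : ℂ) (X : Fin (k+3) → ℂ) : Fin (k+3) → ℂ :=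
  Matrix.vecCons (X 0 - 1) (Matrix.vecCons (X (0 : Fin (k+1)).succ.succ - 1)
    (fun j => if j = 0 then X 1 / β else if (j:ℕ) < p + 1 then X j.succ.succ / β else X j.succ.succ))

lemma BB_XiB {β : ℂ} (hβ : β ≠ 0) (X : Fin (k+3) → ℂ) : BB p β (XiB p β X) = X := by
  apply ext3
  · simp only [BB, XiB, vc_0]; ring
  · simp only [BB, XiB, vc_1, vc_ss, if_true]; field_simp
  · intro j
    simp only [BB, XiB, vc_ss, vc_1]
    split_ifs with h1 h2
    · rw [h1]; ring
    · field_simp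
    · rfl

lemma an_XiB (β : ℂ) (Y : Fin (k+3) → ℂ) : AnalyticAt ℂ (XiB p β) Y := by
  apply analyticAt3
  · simp only [XiB, vc_0]; exact (an_coord _ _).sub analyticAt_const
  · simp only [XiB, vc_1]; exact (an_coord _ _).sub analyticAt_const
  · intro j; simp only [XiB, vc_ss]
    split_ifs
    · exact (an_coord _ _).div_const
    · exact (an_coord _ _).div_const
    · exact an_coord _ _

noncomputable def KB (p : ℕ) (v : Fin (k+3) → ℂ) : Fin (k+3) → ℂ :=
  Matrix.vecCons 0 (Matrix.vecCons ((1 + v 1) ^ 2 - 1)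
    (fun j => if j = 0 then v 1 else if (j:ℕ) < p + 1 then 0 else v j.succ.succ))

lemma an_KB (Y : Fin (k+3) → ℂ) : AnalyticAt ℂ (KB p) Y := by
  apply analyticAt3
  · simp only [KB, vc_0]; exact analyticAt_const
  · simp only [KB, vc_1]; exact ((analyticAt_const.add (an_coord _ _)).pow 2).sub analyticAt_const
  · intro j; simp only [KB, vc_ss]
    split_ifs
    · exact an_coord _ _
    · exact analyticAt_const
    · exact an_coord _ _

lemma K_fib (hpk : p ≤ k) (β : ℂ) {v : Fin (k+3) → ℂ} (hv : bp (SIdx hpk) v = 0) :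
    v 0 = 0 ∧ XiA p (Function.update (BB p β v) 0 0) = KB p v := by
  have h : ∀ i ∈ SIdx hpk, v i = 0 := by
    intro i hi
    have := congrFun hv i
    rwa [bp_apply, if_pos hi] at this
  have h0 : v 0 = 0 := h 0 (by rw [mem_SIdx]; simp)
  have hs : ∀ j : Fin (k+1), (j:ℕ) < p + 1 → v j.succ.succ = 0 := fun j hj => h _ (ss_mem hpk j hj)
  have hT : T2 p (Function.update (BB p β v) 0 0) = (1 + v 1) ^ 2 := by
    unfold T2
    rw [Fin.sum_univ_succ, Finset.sum_eq_zero, add_zero]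
    · rw [if_pos (by simp), Function.update_of_ne (zero_ne_ss _).symm]
      simp only [BB, vc_ss, if_true]
    · intro j _
      split_ifs with hj
      · rw [Function.update_of_ne (zero_ne_ss _).symm]
        simp only [BB, vc_ss, Fin.succ_ne_zero, if_false, hj, if_true, hs _ hj]
        simp
      · rfl
  refine ⟨h0, ext3 ?_ ?_ fun j => ?_⟩
  · simp [XiA, KB]
  · simp only [XiA, vc_1, KB, hT]
    rw [Function.update_of_ne (show (1 : Fin (k+3)) ≠ 0 by simp)]
    simp only [BB, vc_1, hs 0 (by simp)]
    simp
  · simp only [XiA, vc_ss, KB]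
    rw [Function.update_of_ne (zero_ne_ss _).symm]
    simp only [BB, vc_ss]
    split_ifs with h1 h2
    · ring
    · rw [hs _ h2]; simp
    · simp

noncomputable def cN (k : ℕ) : Fin (k+3) → ℂ := Matrix.vecCons 1 (Matrix.vecCons 0 (fun j => if j = 0 then 1 else 0))
noncomputable def rN (k p : ℕ) (β : ℝ) : Fin (k+3) → ℝ :=
  Matrix.vecCons 1 (Matrix.vecCons (3 * β) (fun j => if j = 0 then 1/4 else if (j:ℕ) < p + 1 then 3 * β else 1/4))

lemma XiA_cN : XiA p (Function.update (cN k) 0 0) = 0 := by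
  have hT : T2 p (Function.update (cN k) 0 0) = 1 := by
    unfold T2
    rw [Fin.sum_univ_succ, Finset.sum_eq_zero, add_zero]
    · rw [if_pos (by simp), Function.update_of_ne (zero_ne_ss _).symm]
      simp [cN, vc_ss]
    · intro j _
      rw [Function.update_of_ne (zero_ne_ss _).symm]
      simp [cN, vc_ss]
  apply ext3
  · simp [XiA]
  · simp only [XiA, vc_1, hT]; rw [Function.update_of_ne (show (1 : Fin (k+3)) ≠ 0 by simp)]; simp [cN]
  · intro j
    simp only [XiA, vc_ss]; rw [Function.update_of_ne (zero_ne_ss _).symm]; simp [cN, vc_ss]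

lemma AA_zero : AA p (0 : Fin (k+3) → ℂ) = cN k := by
  rw [← XiA_cN (p := p), AA_XiA]
  simp
  simp [cN]

lemma BB_zero (β : ℂ) : BB p β (0 : Fin (k+3) → ℂ) = cN k := by
  apply ext3
  · simp [BB, cN]
  · simp [BB, cN]
  · intro j; simp [BB, cN, vc_ss]

lemma XiB_cN {β : ℂ} : XiB p β (cN k) = 0 := by
  apply ext3
  · simp [XiB, cN]
  · simp only [XiB, cN, vc_1, vc_ss]; simp
  · intro j; simp only [XiB, vc_ss, cN, vc_1]; split_ifs <;> simp

lemma XiB_bounds (hpk : p ≤ k) {β : ℝ} (hβ : 0 < β) {X : Fin (k+3) → ℂ} (h : X ∈ PD (ball 1 3) (cN k) (rN k p β)) :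
    ‖bp (SIdx hpk) (XiB p β X)‖ < 3 ∧ ‖bp (SIdx hpk)ᶜ (XiB p β X)‖ < (1/2)/2 := by
  have nb : ‖(β:ℂ)‖ = β := by simp [abs_of_pos hβ]
  have h0 : ‖X 0 - 1‖ < 3 := by simpa [dist_eq_norm] using h.1
  have h1 : ‖X 1‖ < 3 * β := by simpa [dist_eq_norm, cN, rN] using h.2 1 (by simp)
  have h2 : ‖X (0 : Fin (k+1)).succ.succ - 1‖ < 1/4 := by
    have := h.2 (0 : Fin (k+1)).succ.succ (zero_ne_ss _).symm
    simp only [cN, rN, vc_ss, if_true, mem_ball, dist_eq_norm] at this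
    exact this
  have h3 : ∀ j : Fin (k+1), j ≠ 0 → ‖X j.succ.succ‖ < if (j:ℕ) < p + 1 then 3 * β else 1/4 := by
    intro j hj
    have := h.2 j.succ.succ (zero_ne_ss _).symm
    simp only [cN, rN, vc_ss, hj, if_false, mem_ball, dist_eq_norm, sub_zero] at this
    exact this
  constructor
  · refine bp_lt (by norm_num) ?_
    apply forall3
    · intro _; exact h0
    · intro h; exact absurd rfl ((mem_SIdx hpk _).1 h).1
    · intro j hj
      have hj' : (j:ℕ) < p + 1 := by have := ((mem_SIdx hpk _).1 hj).2; simp at this; omega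
      simp only [XiB, vc_ss, hj', if_true]
      split_ifs with h
      · rw [norm_div, nb, div_lt_iff₀ hβ]; exact h1
      · have := h3 j h
        rw [if_pos hj'] at this
        rw [norm_div, nb, div_lt_iff₀ hβ]; exact this
  · refine bp_lt (by norm_num) ?_
    apply forall3
    · intro h; rw [Finset.mem_compl, mem_SIdx] at h; exact absurd ⟨by simp, by simp⟩ h
    · intro _; simp only [XiB, vc_1]; linarith
    · intro j hj
      rw [Finset.mem_compl] at hj
      have hj' : ¬ (j:ℕ) < p + 1 := fun h => hj (ss_mem hpk j h)
      have hj0 : j ≠ 0 := by rintro rfl; simp at hj'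
      have := h3 j hj0
      simp only [XiB, vc_ss, hj', hj0, if_false] at this ⊢
      linarith

lemma KB_bounds (hpk : p ≤ k) {v : Fin (k+3) → ℂ} (hv : ‖v‖ < 1) :
    ‖bp (SIdx hpk) (KB p v)‖ < 10 ∧ ‖bp (SIdx hpk)ᶜ (KB p v)‖ < (1000 + 10 * k) / 2 := by
  have hk : (0:ℝ) ≤ k := by positivity
  have hi : ∀ i, ‖v i‖ < 1 := fun i => (norm_le_pi_norm v i).trans_lt hv
  have : ‖KB p v‖ < 10 := by
    rw [pi_norm_lt_iff (by norm_num)]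
    apply forall3
    · simp [KB]
    · simp only [KB, vc_1]
      have e : (1 + v 1) ^ 2 - 1 = v 1 * (2 + v 1) := by ring
      rw [e, norm_mul]
      have h1 := norm_add_le 2 (v 1)
      have h2 : ‖(2:ℂ)‖ = 2 := by simp
      nlinarith [hi 1, norm_nonneg (v 1), norm_nonneg (2 + v 1)]
    · intro j
      simp only [KB, vc_ss]
      split_ifs
      · linarith [hi 1]
      · simp
      · linarith [hi j.succ.succ]
  exact ⟨(bp_norm _ _).trans_lt this, ((bp_norm _ _).trans_lt this).trans_le (by linarith)⟩

end FI
section FI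
variable {k p : ℕ}

noncomputable def F0 (p : ℕ) (x : Fin (k+3) → ℂ) : Fin (k+3) → ℂ :=
  Matrix.vecCons 0 (Matrix.vecCons (Q2 p x) (fun j => if (j:ℕ) < p + 1 then 0 else x j.succ.succ))

/-- the model first integrals in the coordinates X -/
noncomputable def F0X (p : ℕ) (X : Fin (k+3) → ℂ) : Fin (k+3) → ℂ :=
  Matrix.vecCons 0 (Matrix.vecCons (X 0 * X 1 + T2 p X - 1) (fun j => if (j:ℕ) < p + 1 then 0 else X j.succ.succ))

lemma an_F0X (X : Fin (k+3) → ℂ) : AnalyticAt ℂ (F0X p) X := by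
  apply analyticAt3
  · simp only [F0X, vc_0]; exact analyticAt_const
  · simp only [F0X, vc_1]
    exact (((an_coord _ _).mul (an_coord _ _)).add (an_T2 fun i => an_coord _ _)).sub analyticAt_const
  · intro j; simp only [F0X, vc_ss]
    split_ifs
    · exact analyticAt_const
    · exact an_coord _ _

lemma F0X_XiA (hpk : p ≤ k) (Y : Fin (k+3) → ℂ) :
    bp (SIdx hpk)ᶜ (XiA p Y) = F0X p (Function.update Y 0 (Complex.exp (Complex.I * Y 0))) := by
  apply ext3
  · rw [bp_apply, if_neg]; · rfl
    rw [Finset.mem_compl, mem_SIdx]; simp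
  · rw [bp_apply, if_pos]
    · simp only [XiA, F0X, vc_1, Function.update_self]
      rw [Function.update_of_ne (show (1 : Fin (k+3)) ≠ 0 by simp)]
      congr 2
    · rw [Finset.mem_compl, mem_SIdx]; simp
  · intro j
    rw [bp_apply]
    simp only [F0X, vc_ss, XiA]
    rw [Function.update_of_ne (zero_ne_ss j).symm]
    by_cases hj : (j:ℕ) < p + 1
    · rw [if_neg, if_pos hj]
      rw [Finset.mem_compl, not_not]; exact ss_mem hpk j hj
    · have h0 : j ≠ 0 := by rintro rfl; simp at hj
      rw [if_pos, if_neg hj, if_neg h0, sub_zero]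
      rw [Finset.mem_compl, mem_SIdx]
      simp only [Fin.val_succ]
      omega

lemma an_upd {n : ℕ} (i : Fin n) {f : (Fin n → ℂ) → ℂ} {x : Fin n → ℂ} (hf : AnalyticAt ℂ f x) :
    AnalyticAt ℂ (fun z : Fin n → ℂ => Function.update z i (f z)) x := by
  refine analyticAt_pi_iff.2 fun j => ?_
  by_cases h : j = i
  · subst h; simpa using hf
  · simp only [Function.update_of_ne h]; exact an_coord j x

lemma PD_upd {T T' : Set ℂ} {c : Fin (k+3) → ℂ} {r : Fin (k+3) → ℝ} {X : Fin (k+3) → ℂ} (h : X ∈ PD T c r)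
    {ζ : ℂ} (hζ : ζ ∈ T') : Function.update X 0 ζ ∈ PD T' c r := by
  refine ⟨by simpa using hζ, fun i hi => ?_⟩
  rw [Function.update_of_ne hi]; exact h.2 i hi

lemma PD_small {β : ℝ} (hβ : β ≤ 1/10) {T : Set ℂ} {X : Fin (k+3) → ℂ} (h : X ∈ PD T (cN k) (rN k p β)) :
    X ∈ PD (k := k) T 0 (fun _ => 2) := by
  refine ⟨h.1, fun i hi => ?_⟩
  refine ball_subset_ball' ?_ (h.2 i hi)
  rw [dist_eq_norm]
  revert hi
  revert i
  apply forall3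
  · intro h; exact absurd rfl h
  · intro _; simp [cN, rN]; linarith
  · intro j _
    simp only [cN, rN, vc_ss, Pi.zero_apply, sub_zero]
    split_ifs <;> simp <;> linarith

lemma linX_image_ball {x : Fin (k+3) → ℂ} {X : Fin (k+3) → ℂ} (hX : X ∈ PD (k := k) (ball 0 4) 0 (fun _ => 2)) :
    linX X ∈ closedBall (0 : Fin (k+3) → ℂ) 10 := by
  have h0 : ‖X 0‖ < 4 := by simpa using hX.1
  have h2 : ∀ i, i ≠ 0 → ‖X i‖ < 2 := fun i hi => by simpa using hX.2 i hi
  rw [mem_closedBall_zero_iff, pi_norm_le_iff_of_nonneg (by norm_num)]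
  have h1 := h2 1 (by simp)
  apply forall3
  · simp only [linX, vc_0]
    rw [norm_div]
    have := norm_add_le (X 0) (X 1)
    norm_num; linarith
  · simp only [linX, vc_1]
    rw [norm_div]
    have := norm_sub_le (X 0) (X 1)
    norm_num; linarith
  · intro j; simp only [linX, vc_ss]; linarith [h2 j.succ.succ (zero_ne_ss j).symm]

lemma real_strip {θ : ℝ} (hθ : θ ∈ Icc 0 (2 * π)) : (θ : ℂ) ∈ Strip := by
  refine ⟨?_, by simp⟩
  rw [Complex.ofReal_re, abs_of_nonneg hθ.1]
  have := Real.pi_lt_d2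
  linarith [hθ.2]

set_option maxHeartbeats 1000000 in
theorem FI0 (hpk : p ≤ k) {δ : ℝ} (hδ : 0 < δ) :
    ∃ R μ : ℝ, 0 < R ∧ 0 < μ ∧ ∀ P : (Fin (k+3) → ℂ) → MultiVecC (k+3) (p+2),
      (∀ x ∈ closedBall (0 : Fin (k+3) → ℂ) R, AnalyticAt ℂ P x ∧ ‖P x - modelPiC (k+3) (p+2) x‖ ≤ μ) →
      HasChart P (linX (cN k)) → ∃ F : (Fin (k+3) → ℂ) → (Fin (k+3) → ℂ),
        AnalyticOnNhd ℂ F (ball 0 (1/4)) ∧ (∀ x ∈ ball (0 : Fin (k+3) → ℂ) (1/4), ‖F x - F0 p x‖ ≤ δ) ∧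
        ∀ x ∈ ball (0 : Fin (k+3) → ℂ) (1/4), ∀ a, Kills (jacC F x a) (P x) := by
  set η : ℝ := min 1 (δ / 20) with hη
  have hη0 : 0 < η := lt_min one_pos (by positivity)
  have hη1 : η ≤ 1 := min_le_left _ _
  have hη2 : 20 * η ≤ δ := by have := min_le_right 1 (δ/20); rw [← hη] at this; linarith
  have hk : (0:ℝ) ≤ k := by positivity
  obtain ⟨RA, μA, hRA, hμA, HA⟩ := chartA hpk hη0 (κ := 1000 + 10 * k) (by linarith)
  set β : ℝ := 1 / (600 * (36 * (p + 2))) with hβd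
  have hβ : 0 < β := by positivity
  have hβ' : 36 * (p + 2) * β ≤ 1/600 := by rw [hβd]; apply le_of_eq; field_simp
  have hβ1 : β ≤ 1/10 := by
    have : (0:ℝ) ≤ p := by positivity
    nlinarith
  have hβ0 : (β : ℂ) ≠ 0 := by exact_mod_cast hβ.ne'
  obtain ⟨RB, μB, hRB, hμB, HB⟩ := chartB hpk hβ hβ'
  refine ⟨max 10 (max RA RB), min μA μB, by positivity, lt_min hμA hμB, fun P hP hch => ?_⟩
  have eA : PhiA p (0 : Fin (k+3) → ℂ) = linX (cN k) := by rw [PhiA, AA_zero]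
  have eB : PhiB p β (0 : Fin (k+3) → ℂ) = linX (cN k) := by rw [PhiB, BB_zero]
  obtain ⟨gA, gA1, gA2, gA3, gA4, gA5⟩ := HA P (fun x hx => by
    have := hP x (closedBall_subset_closedBall ((le_max_left _ _).trans (le_max_right _ _)) hx)
    exact ⟨this.1, this.2.trans (min_le_left _ _)⟩) (by rw [eA]; exact hch)
  obtain ⟨gB, gB1, gB2, gB3, gB4, gB5⟩ := HB P (fun x hx => by
    have := hP x (closedBall_subset_closedBall ((le_max_right _ _).trans (le_max_right _ _)) hx)
    exact ⟨this.1, this.2.trans (min_le_right _ _)⟩) (by rw [eB]; exact hch)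
  have hPan : ∀ x ∈ closedBall (0 : Fin (k+3) → ℂ) 10, AnalyticAt ℂ P x := fun x hx =>
    (hP x (closedBall_subset_closedBall (le_max_left _ _) hx)).1
  clear HA HB
  rw [eA] at gA4 gA5
  rw [eB] at gB4 gB5
  -- the two functions
  set GA : (Fin (k+3) → ℂ) → (Fin (k+3) → ℂ) := fun Y => gA (XiA p Y) with hGA
  set GB : (Fin (k+3) → ℂ) → (Fin (k+3) → ℂ) := fun X => gA (KB p (gB (XiB p β X))) with hGB
  have GAan : AnalyticOnNhd ℂ GA (PD (k := k) Strip 0 (fun _ => 2)) := fun Y hY =>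
    AnalyticAt.comp (g := gA) (gA1 _ (XiA_bounds hpk hY)) (an_XiA Y)
  have GBan : AnalyticOnNhd ℂ GB (PD (ball 1 3) (cN k) (rN k p β)) := by
    intro X hX
    have hb := XiB_bounds hpk hβ hX
    have h1 := gB3 _ hb.1 hb.2
    have h2 : ‖gB (XiB p β X)‖ < 1 := by
      have := norm_add_le (gB (XiB p β X) - bp (SIdx hpk)ᶜ (XiB p β X)) (bp (SIdx hpk)ᶜ (XiB p β X))
      rw [sub_add_cancel] at this
      linarith [hb.1, hb.2]
    have a1 : AnalyticAt ℂ (fun X => gB (XiB p β X)) X := AnalyticAt.comp (g := gB) (gB1 _ hb) (an_XiB _ X)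
    have a2 : AnalyticAt ℂ (fun X => KB p (gB (XiB p β X))) X := AnalyticAt.comp (g := KB p) (an_KB _) a1
    exact AnalyticAt.comp (g := gA) (gA1 _ (KB_bounds hpk h2)) a2
  -- local first integral
  set lg : (Fin (k+3) → ℂ) → (Fin (k+3) → ℂ) := fun X => Function.update X 0 (-Complex.I * Complex.log (X 0)) with hlg
  have lgan : ∀ X, X 0 ∈ Complex.slitPlane → AnalyticAt ℂ lg X := fun X hX =>
    an_upd 0 (analyticAt_const.mul ((an_coord 0 X).clog hX))
  have slit : ∀ᶠ x in 𝓝 (linX (cN k)), (Lx x) 0 ∈ Complex.slitPlane := by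
    have hc : ContinuousAt (fun x : Fin (k+3) → ℂ => Lx x 0) (linX (cN k)) :=
      (analyticAt_pi_iff.1 (an_Lx analyticAt_id) 0).continuousAt
    refine hc.eventually (Complex.isOpen_slitPlane.mem_nhds ?_)
    show Lx (linX (cN k)) 0 ∈ _
    rw [Lx_linX]; exact Complex.one_mem_slitPlane
  have lgc : lg (cN k) = Function.update (cN k) 0 0 := by
    simp only [hlg]; congr 1; simp [cN]
  have kA : ∀ᶠ x in 𝓝 (linX (cN k)), ∀ a, Kills (jacC (fun y => GA (lg (Lx y))) x a) (P x) := by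
    refine gA5 (fun x => XiA p (lg (Lx x))) ?_ ?_
    · rw [Lx_linX, lgc, XiA_cN]
    · filter_upwards [slit] with x hx
      refine ⟨?_, ?_⟩
      · have a1 : AnalyticAt ℂ (fun x => lg (Lx x)) x := AnalyticAt.comp (g := lg) (lgan _ hx) (an_Lx analyticAt_id)
        exact (AnalyticAt.comp (g := XiA p) (an_XiA _) a1).differentiableAt
      · rw [PhiA, AA_XiA]
        have h0 : Complex.exp (Complex.I * lg (Lx x) 0) = Lx x 0 := by
          simp only [hlg, Function.update_self]
          rw [← mul_assoc]
          have : Complex.I * -Complex.I = 1 := by simp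
          rw [this, one_mul, Complex.exp_log (Complex.slitPlane_ne_zero hx)]
        rw [h0]
        simp only [hlg, Function.update_idem, Function.update_eq_self, linX_Lx]
  have GAd : ∀ᶠ x in 𝓝 (linX (cN k)), DifferentiableAt ℂ (fun y => GA (lg (Lx y))) x := by
    have h0 : Lx (linX (cN k)) 0 ∈ Complex.slitPlane := by rw [Lx_linX]; exact Complex.one_mem_slitPlane
    have a1 : AnalyticAt ℂ (fun x => lg (Lx x)) (linX (cN k)) := AnalyticAt.comp (g := lg) (lgan _ h0) (an_Lx analyticAt_id)
    have a2 : AnalyticAt ℂ (fun y => GA (lg (Lx y))) (linX (cN k)) := by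
      refine AnalyticAt.comp (g := GA) ?_ a1
      rw [Lx_linX, lgc]
      refine AnalyticAt.comp (g := gA) ?_ (an_XiA _)
      apply gA1
      rw [XiA_cN]
      refine ⟨by simp, ?_⟩
      simp; positivity
    exact a2.eventually_analyticAt.mono fun x hx => hx.differentiableAt
  -- comparison near the base point
  have cmp : ∀ᶠ X in 𝓝 (cN k), GA (lg X) = GB X := by
    have h1 := gB4 (fun y => GA (lg (Lx y))) (GAd.and kA)
    have hc : ContinuousAt (XiB p β) (cN k) := (an_XiB (p := p) _ (cN k)).continuousAt
    rw [ContinuousAt, XiB_cN] at hc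
    filter_upwards [hc.eventually h1] with X hX
    simp only [PhiB, Lx_linX, BB_XiB hβ0] at hX
    rw [hX]
    have hf := K_fib hpk β (gB2 (XiB p β X))
    have : lg (BB p β (gB (XiB p β X))) = Function.update (BB p β (gB (XiB p β X))) 0 0 := by
      simp only [hlg]; congr 1
      simp [BB, hf.1]
    rw [this]
    simp only [hGA, hGB, hf.2]
  -- exponential version
  have expS : ∀ ζ ∈ Strip, Complex.exp (Complex.I * ζ) ∈ ball (1:ℂ) 3 := by
    intro ζ hζ
    have := norm_sub_le (Complex.exp (Complex.I * ζ)) 1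
    rw [norm_one] at this
    rw [mem_ball, dist_eq_norm]; linarith [Strip_exp hζ]
  have anU : ∀ Y : Fin (k+3) → ℂ, AnalyticAt ℂ (fun Y : Fin (k+3) → ℂ => Function.update Y 0 (Complex.exp (Complex.I * Y 0))) Y :=
    fun Y => an_upd 0 (analyticAt_const.mul (an_coord 0 Y)).cexp
  have cmp2 : EqOn GA (fun Y => GB (Function.update Y 0 (Complex.exp (Complex.I * Y 0)))) (PD Strip (cN k) (rN k p β)) := by
    have hbase : Function.update (cN k) 0 0 ∈ PD Strip (cN k) (rN k p β) := by
      refine ⟨by simp [Strip], fun i hi => ?_⟩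
      rw [Function.update_of_ne hi]
      apply mem_ball_self
      revert hi; revert i
      apply forall3
      · intro h; exact absurd rfl h
      · intro _; simp only [rN, vc_1]; positivity
      · intro j _; simp only [rN, vc_ss]; split_ifs <;> positivity
    refine (GAan.mono fun Y hY => PD_small hβ1 hY).eqOn_of_preconnected_of_eventuallyEq (z₀ := Function.update (cN k) 0 0) ?_
      (PD_conv Strip_conv _ _).isPreconnected hbase ?_
    · intro Y hY
      exact AnalyticAt.comp (g := GB) (GBan _ (PD_upd hY (expS _ hY.1))) (anU Y)
    · have hc : ContinuousAt (fun Y : Fin (k+3) → ℂ => Function.update Y 0 (Complex.exp (Complex.I * Y 0))) (Function.update (cN k) 0 0) :=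
        (anU _).continuousAt
      have e0 : Function.update (Function.update (cN k) 0 0) 0 (Complex.exp (Complex.I * Function.update (cN k) 0 0 0)) = cN k := by
        simp; simp [cN]
      rw [ContinuousAt, e0] at hc
      have hre : ∀ᶠ Y : Fin (k+3) → ℂ in 𝓝 (Function.update (cN k) 0 0), |(Y 0).re| < 1 := by
        have hc : ContinuousAt (fun Y : Fin (k+3) → ℂ => |(Y 0).re|) (Function.update (cN k) 0 0) :=
          ((Complex.continuous_re.comp (continuous_apply 0)).abs).continuousAt
        exact hc.eventually (gt_mem_nhds (by simp))
      filter_upwards [hc.eventually cmp, hre] with Y hY hr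
      rw [← hY]
      congr 1
      simp only [hlg, Function.update_self, Function.update_idem]
      have hpi := Real.pi_gt_three
      rw [abs_lt] at hr
      rw [Complex.log_exp (by simp; linarith) (by simp; linarith), ← mul_assoc]
      have : -Complex.I * Complex.I = 1 := by simp
      rw [this, one_mul, Function.update_eq_self]
  -- GB kills
  have cL : Continuous (linX (k := k)) := continuous_iff_continuousAt.2 fun X => (an_linX analyticAt_id).continuousAt
  have kB : ∀ X ∈ PD (ball 1 3) (cN k) (rN k p β), ∀ a, Kills (jacC (fun y => GB (Lx y)) (linX X) a) (P (linX X)) := by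
    have := kills_prop (P := P) (F := fun y => GB (Lx y)) (D := linX '' PD (ball 1 3) (cN k) (rN k p β)) (x₀ := linX (cN k))
      ((PD_conv (convex_ball _ _) _ _).isPreconnected.image _ cL.continuousOn) ?_ ?_ ?_ ?_
    · intro X hX; exact this _ (mem_image_of_mem _ hX)
    · rintro _ ⟨X, hX, rfl⟩
      apply hPan
      refine linX_image_ball (x := 0) (PD_small (p := p) hβ1 ⟨?_, hX.2⟩)
      refine ball_subset_ball' ?_ hX.1
      simp; norm_num
    · rintro _ ⟨X, hX, rfl⟩
      exact AnalyticAt.comp (g := GB) (by rw [Lx_linX]; exact GBan _ hX) (an_Lx analyticAt_id)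
    · refine mem_image_of_mem _ ⟨by simp [cN], fun i hi => ?_⟩
      apply mem_ball_self
      revert hi; revert i
      apply forall3
      · intro h; exact absurd rfl h
      · intro _; simp only [rN, vc_1]; positivity
      · intro j _; simp only [rN, vc_ss]; split_ifs <;> positivity
    · have hc : ContinuousAt (Lx (k := k)) (linX (cN k)) := (an_Lx analyticAt_id).continuousAt
      rw [ContinuousAt, Lx_linX] at hc
      filter_upwards [kA, (hc.eventually cmp).eventually_nhds] with x hx he a
      have : (fun y => GB (Lx y)) =ᶠ[𝓝 x] fun y => GA (lg (Lx y)) := he.mono fun y hy => hy.symm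
      rw [jac_congr this]; exact hx a
  -- the Cauchy integral
  set FH : (Fin (k+3) → ℂ) → (Fin (k+3) → ℂ) := fun X => Cav (fun θ : ℝ => GA (Function.update X 0 (θ:ℂ))) (X 0) with hFH
  have updA : ∀ (X : Fin (k+3) → ℂ) (c : ℂ), AnalyticAt ℂ (fun X : Fin (k+3) → ℂ => Function.update X 0 c) X :=
    fun X c => an_upd 0 analyticAt_const
  have FHan : AnalyticOnNhd ℂ FH (PD (k := k) (ball 0 1) 0 (fun _ => 2)) := by
    refine cav_analytic (h := fun X (θ : ℝ) => GA (Function.update X 0 (θ:ℂ))) (PD_open isOpen_ball _ _) (fun X _ => an_coord 0 X) (fun X hX => by simpa using hX.1) ?_ ?_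
    · refine GAan.continuousOn.comp (f := fun q : (Fin (k+3) → ℂ) × ℝ => Function.update q.1 0 (q.2:ℂ)) ?_ ?_
      · exact (Continuous.update continuous_fst 0 (by fun_prop)).continuousOn
      · rintro ⟨X, θ⟩ ⟨hX, hθ⟩
        exact PD_upd hX (real_strip hθ)
    · intro θ hθ X hX
      exact AnalyticAt.comp (g := GA) (GAan _ (PD_upd hX (real_strip hθ))) (updA X _)
  have FHeq : ∀ X ∈ PD (ball 0 1) (cN k) (rN k p β), FH X = GB X := by
    intro X hX
    have hf : DifferentiableOn ℂ (fun ζ => GB (Function.update X 0 ζ)) (closedBall 0 1) := by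
      intro ζ hζ
      have h1 : Function.update X 0 ζ ∈ PD (ball 1 3) (cN k) (rN k p β) := by
        refine PD_upd hX ?_
        rw [mem_closedBall_zero_iff] at hζ
        have := norm_sub_le ζ 1
        rw [norm_one] at this
        rw [mem_ball, dist_eq_norm]; linarith
      refine (DifferentiableAt.comp ζ (g := GB) (f := fun ζ => Function.update X 0 ζ) (GBan _ h1).differentiableAt ?_).differentiableWithinAt
      exact (hasDerivAt_update X 0 ζ).differentiableAt
    have h2 := cav_cauchy hf (ζ := X 0) (by simpa using hX.1)
    rw [Function.update_eq_self] at h2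
    rw [← h2, hFH]
    simp only [Cav]
    congr 1
    refine intervalIntegral.integral_congr fun θ hθ => ?_
    rw [uIcc_of_le Real.two_pi_pos.le] at hθ
    beta_reduce
    rw [cmp2 (PD_upd hX (real_strip hθ))]
    simp
  have ballPD : ∀ x ∈ ball (0 : Fin (k+3) → ℂ) (1/4), Lx x ∈ PD (k := k) (ball 0 (1/2)) 0 (fun _ => 2) := by
    intro x hx
    rw [mem_ball_zero_iff, pi_norm_lt_iff (by norm_num)] at hx
    have h1 : ‖Complex.I * x 1‖ < 1/4 := by simpa using hx 1
    have h2 := norm_add_le (x 0) (Complex.I * x 1)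
    have h3 := norm_sub_le (x 0) (Complex.I * x 1)
    refine ⟨?_, ?_⟩
    · rw [mem_ball_zero_iff]; simp only [Lx, vc_0]; linarith [hx 0]
    · intro i hi
      simp only [Pi.zero_apply, mem_ball_zero_iff]
      revert hi; revert i
      apply forall3
      · intro h; exact absurd rfl h
      · intro _; simp only [Lx, vc_1]; linarith [hx 0]
      · intro j _; simp only [Lx, vc_ss]; linarith [hx j.succ.succ]
  have mono1 : ∀ X, X ∈ PD (k := k) (ball 0 (1/2)) 0 (fun _ => 2) → X ∈ PD (k := k) (ball 0 1) 0 (fun _ => 2) :=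
    fun X hX => ⟨ball_subset_ball (by norm_num) hX.1, hX.2⟩
  have FHL : ∀ X ∈ PD (k := k) (ball 0 1) 0 (fun _ => 2), AnalyticAt ℂ (fun x => FH (Lx x)) (linX X) := by
    intro X hX
    exact AnalyticAt.comp (g := FH) (by rw [Lx_linX]; exact FHan _ hX) (an_Lx analyticAt_id)
  have kF : ∀ X ∈ PD (k := k) (ball 0 1) 0 (fun _ => 2), ∀ a, Kills (jacC (fun y => FH (Lx y)) (linX X) a) (P (linX X)) := by
    have hb : Function.update (cN k) 0 0 ∈ PD (ball 0 1) (cN k) (rN k p β) := by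
      refine ⟨by simp, fun i hi => ?_⟩
      rw [Function.update_of_ne hi]
      apply mem_ball_self
      revert hi; revert i
      apply forall3
      · intro h; exact absurd rfl h
      · intro _; simp only [rN, vc_1]; positivity
      · intro j _; simp only [rN, vc_ss]; split_ifs <;> positivity
    have := kills_prop (P := P) (F := fun y => FH (Lx y)) (D := linX '' PD (k := k) (ball 0 1) 0 (fun _ => 2)) (x₀ := linX (Function.update (cN k) 0 0))
      ((PD_conv (convex_ball _ _) _ _).isPreconnected.image _ cL.continuousOn) ?_ ?_ ?_ ?_
    · intro X hX; exact this _ (mem_image_of_mem _ hX)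
    · rintro _ ⟨X, hX, rfl⟩
      apply hPan
      exact linX_image_ball (x := 0) ⟨ball_subset_ball (by norm_num) hX.1, hX.2⟩
    · rintro _ ⟨X, hX, rfl⟩
      exact FHL X hX
    · exact mem_image_of_mem _ (PD_small hβ1 hb)
    · have hc : ContinuousAt (Lx (k := k)) (linX (Function.update (cN k) 0 0)) := (an_Lx analyticAt_id).continuousAt
      rw [ContinuousAt, Lx_linX] at hc
      have hn := hc.eventually ((PD_open isOpen_ball _ _).mem_nhds hb)
      filter_upwards [hn.eventually_nhds] with x hx a
      have : (fun y => FH (Lx y)) =ᶠ[𝓝 x] fun y => GB (Lx y) := hx.mono fun y hy => FHeq _ hy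
      rw [jac_congr this]
      have h1 := kB (Lx x) ⟨?_, hx.self_of_nhds.2⟩ a
      · rwa [linX_Lx] at h1
      · refine ball_subset_ball' ?_ hx.self_of_nhds.1
        simp; norm_num
  refine ⟨fun x => FH (Lx x) + Pi.single 1 1, ?_, ?_, ?_⟩
  · intro x hx
    have := FHL (Lx x) (mono1 _ (ballPD x hx))
    rw [linX_Lx] at this
    exact this.add analyticAt_const
  · intro x hx
    have hX := ballPD x hx
    have hX1 := mono1 _ hX
    set X := Lx x with hXd
    have e : F0 p x = F0X p X + Pi.single 1 1 := by
      apply ext3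
      · simp [F0, F0X]
      · have : x = linX X := (linX_Lx x).symm
        simp only [F0, F0X, vc_1, Pi.add_apply, Pi.single_eq_same]
        rw [this, Q2_linX]; ring
      · intro j
        simp only [F0, F0X, vc_ss, Pi.add_apply, Pi.single_eq_of_ne (one_ne_ss j).symm, add_zero]
        rfl
    rw [e, add_sub_add_right_eq_sub]
    have hf : DifferentiableOn ℂ (fun ζ => F0X p (Function.update X 0 ζ)) (closedBall 0 1) := by
      intro ζ hζ
      refine (DifferentiableAt.comp ζ (g := F0X p) (f := fun ζ => Function.update X 0 ζ) (an_F0X _).differentiableAt ?_).differentiableWithinAt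
      exact (hasDerivAt_update X 0 ζ).differentiableAt
    have h2 := cav_cauchy hf (ζ := X 0) (by simpa using hX1.1)
    rw [Function.update_eq_self] at h2
    rw [← h2]
    have cU : ContinuousOn (fun θ : ℝ => Function.update X 0 (θ:ℂ)) (Icc 0 (2 * π)) :=
      (Continuous.update continuous_const 0 (by fun_prop)).continuousOn
    refine (cav_bound (c := η * 10) (by have := hX.1; rw [mem_ball_zero_iff] at this; exact this.le) ?_ ?_ ?_).trans (by linarith)
    · intro θ hθ
      have hY := PD_upd hX1 (real_strip hθ)
      have hb := XiA_bounds hpk hY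
      have h3 := gA3 _ hb.1 hb.2
      rw [F0X_XiA] at h3
      simp only [Function.update_self, Function.update_idem] at h3
      exact h3.trans (by have := hb.1; gcongr)
    · exact GAan.continuousOn.comp cU fun θ hθ => PD_upd hX1 (real_strip hθ)
    · refine Continuous.continuousOn ?_
      have c1 : Continuous (F0X (k := k) p) := continuous_iff_continuousAt.2 fun X => (an_F0X X).continuousAt
      exact c1.comp (Continuous.update continuous_const 0 (by fun_prop))
  · intro x hx a
    have h1 := kF (Lx x) (mono1 _ (ballPD x hx)) a
    rw [linX_Lx] at h1
    have : jacC (fun x => FH (Lx x) + Pi.single 1 1) x = jacC (fun y => FH (Lx y)) x := by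
      unfold jacC; rw [fderiv_add_const]
    rw [this]; exact h1

end FI
section CJ

/-- germs of multivector fields at the origin that are conjugate by an analytic germ -/
def Conj {n q : ℕ} (P P' : (Fin n → ℂ) → MultiVecC n q) : Prop :=
  ∃ φ : (Fin n → ℂ) → (Fin n → ℂ), AnalyticAt ℂ φ 0 ∧ φ 0 = 0 ∧ (∃ K, K * jacC φ 0 = 1) ∧
    ∀ᶠ x in 𝓝 0, extPowC n q (jacC φ x) (P x) = P' (φ x)

lemma conj_trans {n q : ℕ} {P P' P'' : (Fin n → ℂ) → MultiVecC n q} (h : Conj P P') (h' : Conj P' P'') :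
    Conj P P'' := by
  obtain ⟨φ, h1, h2, ⟨K, h3⟩, h4⟩ := h
  obtain ⟨χ, g1, g2, ⟨L, g3⟩, g4⟩ := h'
  have g1' : AnalyticAt ℂ χ (φ 0) := by rw [h2]; exact g1
  have hc : Tendsto φ (𝓝 0) (𝓝 0) := by have := h1.continuousAt.tendsto; rwa [h2] at this
  have hj : ∀ᶠ x in 𝓝 0, jacC (fun y => χ (φ y)) x = jacC χ (φ x) * jacC φ x := by
    filter_upwards [h1.eventually_analyticAt, hc.eventually g1.eventually_analyticAt] with x hx hx'
    exact jac_comp hx'.differentiableAt hx.differentiableAt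
  refine ⟨fun y => χ (φ y), AnalyticAt.comp (g := χ) g1' h1, by show χ (φ 0) = 0; rw [h2, g2], ⟨K * L, ?_⟩, ?_⟩
  · rw [hj.self_of_nhds, h2, Matrix.mul_assoc, ← Matrix.mul_assoc L, g3, Matrix.one_mul, h3]
  · filter_upwards [h4, hc.eventually g4, hj] with x hx hx' hx''
    rw [hx'', extPow_mul, hx, hx']

lemma conj_congr {n q : ℕ} {P P' P'' : (Fin n → ℂ) → MultiVecC n q} (h : Conj P P') (h' : P' =ᶠ[𝓝 0] P'') :
    Conj P P'' := by
  obtain ⟨φ, h1, h2, h3, h4⟩ := h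
  have hc : Tendsto φ (𝓝 0) (𝓝 0) := by have := h1.continuousAt.tendsto; rwa [h2] at this
  refine ⟨φ, h1, h2, h3, ?_⟩
  filter_upwards [h4, hc.eventually h'] with x hx hx'
  rw [hx, hx']

lemma extPow_scalar {n q : ℕ} (c : ℂ) (w : MultiVecC n q) :
    extPowC n q (c • (1 : Matrix (Fin n) (Fin n) ℂ)) w = c ^ q • w := by
  apply om_inj
  intro M
  rw [om_extPow, om_smul]
  have : (fun a => Matrix.vecMul (M a) (c • (1 : Matrix (Fin n) (Fin n) ℂ))) = fun a => (fun _ => c) a • M a := by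
    funext a; rw [Matrix.vecMul_smul, Matrix.vecMul_one]
  rw [this, AlternatingMap.map_smul_univ]
  simp

lemma jac_scalar {n : ℕ} (c : ℂ) (x : Fin n → ℂ) : jacC (fun y => c • y) x = c • 1 := by
  apply mat_ext_mulVec
  intro v
  rw [jac_mulVec, Matrix.smul_mulVec, Matrix.one_mulVec]
  have : HasFDerivAt (fun y : Fin n → ℂ => c • y) (c • ContinuousLinearMap.id ℂ _) x :=
    (hasFDerivAt_id x).const_smul c
  rw [this.fderiv]; rfl

lemma model_eq_zero {n q : ℕ} (h : q + 1 ≤ n) (hq : 1 ≤ q) {a : Fin n → ℂ} (ha : modelPiC n q a = 0) (i : Fin n) (hi : (i:ℕ) < q + 1) :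
    a i = 0 := by
  obtain ⟨j, hj⟩ : ∃ j : Fin (q+1), j ≠ ⟨i, hi⟩ := by
    by_cases h0 : (i:ℕ) = 0
    · refine ⟨⟨1, by omega⟩, fun e => ?_⟩
      have := congrArg Fin.val e; simp at this; omega
    · refine ⟨⟨0, by omega⟩, fun e => ?_⟩
      have := congrArg Fin.val e; simp at this; omega
  have hk : Kills (Pi.single (Fin.castLE h j) 1) (modelPiC n q a) := by
    rw [ha]; intro M b _; rw [om_apply]; simp
  have := kills_model h hk ⟨i, hi⟩ j
  have hne : Fin.castLE h ⟨i, hi⟩ ≠ Fin.castLE h j := fun e => hj (Fin.castLE_injective h e).symm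
  rw [Pi.single_eq_same, Pi.single_eq_of_ne hne, mul_one, mul_zero] at this
  exact this

lemma hasChart_nambu {n q : ℕ} {U : Set (Fin n → ℂ)} {P : (Fin n → ℂ) → MultiVecC n q} (hN : IsNambuC n q P U)
    {ε : ℂ} {p : Fin n → ℂ} (hp : ε • p ∈ U) (hP : P (ε • p) ≠ 0) (hε : ε ≠ 0) :
    HasChart (fun x => ε⁻¹ • P (ε • x)) p := by
  obtain ⟨W, hpW, hWU, φ, ⟨hWo, hφo, hφ, ψ, hψ, h1, h2⟩, h3⟩ := hN.2 _ hp hP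
  refine ⟨fun x => φ (ε • x), ε ^ q * ε⁻¹, ?_⟩
  have hc : ContinuousAt (fun x : Fin n → ℂ => ε • x) p := (continuous_const_smul ε).continuousAt
  filter_upwards [hc.eventually (hWo.mem_nhds hpW)] with x hx
  have d1 : DifferentiableAt ℂ (fun x : Fin n → ℂ => ε • x) x := differentiableAt_id.const_smul ε
  have d2 := (hφ _ hx).differentiableAt
  have e : jacC (fun x => φ (ε • x)) x = jacC φ (ε • x) * (ε • 1) := by
    rw [← jac_scalar ε x]; exact jac_comp (f := fun x => ε • x) d2 d1
  refine ⟨DifferentiableAt.comp x (g := φ) d2 d1, ⟨(ε⁻¹ • 1) * jacC ψ (φ (ε • x)), ?_⟩, ?_⟩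
  · have h5 : jacC ψ (φ (ε • x)) * jacC φ (ε • x) = 1 := by
      rw [← jac_comp (hψ _ ⟨_, hx, rfl⟩).differentiableAt d2, ← jac_id (ε • x)]
      apply jac_congr
      filter_upwards [hWo.mem_nhds hx] with y hy using h1 y hy
    rw [e, Matrix.mul_assoc, ← Matrix.mul_assoc (jacC ψ _), h5]
    simp [hε]
  · rw [e, extPow_mul, extPow_scalar, smul_smul, extPow_smul, h3 _ hx]

theorem FI {k p : ℕ} (hpk : p ≤ k) {δ : ℝ} (hδ : 0 < δ) {U : Set (Fin (k+3) → ℂ)} (hU : IsOpen U) (h0U : 0 ∈ U)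
    {P : (Fin (k+3) → ℂ) → MultiVecC (k+3) (p+2)} (hN : IsNambuC (k+3) (p+2) P U)
    (hP0 : P 0 = 0) (hlin : ∀ v, fderiv ℂ P 0 v = modelPiC (k+3) (p+2) v) :
    ∃ P' : (Fin (k+3) → ℂ) → MultiVecC (k+3) (p+2), Conj P P' ∧ AnalyticAt ℂ P' 0 ∧ P' 0 = 0 ∧
      (∃ c : ℂ, c ≠ 0 ∧ ∀ v, fderiv ℂ P' 0 v = c • modelPiC (k+3) (p+2) v) ∧
      ∃ F : (Fin (k+3) → ℂ) → (Fin (k+3) → ℂ),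
        AnalyticOnNhd ℂ F (ball 0 (1/4)) ∧ (∀ x ∈ ball (0 : Fin (k+3) → ℂ) (1/4), ‖F x - F0 p x‖ ≤ δ) ∧
        ∀ x ∈ ball (0 : Fin (k+3) → ℂ) (1/4), ∀ a, Kills (jacC F x a) (P' x) := by
  obtain ⟨R, μ, hR, hμ, H⟩ := FI0 hpk hδ
  set ps := linX (cN k) with hps
  have hm : modelPiC (k+3) (p+2) ps ≠ 0 := by
    intro h
    have := model_eq_zero (by omega) (by omega) h 0 (by simp)
    rw [hps, linX, vc_0] at this
    simp [cN] at this
  set μ' := min μ (‖modelPiC (k+3) (p+2) ps‖ / 2) with hμ'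
  have hμ0 : 0 < μ' := lt_min hμ (by have := norm_pos_iff.2 hm; positivity)
  set R' := max R ‖ps‖ with hR'
  have hR0 : 0 < R' := lt_max_of_lt_left hR
  have hd : HasFDerivAt P (fderiv ℂ P 0) 0 := (hN.1 0 h0U).differentiableAt.hasFDerivAt
  have h1 : ∀ᶠ y in 𝓝 (0 : Fin (k+3) → ℂ), ‖P y - modelPiC (k+3) (p+2) y‖ ≤ μ' / R' * ‖y‖ := by
    have := hd.isLittleO.bound (show 0 < μ' / R' by positivity)
    filter_upwards [this] with y hy
    simpa [hP0, hlin] using hy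
  obtain ⟨r, hr, hr'⟩ := Metric.eventually_nhds_iff_ball.1 (h1.and (hU.mem_nhds h0U))
  set e : ℝ := r / (2 * R') with he
  have he0 : 0 < e := by positivity
  set ε : ℂ := (e : ℂ) with hε
  have hε0 : ε ≠ 0 := by rw [hε]; exact_mod_cast he0.ne'
  have hεn : ‖ε‖ = e := by rw [hε, Complex.norm_real, Real.norm_of_nonneg he0.le]
  have hin : ∀ x : Fin (k+3) → ℂ, ‖x‖ ≤ R' → ε • x ∈ ball (0 : Fin (k+3) → ℂ) r := by
    intro x hx
    rw [mem_ball_zero_iff, norm_smul, hεn]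
    calc e * ‖x‖ ≤ e * R' := by gcongr
      _ = r / 2 := by rw [he]; field_simp
      _ < r := by linarith
  have hcl : ∀ x : Fin (k+3) → ℂ, ‖x‖ ≤ R' → ‖ε⁻¹ • P (ε • x) - modelPiC (k+3) (p+2) x‖ ≤ μ' := by
    intro x hx
    have h2 := (hr' _ (hin x hx)).1
    rw [model_smul] at h2
    have e1 : ε⁻¹ • P (ε • x) - modelPiC (k+3) (p+2) x = ε⁻¹ • (P (ε • x) - ε • modelPiC (k+3) (p+2) x) := by
      rw [smul_sub, inv_smul_smul₀ hε0]
    rw [e1, norm_smul, norm_inv, hεn]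
    rw [norm_smul, hεn] at h2
    calc e⁻¹ * ‖P (ε • x) - ε • modelPiC (k+3) (p+2) x‖ ≤ e⁻¹ * (μ' / R' * (e * ‖x‖)) := by gcongr
      _ = μ' * (‖x‖ / R') := by field_simp
      _ ≤ μ' * 1 := by gcongr; exact (div_le_one hR0).2 hx
      _ = μ' := mul_one _
  have hsm : ∀ x : Fin (k+3) → ℂ, AnalyticAt ℂ (fun x : Fin (k+3) → ℂ => ε • x) x := fun x =>
    (ε • ContinuousLinearMap.id ℂ (Fin (k+3) → ℂ)).analyticAt x
  have han : ∀ x : Fin (k+3) → ℂ, ‖x‖ ≤ R' → AnalyticAt ℂ (fun x => P (ε • x)) x := fun x hx =>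
    AnalyticAt.comp (g := P) (f := fun x => ε • x) (hN.1 _ (hr' _ (hin x hx)).2) (hsm x)
  have hPs : P (ε • ps) ≠ 0 := by
    intro h
    have := hcl ps (le_max_right _ _)
    rw [h, smul_zero, zero_sub, norm_neg] at this
    have h3 := this.trans (min_le_right _ _)
    have := norm_pos_iff.2 hm
    linarith
  obtain ⟨F, F1, F2, F3⟩ := H (fun x => ε⁻¹ • P (ε • x)) (by
      intro x hx
      have hx' : ‖x‖ ≤ R' := (mem_closedBall_zero_iff.1 hx).trans (le_max_left _ _)
      exact ⟨analyticAt_const.fun_smul (han x hx'), (hcl x hx').trans (min_le_left _ _)⟩)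
    (hasChart_nambu hN (hr' _ (hin ps (le_max_right _ _))).2 hPs hε0)
  refine ⟨fun x => (ε⁻¹) ^ (p+2) • P (ε • x), ⟨fun x => ε⁻¹ • x, ?_, by simp, ⟨ε • 1, ?_⟩, ?_⟩, ?_, by simp [hP0], ⟨ε⁻¹ ^ (p+2) * ε, ?_, ?_⟩, F, F1, F2, ?_⟩
  · exact (ε⁻¹ • ContinuousLinearMap.id ℂ (Fin (k+3) → ℂ)).analyticAt 0
  · rw [jac_scalar]; simp [hε0]
  · refine Eventually.of_forall fun x => ?_
    rw [jac_scalar, extPow_scalar]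
    show _ = ε⁻¹ ^ (p+2) • P (ε • ε⁻¹ • x)
    rw [smul_inv_smul₀ hε0]
  · exact analyticAt_const.fun_smul (han 0 (by simpa using hR0.le))
  · exact mul_ne_zero (pow_ne_zero _ (inv_ne_zero hε0)) hε0
  · intro v
    have hd' : HasFDerivAt P (fderiv ℂ P 0) (ε • (0 : Fin (k+3) → ℂ)) := by rw [smul_zero]; exact hd
    have h2 : HasFDerivAt (fun y : Fin (k+3) → ℂ => ε • y) (ε • ContinuousLinearMap.id ℂ _) 0 :=
      (hasFDerivAt_id _).const_smul ε
    have h3 := (HasFDerivAt.comp (0 : Fin (k+3) → ℂ) (g := P) hd' h2).const_smul (ε⁻¹ ^ (p+2))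
    have h4 : fderiv ℂ (fun x => ε⁻¹ ^ (p+2) • P (ε • x)) 0 = _ := h3.fderiv
    rw [h4]
    simp [hlin, smul_smul]
  · intro x hx a
    have := (F3 x hx a).smul_right (ε⁻¹ ^ (p+2) * ε)
    simpa [smul_smul, mul_assoc, hε0] using this
end CJ
section NF

/-- second derivative at the origin -/
noncomputable def D2 {n : ℕ} (H : (Fin n → ℂ) → ℂ) (v w : Fin n → ℂ) : ℂ :=
  fderiv ℂ (fun x => fderiv ℂ H x w) 0 v

lemma an_fd {n : ℕ} {H : (Fin n → ℂ) → ℂ} {x : Fin n → ℂ} (hH : AnalyticAt ℂ H x) (w : Fin n → ℂ) :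
    AnalyticAt ℂ (fun x => fderiv ℂ H x w) x :=
  AnalyticAt.comp (g := fun L : (Fin n → ℂ) →L[ℂ] ℂ => L w) (f := fderiv ℂ H) ((ContinuousLinearMap.apply ℂ ℂ w).analyticAt _) hH.fderiv

lemma cauchyV {n : ℕ} {g : (Fin n → ℂ) → ℂ} {r C : ℝ} (hr : 0 < r) (hg : AnalyticOnNhd ℂ g (ball 0 (2*r)))
    (hC : ∀ x ∈ ball (0 : Fin n → ℂ) (2*r), ‖g x‖ ≤ C) {x v : Fin n → ℂ} (hx : x ∈ ball (0 : Fin n → ℂ) r) (hv : ‖v‖ ≤ 1) :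
    ‖fderiv ℂ g x v‖ ≤ C / (r/2) := by
  have hin : ∀ t ∈ closedBall (0:ℂ) (r/2), x + t • v ∈ ball (0 : Fin n → ℂ) (2*r) := by
    intro t ht
    rw [mem_ball_zero_iff] at *
    rw [mem_closedBall_zero_iff] at ht
    calc ‖x + t • v‖ ≤ ‖x‖ + ‖t‖ * ‖v‖ := (norm_add_le _ _).trans (by rw [norm_smul])
      _ < r + r/2 * 1 := add_lt_add_of_lt_of_le hx (by gcongr)
      _ ≤ _ := by linarith
  have hl : ∀ t : ℂ, HasDerivAt (fun t : ℂ => x + t • v) v t := fun t => by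
    simpa using ((hasDerivAt_id t).smul_const v).const_add x
  have hd : ∀ t ∈ closedBall (0:ℂ) (r/2), DifferentiableAt ℂ (fun t : ℂ => g (x + t • v)) t := fun t ht =>
    DifferentiableAt.comp t (g := g) (f := fun t : ℂ => x + t • v) (hg _ (hin t ht)).differentiableAt (hl t).differentiableAt
  have h1 : deriv (fun t : ℂ => g (x + t • v)) 0 = fderiv ℂ g x v := by
    have e : x + (0:ℂ) • v = x := by simp
    have := (hg _ (hin 0 (by simp; linarith))).differentiableAt.hasFDerivAt
    have h2 := HasFDerivAt.comp_hasDerivAt (0:ℂ) (l := g) (f := fun t : ℂ => x + t • v) this (hl 0)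
    rw [e] at h2
    exact h2.deriv
  rw [← h1]
  refine Complex.norm_deriv_le_of_forall_mem_sphere_norm_le (by linarith) ?_ ?_
  · apply DifferentiableOn.diffContOnCl
    intro t ht
    exact (hd t (closure_ball_subset_closedBall ht)).differentiableWithinAt
  · intro t ht
    exact hC _ (hin t (sphere_subset_closedBall ht))

lemma D2_bound {n : ℕ} {g : (Fin n → ℂ) → ℂ} {C : ℝ} (hg : AnalyticOnNhd ℂ g (ball 0 (1/4)))
    (hC : ∀ x ∈ ball (0 : Fin n → ℂ) (1/4), ‖g x‖ ≤ C) {v w : Fin n → ℂ} (hv : ‖v‖ ≤ 1) (hw : ‖w‖ ≤ 1) :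
    ‖fderiv ℂ g 0 w‖ ≤ 1000 * C ∧ ‖D2 g v w‖ ≤ 1000 * C := by
  have hC0 : 0 ≤ C := (norm_nonneg _).trans (hC 0 (by simp))
  have e : (1/4 : ℝ) = 2 * (1/8) := by norm_num
  have e' : (1/8 : ℝ) = 2 * (1/16) := by norm_num
  have hsub : ball (0 : Fin n → ℂ) (1/8) ⊆ ball 0 (1/4) := ball_subset_ball (by norm_num)
  have h1 : ∀ x ∈ ball (0 : Fin n → ℂ) (1/8), ‖fderiv ℂ g x w‖ ≤ C / (1/8/2) := by
    intro x hx
    rw [e] at hg hC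
    exact cauchyV (by norm_num) hg hC hx hw
  refine ⟨(h1 0 (by simp)).trans (by linarith), ?_⟩
  rw [e'] at h1
  have h2 : AnalyticOnNhd ℂ (fun x => fderiv ℂ g x w) (ball 0 (2 * (1/16))) := by
    rw [← e']; intro x hx; exact an_fd (hg x (hsub hx)) w
  refine (cauchyV (x := 0) (v := v) (by norm_num) h2 h1 (by simp) hv).trans ?_
  have : C / (2 * (1 / 16) / 2) / (1 / 16 / 2) = 512 * C := by ring
  linarith

lemma fd_lin {n : ℕ} {ι : Type*} [Fintype ι] {f : ι → (Fin n → ℂ) → ℂ} {c : ι → ℂ} {x : Fin n → ℂ}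
    (hf : ∀ b, DifferentiableAt ℂ (f b) x) (v : Fin n → ℂ) :
    fderiv ℂ (fun x => ∑ b, c b * f b x) x v = ∑ b, c b * fderiv ℂ (f b) x v := by
  have : HasFDerivAt (fun x => ∑ b, c b * f b x) (∑ b, c b • fderiv ℂ (f b) x) x :=
    HasFDerivAt.fun_sum fun b _ => (hf b).hasFDerivAt.const_mul (c b)
  rw [this.fderiv]; simp

lemma D2_lin {n : ℕ} {ι : Type*} [Fintype ι] {f : ι → (Fin n → ℂ) → ℂ} {c : ι → ℂ}
    (hf : ∀ b, AnalyticAt ℂ (f b) 0) (v w : Fin n → ℂ) :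
    D2 (fun x => ∑ b, c b * f b x) v w = ∑ b, c b * D2 (f b) v w := by
  have h1 : (fun x => fderiv ℂ (fun x => ∑ b, c b * f b x) x w) =ᶠ[𝓝 0] fun x => ∑ b, c b * fderiv ℂ (f b) x w := by
    have : ∀ᶠ x in 𝓝 (0 : Fin n → ℂ), ∀ b, AnalyticAt ℂ (f b) x :=
      eventually_all.2 fun b => (hf b).eventually_analyticAt
    filter_upwards [this] with x hx
    exact fd_lin (fun b => (hx b).differentiableAt) w
  unfold D2
  rw [h1.fderiv_eq, fd_lin]
  exact fun b => (an_fd (hf b) w).differentiableAt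

lemma D2_congr {n : ℕ} {f g : (Fin n → ℂ) → ℂ} (h : f =ᶠ[𝓝 0] g) (v w : Fin n → ℂ) : D2 f v w = D2 g v w := by
  unfold D2
  have : (fun x => fderiv ℂ f x w) =ᶠ[𝓝 0] fun x => fderiv ℂ g x w := by
    filter_upwards [h.fderiv (𝕜 := ℂ)] with x hx; rw [hx]
  rw [this.fderiv_eq]

lemma D2_sub {n : ℕ} {f g : (Fin n → ℂ) → ℂ} (hf : AnalyticAt ℂ f 0) (hg : AnalyticAt ℂ g 0) (v w : Fin n → ℂ) :
    D2 (fun x => f x - g x) v w = D2 f v w - D2 g v w := by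
  have := D2_lin (f := ![f, g]) (c := ![1, -1]) (by intro b; fin_cases b <;> assumption) v w
  simpa [Fin.sum_univ_two, ← sub_eq_add_neg] using this

lemma kills_lim {n q : ℕ} {ι : Type*} {L : Filter ι} [L.NeBot] {l : ι → Fin n → ℂ} {w : ι → MultiVecC n q}
    {l₀ : Fin n → ℂ} {w₀ : MultiVecC n q} (hl : Tendsto l L (𝓝 l₀)) (hw : Tendsto w L (𝓝 w₀))
    (h : ∀ᶠ t in L, Kills (l t) (w t)) : Kills l₀ w₀ := by
  rw [kills_iff]
  intro M a
  have hc : Continuous (fun z : (Fin n → ℂ) × MultiVecC n q => om z.2 (Function.update M a z.1)) :=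
    om_cont (by fun_prop) (by fun_prop)
  have h1 := (hc.tendsto (l₀, w₀)).comp (hl.prodMk_nhds hw)
  refine tendsto_nhds_unique h1 (tendsto_const_nhds.congr' ?_)
  filter_upwards [h] with t ht
  exact (kills_iff.1 ht M a).symm

lemma line_lim {E G : Type*} [NormedAddCommGroup E] [NormedSpace ℂ E] [NormedAddCommGroup G] [NormedSpace ℂ G] {f : E → G}
    (hf : DifferentiableAt ℂ f 0) (h0 : f 0 = 0) (v : E) :
    Tendsto (fun t : ℂ => t⁻¹ • f (t • v)) (𝓝[≠] 0) (𝓝 (fderiv ℂ f 0 v)) := by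
  have hl : HasDerivAt (fun t : ℂ => t • v) v 0 := by simpa using (hasDerivAt_id (0:ℂ)).smul_const v
  have hf' : HasFDerivAt f (fderiv ℂ f 0) ((0:ℂ) • v) := by rw [zero_smul]; exact hf.hasFDerivAt
  have := (HasFDerivAt.comp_hasDerivAt (0:ℂ) hf' hl).tendsto_slope
  refine this.congr' (Eventually.of_forall fun t => ?_)
  simp [slope_def_module, h0]

lemma line_in {E : Type*} [NormedAddCommGroup E] [NormedSpace ℂ E] (v : E) {Q : E → Prop} (h : ∀ᶠ x in 𝓝 0, Q x) :
    ∀ᶠ t : ℂ in 𝓝[≠] 0, Q (t • v) := by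
  have : ContinuousAt (fun t : ℂ => t • v) 0 := by fun_prop
  have h2 : ∀ᶠ x in 𝓝 ((0:ℂ) • v), Q x := by rw [zero_smul]; exact h
  exact (this.eventually h2).filter_mono nhdsWithin_le_nhds

lemma Q2_fd {k p : ℕ} (x w : Fin (k+3) → ℂ) : fderiv ℂ (Q2 p) x w = dQ p x ⬝ᵥ w := by
  have := Q2_hasFDeriv (p := p) (Φ := fun z => z) (z := x) differentiableAt_id w
  simp at this
  exact this.symm

lemma F0_an {k p : ℕ} (x : Fin (k+3) → ℂ) (b : Fin (k+3)) : AnalyticAt ℂ (fun x => F0 p x b) x := by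
  revert b
  refine forall3 ?_ ?_ ?_
  · exact analyticAt_const
  · show AnalyticAt ℂ (Q2 p) x
    refine Finset.analyticAt_fun_sum _ fun i _ => ?_
    split_ifs
    · exact (an_coord i x).pow 2
    · exact analyticAt_const
  · intro j
    simp only [F0, vc_ss]
    split_ifs
    · exact analyticAt_const
    · exact an_coord _ x

lemma F0_fd {k p : ℕ} (x w : Fin (k+3) → ℂ) (b : Fin (k+3)) : fderiv ℂ (fun x => F0 p x b) x w =
    if b = 1 then dQ p x ⬝ᵥ w else if (b:ℕ) < p + 3 then 0 else w b := by
  revert b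
  refine forall3 ?_ ?_ ?_
  · simp [F0]
  · rw [if_pos rfl]; exact Q2_fd x w
  · intro j
    rw [if_neg (one_ne_ss j).symm]
    simp only [F0, vc_ss]
    by_cases hj : (j:ℕ) < p + 1
    · rw [if_pos (by simp; omega)]; simp only [if_pos hj]; simp
    · rw [if_neg (by simp; omega)]; simp only [if_neg hj]
      rw [(hasFDerivAt_apply (𝕜 := ℂ) (j.succ.succ) x).fderiv]; rfl

lemma dQ_apply {k p : ℕ} (x : Fin (k+3) → ℂ) (i) : dQ p x i = if (i:ℕ) < p + 3 then 2 * x i else 0 := rfl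

end NF
section NF2
variable {k p : ℕ}

/-- the differential of a first integral vanishes in the `x`-directions -/
lemma kills_first {P : (Fin (k+3) → ℂ) → MultiVecC (k+3) (p+2)} (hpk : p ≤ k) (hP : AnalyticAt ℂ P 0) (hP0 : P 0 = 0)
    {c : ℂ} (hc : c ≠ 0) (hl : ∀ v, fderiv ℂ P 0 v = c • modelPiC (k+3) (p+2) v)
    {F : (Fin (k+3) → ℂ) → (Fin (k+3) → ℂ)} (hF : AnalyticAt ℂ F 0)
    (hk : ∀ᶠ x in 𝓝 0, ∀ a, Kills (jacC F x a) (P x)) (a : Fin (k+3)) (i : Fin (k+3)) (hi : (i:ℕ) < p + 3) :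
    jacC F 0 a i = 0 := by
  have key : ∀ v, Kills (jacC F 0 a) (modelPiC (k+3) (p+2) v) := by
    intro v
    have h1 := line_lim hP.differentiableAt hP0 v
    have h2 : Tendsto (fun t : ℂ => jacC F (t • v) a) (𝓝[≠] 0) (𝓝 (jacC F 0 a)) := by
      rw [tendsto_pi_nhds]
      intro j
      have h3 : ContinuousAt (fun x => fderiv ℂ F x (Pi.single j 1) a) 0 := by
        have h7 : ContinuousAt (fun x => fderiv ℂ F x (Pi.single j 1)) 0 := hF.fderiv.continuousAt.clm_apply continuousAt_const
        exact ContinuousAt.comp (g := fun z : Fin (k+3) → ℂ => z a) (continuous_apply a).continuousAt h7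
      have h4 : ContinuousAt (fun t : ℂ => t • v) 0 := by fun_prop
      have h5 : ContinuousAt (fun t : ℂ => fderiv ℂ F (t • v) (Pi.single j 1) a) 0 :=
        ContinuousAt.comp (g := fun x => fderiv ℂ F x (Pi.single j 1) a) (f := fun t : ℂ => t • v) (by rw [zero_smul]; exact h3) h4
      have h6 := h5.tendsto
      simp only [zero_smul] at h6
      exact h6.mono_left nhdsWithin_le_nhds
    have h3 := kills_lim h2 h1 (by
      filter_upwards [line_in v hk] with t ht
      exact (ht a).smul_right _)
    rw [hl] at h3
    have := h3.smul_right c⁻¹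
    rwa [inv_smul_smul₀ hc] at this
  obtain ⟨j, hj⟩ : ∃ j : Fin (k+3), (j:ℕ) < p + 3 ∧ j ≠ i := by
    by_cases h0 : i = 0
    · exact ⟨1, by simp, by rw [h0]; simp⟩
    · exact ⟨0, by simp, fun e => h0 e.symm⟩
  have := kills_model (show p + 2 + 1 ≤ k + 3 by omega) (key (Pi.single j 1)) ⟨j, hj.1⟩ ⟨i, hi⟩
  have e1 : Fin.castLE (show p + 2 + 1 ≤ k + 3 by omega) ⟨j, hj.1⟩ = j := rfl
  have e2 : Fin.castLE (show p + 2 + 1 ≤ k + 3 by omega) ⟨i, hi⟩ = i := rfl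
  rw [e1, e2, Pi.single_eq_same, Pi.single_eq_of_ne hj.2.symm] at this
  simpa using this

/-- the Hessian of a first integral with vanishing differential -/
lemma kills_second {P : (Fin (k+3) → ℂ) → MultiVecC (k+3) (p+2)} (hpk : p ≤ k) (hP : AnalyticAt ℂ P 0) (hP0 : P 0 = 0)
    {c : ℂ} (hc : c ≠ 0) (hl : ∀ v, fderiv ℂ P 0 v = c • modelPiC (k+3) (p+2) v)
    {F : (Fin (k+3) → ℂ) → (Fin (k+3) → ℂ)} (hF : AnalyticAt ℂ F 0)
    (hk : ∀ᶠ x in 𝓝 0, ∀ a, Kills (jacC F x a) (P x)) (a : Fin (k+3)) (ha : jacC F 0 a = 0)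
    (h2 : D2 (fun x => F x a) (Pi.single 0 1) (Pi.single 0 1) = 2) (i j : Fin (k+3)) (hi : (i:ℕ) < p + 3) (hj : (j:ℕ) < p + 3) :
    D2 (fun x => F x a) (Pi.single i 1) (Pi.single j 1) = if i = j then 2 else 0 := by
  have hFa : AnalyticAt ℂ (fun x => F x a) 0 := analyticAt_pi_iff.1 hF a
  have ej : ∀ᶠ x in 𝓝 (0 : Fin (k+3) → ℂ), ∀ j, jacC F x a j = fderiv ℂ (fun x => F x a) x (Pi.single j 1) := by
    filter_upwards [hF.eventually_analyticAt] with x hx j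
    have := (hasFDerivAt_pi'.1 hx.differentiableAt.hasFDerivAt a).fderiv
    rw [this]; rfl
  have key : ∀ v, Kills (fun j => D2 (fun x => F x a) v (Pi.single j 1)) (modelPiC (k+3) (p+2) v) := by
    intro v
    have h1 := line_lim hP.differentiableAt hP0 v
    have h2 : Tendsto (fun t : ℂ => t⁻¹ • jacC F (t • v) a) (𝓝[≠] 0) (𝓝 (fun j => D2 (fun x => F x a) v (Pi.single j 1))) := by
      rw [tendsto_pi_nhds]
      intro j
      have h3 := line_lim (an_fd hFa (Pi.single j 1)).differentiableAt (by
        have := ej.self_of_nhds j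
        rw [← this, ha]; rfl) v
      refine h3.congr' ?_
      filter_upwards [line_in v ej] with t ht
      rw [Pi.smul_apply, ht j]
    have h3 := kills_lim h2 h1 (by
      filter_upwards [line_in v hk] with t ht
      exact ((ht a).smul _).smul_right _)
    rw [hl] at h3
    have := h3.smul_right c⁻¹
    rwa [inv_smul_smul₀ hc] at this
  have hm : p + 2 + 1 ≤ k + 3 := by omega
  have key2 : ∀ v (i j : Fin (k+3)), (i:ℕ) < p + 3 → (j:ℕ) < p + 3 → v i * D2 (fun x => F x a) v (Pi.single j 1) = v j * D2 (fun x => F x a) v (Pi.single i 1) := by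
    intro v i j hi hj
    exact kills_model hm (key v) ⟨i, hi⟩ ⟨j, hj⟩
  have off : ∀ i j : Fin (k+3), (i:ℕ) < p + 3 → (j:ℕ) < p + 3 → i ≠ j → D2 (fun x => F x a) (Pi.single i 1) (Pi.single j 1) = 0 := by
    intro i j hi hj hij
    have := key2 (Pi.single i 1) i j hi hj
    rw [Pi.single_eq_same, Pi.single_eq_of_ne hij.symm] at this
    simpa using this
  have hadd : ∀ u v w, D2 (fun x => F x a) (u + v) w = D2 (fun x => F x a) u w + D2 (fun x => F x a) v w := by
    intro u v w; simp [D2]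
  by_cases hij : i = j
  · subst hij
    rw [if_pos rfl]
    by_cases h0 : i = 0
    · rw [h0]; exact h2
    · have := key2 (Pi.single 0 1 + Pi.single i 1) 0 i (by simp) hi
      rw [hadd, hadd, off 0 i (by simp) hi (Ne.symm h0), off i 0 hi (by simp) h0, h2] at this
      simpa [Pi.single_eq_of_ne h0, Pi.single_eq_of_ne (Ne.symm h0)] using this
  · rw [if_neg hij]; exact off i j hi hj hij

/-- normalised first integrals -/
theorem nf {P : (Fin (k+3) → ℂ) → MultiVecC (k+3) (p+2)} (hpk : p ≤ k) (hP : AnalyticAt ℂ P 0) (hP0 : P 0 = 0)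
    {c : ℂ} (hc : c ≠ 0) (hl : ∀ v, fderiv ℂ P 0 v = c • modelPiC (k+3) (p+2) v)
    {F : (Fin (k+3) → ℂ) → (Fin (k+3) → ℂ)} (hF : AnalyticOnNhd ℂ F (ball 0 (1/4)))
    (hcl : ∀ x ∈ ball (0 : Fin (k+3) → ℂ) (1/4), ‖F x - F0 p x‖ ≤ 1 / (4000 * (k+3)))
    (hk : ∀ x ∈ ball (0 : Fin (k+3) → ℂ) (1/4), ∀ a, Kills (jacC F x a) (P x)) :
    ∃ F' : (Fin (k+3) → ℂ) → (Fin (k+3) → ℂ), AnalyticAt ℂ F' 0 ∧ F' 0 = 0 ∧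
      (∀ᶠ x in 𝓝 0, ∀ a, Kills (jacC F' x a) (P x)) ∧ (∀ v (l : Fin (k+3)), p + 3 ≤ (l:ℕ) → fderiv ℂ F' 0 v l = v l) ∧
      (∀ v, fderiv ℂ F' 0 v 1 = 0) ∧ ∀ i j : Fin (k+3), (i:ℕ) < p + 3 → (j:ℕ) < p + 3 →
        D2 (fun x => F' x 1) (Pi.single i 1) (Pi.single j 1) = if i = j then 2 else 0 := by
  have h0b : (0 : Fin (k+3) → ℂ) ∈ ball (0 : Fin (k+3) → ℂ) (1/4) := by simp
  have hFb : ∀ b, ∀ x ∈ ball (0 : Fin (k+3) → ℂ) (1/4), AnalyticAt ℂ (fun x => F x b) x := fun b x hx => analyticAt_pi_iff.1 (hF x hx) b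
  set A : Matrix (Fin (k+3)) (Fin (k+3)) ℂ := Matrix.of fun a b =>
    if a = 1 then 2⁻¹ * D2 (fun x => F x b) (Pi.single 0 1) (Pi.single 0 1) else if p + 3 ≤ (a:ℕ) then fderiv ℂ (fun x => F x b) 0 (Pi.single a 1)
    else if a = b then 1 else 0 with hA
  have hs : ∀ i : Fin (k+3), ‖(Pi.single i 1 : Fin (k+3) → ℂ)‖ ≤ 1 := by
    intro i
    refine (pi_norm_le_iff_of_nonneg zero_le_one).2 fun j => ?_
    by_cases h : j = i
    · subst h; simp
    · simp [Pi.single_eq_of_ne h]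
  set η : ℝ := 1 / (4 * (k+3)) with hη
  have hη0 : 0 < η := by positivity
  have hA1 : ∀ a b, ‖A a b - if a = b then 1 else 0‖ ≤ η := by
    intro a b
    have hb := fun (v w : Fin (k+3) → ℂ) hv hw => D2_bound (g := fun x => F x b - F0 p x b) (C := 1 / (4000 * (k+3))) (v := v) (w := w)
      (fun x hx => (hFb b x hx).sub (F0_an x b))
      (fun x hx => (norm_le_pi_norm (F x - F0 p x) b).trans (hcl x hx)) hv hw
    have e1000 : 1000 * (1 / (4000 * ((k:ℝ)+3))) = η := by rw [hη]; field_simp; norm_num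
    rw [e1000] at hb
    simp only [hA, Matrix.of_apply]
    by_cases ha1 : a = 1
    · subst ha1
      rw [if_pos rfl]
      have h1 := (hb (Pi.single 0 1) (Pi.single 0 1) (hs 0) (hs 0)).2
      rw [D2_sub (hFb b 0 h0b) (F0_an 0 b)] at h1
      have h2 : D2 (fun x => F0 p x b) (Pi.single 0 1) (Pi.single 0 1) = if (1 : Fin (k+3)) = b then 2 else 0 := by
        unfold D2
        simp only [F0_fd]
        by_cases hb1 : b = 1
        · subst hb1
          simp only [if_true]
          have : (fun x : Fin (k+3) → ℂ => dQ p x ⬝ᵥ Pi.single 0 1) = fun x => 2 * x 0 := by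
            funext x; rw [dotProduct_single_one, dQ_apply, if_pos (by simp)]
          rw [this, ((hasFDerivAt_apply (𝕜 := ℂ) (0 : Fin (k+3)) 0).const_mul (2:ℂ)).fderiv]
          simp
        · rw [if_neg (Ne.symm hb1)]
          simp only [if_neg hb1]
          simp
      rw [h2] at h1
      have e : 2⁻¹ * D2 (fun x => F x b) (Pi.single 0 1) (Pi.single 0 1) - (if (1 : Fin (k+3)) = b then 1 else 0) =
          2⁻¹ * (D2 (fun x => F x b) (Pi.single 0 1) (Pi.single 0 1) - (if (1 : Fin (k+3)) = b then 2 else 0)) := by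
        split_ifs <;> ring
      rw [e, norm_mul]
      have : ‖(2⁻¹ : ℂ)‖ ≤ 1 := by norm_num
      calc _ ≤ 1 * η := by gcongr
        _ = η := one_mul _
    · rw [if_neg ha1]
      by_cases ha : p + 3 ≤ (a:ℕ)
      · rw [if_pos ha]
        have h1 := (hb (Pi.single a 1) (Pi.single a 1) (hs a) (hs a)).1
        rw [fderiv_fun_sub (hFb b 0 h0b).differentiableAt (F0_an 0 b).differentiableAt, _root_.sub_apply, F0_fd] at h1
        convert h1 using 3
        by_cases hb1 : b = 1
        · rw [if_pos hb1, if_neg (fun e => ha1 (e.trans hb1)), dotProduct_single_one, dQ_apply, if_neg (by omega)]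
        · rw [if_neg hb1]
          by_cases hab : a = b
          · subst hab; rw [if_pos rfl, if_neg (by omega), Pi.single_eq_same]
          · rw [if_neg hab, Pi.single_eq_of_ne (Ne.symm hab)]; simp
      · rw [if_neg ha, sub_self, norm_zero]; exact hη0.le
  have hdet : A.det ≠ 0 := by
    apply det_ne_zero_of_sum_row_lt_diag
    intro a
    have h1 : ∑ b ∈ Finset.univ.erase a, ‖A a b‖ ≤ ∑ b ∈ Finset.univ.erase a, η := by
      refine Finset.sum_le_sum fun b hb => ?_
      have := hA1 a b
      rwa [if_neg (Finset.ne_of_mem_erase hb).symm, sub_zero] at this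
    have h2 : ∑ b ∈ Finset.univ.erase a, η ≤ 1/4 := by
      rw [Finset.sum_const, Finset.card_erase_of_mem (Finset.mem_univ _), Finset.card_univ, Fintype.card_fin, nsmul_eq_mul]
      have : ((k + 3 - 1 : ℕ) : ℝ) ≤ k + 3 := by push_cast [Nat.add_sub_assoc]; linarith
      calc _ ≤ ((k:ℝ)+3) * η := by gcongr
        _ = 1/4 := by rw [hη]; field_simp
    have h3 := hA1 a a
    rw [if_pos rfl] at h3
    have h4 : η ≤ 1/4 := by
      rw [hη]; rw [div_le_div_iff₀ (by positivity) (by norm_num)]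
      have : (0:ℝ) ≤ k := by positivity
      linarith
    have h5 : (1:ℝ) ≤ ‖A a a‖ + ‖A a a - 1‖ := by
      have := norm_sub_le (A a a) (A a a - 1)
      simpa using this
    linarith
  have hAN : A * A⁻¹ = 1 := Matrix.mul_nonsing_inv _ (by rwa [isUnit_iff_ne_zero])
  set F' : (Fin (k+3) → ℂ) → (Fin (k+3) → ℂ) := fun x a => ∑ b, A⁻¹ b a * (F x b - F 0 b) with hF'
  have hsubA : ∀ b, ∀ x ∈ ball (0 : Fin (k+3) → ℂ) (1/4), AnalyticAt ℂ (fun x => F x b - F 0 b) x := fun b x hx => (hFb b x hx).sub analyticAt_const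
  have F'an : ∀ x ∈ ball (0 : Fin (k+3) → ℂ) (1/4), AnalyticAt ℂ F' x := by
    intro x hx
    refine analyticAt_pi_iff.2 fun a => Finset.analyticAt_fun_sum _ fun b _ => ?_
    exact analyticAt_const.mul (hsubA b x hx)
  have hfs : ∀ b x, fderiv ℂ (fun x => F x b - F 0 b) x = fderiv ℂ (fun x => F x b) x := fun b x => fderiv_sub_const _
  have hD2s : ∀ b v w, D2 (fun x => F x b - F 0 b) v w = D2 (fun x => F x b) v w := by
    intro b v w; unfold D2; simp only [hfs]
  have hfd : ∀ x ∈ ball (0 : Fin (k+3) → ℂ) (1/4), ∀ a v, fderiv ℂ F' x v a = ∑ b, A⁻¹ b a * fderiv ℂ (fun x => F x b) x v := by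
    intro x hx a v
    have h1 := (hasFDerivAt_pi'.1 (F'an x hx).differentiableAt.hasFDerivAt a).fderiv
    have h2 : fderiv ℂ F' x v a = fderiv ℂ (fun x => F' x a) x v := by rw [h1]; rfl
    rw [h2, hF', fd_lin (fun b => (hsubA b x hx).differentiableAt)]
    simp only [hfs]
  have hjac : ∀ x ∈ ball (0 : Fin (k+3) → ℂ) (1/4), ∀ a, jacC F' x a = ∑ b, A⁻¹ b a • jacC F x b := by
    intro x hx a
    funext j
    rw [Finset.sum_apply]
    refine (hfd x hx a (Pi.single j 1)).trans (Finset.sum_congr rfl fun b _ => ?_)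
    have h1 := (hasFDerivAt_pi'.1 (hF x hx).differentiableAt.hasFDerivAt b).fderiv
    rw [h1]; rfl
  have hkF' : ∀ x ∈ ball (0 : Fin (k+3) → ℂ) (1/4), ∀ a, Kills (jacC F' x a) (P x) := by
    intro x hx a
    rw [hjac x hx a]
    exact Kills.sum fun b _ => (hk x hx b).smul _
  have hkev : ∀ᶠ x in 𝓝 (0 : Fin (k+3) → ℂ), ∀ a, Kills (jacC F' x a) (P x) := by
    filter_upwards [isOpen_ball.mem_nhds h0b] with x hx using hkF' x hx
  have hAe : ∀ a c, ∑ b, A a b * A⁻¹ b c = if a = c then 1 else 0 := by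
    intro a c
    rw [← Matrix.mul_apply, hAN, Matrix.one_apply]
  have hy : ∀ a (l : Fin (k+3)), p + 3 ≤ (l:ℕ) → fderiv ℂ F' 0 (Pi.single l 1) a = if l = a then 1 else 0 := by
    intro a l hl'
    rw [hfd 0 h0b, ← hAe]
    refine Finset.sum_congr rfl fun b _ => ?_
    rw [mul_comm]; congr 1
    have : l ≠ 1 := by intro e; rw [e] at hl'; simp at hl'
    simp only [hA, Matrix.of_apply, if_neg this, if_pos hl']
  have hx : ∀ a (i : Fin (k+3)), (i:ℕ) < p + 3 → fderiv ℂ F' 0 (Pi.single i 1) a = 0 := by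
    intro a i hi
    exact kills_first hpk hP hP0 hc hl (F'an 0 h0b) hkev a i hi
  have hall : ∀ a v, fderiv ℂ F' 0 v a = ∑ i, v i * fderiv ℂ F' 0 (Pi.single i 1) a := by
    intro a v
    rw [← jac_dot, dotProduct]
    exact Finset.sum_congr rfl fun i _ => mul_comm _ _
  have hj1 : jacC F' 0 1 = 0 := by
    funext j
    show fderiv ℂ F' 0 (Pi.single j 1) 1 = 0
    by_cases hj : (j:ℕ) < p + 3
    · exact hx 1 j hj
    · rw [hy 1 j (by omega), if_neg]
      intro e; rw [e] at hj; simp at hj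
  refine ⟨F', F'an 0 h0b, ?_, hkev, ?_, ?_, ?_⟩
  · funext a; simp [hF']
  · intro v l hl'
    rw [hall, Finset.sum_eq_single l]
    · rw [hy l l hl', if_pos rfl, mul_one]
    · intro i _ hil
      by_cases hi : (i:ℕ) < p + 3
      · rw [hx l i hi, mul_zero]
      · rw [hy l i (by omega), if_neg hil, mul_zero]
    · simp
  · intro v
    rw [← jac_dot, hj1, zero_dotProduct]
  · refine kills_second hpk hP hP0 hc hl (F'an 0 h0b) hkev 1 hj1 ?_
    simp only [hF']
    rw [D2_lin (f := fun b x => F x b - F 0 b) (c := fun b => A⁻¹ b 1) (fun b => hsubA b 0 h0b)]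
    simp only [hD2s]
    have := hAe 1 1
    rw [if_pos rfl] at this
    simp only [hA, Matrix.of_apply, if_true] at this
    rw [← hA] at this
    calc _ = 2 * ∑ b, 2⁻¹ * D2 (fun x => F x b) (Pi.single 0 1) (Pi.single 0 1) * A⁻¹ b 1 := by
          rw [Finset.mul_sum]; exact Finset.sum_congr rfl fun b _ => by ring
      _ = 2 := by rw [this, mul_one]
end NF2
section GDs
variable {V : Type*} [NormedAddCommGroup V] [NormedSpace ℂ V]

/-- analytic germs of diffeomorphisms fixing the origin -/
def GD (φ : V → V) : Prop := AnalyticAt ℂ φ 0 ∧ φ 0 = 0 ∧ ∀ v, fderiv ℂ φ 0 v = 0 → v = 0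

lemma GD.tendsto {φ : V → V} (h : GD φ) : Tendsto φ (𝓝 0) (𝓝 0) := by
  have := h.1.continuousAt.tendsto; rwa [h.2.1] at this

lemma GD.comp {φ χ : V → V} (h : GD χ) (h' : GD φ) : GD (fun x => χ (φ x)) := by
  have h1 : AnalyticAt ℂ χ (φ 0) := by rw [h'.2.1]; exact h.1
  refine ⟨AnalyticAt.comp (g := χ) h1 h'.1, by show χ (φ 0) = 0; rw [h'.2.1, h.2.1], fun v hv => ?_⟩
  have e : fderiv ℂ (fun x => χ (φ x)) 0 = (fderiv ℂ χ (φ 0)).comp (fderiv ℂ φ 0) :=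
    fderiv_comp 0 h1.differentiableAt h'.1.differentiableAt
  rw [e, h'.2.1] at hv
  exact h'.2.2 _ (h.2.2 _ hv)

lemma GD.of_fd {φ : V → V} (h : AnalyticAt ℂ φ 0) (h0 : φ 0 = 0) (h1 : ∀ v, fderiv ℂ φ 0 v = v) : GD φ :=
  ⟨h, h0, fun v hv => by rwa [h1] at hv⟩

lemma GD.inv [FiniteDimensional ℂ V] {φ : V → V} (h : GD φ) :
    ∃ θ : V → V, GD θ ∧ (∀ᶠ x in 𝓝 0, θ (φ x) = x) ∧ ∀ᶠ y in 𝓝 0, φ (θ y) = y := by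
  have : CompleteSpace V := FiniteDimensional.complete ℂ V
  obtain ⟨h1, h2, h3⟩ := h
  have hinj : Function.Injective (fderiv ℂ φ 0 : V →ₗ[ℂ] V) := by
    rw [← LinearMap.ker_eq_bot, LinearMap.ker_eq_bot']
    exact h3
  set L : V ≃L[ℂ] V := (LinearEquiv.ofInjectiveEndo _ hinj).toContinuousLinearEquiv with hL
  have hLe : (L : V →L[ℂ] V) = fderiv ℂ φ 0 := by ext v; rfl
  have hs : HasStrictFDerivAt φ (L : V →L[ℂ] V) 0 := by rw [hLe]; exact h1.hasStrictFDerivAt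
  set R := hs.toOpenPartialHomeomorph φ with hR
  have hm : (0 : V) ∈ R.source := hs.mem_toOpenPartialHomeomorph_source
  have hm2 : (0 : V) ∈ R.target := by
    have := R.map_source hm
    rwa [show R 0 = 0 from h2] at this
  have hs0 : R.symm 0 = 0 := by
    have := R.left_inv hm
    rwa [show R 0 = 0 from h2] at this
  have ha : AnalyticAt ℂ R.symm 0 := by
    have := R.analyticAt_symm' (i := L) hm (show AnalyticAt ℂ R 0 from h1) (by
      show fderiv ℂ φ 0 = _
      rw [hLe])
    rwa [show R 0 = 0 from h2] at this
  have hl : ∀ᶠ x in 𝓝 0, R.symm (φ x) = x := by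
    filter_upwards [R.open_source.mem_nhds hm] with x hx using R.left_inv hx
  have hr : ∀ᶠ x in 𝓝 0, φ (R.symm x) = x := by
    filter_upwards [R.open_target.mem_nhds hm2] with x hx using R.right_inv hx
  refine ⟨R.symm, ⟨ha, hs0, fun v hv => ?_⟩, hl, hr⟩
  have e : fderiv ℂ (fun x => φ (R.symm x)) 0 = (fderiv ℂ φ (R.symm 0)).comp (fderiv ℂ R.symm 0) :=
    fderiv_comp 0 (by rw [hs0]; exact h1.differentiableAt) ha.differentiableAt
  have e2 : fderiv ℂ (fun x => φ (R.symm x)) 0 = ContinuousLinearMap.id ℂ V := by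
    rw [Filter.EventuallyEq.fderiv_eq (f := fun x => x) hr]; exact fderiv_id'
  have := congrArg (fun L => L v) (e.symm.trans e2)
  simp [hv] at this
  exact this.symm

lemma GD.jac {n : ℕ} {φ : (Fin n → ℂ) → (Fin n → ℂ)} (h : GD φ) : ∃ K, K * jacC φ 0 = 1 := by
  obtain ⟨θ, hθ, h1, _⟩ := h.inv
  refine ⟨jacC θ (φ 0), ?_⟩
  rw [← jac_comp (by rw [h.2.1]; exact hθ.1.differentiableAt) h.1.differentiableAt, ← jac_id 0]
  exact jac_congr h1

lemma GD.of_jac {n : ℕ} {φ : (Fin n → ℂ) → (Fin n → ℂ)} (h : AnalyticAt ℂ φ 0) (h0 : φ 0 = 0)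
    {K} (hK : K * jacC φ 0 = 1) : GD φ := by
  refine ⟨h, h0, fun v hv => ?_⟩
  rw [← jac_mulVec] at hv
  rw [← Matrix.one_mulVec v, ← hK, ← Matrix.mulVec_mulVec, hv, Matrix.mulVec_zero]

/-- derivative of the inverse germ -/
lemma GD.inv_fd {φ θ : V → V} (h : GD φ) (hθ : GD θ) (h1 : ∀ᶠ x in 𝓝 0, θ (φ x) = x) {v w : V} (hv : fderiv ℂ φ 0 v = w) :
    fderiv ℂ θ 0 w = v := by
  have e : fderiv ℂ (fun x => θ (φ x)) 0 = (fderiv ℂ θ (φ 0)).comp (fderiv ℂ φ 0) :=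
    fderiv_comp 0 (by rw [h.2.1]; exact hθ.1.differentiableAt) h.1.differentiableAt
  have e2 : fderiv ℂ (fun x => θ (φ x)) 0 = ContinuousLinearMap.id ℂ V := by
    rw [Filter.EventuallyEq.fderiv_eq (f := fun x => x) h1]; exact fderiv_id'
  have := congrArg (fun L => L v) (e.symm.trans e2)
  simpa [hv, h.2.1] using this

lemma D2_comp {n : ℕ} {H : (Fin n → ℂ) → ℂ} {θ : (Fin n → ℂ) → (Fin n → ℂ)} (hH : AnalyticAt ℂ H 0) (hθ : AnalyticAt ℂ θ 0)
    (h0 : θ 0 = 0) (hd : fderiv ℂ H 0 = 0) (v w : Fin n → ℂ) :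
    D2 (fun x => H (θ x)) v w = D2 H (fderiv ℂ θ 0 v) (fderiv ℂ θ 0 w) := by
  have hH' : AnalyticAt ℂ H (θ 0) := by rw [h0]; exact hH
  have hc : Tendsto θ (𝓝 0) (𝓝 0) := by have := hθ.continuousAt.tendsto; rwa [h0] at this
  have e1 : (fun x => fderiv ℂ (fun x => H (θ x)) x w) =ᶠ[𝓝 0] fun x => fderiv ℂ H (θ x) (fderiv ℂ θ x w) := by
    filter_upwards [hθ.eventually_analyticAt, hc.eventually hH.eventually_analyticAt] with x hx hx'
    have : fderiv ℂ (fun x => H (θ x)) x = (fderiv ℂ H (θ x)).comp (fderiv ℂ θ x) := fderiv_comp x hx'.differentiableAt hx.differentiableAt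
    rw [this]; rfl
  have d1 : HasFDerivAt (fderiv ℂ H) (fderiv ℂ (fderiv ℂ H) 0) (θ 0) := by rw [h0]; exact hH.fderiv.differentiableAt.hasFDerivAt
  have d2 := HasFDerivAt.comp (0 : Fin n → ℂ) d1 hθ.differentiableAt.hasFDerivAt
  have d3 : HasFDerivAt (fun x => fderiv ℂ θ x w) (fderiv ℂ (fun x => fderiv ℂ θ x w) 0) 0 :=
    (hθ.fderiv.differentiableAt.clm_apply (differentiableAt_const w)).hasFDerivAt
  have d4 := d2.clm_apply d3
  have d5 : fderiv ℂ (fun x => fderiv ℂ H (θ x) (fderiv ℂ θ x w)) 0 = _ := d4.fderiv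
  unfold D2
  rw [e1.fderiv_eq, d5]
  have d6 := (hH.fderiv.differentiableAt.hasFDerivAt.clm_apply (hasFDerivAt_const (fderiv ℂ θ 0 w) (0 : Fin n → ℂ))).fderiv
  rw [d6]
  simp [h0, hd]
end GDs
section Morse

lemma fd_line {V W : Type*} [NormedAddCommGroup V] [NormedSpace ℂ V] [NormedAddCommGroup W] [NormedSpace ℂ W]
    {f : V → W} {v : V} {w : W} (hf : DifferentiableAt ℂ f 0) (h : HasDerivAt (fun t : ℂ => f (t • v)) w 0) :
    fderiv ℂ f 0 v = w := by
  have h1 : HasDerivAt (fun t : ℂ => t • v) v 0 := by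
    simpa using (hasDerivAt_id (0:ℂ)).smul_const v
  have h2 : HasFDerivAt f (fderiv ℂ f 0) ((0:ℂ) • v) := by rw [zero_smul]; exact hf.hasFDerivAt
  exact (h2.comp_hasDerivAt (0:ℂ) h1).unique h

lemma sqrtM (m : ℕ) : ∃ β : (Fin m → Fin m → ℂ) → (Fin m → Fin m → ℂ), AnalyticAt ℂ β 0 ∧ β 0 = 0 ∧
    ∀ᶠ S in 𝓝 0, ∀ i j, 2 * β S i j + ∑ k, β S i k * β S j k = S i j := by
  set g : (Fin m → Fin m → ℂ) → (Fin m → Fin m → ℂ) := fun B i j => 2 * B i j + ∑ k, B i k * B j k with hg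
  have hga : AnalyticAt ℂ g 0 := by
    have hc : ∀ i j, AnalyticAt ℂ (fun B : Fin m → Fin m → ℂ => B i j) 0 := fun i j =>
      ((ContinuousLinearMap.proj (R := ℂ) (φ := fun _ : Fin m => ℂ) j).comp
        (ContinuousLinearMap.proj (R := ℂ) (φ := fun _ : Fin m => Fin m → ℂ) i)).analyticAt 0
    refine analyticAt_pi_iff.2 fun i => analyticAt_pi_iff.2 fun j => ?_
    exact (analyticAt_const.mul (hc i j)).add (Finset.analyticAt_fun_sum _ fun k _ => (hc i k).mul (hc j k))
  have hG : GD g := by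
    refine ⟨hga, by ext i j; simp [hg], fun v hv => ?_⟩
    have : fderiv ℂ g 0 v = (2:ℂ) • v := by
      refine fd_line hga.differentiableAt (hasDerivAt_pi.2 fun i => hasDerivAt_pi.2 fun j => ?_)
      have e : (fun t : ℂ => g (t • v) i j) = fun t => t * (2 * v i j) + t^2 * ∑ k, v i k * v j k := by
        ext t
        simp only [hg, Pi.smul_apply, smul_eq_mul, Finset.mul_sum]
        congr 1
        · ring
        · exact Finset.sum_congr rfl fun k _ => by ring
      show HasDerivAt (fun t : ℂ => g (t • v) i j) _ 0
      rw [e]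
      have := ((hasDerivAt_id (0:ℂ)).mul_const (2 * v i j)).add (((hasDerivAt_id (0:ℂ)).pow 2).mul_const (∑ k, v i k * v j k))
      refine this.congr_deriv ?_
      simp
    rw [this] at hv
    simpa using hv
  obtain ⟨θ, h1, -, h3⟩ := hG.inv
  refine ⟨θ, h1.1, h1.2.1, ?_⟩
  filter_upwards [h3] with S hS i j
  exact congrFun (congrFun hS i) j

lemma sq_alg {m : ℕ} (x : Fin m → ℂ) (b S : Fin m → Fin m → ℂ)
    (hb : ∀ i j, 2 * b i j + ∑ k, b i k * b j k = S i j - if i = j then 1 else 0) :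
    ∑ k, (x k + ∑ i, b i k * x i)^2 = ∑ j, x j * ∑ i, x i * S i j := by
  have hS : ∀ i j, S i j = 2 * b i j + ∑ k, b i k * b j k + if i = j then 1 else 0 := fun i j => by rw [hb]; ring
  simp only [hS, mul_add, Finset.sum_add_distrib, mul_ite, mul_one, mul_zero, Finset.sum_ite_eq', Finset.mem_univ, if_true]
  have h1 : ∀ k, (x k + ∑ i, b i k * x i)^2 = x k * x k + x k * ∑ i, x i * (2 * b i k) + ∑ i, ∑ j, (b i k * x i) * (b j k * x j) := by
    intro k
    rw [← Finset.sum_mul_sum]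
    have : ∑ i, x i * (2 * b i k) = 2 * ∑ i, b i k * x i := by
      rw [Finset.mul_sum]; exact Finset.sum_congr rfl fun i _ => by ring
    rw [this]; ring
  rw [Finset.sum_congr rfl fun k _ => h1 k]
  simp only [Finset.sum_add_distrib]
  have h2 : ∑ k, ∑ i, ∑ j, (b i k * x i) * (b j k * x j) = ∑ j, x j * ∑ i, x i * ∑ k, b i k * b j k := by
    rw [Finset.sum_comm]
    simp only [Finset.mul_sum]
    rw [Finset.sum_congr rfl fun i _ => Finset.sum_comm, Finset.sum_comm]
    exact Finset.sum_congr rfl fun j _ => Finset.sum_congr rfl fun i _ => Finset.sum_congr rfl fun k _ => by ring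
  rw [h2]; ring

/-- the finset of the first m indices -/
def Sm (n m : ℕ) : Finset (Fin n) := Finset.univ.filter fun i => (i : ℕ) < m

lemma mem_Sm {n m : ℕ} {i : Fin n} : i ∈ Sm n m ↔ (i : ℕ) < m := by simp [Sm]

lemma bp_sum {n m : ℕ} (h : m ≤ n) (x : Fin n → ℂ) :
    bp (Sm n m) x = ∑ j : Fin m, x (Fin.castLE h j) • (Pi.single (Fin.castLE h j) 1 : Fin n → ℂ) := by
  ext i
  rw [bp_apply, Finset.sum_apply]
  simp only [Pi.smul_apply, smul_eq_mul, mem_Sm, Pi.single_apply, mul_ite, mul_one, mul_zero]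
  split_ifs with hi
  · rw [Finset.sum_eq_single ⟨i, hi⟩]
    · simp
    · intro b _ hb
      rw [if_neg]; rintro rfl; exact hb rfl
    · simp
  · refine (Finset.sum_eq_zero fun j _ => if_neg ?_).symm
    rintro rfl; exact hi j.2

lemma fd_sum {n m : ℕ} (h : m ≤ n) (L : (Fin n → ℂ) →L[ℂ] ℂ) (x : Fin n → ℂ) :
    L (bp (Sm n m) x) = ∑ j : Fin m, x (Fin.castLE h j) * L (Pi.single (Fin.castLE h j) 1) := by
  rw [bp_sum h, map_sum]; simp

lemma zt_norm {n m : ℕ} (x : Fin n → ℂ) (t : ℝ) (ht : t ∈ Icc (0:ℝ) 1) :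
    ‖bp (Sm n m)ᶜ x + (t:ℂ) • bp (Sm n m) x‖ ≤ ‖x‖ := by
  refine (pi_norm_le_iff_of_nonneg (norm_nonneg _)).2 fun i => ?_
  simp only [Pi.add_apply, Pi.smul_apply, bp_apply, Finset.mem_compl, smul_eq_mul]
  by_cases hi : i ∈ Sm n m
  · simp only [hi, not_true, if_false, if_true, zero_add, norm_mul, Complex.norm_real]
    rw [Real.norm_of_nonneg ht.1]
    have := norm_le_pi_norm x i
    nlinarith [ht.2, norm_nonneg (x i)]
  · simp only [hi, not_false_eq_true, if_false, if_true, mul_zero, add_zero]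
    exact norm_le_pi_norm x i

lemma M1 {n m : ℕ} (h : m ≤ n) {G : (Fin n → ℂ) → ℂ} (hG : AnalyticAt ℂ G 0)
    (hc : ∀ᶠ x in 𝓝 0, ∀ i : Fin m, fderiv ℂ G (bp (Sm n m)ᶜ x) (Pi.single (Fin.castLE h i) 1) = 0)
    (hd : ∀ i j : Fin m, D2 G (Pi.single (Fin.castLE h i) 1) (Pi.single (Fin.castLE h j) 1) = if i = j then 2 else 0) :
    ∃ μ : (Fin n → ℂ) → (Fin n → ℂ), GD μ ∧ (∀ x, ∀ l : Fin n, m ≤ (l : ℕ) → μ x l = x l) ∧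
      ∀ᶠ x in 𝓝 0, G x = ∑ i : Fin m, (μ x (Fin.castLE h i))^2 + G (bp (Sm n m)ᶜ x) := by
  obtain ⟨r, hr, hGr⟩ : ∃ r > 0, AnalyticOnNhd ℂ G (ball 0 r) := by
    obtain ⟨r, hr, h'⟩ := Metric.eventually_nhds_iff_ball.1 hG.eventually_analyticAt
    exact ⟨r, hr, h'⟩
  set e : Fin m → (Fin n → ℂ) := fun i => Pi.single (Fin.castLE h i) 1 with he
  have hfa : ∀ j, AnalyticOnNhd ℂ (fun z => fderiv ℂ G z (e j)) (ball 0 r) := fun j z hz => an_fd (hGr z hz) (e j)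
  set hh : Fin m → Fin m → (Fin n → ℂ) → ℂ := fun i j z => fderiv ℂ (fun z => fderiv ℂ G z (e j)) z (e i) with hhd
  have hha : ∀ i j, AnalyticOnNhd ℂ (hh i j) (ball 0 r) := fun i j z hz => an_fd (hfa j z hz) (e i)
  set zt : (Fin n → ℂ) → ℝ → (Fin n → ℂ) := fun x t => bp (Sm n m)ᶜ x + (t:ℂ) • bp (Sm n m) x with hzt
  have hzm : ∀ x ∈ ball (0 : Fin n → ℂ) r, ∀ t ∈ Icc (0:ℝ) 1, zt x t ∈ ball (0 : Fin n → ℂ) r := by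
    intro x hx t ht
    rw [mem_ball_zero_iff] at hx ⊢
    exact (zt_norm x t ht).trans_lt hx
  have hzc : Continuous fun p : (Fin n → ℂ) × ℝ => zt p.1 p.2 := by
    simp only [hzt]; fun_prop
  set S : (Fin n → ℂ) → Fin m → Fin m → ℂ := fun x i j => ∫ t in (0:ℝ)..1, (1 - (t:ℂ)) * hh i j (zt x t) with hS
  have hcont : ∀ i j, ContinuousOn (fun p : (Fin n → ℂ) × ℝ => (1 - (p.2:ℂ)) * hh i j (zt p.1 p.2)) (ball 0 r ×ˢ Icc (0:ℝ) 1) := by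
    intro i j
    refine ContinuousOn.mul (by fun_prop) ?_
    exact (hha i j).continuousOn.comp hzc.continuousOn fun p hp => hzm p.1 hp.1 p.2 hp.2
  have hSa : ∀ i j, AnalyticOnNhd ℂ (fun x => S x i j) (ball 0 r) := by
    intro i j
    refine analytic_integral zero_le_one isOpen_ball (hcont i j) fun t ht x hx => ?_
    refine analyticAt_const.mul (AnalyticAt.comp (g := hh i j) (f := fun x => zt x t) (hha i j _ (hzm x hx t ht)) ?_)
    exact ((bp (Sm n m)ᶜ).analyticAt x).add (analyticAt_const.fun_smul ((bp (Sm n m)).analyticAt x))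
  have hS0 : ∀ i j, S 0 i j = if i = j then 1 else 0 := by
    intro i j
    have e0 : ∀ t : ℝ, zt 0 t = 0 := fun t => by simp [hzt]
    have e1 : hh i j 0 = if i = j then 2 else 0 := hd i j
    simp only [hS, e0, e1]
    rw [intervalIntegral.integral_mul_const]
    have : ∫ t in (0:ℝ)..1, (1 - (t:ℂ)) = 1/2 := by
      have : ∀ t : ℝ, (1 - (t:ℂ)) = ((1 - t : ℝ) : ℂ) := fun t => by push_cast; rfl
      simp only [this]
      rw [intervalIntegral.integral_ofReal]
      rw [intervalIntegral.integral_sub (by simp) (by simp), integral_id]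
      norm_num
    rw [this]; split_ifs <;> norm_num
  have hintg : ∀ x ∈ ball (0 : Fin n → ℂ) r, (∀ i, fderiv ℂ G (bp (Sm n m)ᶜ x) (e i) = 0) →
      G x - G (bp (Sm n m)ᶜ x) = ∑ j, x (Fin.castLE h j) * ∑ i, x (Fin.castLE h i) * S x i j := by
    intro x hx hcr
    have hz' : ∀ t, HasDerivAt (zt x) (bp (Sm n m) x) t := by
      intro t
      have := (((hasDerivAt_id t).ofReal_comp).smul_const (bp (Sm n m) x)).const_add (bp (Sm n m)ᶜ x)
      simpa [hzt] using this
    have hD : ∀ (f : (Fin n → ℂ) → ℂ), AnalyticOnNhd ℂ f (ball 0 r) → ∀ t ∈ Icc (0:ℝ) 1,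
        HasDerivAt (fun t => f (zt x t)) (∑ j : Fin m, x (Fin.castLE h j) * fderiv ℂ f (zt x t) (e j)) t := by
      intro f hf t ht
      have h1 := ((hf _ (hzm x hx t ht)).differentiableAt.hasFDerivAt.restrictScalars ℝ)
      have h2 := h1.comp_hasDerivAt t (hz' t)
      rw [← fd_sum h]
      exact h2
    have hA : ∀ t ∈ uIcc (0:ℝ) 1, HasDerivAt (fun t : ℝ => G (zt x t) + (1 - (t:ℂ)) * ∑ j, x (Fin.castLE h j) * fderiv ℂ G (zt x t) (e j))
        (∑ j, x (Fin.castLE h j) * ∑ i, x (Fin.castLE h i) * ((1 - (t:ℂ)) * hh i j (zt x t))) t := by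
      intro t ht
      rw [uIcc_of_le zero_le_one] at ht
      have h1 := hD G hGr t ht
      have h2 : HasDerivAt (fun t => ∑ j, x (Fin.castLE h j) * fderiv ℂ G (zt x t) (e j))
          (∑ j, x (Fin.castLE h j) * ∑ i, x (Fin.castLE h i) * hh i j (zt x t)) t :=
        HasDerivAt.fun_sum fun j _ => (hD _ (hfa j) t ht).const_mul _
      have h3 : HasDerivAt (fun t : ℝ => (1 - (t:ℂ))) (-1) t := by
        simpa using ((hasDerivAt_id t).ofReal_comp).const_sub 1
      refine (h1.add (h3.mul h2)).congr_deriv ?_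
      rw [neg_one_mul, add_neg_cancel_left, Finset.mul_sum]
      refine Finset.sum_congr rfl fun j _ => ?_
      rw [mul_left_comm, Finset.mul_sum]
      refine congrArg _ (Finset.sum_congr rfl fun i _ => by ring)
    have hii : ∀ i j, ContinuousOn (fun t : ℝ => (1 - (t:ℂ)) * hh i j (zt x t)) (uIcc 0 1) := by
      intro i j
      rw [uIcc_of_le zero_le_one]
      exact (hcont i j).comp (f := fun t : ℝ => (x, t)) (by fun_prop) fun t ht => ⟨hx, ht⟩
    have hF := intervalIntegral.integral_eq_sub_of_hasDerivAt hA (by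
      refine ContinuousOn.intervalIntegrable ?_
      refine continuousOn_finsetSum _ fun j _ => continuousOn_const.mul (continuousOn_finsetSum _ fun i _ => continuousOn_const.mul (hii i j)))
    have e1 : zt x 1 = x := by
      have := bp_add_compl (Sm n m) x
      simp only [hzt, Complex.ofReal_one, one_smul]
      rw [add_comm]; exact this
    have e0 : zt x 0 = bp (Sm n m)ᶜ x := by simp [hzt]
    rw [e1, e0] at hF
    simp only [hcr, Complex.ofReal_one, sub_self, zero_mul, mul_zero, Finset.sum_const_zero, add_zero] at hF
    rw [← hF, intervalIntegral.integral_finsetSum]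
    · refine Finset.sum_congr rfl fun j _ => ?_
      rw [intervalIntegral.integral_const_mul, intervalIntegral.integral_finsetSum]
      · refine congrArg _ (Finset.sum_congr rfl fun i _ => ?_)
        rw [intervalIntegral.integral_const_mul]
      · exact fun i _ => (continuousOn_const.mul (hii i j)).intervalIntegrable
    · exact fun j _ => (continuousOn_const.mul (continuousOn_finsetSum _ fun i _ => continuousOn_const.mul (hii i j))).intervalIntegrable
  obtain ⟨β, hβa, hβ0, hβ⟩ := sqrtM m
  set T : (Fin n → ℂ) → Fin m → Fin m → ℂ := fun x i j => S x i j - if i = j then 1 else 0 with hT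
  have hTa : AnalyticAt ℂ T 0 := analyticAt_pi_iff.2 fun i => analyticAt_pi_iff.2 fun j =>
    (hSa i j 0 (mem_ball_self hr)).sub analyticAt_const
  have hT0 : T 0 = 0 := by ext i j; simp [hT, hS0]
  have hb : AnalyticAt ℂ (fun x => β (T x)) 0 := AnalyticAt.comp (g := β) (f := T) (by rw [hT0]; exact hβa) hTa
  have hbij : ∀ i j, AnalyticAt ℂ (fun x => β (T x) i j) 0 := fun i j => analyticAt_pi_iff.1 (analyticAt_pi_iff.1 hb i) j
  set μ : (Fin n → ℂ) → (Fin n → ℂ) := fun x l => x l + if hl : (l:ℕ) < m then ∑ i, β (T x) i ⟨l, hl⟩ * x (Fin.castLE h i) else 0 with hμ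
  have hμa : AnalyticAt ℂ μ 0 := by
    refine analyticAt_pi_iff.2 fun l => ?_
    refine (an_coord l 0).add ?_
    by_cases hl : (l:ℕ) < m
    · simp only [hl, dif_pos]
      exact Finset.analyticAt_fun_sum _ fun i _ => (hbij i _).mul (an_coord _ 0)
    · simp only [hl, dif_neg, not_false_eq_true]; exact analyticAt_const
  refine ⟨μ, GD.of_fd hμa (by ext l; simp [hμ]) fun v => ?_, fun x l hl => by simp [hμ, not_lt.2 hl], ?_⟩
  · refine fd_line hμa.differentiableAt (hasDerivAt_pi.2 fun l => ?_)
    have h1 : HasDerivAt (fun t : ℂ => (t • v) l) (v l) 0 := by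
      simpa using (hasDerivAt_id (0:ℂ)).mul_const (v l)
    rw [← add_zero (v l)]
    refine h1.add ?_
    by_cases hl : (l:ℕ) < m
    · simp only [hl, dif_pos]
      have h00 : ∑ i : Fin m, (0:ℂ) = 0 := by simp
      refine HasDerivAt.congr_deriv (HasDerivAt.fun_sum fun i _ => ?_) h00
      have h2 : DifferentiableAt ℂ (fun t : ℂ => β (T (t • v)) i ⟨l, hl⟩) 0 := by
        refine DifferentiableAt.comp (g := fun x => β (T x) i ⟨l, hl⟩) (f := fun t : ℂ => t • v) 0 ?_ (by fun_prop)
        rw [zero_smul]; exact (hbij i _).differentiableAt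
      have h3 : HasDerivAt (fun t : ℂ => (t • v) (Fin.castLE h i)) (v (Fin.castLE h i)) 0 := by
        simpa using (hasDerivAt_id (0:ℂ)).mul_const (v (Fin.castLE h i))
      have h4 := h2.hasDerivAt.mul h3
      simp only [zero_smul, hT0, hβ0, Pi.zero_apply, zero_mul, mul_zero, add_zero] at h4
      exact h4
    · simp only [hl, dif_neg, not_false_eq_true]; exact hasDerivAt_const _ _
  · have hTt : Tendsto T (𝓝 0) (𝓝 0) := by have := hTa.continuousAt.tendsto; rwa [hT0] at this
    filter_upwards [hc, ball_mem_nhds 0 hr, hTt.eventually hβ] with x h1 h2 h3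
    have := hintg x h2 h1
    rw [eq_comm, ← eq_sub_iff_add_eq, this, ← sq_alg (fun i => x (Fin.castLE h i)) (β (T x)) (S x) h3]
    refine Finset.sum_congr rfl fun k _ => ?_
    simp [hμ]
end Morse
section Morse2

lemma fd_coord {n : ℕ} {f : (Fin n → ℂ) → (Fin n → ℂ)} {x : Fin n → ℂ} (hf : DifferentiableAt ℂ f x) (l : Fin n) (v : Fin n → ℂ) :
    fderiv ℂ (fun z => f z l) x v = fderiv ℂ f x v l := by
  have := (hasFDerivAt_pi'.1 hf.hasFDerivAt l).fderiv
  rw [this]; rfl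

lemma M2 {n m : ℕ} (h : m ≤ n) {G : (Fin n → ℂ) → ℂ} (hG : AnalyticAt ℂ G 0) (hG0 : fderiv ℂ G 0 = 0)
    (hd : ∀ i j : Fin m, D2 G (Pi.single (Fin.castLE h i) 1) (Pi.single (Fin.castLE h j) 1) = if i = j then 2 else 0) :
    ∃ (φ : (Fin n → ℂ) → (Fin n → ℂ)) (c : (Fin n → ℂ) → ℂ), GD φ ∧ AnalyticAt ℂ c 0 ∧ (∀ x, ∀ l : Fin n, m ≤ (l : ℕ) → φ x l = x l) ∧
      ∀ᶠ x in 𝓝 0, G x = ∑ i : Fin m, (φ x (Fin.castLE h i))^2 + c (bp (Sm n m)ᶜ (φ x)) := by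
  set κ : (Fin n → ℂ) → (Fin n → ℂ) := fun x l => if (l:ℕ) < m then (1/2) * fderiv ℂ G x (Pi.single l 1) else x l with hκ
  have hκl : ∀ l, AnalyticAt ℂ (fun x => κ x l) 0 := by
    intro l
    simp only [hκ]
    split_ifs with hl
    · exact analyticAt_const.mul (an_fd hG _)
    · exact an_coord l 0
  have hκa : AnalyticAt ℂ κ 0 := analyticAt_pi_iff.2 hκl
  have hκ0 : κ 0 = 0 := by
    ext l; simp [hκ, hG0]
  have hκd : ∀ v (l : Fin n), fderiv ℂ κ 0 v l = if (l:ℕ) < m then (1/2) * D2 G v (Pi.single l 1) else v l := by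
    intro v l
    rw [← fd_coord hκa.differentiableAt]
    split_ifs with hl
    · have e : (fun z => κ z l) = fun z => (1/2) * fderiv ℂ G z (Pi.single l 1) := by ext z; simp [hκ, hl]
      rw [e, fderiv_const_mul (an_fd hG _).differentiableAt]
      rfl
    · have e : (fun z => κ z l) = fun z => z l := by ext z; simp [hκ, hl]
      rw [e, (hasFDerivAt_apply (𝕜 := ℂ) l 0).fderiv]; rfl
  have hD2 : ∀ (v : Fin n → ℂ) (j : Fin m), (∀ l : Fin n, m ≤ (l:ℕ) → v l = 0) → D2 G v (Pi.single (Fin.castLE h j) 1) = 2 * v (Fin.castLE h j) := by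
    intro v j hv
    have : v = bp (Sm n m) v := by
      ext l; rw [bp_apply]
      split_ifs with hl
      · rfl
      · exact hv l (not_lt.1 fun h => hl (mem_Sm.2 h))
    conv_lhs => rw [this]
    unfold D2
    rw [fd_sum h, Finset.sum_eq_single j]
    · have := hd j j
      rw [if_pos rfl] at this
      unfold D2 at this
      rw [this, mul_comm]
    · intro i _ hij
      have := hd i j
      rw [if_neg hij] at this
      unfold D2 at this
      rw [this, mul_zero]
    · simp
  have hGD : GD κ := by
    refine ⟨hκa, hκ0, fun v hv => ?_⟩
    have h1 : ∀ l : Fin n, m ≤ (l:ℕ) → v l = 0 := by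
      intro l hl
      have := hκd v l
      rw [if_neg (not_lt.2 hl), hv] at this
      exact this.symm
    ext l
    by_cases hl : (l:ℕ) < m
    · have := hκd v l
      rw [if_pos hl, hv] at this
      have h2 := hD2 v ⟨l, hl⟩ h1
      have e : Fin.castLE h ⟨l, hl⟩ = l := rfl
      rw [e] at h2
      rw [h2] at this
      simpa using this.symm
    · exact h1 l (not_lt.1 hl)
  have hκe : ∀ i : Fin m, fderiv ℂ κ 0 (Pi.single (Fin.castLE h i) 1) = Pi.single (Fin.castLE h i) 1 := by
    intro i
    have hz : ∀ l : Fin n, m ≤ (l:ℕ) → (Pi.single (Fin.castLE h i) 1 : Fin n → ℂ) l = 0 := by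
      intro l hl
      rw [Pi.single_apply, if_neg]
      rintro rfl
      exact absurd i.2 (not_lt.2 hl)
    ext l
    rw [hκd]
    split_ifs with hl
    · have h2 := hD2 (Pi.single (Fin.castLE h i) 1) ⟨l, hl⟩ hz
      have e : Fin.castLE h ⟨l, hl⟩ = l := rfl
      rw [e] at h2
      rw [h2]; ring
    · rfl
  obtain ⟨θ, hθ, hθ1, hθ2⟩ := hGD.inv
  have hθe : ∀ i : Fin m, fderiv ℂ θ 0 (Pi.single (Fin.castLE h i) 1) = Pi.single (Fin.castLE h i) 1 := fun i =>
    GD.inv_fd hGD hθ hθ1 (hκe i)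
  have hGt : AnalyticAt ℂ (fun x => G (θ x)) 0 := AnalyticAt.comp (g := G) (f := θ) (by rw [hθ.2.1]; exact hG) hθ.1
  have hyp : Tendsto (fun x : Fin n → ℂ => bp (Sm n m)ᶜ x) (𝓝 0) (𝓝 0) := by
    have := (bp (Sm n m)ᶜ).continuous.tendsto (0 : Fin n → ℂ)
    rwa [map_zero] at this
  obtain ⟨μ, hμ, hμl, hμs⟩ := M1 h hGt (by
    filter_upwards [hyp.eventually hθ.1.eventually_analyticAt, (hθ.tendsto.comp hyp).eventually hG.eventually_analyticAt,
      hyp.eventually hθ2.eventually_nhds] with x h1 h2 h3 i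
    set z := bp (Sm n m)ᶜ x with hz
    have e : fderiv ℂ (fun x => G (θ x)) z = (fderiv ℂ G (θ z)).comp (fderiv ℂ θ z) := fderiv_comp z h2.differentiableAt h1.differentiableAt
    rw [e]
    show fderiv ℂ G (θ z) (fderiv ℂ θ z (Pi.single (Fin.castLE h i) 1)) = 0
    set w := fderiv ℂ θ z (Pi.single (Fin.castLE h i) 1) with hw
    have hwl : ∀ l : Fin n, m ≤ (l:ℕ) → w l = 0 := by
      intro l hl
      rw [hw, ← fd_coord h1.differentiableAt]
      have : (fun z => θ z l) =ᶠ[𝓝 z] fun z => z l := by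
        filter_upwards [h3] with y hy
        have := congrFun hy l
        simp only [hκ, not_lt.2 hl, if_false] at this
        exact this
      rw [this.fderiv_eq, (hasFDerivAt_apply (𝕜 := ℂ) l z).fderiv]
      show (Pi.single (Fin.castLE h i) 1 : Fin n → ℂ) l = 0
      rw [Pi.single_apply, if_neg]
      rintro rfl
      exact absurd i.2 (not_lt.2 hl)
    have : w = bp (Sm n m) w := by
      ext l; rw [bp_apply]
      split_ifs with hl
      · rfl
      · exact hwl l (not_lt.1 fun h => hl (mem_Sm.2 h))
    rw [this, fd_sum h]
    refine Finset.sum_eq_zero fun j _ => ?_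
    have h4 := congrFun h3.self_of_nhds (Fin.castLE h j)
    have h5 : z (Fin.castLE h j) = 0 := by
      rw [hz, bp_apply, if_neg]
      rw [Finset.mem_compl, mem_Sm]; simp
    rw [h5] at h4
    simp only [hκ, Fin.val_castLE, j.2, if_true] at h4
    have h6 : fderiv ℂ G (θ z) (Pi.single (Fin.castLE h j) 1) = 0 := by
      have : (1/2 : ℂ) ≠ 0 := by norm_num
      exact (mul_eq_zero.1 h4).resolve_left this
    rw [h6, mul_zero]) (fun i j => by
      rw [D2_comp hG hθ.1 hθ.2.1 hG0, hθe, hθe]; exact hd i j)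
  refine ⟨fun x => μ (κ x), fun x => G (θ x), hμ.comp hGD, hGt, fun x l hl => ?_, ?_⟩
  · show μ (κ x) l = x l
    rw [hμl _ l hl]; simp [hκ, not_lt.2 hl]
  · filter_upwards [hGD.tendsto.eventually hμs, hθ1] with x h1 h2
    have e : bp (Sm n m)ᶜ (μ (κ x)) = bp (Sm n m)ᶜ (κ x) := by
      ext l
      rw [bp_apply, bp_apply]
      split_ifs with hl
      · rw [Finset.mem_compl, mem_Sm] at hl
        exact hμl _ l (not_lt.1 hl)
      · rfl
    rw [e, ← h1, h2]

lemma M3 {n m : ℕ} (h : m ≤ n) {H : (Fin n → ℂ) → ℂ} {Y : (Fin n → ℂ) → (Fin n → ℂ)} (hH : AnalyticAt ℂ H 0) (hH0 : fderiv ℂ H 0 = 0)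
    (hd : ∀ i j : Fin m, D2 H (Pi.single (Fin.castLE h i) 1) (Pi.single (Fin.castLE h j) 1) = if i = j then 2 else 0)
    (hY : AnalyticAt ℂ Y 0) (hY0 : Y 0 = 0) (hYd : ∀ v, ∀ l : Fin n, m ≤ (l:ℕ) → fderiv ℂ Y 0 v l = v l) :
    ∃ (φ : (Fin n → ℂ) → (Fin n → ℂ)) (c : (Fin n → ℂ) → ℂ), GD φ ∧ AnalyticAt ℂ c 0 ∧ (∀ x, ∀ l : Fin n, m ≤ (l : ℕ) → φ x l = Y x l) ∧
      ∀ᶠ x in 𝓝 0, H x = ∑ i : Fin m, (φ x (Fin.castLE h i))^2 + c (bp (Sm n m)ᶜ (φ x)) := by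
  set χ : (Fin n → ℂ) → (Fin n → ℂ) := fun x l => if (l:ℕ) < m then x l else Y x l with hχ
  have hχa : AnalyticAt ℂ χ 0 := by
    refine analyticAt_pi_iff.2 fun l => ?_
    by_cases hl : (l:ℕ) < m
    · have e : (fun z => χ z l) = fun z => z l := by ext z; simp [hχ, hl]
      show AnalyticAt ℂ (fun z => χ z l) 0
      rw [e]; exact an_coord l 0
    · have e : (fun z => χ z l) = fun z => Y z l := by ext z; simp [hχ, hl]
      show AnalyticAt ℂ (fun z => χ z l) 0
      rw [e]; exact analyticAt_pi_iff.1 hY l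
  have hχd : ∀ v, fderiv ℂ χ 0 v = v := by
    intro v
    ext l
    rw [← fd_coord hχa.differentiableAt]
    by_cases hl : (l:ℕ) < m
    · have e : (fun z => χ z l) = fun z => z l := by ext z; simp [hχ, hl]
      rw [e, (hasFDerivAt_apply (𝕜 := ℂ) l 0).fderiv]; rfl
    · have e : (fun z => χ z l) = fun z => Y z l := by ext z; simp [hχ, hl]
      rw [e, fd_coord hY.differentiableAt]; exact hYd v l (not_lt.1 hl)
  have hG : GD χ := GD.of_fd hχa (by ext l; simp [hχ, hY0]) hχd
  obtain ⟨θ, hθ, hθ1, hθ2⟩ := hG.inv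
  have hθd : ∀ v, fderiv ℂ θ 0 v = v := fun v => GD.inv_fd hG hθ hθ1 (hχd v)
  have hH' : AnalyticAt ℂ H (θ 0) := by rw [hθ.2.1]; exact hH
  obtain ⟨φ, c, h1, h2, h3, h4⟩ := M2 h (G := fun x => H (θ x)) (AnalyticAt.comp (g := H) (f := θ) hH' hθ.1) (by
    have e : fderiv ℂ (fun x => H (θ x)) 0 = (fderiv ℂ H (θ 0)).comp (fderiv ℂ θ 0) := fderiv_comp 0 hH'.differentiableAt hθ.1.differentiableAt
    rw [e, hθ.2.1, hH0]; simp) (fun i j => by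
      rw [D2_comp hH hθ.1 hθ.2.1 hH0, hθd, hθd]; exact hd i j)
  refine ⟨fun x => φ (χ x), c, h1.comp hG, h2, fun x l hl => ?_, ?_⟩
  · show φ (χ x) l = Y x l
    rw [h3 _ l hl]; simp [hχ, not_lt.2 hl]
  · filter_upwards [hG.tendsto.eventually h4, hθ1] with x h5 h6
    rw [← h5, h6]
end Morse2
section Push

lemma an_upd' {n : ℕ} (i : Fin n) {f : (Fin n → ℂ) → ℂ} {x : Fin n → ℂ} (hf : AnalyticAt ℂ f x) :
    AnalyticAt ℂ (fun y => Function.update y i (f y)) x := by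
  refine analyticAt_pi_iff.2 fun l => ?_
  by_cases hl : l = i
  · subst hl; simpa using hf
  · simpa [Function.update_of_ne hl] using an_coord l x

lemma upd_t_norm {n : ℕ} (i : Fin n) (x : Fin n → ℂ) {t : ℝ} (ht : t ∈ Icc (0:ℝ) 1) :
    ‖Function.update x i ((t:ℂ) * x i)‖ ≤ ‖x‖ := by
  refine (pi_norm_le_iff_of_nonneg (norm_nonneg _)).2 fun l => ?_
  by_cases hl : l = i
  · subst hl
    rw [Function.update_self, norm_mul, Complex.norm_real, Real.norm_of_nonneg ht.1]
    have := norm_le_pi_norm x l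
    nlinarith [ht.2, norm_nonneg (x l)]
  · rw [Function.update_of_ne hl]; exact norm_le_pi_norm x l

lemma hadamard {n : ℕ} (i : Fin n) {a : (Fin n → ℂ) → ℂ} (ha : AnalyticAt ℂ a 0)
    (h0 : ∀ᶠ y in 𝓝 0, a (Function.update y i 0) = 0) :
    ∃ f : (Fin n → ℂ) → ℂ, AnalyticAt ℂ f 0 ∧ ∀ᶠ y in 𝓝 0, a y = y i * f y := by
  obtain ⟨r, hr, har⟩ : ∃ r > 0, AnalyticOnNhd ℂ a (ball 0 r) := by
    obtain ⟨r, hr, h'⟩ := Metric.eventually_nhds_iff_ball.1 ha.eventually_analyticAt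
    exact ⟨r, hr, h'⟩
  have hd : AnalyticOnNhd ℂ (fun z => fderiv ℂ a z (Pi.single i 1)) (ball 0 r) := fun z hz => an_fd (har z hz) _
  have hm : ∀ x ∈ ball (0 : Fin n → ℂ) r, ∀ t ∈ Icc (0:ℝ) 1, Function.update x i ((t:ℂ) * x i) ∈ ball (0 : Fin n → ℂ) r := by
    intro x hx t ht
    rw [mem_ball_zero_iff] at hx ⊢
    exact (upd_t_norm i x ht).trans_lt hx
  have hcc : ContinuousOn (fun p : (Fin n → ℂ) × ℝ => fderiv ℂ a (Function.update p.1 i ((p.2:ℂ) * p.1 i)) (Pi.single i 1)) (ball 0 r ×ˢ Icc (0:ℝ) 1) :=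
    hd.continuousOn.comp (f := fun p : (Fin n → ℂ) × ℝ => Function.update p.1 i ((p.2:ℂ) * p.1 i)) (by fun_prop) fun p hp => hm p.1 hp.1 p.2 hp.2
  refine ⟨fun x => ∫ t in (0:ℝ)..1, fderiv ℂ a (Function.update x i ((t:ℂ) * x i)) (Pi.single i 1), ?_, ?_⟩
  · refine analytic_integral zero_le_one isOpen_ball hcc (fun t ht x hx => ?_) 0 (mem_ball_self hr)
    exact AnalyticAt.comp (g := fun z => fderiv ℂ a z (Pi.single i 1)) (f := fun x => Function.update x i ((t:ℂ) * x i)) (hd _ (hm x hx t ht))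
      (an_upd' i (analyticAt_const.mul (an_coord i x)))
  · filter_upwards [ball_mem_nhds 0 hr, h0] with x hx hx0
    have hA : ∀ t ∈ uIcc (0:ℝ) 1, HasDerivAt (fun t : ℝ => a (Function.update x i ((t:ℂ) * x i)))
        (x i * fderiv ℂ a (Function.update x i ((t:ℂ) * x i)) (Pi.single i 1)) t := by
      intro t ht
      rw [uIcc_of_le zero_le_one] at ht
      have h1 := ((har _ (hm x hx t ht)).differentiableAt.hasFDerivAt.restrictScalars ℝ)
      have h2 : HasDerivAt (fun t : ℝ => Function.update x i ((t:ℂ) * x i)) (x i • Pi.single i (1:ℂ)) t := by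
        refine hasDerivAt_pi.2 fun l => ?_
        by_cases hl : l = i
        · subst hl
          simpa using ((hasDerivAt_id t).ofReal_comp).mul_const (x l)
        · simpa [Function.update_of_ne hl, Pi.single_apply, hl] using hasDerivAt_const t (x l)
      refine (h1.comp_hasDerivAt t h2).congr_deriv ?_
      simp
    have hci : ContinuousOn (fun t : ℝ => fderiv ℂ a (Function.update x i ((t:ℂ) * x i)) (Pi.single i 1)) (uIcc 0 1) := by
      rw [uIcc_of_le zero_le_one]
      exact hcc.comp (f := fun t : ℝ => (x, t)) (by fun_prop) fun t ht => ⟨hx, ht⟩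
    have hF := intervalIntegral.integral_eq_sub_of_hasDerivAt hA ((continuousOn_const.mul hci).intervalIntegrable)
    rw [intervalIntegral.integral_const_mul] at hF
    rw [hF]
    simp [hx0]

lemma cancel_coord {n : ℕ} (i : Fin n) {g : (Fin n → ℂ) → ℂ} (hg : ∀ᶠ y in 𝓝 0, ContinuousAt g y)
    (h : ∀ᶠ y in 𝓝 0, y i * g y = 0) : ∀ᶠ y in 𝓝 0, g y = 0 := by
  filter_upwards [hg, h.eventually_nhds] with y hy h1
  by_cases h0 : y i = 0
  · have hl : Tendsto (fun t : ℂ => y + t • (Pi.single i 1 : Fin n → ℂ)) (𝓝[≠] 0) (𝓝 y) := by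
      have : Continuous (fun t : ℂ => y + t • (Pi.single i 1 : Fin n → ℂ)) := by fun_prop
      have := this.tendsto 0
      simp only [zero_smul, add_zero] at this
      exact this.mono_left nhdsWithin_le_nhds
    refine tendsto_nhds_unique (hy.tendsto.comp hl) (tendsto_const_nhds.congr' ?_)
    filter_upwards [hl.eventually h1, self_mem_nhdsWithin] with t ht ht0
    have : (y + t • (Pi.single i 1 : Fin n → ℂ)) i = t := by simp [h0]
    rw [this] at ht
    exact ((mul_eq_zero.1 ht).resolve_left ht0).symm
  · exact (mul_eq_zero.1 h1.self_of_nhds).resolve_left h0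

lemma model_congr {n q : ℕ} {a b : Fin n → ℂ} (h : ∀ i : Fin n, (i:ℕ) < q + 1 → a i = b i) : modelPiC n q a = modelPiC n q b := by
  ext J
  refine Finset.sum_congr rfl fun j _ => ?_
  split_ifs with hj
  · rw [h j hj.1]
  · rfl

lemma extPow_cont {n q : ℕ} : Continuous fun z : Matrix (Fin n) (Fin n) ℂ × MultiVecC n q => extPowC n q z.1 z.2 := by
  unfold extPowC
  refine continuous_pi fun J => continuous_finsetSum _ fun I _ => ?_
  refine Continuous.mul (Continuous.matrix_det ?_) (by fun_prop)
  exact continuous_fst.matrix_submatrix _ _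

lemma jac_entry_an {n : ℕ} {φ : (Fin n → ℂ) → (Fin n → ℂ)} {x : Fin n → ℂ} (h : AnalyticAt ℂ φ x) (i j : Fin n) :
    AnalyticAt ℂ (fun x => jacC φ x i j) x := by
  have h1 : AnalyticAt ℂ (fun x => fderiv ℂ φ x (Pi.single j 1)) x :=
    AnalyticAt.comp (g := fun L : (Fin n → ℂ) →L[ℂ] (Fin n → ℂ) => L (Pi.single j 1)) (f := fderiv ℂ φ)
      ((ContinuousLinearMap.apply ℂ (Fin n → ℂ) (Pi.single j 1 : Fin n → ℂ)).analyticAt _) h.fderiv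
  exact analyticAt_pi_iff.1 h1 i

lemma extPow_an {n q : ℕ} {A : (Fin n → ℂ) → Matrix (Fin n) (Fin n) ℂ} {w : (Fin n → ℂ) → MultiVecC n q} {x : Fin n → ℂ}
    (hA : ∀ i j, AnalyticAt ℂ (fun x => A x i j) x) (hw : AnalyticAt ℂ w x) : AnalyticAt ℂ (fun x => extPowC n q (A x) (w x)) x := by
  refine analyticAt_pi_iff.2 fun J => ?_
  refine Finset.analyticAt_fun_sum _ fun I _ => ?_
  refine AnalyticAt.mul ?_ (analyticAt_pi_iff.1 hw I)
  simp only [Matrix.det_apply', Matrix.submatrix_apply]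
  refine Finset.analyticAt_fun_sum _ fun σ _ => analyticAt_const.mul (Finset.analyticAt_fun_prod _ fun i _ => hA _ _)

lemma jac_cont0 {n : ℕ} {φ : (Fin n → ℂ) → (Fin n → ℂ)} (h : AnalyticAt ℂ φ 0) : ContinuousAt (jacC φ) 0 :=
  continuousAt_pi.2 fun i => continuousAt_pi.2 fun j => (jac_entry_an h i j).continuousAt

lemma push {n q : ℕ} (h : q + 1 ≤ n) (hq : 1 ≤ q) {P : (Fin n → ℂ) → MultiVecC n q} (hP : AnalyticAt ℂ P 0) (hP0 : P 0 = 0)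
    {c : ℂ} (hc : c ≠ 0) (hl : ∀ v, fderiv ℂ P 0 v = c • modelPiC n q v)
    {φ : (Fin n → ℂ) → (Fin n → ℂ)} (hφ : GD φ) {H c0 : (Fin n → ℂ) → ℂ} (hc0 : AnalyticAt ℂ c0 0)
    (hH : ∀ᶠ x in 𝓝 0, H x = ∑ i : Fin (q+1), (φ x (Fin.castLE h i))^2 + c0 (bp (Sm n (q+1))ᶜ (φ x)))
    (hk1 : ∀ᶠ x in 𝓝 0, ∀ l : Fin n, q + 1 ≤ (l:ℕ) → Kills (jacC φ x l) (P x))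
    (hk2 : ∀ᶠ x in 𝓝 0, Kills (fun j => fderiv ℂ H x (Pi.single j 1)) (P x)) :
    ∃ f : (Fin n → ℂ) → ℂ, AnalyticAt ℂ f 0 ∧ f 0 ≠ 0 ∧ Conj P (fun y => f y • modelPiC n q y) := by
  obtain ⟨θ, hθ, hθ1, hθ2⟩ := hφ.inv
  set P' : (Fin n → ℂ) → MultiVecC n q := fun y => extPowC n q (jacC φ (θ y)) (P (θ y)) with hP'
  have hP'a : AnalyticAt ℂ P' 0 := by
    have h1 : AnalyticAt ℂ φ (θ 0) := by rw [hθ.2.1]; exact hφ.1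
    have h2 : AnalyticAt ℂ P (θ 0) := by rw [hθ.2.1]; exact hP
    refine extPow_an (fun i j => ?_) (AnalyticAt.comp (g := P) (f := θ) h2 hθ.1)
    exact AnalyticAt.comp (g := fun x => jacC φ x i j) (f := θ) (jac_entry_an h1 i j) hθ.1
  have hconj : Conj P P' := by
    refine ⟨φ, hφ.1, hφ.2.1, hφ.jac, ?_⟩
    filter_upwards [hθ1] with x hx
    simp only [hP', hx]
  have hφt : Tendsto (fun x => bp (Sm n (q+1))ᶜ (φ x)) (𝓝 0) (𝓝 0) := by
    have := (bp (Sm n (q+1))ᶜ).continuous.tendsto (0 : Fin n → ℂ)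
    rw [map_zero] at this
    exact this.comp hφ.tendsto
  have hK2 : ∀ᶠ x in 𝓝 0, Kills (Matrix.vecMul (fun i : Fin n => if (i:ℕ) < q + 1 then φ x i else 0) (jacC φ x)) (P x) := by
    filter_upwards [hH.eventually_nhds, hk1, hk2, hφ.1.eventually_analyticAt, hφt.eventually hc0.eventually_analyticAt] with x h1 h2 h3 h4 h5
    set d : Fin n → ℂ := fun l => if l ∈ (Sm n (q+1))ᶜ then fderiv ℂ c0 (bp (Sm n (q+1))ᶜ (φ x)) (Pi.single l 1) else 0 with hd
    have hs : Kills (∑ l : Fin n, d l • jacC φ x l) (P x) := by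
      refine Kills.sum fun l _ => ?_
      by_cases hl : l ∈ (Sm n (q+1))ᶜ
      · refine (h2 l ?_).smul _
        rw [Finset.mem_compl, mem_Sm] at hl; omega
      · simp only [hd, hl, if_false, zero_smul]; exact Kills.zero
    have := (h3.add (hs.smul (-1))).smul (1/2)
    convert this using 1
    ext j
    have e1 : H =ᶠ[𝓝 x] fun x => ∑ i : Fin (q+1), (φ x (Fin.castLE h i))^2 + c0 (bp (Sm n (q+1))ᶜ (φ x)) := h1
    have hco : ∀ i, HasFDerivAt (fun x => φ x i) (fderiv ℂ (fun x => φ x i) x) x := fun i =>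
      (analyticAt_pi_iff.1 h4 i).differentiableAt.hasFDerivAt
    have d1 : HasFDerivAt (fun x => ∑ i : Fin (q+1), (φ x (Fin.castLE h i))^2) (∑ i : Fin (q+1), (2 * φ x (Fin.castLE h i)) • fderiv ℂ (fun x => φ x (Fin.castLE h i)) x) x := by
      refine HasFDerivAt.fun_sum fun i _ => ?_
      have := (hco (Fin.castLE h i)).pow 2
      simpa using this
    have d2 : HasFDerivAt (fun x => c0 (bp (Sm n (q+1))ᶜ (φ x))) ((fderiv ℂ c0 (bp (Sm n (q+1))ᶜ (φ x))).comp ((bp (Sm n (q+1))ᶜ).comp (fderiv ℂ φ x))) x := by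
      have a1 := (bp (Sm n (q+1))ᶜ).hasFDerivAt.comp x h4.differentiableAt.hasFDerivAt
      exact h5.differentiableAt.hasFDerivAt.comp x a1
    have e2 := (d1.add d2).fderiv
    have e3 : fderiv ℂ H x (Pi.single j 1) = (∑ i : Fin (q+1), (2 * φ x (Fin.castLE h i)) * jacC φ x (Fin.castLE h i) j) + ∑ l, d l * jacC φ x l j := by
      rw [e1.fderiv_eq]
      have := congrArg (fun L => L (Pi.single j 1)) e2
      refine Eq.trans this ?_
      rw [_root_.add_apply, _root_.sum_apply]
      congr 1
      · refine Finset.sum_congr rfl fun i _ => ?_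
        rw [_root_.smul_apply, fd_coord h4.differentiableAt]; rfl
      · show fderiv ℂ c0 (bp (Sm n (q+1))ᶜ (φ x)) (bp (Sm n (q+1))ᶜ (fderiv ℂ φ x (Pi.single j 1))) = _
        have hw : bp (Sm n (q+1))ᶜ (fderiv ℂ φ x (Pi.single j 1)) = ∑ l : Fin n, (if l ∈ (Sm n (q+1))ᶜ then jacC φ x l j else 0) • (Pi.single l 1 : Fin n → ℂ) := by
          ext l
          rw [bp_apply, Finset.sum_apply]
          simp [Pi.single_apply, jacC]
        rw [hw, map_sum]
        refine Finset.sum_congr rfl fun l _ => ?_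
        rw [map_smul, smul_eq_mul]
        simp only [hd]
        split_ifs <;> ring
    simp only [Pi.smul_apply, Pi.add_apply, smul_eq_mul, Finset.sum_apply, e3]
    have e4 : ∑ i : Fin (q+1), (2 * φ x (Fin.castLE h i)) * jacC φ x (Fin.castLE h i) j = 2 * ∑ i : Fin n, (if (i:ℕ) < q+1 then φ x i else 0) * jacC φ x i j := by
      have := bp_sum h (fun i => φ x i * jacC φ x i j)
      have := congrArg (fun v => ∑ i, v i) this
      simp only [bp_apply, Finset.sum_apply, mem_Sm] at this
      rw [Finset.sum_comm] at this
      simp only [Pi.smul_apply, Pi.single_apply, smul_eq_mul, mul_ite, mul_one, mul_zero, Finset.sum_ite_eq', Finset.mem_univ, if_true] at this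
      simp only [ite_mul, zero_mul, mul_assoc, ← Finset.mul_sum]
      rw [← this]
    rw [e4]
    show ∑ i : Fin n, (if (i:ℕ) < q+1 then φ x i else 0) * jacC φ x i j = _
    ring
  set a : (Fin n → ℂ) → (Fin n → ℂ) := fun y j => (-1)^(j:ℕ) * om (P' y) (fun b => if hj : (j:ℕ) < q + 1 then
      Pi.single (Fin.castLE h ((⟨j, hj⟩ : Fin (q+1)).succAbove b)) 1 else 0) with ha
  have haa : ∀ j, AnalyticAt ℂ (fun y => a y j) 0 := fun j =>
    analyticAt_const.mul (om_analytic hP'a fun _ _ => analyticAt_const)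
  have hPa : ∀ᶠ y in 𝓝 0, P' y = modelPiC n q (a y) := by
    filter_upwards [hθ.tendsto.eventually hk1] with y hy
    refine eq_model_of_kills h fun l hl' => Kills.extPow ?_
    rw [Matrix.single_one_vecMul]
    exact hy l hl'
  have hrel : ∀ᶠ y in 𝓝 0, ∀ i j : Fin (q+1), a y (Fin.castLE h i) * y (Fin.castLE h j) = a y (Fin.castLE h j) * y (Fin.castLE h i) := by
    filter_upwards [hθ.tendsto.eventually hK2, hPa, hθ2] with y h1 h2 h3 i j
    have h4 := Kills.extPow h1
    have h5 : Kills (fun i : Fin n => if (i:ℕ) < q + 1 then φ (θ y) i else 0) (P' y) := h4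
    rw [h2, h3] at h5
    have := kills_model h h5 i j
    simp only [Fin.val_castLE, i.2, j.2, if_true] at this
    exact this
  set i0 : Fin n := Fin.castLE h ⟨0, by omega⟩ with hi0
  set i1 : Fin n := Fin.castLE h ⟨1, by omega⟩ with hi1
  have h01 : i1 ≠ i0 := by intro e; have := congrArg Fin.val e; simp [hi0, hi1] at this
  have hut : Tendsto (fun y : Fin n → ℂ => Function.update y i0 0) (𝓝 0) (𝓝 0) := by
    have : Continuous (fun y : Fin n → ℂ => Function.update y i0 0) := by fun_prop
    have := this.tendsto 0
    rwa [show Function.update (0 : Fin n → ℂ) i0 0 = 0 by simp] at this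
  obtain ⟨f, hf, hfa⟩ := hadamard i0 (haa i0) (by
    refine cancel_coord i1 ?_ ?_
    · filter_upwards [hut.eventually (haa i0).eventually_analyticAt] with y hy
      exact hy.continuousAt.comp (f := fun y : Fin n → ℂ => Function.update y i0 0) (by fun_prop)
    · filter_upwards [hut.eventually hrel] with y hy
      have := hy ⟨0, by omega⟩ ⟨1, by omega⟩
      rw [← hi0, ← hi1, Function.update_of_ne h01, Function.update_self, mul_zero] at this
      rw [mul_comm]; exact this)
  have hfi : ∀ j : Fin (q+1), ∀ᶠ y in 𝓝 0, a y (Fin.castLE h j) - f y * y (Fin.castLE h j) = 0 := by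
    intro j
    refine cancel_coord i0 ?_ ?_
    · filter_upwards [hf.eventually_analyticAt, (haa (Fin.castLE h j)).eventually_analyticAt] with y h1 h2
      exact (h2.sub (h1.mul (an_coord _ y))).continuousAt
    · filter_upwards [hfa, hrel] with y h1 h2
      have := h2 ⟨0, by omega⟩ j
      rw [← hi0, h1] at this
      linear_combination -this
  have hPf : P' =ᶠ[𝓝 0] fun y => f y • modelPiC n q y := by
    filter_upwards [hPa, Filter.eventually_all.2 hfi] with y h1 h2
    rw [h1, ← model_smul]
    refine model_congr fun i hi => ?_
    exact sub_eq_zero.1 (h2 ⟨i, hi⟩)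
  refine ⟨f, hf, fun hf0 => ?_, conj_congr hconj hPf⟩
  obtain ⟨K, hK⟩ := hφ.jac
  have hz : ∀ v, extPowC n q (jacC φ 0) (c • modelPiC n q v) = 0 := by
    intro v
    have t1 := line_lim hP.differentiableAt hP0 v
    rw [hl] at t1
    have tl : Tendsto (fun t : ℂ => t • v) (𝓝[≠] 0) (𝓝 0) := by
      have : Continuous (fun t : ℂ => t • v) := by fun_prop
      have := this.tendsto 0
      rw [zero_smul] at this
      exact this.mono_left nhdsWithin_le_nhds
    have t2 := (jac_cont0 hφ.1).tendsto.comp tl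
    have t3 := (extPow_cont.tendsto (jacC φ 0, c • modelPiC n q v)).comp (t2.prodMk_nhds t1)
    have t4 := line_lim hφ.1.differentiableAt hφ.2.1 v
    have t5 : Tendsto (fun t : ℂ => f (φ (t • v)) • modelPiC n q (t⁻¹ • φ (t • v))) (𝓝[≠] 0) (𝓝 ((0:ℂ) • modelPiC n q (fderiv ℂ φ 0 v))) := by
      refine Tendsto.smul ?_ ((model_cont.tendsto _).comp t4)
      have := (hf.continuousAt.tendsto.comp hφ.tendsto).comp tl
      rwa [hf0] at this
    rw [zero_smul] at t5
    refine tendsto_nhds_unique t3 (t5.congr' ?_)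
    filter_upwards [tl.eventually hθ1, (hφ.tendsto.comp tl).eventually hPf] with t h1 h2
    have h2' : P' (φ (t • v)) = f (φ (t • v)) • modelPiC n q (φ (t • v)) := h2
    show _ = extPowC n q (jacC φ (t • v)) (t⁻¹ • P (t • v))
    rw [extPow_smul, model_smul, smul_comm, ← h2']
    simp only [hP', h1]
  have hz2 := congrArg (extPowC n q K) (hz (Pi.single i0 1))
  rw [← extPow_mul, hK, extPow_one] at hz2
  have hz3 : extPowC n q K 0 = 0 := by ext J; simp [extPowC]
  rw [hz3] at hz2
  have := model_eq_zero h hq ((smul_eq_zero.1 hz2).resolve_left hc) i0 (by simp [hi0])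
  simp at this
end Push
section Step5

theorem step5 {k p : ℕ} (hpk : p ≤ k) {U : Set (Fin (k+3) → ℂ)} (hU : IsOpen U) (h0U : 0 ∈ U)
    {P : (Fin (k+3) → ℂ) → MultiVecC (k+3) (p+2)} (hN : IsNambuC (k+3) (p+2) P U) (hP0 : P 0 = 0)
    (hlin : ∀ v, fderiv ℂ P 0 v = modelPiC (k+3) (p+2) v) :
    ∃ f : (Fin (k+3) → ℂ) → ℂ, AnalyticAt ℂ f 0 ∧ f 0 ≠ 0 ∧ Conj P (fun y => f y • modelPiC (k+3) (p+2) y) := by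
  have hδ : (0:ℝ) < 1/(4000*(k+3)) := by positivity
  obtain ⟨P', hc, hP', hP'0, ⟨c, hc0, hcl⟩, F, hF, hFb, hFk⟩ := FI hpk hδ hU h0U hN hP0 hlin
  obtain ⟨F', h1, h2, h3, h4, h5, h6⟩ := nf hpk hP' hP'0 hc0 hcl hF hFb hFk
  have h : p + 2 + 1 ≤ k + 3 := by omega
  have hF1 : AnalyticAt ℂ (fun x => F' x 1) 0 := analyticAt_pi_iff.1 h1 1
  obtain ⟨φ, c1, g1, g2, g3, g4⟩ := M3 h (H := fun x => F' x 1) (Y := F') hF1 (by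
      ext v; rw [fd_coord h1.differentiableAt, h5]; rfl) (fun i j => by
      rw [h6 _ _ (by simpa using i.2) (by simpa using j.2)]
      simp [Fin.castLE_inj]) h1 h2 (fun v l hl => h4 v l hl)
  have hj : ∀ᶠ x in 𝓝 0, ∀ l : Fin (k+3), p + 2 + 1 ≤ (l:ℕ) → jacC φ x l = jacC F' x l := by
    filter_upwards [g1.1.eventually_analyticAt, h1.eventually_analyticAt] with x a1 a2 l hl
    ext j
    show fderiv ℂ φ x (Pi.single j 1) l = fderiv ℂ F' x (Pi.single j 1) l
    rw [← fd_coord a1.differentiableAt, ← fd_coord a2.differentiableAt]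
    congr 2
    ext z; exact g3 z l hl
  obtain ⟨f, f1, f2, f3⟩ := push h (by omega) hP' hP'0 hc0 hcl g1 g2 g4 (by
      filter_upwards [hj, h3] with x a1 a2 l hl
      rw [a1 l hl]; exact a2 l) (by
      filter_upwards [h3, h1.eventually_analyticAt] with x a1 a2
      have := a1 1
      convert this using 1
      ext j
      rw [fd_coord a2.differentiableAt]; rfl)
  exact ⟨f, f1, f2, conj_trans hc f3⟩
end Step5
section Prim

lemma ball_an {E F : Type*} [NormedAddCommGroup E] [NormedSpace ℂ E] [NormedAddCommGroup F] [NormedSpace ℂ F] [CompleteSpace F] {U : E → F}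
    (hU : AnalyticAt ℂ U 0) : ∃ r > 0, AnalyticOnNhd ℂ U (ball 0 r) := by
  obtain ⟨r, hr, h'⟩ := Metric.eventually_nhds_iff_ball.1 hU.eventually_analyticAt
  exact ⟨r, hr, h'⟩

/-- primitive in the direction `e` -/
lemma prim {E : Type*} [NormedAddCommGroup E] [NormedSpace ℂ E] [FiniteDimensional ℂ E] (ℓ : E →L[ℂ] ℂ) (e : E) (he : ℓ e = 1)
    {U : E → ℂ} (hU : AnalyticAt ℂ U 0) :
    ∃ Ψ : E → ℂ, AnalyticAt ℂ Ψ 0 ∧ (∀ z, ℓ z = 0 → Ψ z = 0) ∧ ∀ᶠ z in 𝓝 0, fderiv ℂ Ψ z e = U z := by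
  obtain ⟨R, hR, hUR⟩ := ball_an hU
  set C : ℝ := 1 + ‖ℓ‖ * ‖e‖ + (‖ℓ‖ + 1) * ‖e‖ with hC
  have hC0 : 0 < C := by positivity
  set r := R / C with hr
  have hr0 : 0 < r := by positivity
  have hrC : r * C = R := by rw [hr]; field_simp
  have hin : ∀ z ∈ ball (0:E) r, ∀ s ∈ ball (0:ℂ) ((‖ℓ‖ + 1) * r), z - ℓ z • e + s • e ∈ ball (0:E) R := by
    intro z hz s hs
    rw [mem_ball_zero_iff] at hz hs ⊢
    have h1 : ‖ℓ z‖ ≤ ‖ℓ‖ * ‖z‖ := ℓ.le_opNorm z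
    have h2 : ‖z - ℓ z • e + s • e‖ ≤ ‖z‖ + ‖ℓ z‖ * ‖e‖ + ‖s‖ * ‖e‖ := by
      refine (norm_add_le _ _).trans ?_
      rw [norm_smul]
      gcongr
      refine (norm_sub_le _ _).trans ?_
      rw [norm_smul]
    have h3 : ‖ℓ z‖ * ‖e‖ ≤ ‖ℓ‖ * r * ‖e‖ := by gcongr; exact h1.trans (by gcongr)
    have h4 : ‖s‖ * ‖e‖ ≤ ((‖ℓ‖ + 1) * r) * ‖e‖ := by gcongr
    have : r * C = r + ‖ℓ‖ * r * ‖e‖ + ((‖ℓ‖ + 1) * r) * ‖e‖ := by rw [hC]; ring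
    linarith
  have hlz : ∀ z ∈ ball (0:E) r, ∀ σ ∈ Icc (0:ℝ) 1, (σ:ℂ) * ℓ z ∈ ball (0:ℂ) ((‖ℓ‖ + 1) * r) := by
    intro z hz σ hσ
    rw [mem_ball_zero_iff] at hz ⊢
    have h1 : ‖ℓ z‖ ≤ ‖ℓ‖ * ‖z‖ := ℓ.le_opNorm z
    rw [norm_mul, Complex.norm_real, Real.norm_of_nonneg hσ.1]
    have : ‖ℓ‖ * ‖z‖ ≤ ‖ℓ‖ * r := by gcongr
    nlinarith [hσ.1, hσ.2, norm_nonneg (ℓ z)]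
  set Ψ : E → ℂ := fun z => ℓ z * ∫ σ in (0:ℝ)..1, U (z - ℓ z • e + ((σ:ℂ) * ℓ z) • e) with hΨ
  have hΨa : AnalyticOnNhd ℂ Ψ (ball 0 r) := by
    intro z hz
    refine (ℓ.analyticAt z).mul (analytic_integral zero_le_one isOpen_ball ?_ (fun σ hσ w hw => ?_) z hz)
    · exact hUR.continuousOn.comp (f := fun p : E × ℝ => p.1 - ℓ p.1 • e + ((p.2:ℂ) * ℓ p.1) • e) (by fun_prop)
        fun p hp => hin p.1 hp.1 _ (hlz p.1 hp.1 p.2 hp.2)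
    · refine AnalyticAt.comp (g := U) (f := fun w => w - ℓ w • e + ((σ:ℂ) * ℓ w) • e) (hUR _ (hin w hw _ (hlz w hw σ hσ))) ?_
      exact (analyticAt_id.sub ((ℓ.analyticAt w).smul analyticAt_const)).add ((analyticAt_const.mul (ℓ.analyticAt w)).smul analyticAt_const)
  refine ⟨Ψ, hΨa 0 (mem_ball_self hr0), fun z hz => by simp [hΨ, hz], ?_⟩
  filter_upwards [ball_mem_nhds 0 hr0] with z hz
  set z0 := z - ℓ z • e with hz0
  have hud : DifferentiableOn ℂ (fun s : ℂ => U (z0 + s • e)) (ball 0 ((‖ℓ‖ + 1) * r)) := by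
    intro s hs
    refine (DifferentiableAt.comp (g := U) (f := fun s : ℂ => z0 + s • e) s (hUR _ (hin z hz s hs)).differentiableAt (by fun_prop)).differentiableWithinAt
  obtain ⟨F, hF⟩ := hud.isExactOn_ball
  have hFΨ : ∀ w ∈ ball (0:E) r, w - ℓ w • e = z0 → Ψ w = F (ℓ w) - F 0 := by
    intro w hw hw0
    have hA : ∀ σ ∈ uIcc (0:ℝ) 1, HasDerivAt (fun σ : ℝ => F ((σ:ℂ) * ℓ w)) (ℓ w * U (z0 + ((σ:ℂ) * ℓ w) • e)) σ := by
      intro σ hσ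
      rw [uIcc_of_le zero_le_one] at hσ
      have h1 : HasDerivAt (fun σ : ℝ => (σ:ℂ) * ℓ w) (ℓ w) σ := by
        simpa using ((hasDerivAt_id σ).ofReal_comp).mul_const (ℓ w)
      have h2 := HasDerivAt.comp σ (hF _ (hlz w hw σ hσ)) h1
      refine h2.congr_deriv (mul_comm _ _)
    have hci : ContinuousOn (fun σ : ℝ => U (z0 + ((σ:ℂ) * ℓ w) • e)) (uIcc 0 1) := by
      rw [uIcc_of_le zero_le_one]
      refine hud.continuousOn.comp (f := fun σ : ℝ => (σ:ℂ) * ℓ w) (by fun_prop) fun σ hσ => hlz w hw σ hσ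
    have h3 := intervalIntegral.integral_eq_sub_of_hasDerivAt hA ((continuousOn_const.mul hci).intervalIntegrable)
    rw [intervalIntegral.integral_const_mul] at h3
    simp only [hΨ, hw0]
    rw [h3]; simp
  have h1 : HasDerivAt (fun t : ℂ => z + t • e) e 0 := by
    simpa using ((hasDerivAt_id (0:ℂ)).smul_const e).const_add z
  have h2 : HasFDerivAt Ψ (fderiv ℂ Ψ z) (z + (0:ℂ) • e) := by
    rw [zero_smul, add_zero]; exact (hΨa z hz).differentiableAt.hasFDerivAt
  have h3 := h2.comp_hasDerivAt (0:ℂ) h1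
  have hlz' : ℓ z ∈ ball (0:ℂ) ((‖ℓ‖ + 1) * r) := by
    have := hlz z hz 1 (by simp)
    simpa using this
  have h4 : HasDerivAt (fun t : ℂ => F (ℓ z + t) - F 0) (U (z0 + ℓ z • e)) 0 := by
    have h5 : HasDerivAt (fun t : ℂ => ℓ z + t) 1 0 := (hasDerivAt_id (0:ℂ)).const_add _
    have h6 := HasDerivAt.comp (0:ℂ) (h₂ := F) (h := fun t : ℂ => ℓ z + t) (by rw [add_zero]; exact hF _ hlz') h5
    simpa using h6.sub_const (F 0)
  have h7 : (fun t : ℂ => F (ℓ z + t) - F 0) =ᶠ[𝓝 0] Ψ ∘ fun t : ℂ => z + t • e := by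
    have hc : Tendsto (fun t : ℂ => z + t • e) (𝓝 0) (𝓝 z) := by
      have : Continuous (fun t : ℂ => z + t • e) := by fun_prop
      simpa using this.tendsto 0
    filter_upwards [hc.eventually (isOpen_ball.mem_nhds hz)] with t ht
    have := hFΨ (z + t • e) ht (by simp [hz0, he, add_smul])
    rw [Function.comp_apply, this]
    simp [he]
  have h8 := h3.unique (h4.congr_of_eventuallyEq h7.symm)
  rw [h8, hz0, sub_add_cancel]
end Prim

section Rot
variable {ι : Type*} [Fintype ι] [DecidableEq ι]

def Jm (i j : ι) : Matrix ι ι ℂ := Matrix.single i j 1 - Matrix.single j i 1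
def Dm (i j : ι) : Matrix ι ι ℂ := Matrix.single i i 1 + Matrix.single j j 1
noncomputable def Rt (i j : ι) (s : ℂ) : Matrix ι ι ℂ := 1 + Complex.sin s • Jm i j + (Complex.cos s - 1) • Dm i j

variable {i j : ι}

lemma JJ (hij : i ≠ j) : Jm i j * Jm i j = - Dm i j := by
  simp [Jm, Dm, sub_mul, mul_sub, hij, hij.symm]; abel
lemma JD (hij : i ≠ j) : Jm i j * Dm i j = Jm i j := by
  simp [Jm, Dm, sub_mul, mul_add, hij, hij.symm]; abel
lemma DJ (hij : i ≠ j) : Dm i j * Jm i j = Jm i j := by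
  simp [Jm, Dm, mul_sub, add_mul, hij, hij.symm]
lemma DD (hij : i ≠ j) : Dm i j * Dm i j = Dm i j := by
  simp [Dm, add_mul, mul_add, hij, hij.symm]

lemma Rt_add (hij : i ≠ j) (s t : ℂ) : Rt i j (s + t) = Rt i j s * Rt i j t := by
  simp only [Rt, add_mul, mul_add, smul_mul_assoc, mul_smul_comm, one_mul, mul_one, JJ hij, JD hij, DJ hij, DD hij, Complex.sin_add, Complex.cos_add]
  module

lemma Rt_zero : Rt i j 0 = 1 := by simp [Rt]

lemma J_tr : (Jm i j).transpose = - Jm i j := by simp [Jm]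
lemma D_tr : (Dm i j).transpose = Dm i j := by simp [Dm]

lemma Rt_tr (s : ℂ) : (Rt i j s).transpose = Rt i j (-s) := by
  simp [Rt, J_tr, D_tr]

lemma Rt_orth (hij : i ≠ j) (s : ℂ) : (Rt i j s).transpose * Rt i j s = 1 := by
  rw [Rt_tr, ← Rt_add hij, neg_add_cancel, Rt_zero]

lemma Rt_det (hij : i ≠ j) (s : ℂ) : (Rt i j s).det = 1 := by
  have h : s = s/2 + s/2 := by ring
  have h2 := congrArg Matrix.det (Rt_orth hij (s/2))
  rw [Matrix.det_mul, Matrix.det_transpose, Matrix.det_one] at h2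
  rw [h, Rt_add hij, Matrix.det_mul, h2]

lemma JR (hij : i ≠ j) (s : ℂ) : Jm i j * Rt i j s = Complex.cos s • Jm i j - Complex.sin s • Dm i j := by
  simp only [Rt, mul_add, mul_smul_comm, mul_one, JJ hij, JD hij]; module

lemma RJ (hij : i ≠ j) (s : ℂ) : Rt i j s * Jm i j = Complex.cos s • Jm i j - Complex.sin s • Dm i j := by
  simp only [Rt, add_mul, smul_mul_assoc, one_mul, JJ hij, DJ hij]; module

end Rot
section RotAlg

lemma block_sum {n m : ℕ} (h : m ≤ n) (f : Fin n → ℂ) (hf : ∀ l : Fin n, m ≤ (l:ℕ) → f l = 0) :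
    ∑ l, f l = ∑ i : Fin m, f (Fin.castLE h i) := by
  have hinj : Function.Injective (Fin.castLE h) := Fin.castLE_injective h
  rw [← Finset.sum_image (s := Finset.univ) (g := Fin.castLE h) (fun a _ b _ e => hinj e)]
  symm
  apply Finset.sum_subset (Finset.subset_univ _)
  intro l _ hl
  apply hf
  by_contra hc
  push Not at hc
  exact hl (Finset.mem_image.2 ⟨⟨l, hc⟩, Finset.mem_univ _, rfl⟩)

lemma extPow_model2 {n q : ℕ} (h : q + 1 ≤ n) (A : Matrix (Fin n) (Fin n) ℂ) (v v' : Fin n → ℂ)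
    (hA : ∀ l : Fin n, q + 1 ≤ (l : ℕ) → ∀ j, A l (Fin.castLE h j) = 0)
    (hv : ∀ j : Fin (q+1), Matrix.vecMul v' A (Fin.castLE h j) = v (Fin.castLE h j)) :
    extPowC n q A (modelPiC n q v) = (A.submatrix (Fin.castLE h) (Fin.castLE h)).det • modelPiC n q v' := by
  refine extPow_model h A v v' _ (fun i j => rfl) hA fun j => ?_
  rw [← hv j]
  show ∑ l, v' l * A l (Fin.castLE h j) = _
  rw [block_sum h _ (fun l hl => by rw [hA l hl, mul_zero])]
  rfl

variable {n m : ℕ} (h : m ≤ n) (i j : Fin m)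

lemma single_cast (c : ℂ) (l : Fin n) (b : Fin m) :
    Matrix.single (Fin.castLE h i) (Fin.castLE h j) c l (Fin.castLE h b) = if hl : (l:ℕ) < m then Matrix.single i j c ⟨l, hl⟩ b else 0 := by
  have hinj : Function.Injective (Fin.castLE h) := Fin.castLE_injective h
  split_ifs with hl
  · obtain ⟨l', rfl⟩ : ∃ l', l = Fin.castLE h l' := ⟨⟨l, hl⟩, rfl⟩
    simp only [Matrix.single_apply, hinj.eq_iff]
    rfl
  · rw [Matrix.single_apply_of_row_ne]
    intro e
    apply hl; rw [← e]; exact i.2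

lemma Rt_cast (s : ℂ) (l : Fin n) (b : Fin m) :
    Rt (Fin.castLE h i) (Fin.castLE h j) s l (Fin.castLE h b) = if hl : (l:ℕ) < m then Rt i j s ⟨l, hl⟩ b else 0 := by
  have hinj : Function.Injective (Fin.castLE h) := Fin.castLE_injective h
  have h1 : (1 : Matrix (Fin n) (Fin n) ℂ) l (Fin.castLE h b) = if hl : (l:ℕ) < m then (1 : Matrix (Fin m) (Fin m) ℂ) ⟨l, hl⟩ b else 0 := by
    split_ifs with hl
    · obtain ⟨l', rfl⟩ : ∃ l', l = Fin.castLE h l' := ⟨⟨l, hl⟩, rfl⟩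
      simp only [Matrix.one_apply, hinj.eq_iff]
      rfl
    · rw [Matrix.one_apply_ne]
      intro e; apply hl; rw [e]; exact b.2
  simp only [Rt, Jm, Dm, Matrix.add_apply, Matrix.sub_apply, Matrix.smul_apply, single_cast, h1]
  split_ifs <;> simp

lemma ext_rot {q : ℕ} (h : q + 1 ≤ n) {i j : Fin (q+1)} (hij : i ≠ j) (s : ℂ) (x : Fin n → ℂ) :
    extPowC n q (Rt (Fin.castLE h i) (Fin.castLE h j) s) (modelPiC n q x) =
      modelPiC n q ((Rt (Fin.castLE h i) (Fin.castLE h j) s).mulVec x) := by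
  have hij' : Fin.castLE h i ≠ Fin.castLE h j := fun e => hij (Fin.castLE_injective h e)
  rw [extPow_model2 h _ _ ((Rt (Fin.castLE h i) (Fin.castLE h j) s).mulVec x)]
  · have : (Rt (Fin.castLE h i) (Fin.castLE h j) s).submatrix (Fin.castLE h) (Fin.castLE h) = Rt i j s := by
      ext a b
      rw [Matrix.submatrix_apply, Rt_cast, dif_pos (show ((Fin.castLE h a : Fin n) : ℕ) < q + 1 from a.2)]
      rfl
    rw [this, Rt_det hij, one_smul]
  · intro l hl b
    rw [Rt_cast, dif_neg (by omega)]
  · intro b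
    rw [← Matrix.mulVec_transpose, Matrix.mulVec_mulVec, Rt_orth hij', Matrix.one_mulVec]

lemma Jm_apply {ι : Type*} [Fintype ι] [DecidableEq ι] (i j : ι) (x : ι → ℂ) (l : ι) :
    (Jm i j).mulVec x l = (if l = i then x j else 0) - if l = j then x i else 0 := by
  simp [Jm, Matrix.sub_mulVec, Matrix.single_mulVec, Function.update_apply]

lemma x_Jx {ι : Type*} [Fintype ι] [DecidableEq ι] (i j : ι) (x : ι → ℂ) : x ⬝ᵥ (Jm i j).mulVec x = 0 := by
  simp [dotProduct, Jm_apply, mul_sub, Finset.sum_sub_distrib, mul_comm]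

lemma ext_shear {q : ℕ} (h : q + 1 ≤ n) (i j : Fin (q+1)) (x w : Fin n → ℂ) :
    extPowC n q (1 + Matrix.vecMulVec ((Jm (Fin.castLE h i) (Fin.castLE h j)).mulVec x) w) (modelPiC n q x) =
      (1 + w ⬝ᵥ (Jm (Fin.castLE h i) (Fin.castLE h j)).mulVec x) • modelPiC n q x := by
  have hinj : Function.Injective (Fin.castLE h) := Fin.castLE_injective h
  set u := (Jm (Fin.castLE h i) (Fin.castLE h j)).mulVec x with hu
  have hu0 : ∀ l : Fin n, q + 1 ≤ (l:ℕ) → u l = 0 := by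
    intro l hl
    rw [hu, Jm_apply, if_neg, if_neg, sub_zero]
    · rintro rfl; have := j.2; simp at hl; omega
    · rintro rfl; have := i.2; simp at hl; omega
  rw [extPow_model2 h _ _ x]
  · congr 1
    have : (1 + Matrix.vecMulVec u w).submatrix (Fin.castLE h) (Fin.castLE h) =
        1 + Matrix.replicateCol Unit (fun a => u (Fin.castLE h a)) * Matrix.replicateRow Unit (fun a => w (Fin.castLE h a)) := by
      ext a b
      simp [Matrix.one_apply, hinj.eq_iff, Matrix.mul_apply, Matrix.vecMulVec_apply]
    rw [this, Matrix.det_one_add_replicateCol_mul_replicateRow]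
    congr 1
    rw [dotProduct, dotProduct, block_sum h _ (fun l hl => by rw [hu0 l hl, mul_zero])]
  · intro l hl b
    rw [Matrix.add_apply, Matrix.vecMulVec_apply, hu0 l hl, zero_mul, add_zero, Matrix.one_apply_ne]
    rintro rfl; have := b.2; simp at hl; omega
  · intro b
    rw [Matrix.vecMul_add, Matrix.vecMul_one, Matrix.vecMul_vecMulVec, hu, x_Jx]
    simp
end RotAlg
section RotAn
variable {n : ℕ}

/-- equivalence of densities -/
def Equ (n q : ℕ) (g g' : (Fin n → ℂ) → ℂ) : Prop :=
  Conj (fun x => (g x)⁻¹ • modelPiC n q x) (fun x => (g' x)⁻¹ • modelPiC n q x)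

lemma mv_an {E : Type*} [NormedAddCommGroup E] [NormedSpace ℂ E] (M : Matrix (Fin n) (Fin n) ℂ) {f : E → Fin n → ℂ} {z : E} (hf : AnalyticAt ℂ f z) :
    AnalyticAt ℂ (fun z => M.mulVec (f z)) z :=
  AnalyticAt.comp (g := fun x => M.mulVec x) ((M.mulVecLin.toContinuousLinearMap).analyticAt (f z)) hf

lemma mv_fd (M : Matrix (Fin n) (Fin n) ℂ) (x : Fin n → ℂ) :
    HasFDerivAt (fun x => M.mulVec x) (M.mulVecLin.toContinuousLinearMap) x :=
  (M.mulVecLin.toContinuousLinearMap).hasFDerivAt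

lemma Rt_mv (i j : Fin n) (s : ℂ) (x : Fin n → ℂ) : (Rt i j s).mulVec x =
    x + Complex.sin s • (Jm i j).mulVec x + (Complex.cos s - 1) • (Dm i j).mulVec x := by
  simp only [Rt, Matrix.add_mulVec, Matrix.smul_mulVec, Matrix.one_mulVec]

lemma Rt_an {E : Type*} [NormedAddCommGroup E] [NormedSpace ℂ E] (i j : Fin n) {f : E → Fin n → ℂ} {σ : E → ℂ} {z : E}
    (hf : AnalyticAt ℂ f z) (hσ : AnalyticAt ℂ σ z) : AnalyticAt ℂ (fun z => (Rt i j (σ z)).mulVec (f z)) z := by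
  simp only [Rt_mv]
  have hsin : AnalyticAt ℂ (fun z => Complex.sin (σ z)) z := 
    AnalyticAt.comp (g := Complex.sin) (Complex.differentiable_sin.analyticAt _) hσ
  have hcos : AnalyticAt ℂ (fun z => Complex.cos (σ z)) z := 
    AnalyticAt.comp (g := Complex.cos) (Complex.differentiable_cos.analyticAt _) hσ
  exact (hf.add (hsin.smul (mv_an _ hf))).add ((hcos.sub analyticAt_const).smul (mv_an _ hf))

lemma Rt_deriv0 (i j : Fin n) (x : Fin n → ℂ) : HasDerivAt (fun t : ℂ => (Rt i j t).mulVec x) ((Jm i j).mulVec x) 0 := by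
  simp only [Rt_mv]
  have h1 := ((Complex.hasDerivAt_sin 0).smul_const ((Jm i j).mulVec x)).const_add x
  have h2 := ((Complex.hasDerivAt_cos 0).sub_const 1).smul_const ((Dm i j).mulVec x)
  have h3 := h1.add h2
  have h4 : Complex.cos 0 • (Jm i j).mulVec x + (-Complex.sin 0) • (Dm i j).mulVec x = (Jm i j).mulVec x := by simp
  rw [h4] at h3
  exact h3

/-- the key identity -/
lemma psi_X {i j : Fin n} (hij : i ≠ j) {g' : (Fin n → ℂ) → ℂ} {Ψ : ℂ × (Fin n → ℂ) → ℂ} (hΨ : AnalyticAt ℂ Ψ 0)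
    (h0 : ∀ x, Ψ (0, x) = 0) (hd : ∀ᶠ z in 𝓝 (0 : ℂ × (Fin n → ℂ)), fderiv ℂ Ψ z (1, 0) = g' ((Rt i j z.1).mulVec z.2)) :
    ∀ᶠ z in 𝓝 (0 : ℂ × (Fin n → ℂ)), fderiv ℂ Ψ z (0, (Jm i j).mulVec z.2) = g' ((Rt i j z.1).mulVec z.2) - g' z.2 := by
  obtain ⟨r, hr, hB⟩ := Metric.eventually_nhds_iff_ball.1 (hΨ.eventually_analyticAt.and hd)
  have hs : ∀ x : Fin n → ℂ, ∀ s, (s, x) ∈ ball (0 : ℂ × (Fin n → ℂ)) r → HasDerivAt (fun s => Ψ (s, x)) (g' ((Rt i j s).mulVec x)) s := by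
    intro x s hsx
    have h1 : HasDerivAt (fun s : ℂ => (s, x)) ((1:ℂ), (0 : Fin n → ℂ)) s := (hasDerivAt_id s).prodMk (hasDerivAt_const s x)
    have h2 := ((hB _ hsx).1.differentiableAt.hasFDerivAt).comp_hasDerivAt s h1
    rw [(hB _ hsx).2] at h2
    exact h2
  have hmem : ∀ (s : ℂ) (x : Fin n → ℂ), (s, x) ∈ ball (0 : ℂ × (Fin n → ℂ)) r ↔ ‖s‖ < r ∧ ‖x‖ < r := by
    intro s x; rw [mem_ball_zero_iff, Prod.norm_def]; exact max_lt_iff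
  filter_upwards [ball_mem_nhds 0 hr] with z hz
  obtain ⟨s, x⟩ := z
  have hz' := (hmem s x).1 hz
  have hx0 : ((0:ℂ), x) ∈ ball (0 : ℂ × (Fin n → ℂ)) r := (hmem _ _).2 ⟨by simpa using hr, hz'.2⟩
  have hRt := Rt_deriv0 i j x
  have e1 : HasDerivAt (fun t : ℂ => Ψ (s, (Rt i j t).mulVec x)) (fderiv ℂ Ψ (s, x) (0, (Jm i j).mulVec x)) 0 := by
    have h1 : HasDerivAt (fun t : ℂ => (s, (Rt i j t).mulVec x)) ((0:ℂ), (Jm i j).mulVec x) 0 := (hasDerivAt_const _ s).prodMk hRt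
    have h2 : HasFDerivAt Ψ (fderiv ℂ Ψ (s, x)) (s, (Rt i j 0).mulVec x) := by
      rw [Rt_zero, Matrix.one_mulVec]
      exact (hB _ hz).1.differentiableAt.hasFDerivAt
    exact h2.comp_hasDerivAt (0:ℂ) h1
  have e2 : HasDerivAt (fun t : ℂ => Ψ (s + t, x) - Ψ (t, x)) (g' ((Rt i j s).mulVec x) - g' x) 0 := by
    have h5 : HasDerivAt (fun t : ℂ => s + t) 1 0 := (hasDerivAt_id (0:ℂ)).const_add _
    have h6 := HasDerivAt.comp (0:ℂ) (h₂ := fun s => Ψ (s, x)) (h := fun t : ℂ => s + t) (by rw [add_zero]; exact hs x s hz) h5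
    have h7 := hs x 0 hx0
    rw [Rt_zero, Matrix.one_mulVec] at h7
    have := h6.sub h7
    rw [mul_one] at this
    exact this
  refine e1.unique (e2.congr_of_eventuallyEq ?_)
  have c1 : ∀ᶠ t : ℂ in 𝓝 0, ‖(Rt i j t).mulVec x‖ < r := by
    have : Tendsto (fun t : ℂ => ‖(Rt i j t).mulVec x‖) (𝓝 0) (𝓝 ‖x‖) := by
      have := hRt.continuousAt.norm.tendsto
      rwa [Rt_zero, Matrix.one_mulVec] at this
    exact this.eventually (gt_mem_nhds hz'.2)
  have c2 : ∀ᶠ t : ℂ in 𝓝 0, ‖t‖ < r - ‖s‖ := by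
    have : Tendsto (fun t : ℂ => ‖t‖) (𝓝 0) (𝓝 0) := by simpa using (continuous_norm (E := ℂ)).tendsto 0
    exact this.eventually (gt_mem_nhds (by linarith [hz'.1]))
  filter_upwards [c1, c2] with t ht ht'
  have hk : ∀ s' ∈ ball (0:ℂ) (r - ‖t‖), HasDerivAt (fun s' => Ψ (s', (Rt i j t).mulVec x) - Ψ (s' + t, x)) 0 s' := by
    intro s' hs'
    rw [mem_ball_zero_iff] at hs'
    have k1 := hs ((Rt i j t).mulVec x) s' ((hmem _ _).2 ⟨by linarith [norm_nonneg t], ht⟩)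
    have k2 := hs x (s' + t) ((hmem _ _).2 ⟨(norm_add_le _ _).trans_lt (by linarith), hz'.2⟩)
    have k3 := HasDerivAt.comp s' (h₂ := fun s => Ψ (s, x)) (h := fun s' : ℂ => s' + t) k2 ((hasDerivAt_id s').add_const t)
    have k4 := k1.sub k3
    rw [Matrix.mulVec_mulVec, ← Rt_add hij, mul_one, sub_self] at k4
    exact k4
  have := isOpen_ball.is_const_of_deriv_eq_zero (convex_ball (0:ℂ) (r - ‖t‖)).isPreconnected
    (fun s' hs' => (hk s' hs').differentiableAt.differentiableWithinAt) (fun s' hs' => (hk s' hs').deriv)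
    (x := s) (y := 0) (by rw [mem_ball_zero_iff]; linarith) (by rw [mem_ball_zero_iff, norm_zero]; linarith [norm_nonneg s])
  simp only [h0, zero_add, zero_sub] at this
  show Ψ (s, (Rt i j t).mulVec x) = Ψ (s + t, x) - Ψ (t, x)
  linear_combination this

theorem rot {q : ℕ} (h : q + 1 ≤ n) {i j : Fin (q+1)} (hij : i ≠ j) {g g' W : (Fin n → ℂ) → ℂ}
    (hg' : AnalyticAt ℂ g' 0) (hW : AnalyticAt ℂ W 0) (hg0 : g' 0 ≠ 0)
    (he : ∀ᶠ x in 𝓝 0, g x = g' x + fderiv ℂ W x ((Jm (Fin.castLE h i) (Fin.castLE h j)).mulVec x)) :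
    Equ n q g g' := by
  set a := Fin.castLE h i with ha
  set b := Fin.castLE h j with hb
  have hab : a ≠ b := fun e => hij (Fin.castLE_injective h e)
  have hUa : AnalyticAt ℂ (fun z : ℂ × (Fin n → ℂ) => g' ((Rt a b z.1).mulVec z.2)) 0 := by
    refine AnalyticAt.comp (g := g') (f := fun z : ℂ × (Fin n → ℂ) => (Rt a b z.1).mulVec z.2) ?_ (Rt_an a b analyticAt_snd analyticAt_fst)
    simpa using hg'
  obtain ⟨Ψ, hΨ, hΨ0, hΨd⟩ := prim (ContinuousLinearMap.fst ℂ ℂ (Fin n → ℂ)) (1, 0) rfl hUa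
  have hΨ0' : ∀ x, Ψ (0, x) = 0 := fun x => hΨ0 (0, x) rfl
  have hX := psi_X hab hΨ hΨ0' hΨd
  set χ : ℂ × (Fin n → ℂ) → ℂ × (Fin n → ℂ) := fun z => (Ψ z - (W z.2 - W 0), z.2) with hχ
  have hχd : HasFDerivAt χ ((fderiv ℂ Ψ 0 - (fderiv ℂ W 0).comp (ContinuousLinearMap.snd ℂ ℂ (Fin n → ℂ))).prod (ContinuousLinearMap.snd ℂ ℂ (Fin n → ℂ))) 0 := by
    refine HasFDerivAt.prodMk ?_ hasFDerivAt_snd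
    refine hΨ.differentiableAt.hasFDerivAt.sub ?_
    refine HasFDerivAt.sub_const _ ?_
    exact HasFDerivAt.comp (g := W) (f := fun z : ℂ × (Fin n → ℂ) => z.2) 0 hW.differentiableAt.hasFDerivAt hasFDerivAt_snd
  have hGD : GD χ := by
    refine ⟨?_, ?_, ?_⟩
    · refine AnalyticAt.prod (hΨ.sub (AnalyticAt.sub ?_ analyticAt_const)) analyticAt_snd
      exact AnalyticAt.comp (g := W) (f := fun z : ℂ × (Fin n → ℂ) => z.2) hW analyticAt_snd
    · have := hΨ0' 0
      simp only [hχ]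
      rw [show (0 : ℂ × (Fin n → ℂ)) = (0, 0) from rfl, this]; simp
    · rintro ⟨σ, v⟩ hv
      rw [hχd.fderiv] at hv
      simp only [ContinuousLinearMap.prod_apply, Prod.mk_eq_zero] at hv
      obtain ⟨h1, h2⟩ := hv
      have h2' : v = 0 := h2
      subst h2'
      have h3 := hΨd.self_of_nhds
      have h4 : fderiv ℂ Ψ 0 (σ, 0) = σ * g' 0 := by
        rw [show ((σ, 0) : ℂ × (Fin n → ℂ)) = σ • (1, 0) by simp, map_smul, h3]; simp
      rw [_root_.sub_apply, h4] at h1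
      simp [hg0] at h1
      simp [h1]
  obtain ⟨θ, hθ, -, hχθ⟩ := hGD.inv
  set τ : (Fin n → ℂ) → ℂ := fun x => (θ (0, x)).1 with hτ
  have hpair : AnalyticAt ℂ (fun x : Fin n → ℂ => ((0:ℂ), x)) 0 := analyticAt_const.prod analyticAt_id
  have hτa : AnalyticAt ℂ τ 0 := by
    refine AnalyticAt.comp (g := Prod.fst) (f := fun x => θ (0, x)) analyticAt_fst ?_
    exact AnalyticAt.comp (g := θ) (f := fun x : Fin n → ℂ => ((0:ℂ), x)) hθ.1 hpair
  have hτ0 : τ 0 = 0 := by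
    simp only [hτ]; rw [show ((0:ℂ), (0 : Fin n → ℂ)) = 0 from rfl, hθ.2.1]; rfl
  have hτW : ∀ᶠ x in 𝓝 (0 : Fin n → ℂ), Ψ (τ x, x) = W x - W 0 := by
    have hc : Tendsto (fun x : Fin n → ℂ => ((0:ℂ), x)) (𝓝 0) (𝓝 0) := hpair.continuousAt.tendsto
    filter_upwards [hc.eventually hχθ] with x hx
    simp only [hχ, Prod.mk.injEq] at hx
    have e : θ (0, x) = (τ x, x) := Prod.ext rfl hx.2
    rw [hx.2, e] at hx
    linear_combination hx.1
  have hτt : Tendsto (fun x : Fin n → ℂ => (τ x, x)) (𝓝 0) (𝓝 0) := by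
    have : ContinuousAt (fun x : Fin n → ℂ => (τ x, x)) 0 := hτa.continuousAt.prodMk continuousAt_id
    have := this.tendsto
    rwa [hτ0] at this
  set J := (Jm a b) with hJ
  have key : ∀ᶠ x in 𝓝 (0 : Fin n → ℂ), g' ((Rt a b (τ x)).mulVec x) * (1 + fderiv ℂ τ x (J.mulVec x)) = g x := by
    filter_upwards [hτW.eventually_nhds, hτt.eventually hX, hτt.eventually hΨd, hτt.eventually hΨ.eventually_analyticAt, hτa.eventually_analyticAt, hW.eventually_analyticAt, he] with x h1 h2 h3 h4 h5 h6 h7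
    have d1 : HasFDerivAt (fun x => (τ x, x)) ((fderiv ℂ τ x).prod (ContinuousLinearMap.id ℂ _)) x :=
      h5.differentiableAt.hasFDerivAt.prodMk (hasFDerivAt_id x)
    have d2 := HasFDerivAt.comp (g := Ψ) (f := fun x => (τ x, x)) x h4.differentiableAt.hasFDerivAt d1
    have d3 := (h6.differentiableAt.hasFDerivAt.sub_const (W 0)).congr_of_eventuallyEq h1
    have d4 := congrArg (fun L : (Fin n → ℂ) →L[ℂ] ℂ => L (J.mulVec x)) (d2.unique d3)
    simp only [ContinuousLinearMap.comp_apply, ContinuousLinearMap.prod_apply, ContinuousLinearMap.id_apply] at d4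
    have d5 : ((fderiv ℂ τ x (J.mulVec x), J.mulVec x) : ℂ × (Fin n → ℂ)) = fderiv ℂ τ x (J.mulVec x) • (1, 0) + (0, J.mulVec x) := by simp
    rw [d5, map_add, map_smul, h2, h3, smul_eq_mul] at d4
    rw [h7, ← d4]; ring
  set φ : (Fin n → ℂ) → (Fin n → ℂ) := fun x => (Rt a b (τ x)).mulVec x with hφ
  have hφa : AnalyticAt ℂ φ 0 := Rt_an a b analyticAt_id hτa
  have hjac : ∀ᶠ x in 𝓝 (0 : Fin n → ℂ), jacC φ x = Rt a b (τ x) * (1 + Matrix.vecMulVec (J.mulVec x) (fun l => fderiv ℂ τ x (Pi.single l 1))) := by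
    filter_upwards [hτa.eventually_analyticAt] with x h5
    apply mat_ext_mulVec
    intro v
    rw [jac_mulVec, ← Matrix.mulVec_mulVec, Matrix.add_mulVec, Matrix.one_mulVec]
    have hdot : (fun l => fderiv ℂ τ x (Pi.single l 1)) ⬝ᵥ v = fderiv ℂ τ x v := by
      conv_rhs => rw [pi_eq_sum_univ' v]
      simp only [dotProduct, map_sum, map_smul, smul_eq_mul, mul_comm]
    have hvm : (Matrix.vecMulVec (J.mulVec x) (fun l => fderiv ℂ τ x (Pi.single l 1))).mulVec v = fderiv ℂ τ x v • J.mulVec x := by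
      rw [Matrix.vecMulVec_mulVec, hdot]; ext l; simp [mul_comm]
    rw [hvm, Matrix.mulVec_add, Matrix.mulVec_smul, Matrix.mulVec_mulVec, RJ hab, Matrix.sub_mulVec, Matrix.smul_mulVec, Matrix.smul_mulVec, Rt_mv]
    have hτx := h5.differentiableAt.hasFDerivAt
    have s1 := (Complex.hasDerivAt_sin (τ x)).comp_hasFDerivAt x hτx
    have s2 := ((Complex.hasDerivAt_cos (τ x)).comp_hasFDerivAt x hτx).sub_const 1
    have s3 := ((hasFDerivAt_id x).add (s1.smul (mv_fd (Jm a b) x))).add (s2.smul (mv_fd (Dm a b) x))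
    have s4 : φ = fun x => x + Complex.sin (τ x) • (Jm a b).mulVec x + (Complex.cos (τ x) - 1) • (Dm a b).mulVec x := by
      funext x; simp only [hφ, Rt_mv]
    have s5 := s3.congr_of_eventuallyEq (f₁ := φ) (Eventually.of_forall fun y => congrFun s4 y)
    rw [s5.fderiv]
    simp [ContinuousLinearMap.smulRight_apply, hJ]
    module
  refine ⟨φ, hφa, by simp [hφ], ⟨1, ?_⟩, ?_⟩
  · rw [hjac.self_of_nhds, hτ0, Rt_zero]
    simp
  · have hφt : Tendsto φ (𝓝 0) (𝓝 0) := by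
      have := hφa.continuousAt.tendsto
      rwa [show φ 0 = 0 by simp [hφ]] at this
    have hne : ∀ᶠ x in 𝓝 (0 : Fin n → ℂ), g' (φ x) ≠ 0 := hφt.eventually (hg'.continuousAt.eventually_ne hg0)
    have hXt : ∀ᶠ x in 𝓝 (0 : Fin n → ℂ), 1 + fderiv ℂ τ x (J.mulVec x) ≠ 0 := by
      have hc : ContinuousAt (fun x : Fin n → ℂ => 1 + fderiv ℂ τ x (J.mulVec x)) 0 := by
        have h1 : ContinuousAt (fderiv ℂ τ) 0 := hτa.fderiv.continuousAt
        have h2 : ContinuousAt (fun x : Fin n → ℂ => J.mulVec x) 0 := (mv_fd J 0).continuousAt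
        exact continuousAt_const.add (h1.clm_apply h2)
      exact hc.eventually_ne (by simp)
    filter_upwards [key, hjac, hne, hXt] with x h1 h2 h3 h4
    rw [h2, extPow_mul, extPow_smul, ext_shear, extPow_smul, extPow_smul, ext_rot h hij, ← h1]
    have hdot : (fun l => fderiv ℂ τ x (Pi.single l 1)) ⬝ᵥ J.mulVec x = fderiv ℂ τ x (J.mulVec x) := by
      conv_rhs => rw [pi_eq_sum_univ' (J.mulVec x)]
      simp only [dotProduct, map_sum, map_smul, smul_eq_mul, mul_comm]
    rw [hdot, smul_smul]
    congr 1
    show (g' (φ x) * (1 + fderiv ℂ τ x (J.mulVec x)))⁻¹ * (1 + fderiv ℂ τ x (J.mulVec x)) = (g' (φ x))⁻¹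
    field_simp
end RotAn
section Dv
variable {F : Type*} [NormedAddCommGroup F] [NormedSpace ℂ F]

/-- difference quotient in the first variable -/
noncomputable def So (f : ℂ × F → ℂ) (z : ℂ × F) : ℂ := dslope (fun s => f (s, z.2)) 0 z.1

noncomputable def Io (k : ℕ) (f : ℂ × F → ℂ) (z : ℂ × F) : ℂ := ∫ τ in (0:ℝ)..1, (τ:ℂ)^k * f ((τ:ℂ) * z.1, z.2)

lemma So_eq (f : ℂ × F → ℂ) (s : ℂ) (y : F) : s * So f (s, y) = f (s, y) - f (0, y) := by
  have := sub_smul_dslope (fun s => f (s, y)) 0 s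
  rw [sub_zero, smul_eq_mul] at this
  exact this

lemma So2_eq (f : ℂ × F → ℂ) (s : ℂ) (y : F) : s^2 * So (So f) (s, y) = f (s, y) - f (0, y) - s * So f (0, y) := by
  linear_combination s * So_eq (So f) s y + So_eq f s y

lemma slice {f : ℂ × F → ℂ} {s : ℂ} {y : F} (h : AnalyticAt ℂ f (s, y)) :
    HasDerivAt (fun s => f (s, y)) (fderiv ℂ f (s, y) (1, 0)) s := by
  have h1 : HasDerivAt (fun s : ℂ => (s, y)) ((1:ℂ), (0 : F)) s := (hasDerivAt_id s).prodMk (hasDerivAt_const s y)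
  exact h.differentiableAt.hasFDerivAt.comp_hasDerivAt s h1

variable {ρ r : ℝ}

lemma tau_mem {s : ℂ} (hs : s ∈ ball (0:ℂ) ρ) {τ : ℝ} (hτ : τ ∈ Icc (0:ℝ) 1) : (τ:ℂ) * s ∈ ball (0:ℂ) ρ := by
  rw [mem_ball_zero_iff] at hs ⊢
  rw [norm_mul, Complex.norm_real, Real.norm_of_nonneg hτ.1]
  nlinarith [hτ.1, hτ.2, norm_nonneg s]

variable [FiniteDimensional ℂ F]

lemma So_an {f : ℂ × F → ℂ} (hf : AnalyticOnNhd ℂ f (ball 0 ρ ×ˢ ball 0 r)) : AnalyticOnNhd ℂ (So f) (ball 0 ρ ×ˢ ball 0 r) := by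
  have hO : IsOpen (ball (0:ℂ) ρ ×ˢ ball (0:F) r) := isOpen_ball.prod isOpen_ball
  have hfd : AnalyticOnNhd ℂ (fun z => fderiv ℂ f z (1, 0)) (ball 0 ρ ×ˢ ball 0 r) := by
    intro z hz
    exact AnalyticAt.comp (g := fun L : ℂ × F →L[ℂ] ℂ => L (1, 0)) (f := fderiv ℂ f)
      ((ContinuousLinearMap.apply ℂ ℂ ((1, 0) : ℂ × F)).analyticAt _) (hf z hz).fderiv
  have hm : ∀ z ∈ ball (0:ℂ) ρ ×ˢ ball (0:F) r, ∀ τ ∈ Icc (0:ℝ) 1, (((τ:ℂ) * z.1, z.2) : ℂ × F) ∈ ball (0:ℂ) ρ ×ˢ ball (0:F) r :=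
    fun z hz τ hτ => ⟨tau_mem hz.1 hτ, hz.2⟩
  have hI : AnalyticOnNhd ℂ (fun z : ℂ × F => ∫ τ in (0:ℝ)..1, fderiv ℂ f ((τ:ℂ) * z.1, z.2) (1, 0)) (ball 0 ρ ×ˢ ball 0 r) := by
    refine analytic_integral zero_le_one hO ?_ fun τ hτ z hz => ?_
    · exact hfd.continuousOn.comp (f := fun p : (ℂ × F) × ℝ => (((p.2:ℂ) * p.1.1, p.1.2) : ℂ × F)) (by fun_prop) fun p hp => hm p.1 hp.1 p.2 hp.2
    · exact AnalyticAt.comp (g := fun z => fderiv ℂ f z (1, 0)) (f := fun z : ℂ × F => (((τ:ℂ) * z.1, z.2) : ℂ × F)) (hfd _ (hm z hz τ hτ))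
        ((analyticAt_const.mul analyticAt_fst).prod analyticAt_snd)
  refine AnalyticOnNhd.congr hO hI ?_
  rintro ⟨s, y⟩ hz
  show (∫ τ in (0:ℝ)..1, fderiv ℂ f ((τ:ℂ) * s, y) (1, 0)) = dslope (fun s => f (s, y)) 0 s
  by_cases hs : s = 0
  · subst hs
    rw [dslope_same, (slice (hf _ hz)).deriv]
    simp
  · have hA : ∀ σ ∈ uIcc (0:ℝ) 1, HasDerivAt (fun σ : ℝ => f ((σ:ℂ) * s, y)) (s * fderiv ℂ f ((σ:ℂ) * s, y) (1, 0)) σ := by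
      intro σ hσ
      rw [uIcc_of_le zero_le_one] at hσ
      have h1 : HasDerivAt (fun σ : ℝ => (σ:ℂ) * s) s σ := by
        simpa using ((hasDerivAt_id σ).ofReal_comp).mul_const s
      have h2 := HasDerivAt.comp σ (slice (hf _ (hm _ hz σ hσ))) h1
      exact h2.congr_deriv (mul_comm _ _)
    have hci : ContinuousOn (fun σ : ℝ => fderiv ℂ f ((σ:ℂ) * s, y) (1, 0)) (uIcc 0 1) := by
      rw [uIcc_of_le zero_le_one]
      exact hfd.continuousOn.comp (f := fun σ : ℝ => (((σ:ℂ) * s, y) : ℂ × F)) (by fun_prop) fun σ hσ => hm _ hz σ hσ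
    have h3 := intervalIntegral.integral_eq_sub_of_hasDerivAt hA ((continuousOn_const.mul hci).intervalIntegrable)
    rw [intervalIntegral.integral_const_mul] at h3
    have h4 := So_eq f s y
    simp only [Complex.ofReal_one, one_mul, Complex.ofReal_zero, zero_mul] at h3
    rw [← h4] at h3
    exact mul_left_cancel₀ hs h3

lemma So_bd {f : ℂ × F → ℂ} (hf : AnalyticOnNhd ℂ f (ball 0 ρ ×ˢ ball 0 r)) {c : ℝ} (hc : ∀ z ∈ ball (0:ℂ) ρ ×ˢ ball (0:F) r, ‖f z‖ ≤ c) :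
    ∀ z ∈ ball (0:ℂ) ρ ×ˢ ball (0:F) r, ‖So f z‖ ≤ 2 * c / ρ := by
  rintro ⟨s, y⟩ hz
  refine Complex.norm_dslope_le_div_of_mapsTo_ball (f := fun s => f (s, y)) (fun s' hs' => (slice (hf (s', y) ⟨hs', hz.2⟩)).differentiableAt.differentiableWithinAt) ?_ hz.1
  intro s' hs'
  rw [mem_closedBall, dist_eq_norm]
  have h1 := hc (s', y) ⟨hs', hz.2⟩
  have hρ : 0 < ρ := pos_of_mem_ball hs'
  have h2 := hc (0, y) ⟨mem_ball_self hρ, hz.2⟩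
  exact (norm_sub_le _ _).trans (by linarith)

lemma So_sub {f g : ℂ × F → ℂ} (hf : AnalyticOnNhd ℂ f (ball 0 ρ ×ˢ ball 0 r)) (hg : AnalyticOnNhd ℂ g (ball 0 ρ ×ˢ ball 0 r)) :
    ∀ z ∈ ball (0:ℂ) ρ ×ˢ ball (0:F) r, So (fun z => f z - g z) z = So f z - So g z := by
  rintro ⟨s, y⟩ hz
  by_cases hs : s = 0
  · subst hs
    show dslope _ _ _ = dslope _ _ _ - dslope _ _ _
    rw [dslope_same, dslope_same, dslope_same]
    exact ((slice (hf _ hz)).sub (slice (hg _ hz))).deriv.trans (by rw [(slice (hf _ hz)).deriv, (slice (hg _ hz)).deriv])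
  · apply mul_left_cancel₀ hs
    rw [mul_sub, So_eq, So_eq, So_eq]; ring

lemma So_congr {f g : ℂ × F → ℂ} (h : ∀ z ∈ ball (0:ℂ) ρ ×ˢ ball (0:F) r, f z = g z) :
    ∀ z ∈ ball (0:ℂ) ρ ×ˢ ball (0:F) r, So f z = So g z := by
  rintro ⟨s, y⟩ hz
  have hρ : 0 < ρ := pos_of_mem_ball hz.1
  by_cases hs : s = 0
  · subst hs
    show dslope _ _ _ = dslope _ _ _
    rw [dslope_same, dslope_same]
    apply Filter.EventuallyEq.deriv_eq
    filter_upwards [ball_mem_nhds 0 hρ] with s hs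
    exact h _ ⟨hs, hz.2⟩
  · apply mul_left_cancel₀ hs
    rw [So_eq, So_eq, h _ hz, h (0, y) ⟨mem_ball_self hρ, hz.2⟩]

lemma Io_an (k : ℕ) {f : ℂ × F → ℂ} (hf : AnalyticOnNhd ℂ f (ball 0 ρ ×ˢ ball 0 r)) : AnalyticOnNhd ℂ (Io k f) (ball 0 ρ ×ˢ ball 0 r) := by
  have hO : IsOpen (ball (0:ℂ) ρ ×ˢ ball (0:F) r) := isOpen_ball.prod isOpen_ball
  have hm : ∀ z ∈ ball (0:ℂ) ρ ×ˢ ball (0:F) r, ∀ τ ∈ Icc (0:ℝ) 1, (((τ:ℂ) * z.1, z.2) : ℂ × F) ∈ ball (0:ℂ) ρ ×ˢ ball (0:F) r :=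
    fun z hz τ hτ => ⟨tau_mem hz.1 hτ, hz.2⟩
  refine analytic_integral zero_le_one hO ?_ fun τ hτ z hz => ?_
  · refine ContinuousOn.mul (by fun_prop) ?_
    exact hf.continuousOn.comp (f := fun p : (ℂ × F) × ℝ => (((p.2:ℂ) * p.1.1, p.1.2) : ℂ × F)) (by fun_prop) fun p hp => hm p.1 hp.1 p.2 hp.2
  · refine analyticAt_const.mul ?_
    exact AnalyticAt.comp (g := f) (f := fun z : ℂ × F => (((τ:ℂ) * z.1, z.2) : ℂ × F)) (hf _ (hm z hz τ hτ))
        ((analyticAt_const.mul analyticAt_fst).prod analyticAt_snd)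

lemma Io_ci (k : ℕ) {f : ℂ × F → ℂ} (hf : AnalyticOnNhd ℂ f (ball 0 ρ ×ˢ ball 0 r)) {z : ℂ × F} (hz : z ∈ ball (0:ℂ) ρ ×ˢ ball (0:F) r) :
    ContinuousOn (fun τ : ℝ => (τ:ℂ)^k * f ((τ:ℂ) * z.1, z.2)) (uIcc 0 1) := by
  rw [uIcc_of_le zero_le_one]
  refine ContinuousOn.mul (by fun_prop) ?_
  exact hf.continuousOn.comp (f := fun σ : ℝ => (((σ:ℂ) * z.1, z.2) : ℂ × F)) (by fun_prop) fun σ hσ => ⟨tau_mem hz.1 hσ, hz.2⟩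

lemma Io_bd (k : ℕ) {f : ℂ × F → ℂ} {c : ℝ} (hc : ∀ z ∈ ball (0:ℂ) ρ ×ˢ ball (0:F) r, ‖f z‖ ≤ c) :
    ∀ z ∈ ball (0:ℂ) ρ ×ˢ ball (0:F) r, ‖Io k f z‖ ≤ c := by
  intro z hz
  have := intervalIntegral.norm_integral_le_of_norm_le_const (a := (0:ℝ)) (b := 1) (C := c) (f := fun τ : ℝ => (τ:ℂ)^k * f ((τ:ℂ) * z.1, z.2)) (by
    intro τ hτ
    rw [uIoc_of_le zero_le_one] at hτ
    have h1 := hc ((τ:ℂ) * z.1, z.2) ⟨tau_mem hz.1 ⟨hτ.1.le, hτ.2⟩, hz.2⟩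
    rw [norm_mul, norm_pow, Complex.norm_real, Real.norm_of_nonneg hτ.1.le]
    have h2 : τ ^ k ≤ 1 := pow_le_one₀ hτ.1.le hτ.2
    nlinarith [norm_nonneg (f ((τ:ℂ) * z.1, z.2)), pow_nonneg hτ.1.le k])
  simpa [Io] using this

lemma Io_sub (k : ℕ) {f g : ℂ × F → ℂ} (hf : AnalyticOnNhd ℂ f (ball 0 ρ ×ˢ ball 0 r)) (hg : AnalyticOnNhd ℂ g (ball 0 ρ ×ˢ ball 0 r)) :
    ∀ z ∈ ball (0:ℂ) ρ ×ˢ ball (0:F) r, Io k (fun z => f z - g z) z = Io k f z - Io k g z := by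
  intro z hz
  simp only [Io]
  rw [← intervalIntegral.integral_sub ((Io_ci k hf hz).intervalIntegrable) ((Io_ci k hg hz).intervalIntegrable)]
  congr 1; funext τ; ring

lemma Io_ode (k : ℕ) {f : ℂ × F → ℂ} (hf : AnalyticOnNhd ℂ f (ball 0 ρ ×ˢ ball 0 r)) {s : ℂ} {y : F} (hz : (s, y) ∈ ball (0:ℂ) ρ ×ˢ ball (0:F) r) :
    s * (s * fderiv ℂ (Io k f) (s, y) (1, 0) + (k + 1) * Io k f (s, y)) = s * f (s, y) := by
  by_cases hs : s = 0
  · simp [hs]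
  have hud : DifferentiableOn ℂ (fun s : ℂ => s^k * f (s, y)) (ball 0 ρ) := fun s' hs' =>
    ((differentiableAt_id.pow k).mul (slice (hf (s', y) ⟨hs', hz.2⟩)).differentiableAt).differentiableWithinAt
  obtain ⟨G, hG⟩ := hud.isExactOn_ball
  have hGI : ∀ s' ∈ ball (0:ℂ) ρ, s'^(k+1) * Io k f (s', y) = G s' - G 0 := by
    intro s' hs'
    have hA : ∀ σ ∈ uIcc (0:ℝ) 1, HasDerivAt (fun σ : ℝ => G ((σ:ℂ) * s')) (s'^(k+1) * ((σ:ℂ)^k * f ((σ:ℂ) * s', y))) σ := by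
      intro σ hσ
      rw [uIcc_of_le zero_le_one] at hσ
      have h1 : HasDerivAt (fun σ : ℝ => (σ:ℂ) * s') s' σ := by
        simpa using ((hasDerivAt_id σ).ofReal_comp).mul_const s'
      have h2 := HasDerivAt.comp σ (hG _ (tau_mem hs' hσ)) h1
      exact h2.congr_deriv (by ring)
    have h3 := intervalIntegral.integral_eq_sub_of_hasDerivAt hA ((continuousOn_const.mul (Io_ci k hf (z := (s', y)) ⟨hs', hz.2⟩)).intervalIntegrable)
    rw [intervalIntegral.integral_const_mul] at h3
    simpa [Io] using h3
  have d1 := ((hasDerivAt_id s).pow (k+1)).mul (slice (Io_an k hf _ hz))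
  have d2 := (hG s hz.1).sub_const (G 0)
  have d3 := d2.congr_of_eventuallyEq (f₁ := fun s' => s'^(k+1) * Io k f (s', y)) (by
    filter_upwards [isOpen_ball.mem_nhds hz.1] with s' hs' using hGI s' hs')
  have d4 := d1.unique d3
  simp only [Pi.pow_apply, id_eq, Nat.add_sub_cancel, mul_one] at d4
  have hsk : s^k ≠ 0 := pow_ne_zero _ hs
  apply mul_left_cancel₀ hsk
  push_cast at d4
  linear_combination s * d4

lemma fp2 (ℓ : F →L[ℂ] ℂ) {f0 : ℂ × F → ℂ} (hf0 : AnalyticAt ℂ f0 0) (c : ℂ) (k : ℕ) :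
    ∃ ρ > 0, ∃ r > 0, ∃ v : ℂ × F → ℂ, AnalyticOnNhd ℂ f0 (ball 0 ρ ×ˢ ball 0 r) ∧ AnalyticOnNhd ℂ v (ball 0 ρ ×ˢ ball 0 r) ∧ 
      ∀ z ∈ ball (0:ℂ) ρ ×ˢ ball (0:F) r, v z = f0 z + ℓ z.2 * (So (So v) z - c * Io k (So (So v)) z) := by
  have hb : ∀ᶠ z in 𝓝 (0 : ℂ × F), ‖f0 z‖ < ‖f0 0‖ + 1 := hf0.continuousAt.norm.eventually (gt_mem_nhds (lt_add_one _))
  obtain ⟨ρ, hρ, hB⟩ := Metric.eventually_nhds_iff_ball.1 (hf0.eventually_analyticAt.and hb)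
  set M := ‖f0 0‖ + 1 with hM
  have hM0 : 0 < M := by positivity
  set C : ℝ := (2/ρ)^2 * (1 + ‖c‖) with hC
  have hC0 : 0 < C := by positivity
  set r : ℝ := min ρ (1 / (2 * C * (‖ℓ‖ + 1))) with hr
  have hr0 : 0 < r := by rw [hr]; positivity
  have hℓ : ∀ y ∈ ball (0:F) r, ‖ℓ y‖ * C ≤ 1/2 := by
    intro y hy
    rw [mem_ball_zero_iff] at hy
    have h1 := ℓ.le_opNorm y
    have h2 : r ≤ 1 / (2 * C * (‖ℓ‖ + 1)) := min_le_right _ _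
    have h3 : ‖ℓ‖ * ‖y‖ ≤ (‖ℓ‖ + 1) * (1 / (2 * C * (‖ℓ‖ + 1))) := by
      gcongr
      · linarith
      · linarith
    have h4 : (‖ℓ‖ + 1) * (1 / (2 * C * (‖ℓ‖ + 1))) * C = 1/2 := by
      have : ‖ℓ‖ + 1 ≠ 0 := by positivity
      field_simp
    rw [← h4]
    gcongr
    exact h1.trans h3
  set D := ball (0:ℂ) ρ ×ˢ ball (0:F) r with hD
  have hO : IsOpen D := isOpen_ball.prod isOpen_ball
  have hsub : ∀ z ∈ D, z ∈ ball (0 : ℂ × F) ρ := by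
    rintro z ⟨h1, h2⟩
    rw [mem_ball_zero_iff] at *
    rw [Prod.norm_def]
    exact max_lt h1 (h2.trans_le (min_le_left _ _))
  have hKbd : ∀ f, AnalyticOnNhd ℂ f D → ∀ b : ℝ, (∀ z ∈ D, ‖f z‖ ≤ b) → ∀ z ∈ D, ‖ℓ z.2 * (So (So f) z - c * Io k (So (So f)) z)‖ ≤ b / 2 := by
    intro f hf b hfb z hz
    have h1 := So_bd (So_an hf) (So_bd hf hfb)
    have h2 := Io_bd k h1 z hz
    have hb0 : 0 ≤ b := (norm_nonneg _).trans (hfb z hz)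
    have e : 2 * (2 * b / ρ) / ρ = (2/ρ)^2 * b := by ring
    rw [e] at h2
    have h1' := h1 z hz
    rw [e] at h1'
    rw [norm_mul]
    have h3 : ‖So (So f) z - c * Io k (So (So f)) z‖ ≤ C * b := by
      refine (norm_sub_le _ _).trans ?_
      rw [norm_mul]
      have : ‖c‖ * ‖Io k (So (So f)) z‖ ≤ ‖c‖ * ((2/ρ)^2 * b) := by gcongr
      calc _ ≤ (2/ρ)^2 * b + ‖c‖ * ((2/ρ)^2 * b) := add_le_add h1' this
        _ = C * b := by rw [hC]; ring
    calc _ ≤ ‖ℓ z.2‖ * (C * b) := by gcongr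
      _ = (‖ℓ z.2‖ * C) * b := by ring
      _ ≤ 1/2 * b := by gcongr; exact hℓ _ hz.2
      _ = b / 2 := by ring
  obtain ⟨v, h1, -, h3⟩ := analytic_fp (E := ℂ × F) (F := ℂ) hO (δ := 2 * M) (by positivity)
    (fun f z => f0 z + ℓ z.2 * (So (So f) z - c * Io k (So (So f)) z)) (by
      intro f hf hfb
      refine ⟨fun z hz => ?_, fun z hz => ?_⟩
      · refine (hB z (hsub z hz)).1.add (AnalyticAt.mul ?_ (AnalyticAt.sub (So_an (So_an hf) z hz) (analyticAt_const.mul (Io_an k (So_an (So_an hf)) z hz))))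
        exact AnalyticAt.comp (g := ℓ) (f := fun z : ℂ × F => z.2) (ℓ.analyticAt _) analyticAt_snd
      · have := hKbd f hf _ hfb z hz
        refine (norm_add_le _ _).trans ?_
        linarith [(hB z (hsub z hz)).2]) (by
      intro f g hf hfb hg hgb b hb z hz
      have h1 := hKbd (fun z => f z - g z) (hf.sub hg) b hb z hz
      have e2 : ∀ z ∈ D, So (So fun z => f z - g z) z = So (So f) z - So (So g) z := by
        intro z hz
        rw [So_congr (So_sub hf hg) z hz, So_sub (So_an hf) (So_an hg) z hz]
      have e3 : Io k (So (So fun z => f z - g z)) z = Io k (So (So f)) z - Io k (So (So g)) z := by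
        rw [← Io_sub k (So_an (So_an hf)) (So_an (So_an hg)) z hz]
        simp only [Io]
        apply intervalIntegral.integral_congr
        intro τ hτ
        rw [uIcc_of_le zero_le_one] at hτ
        show _ * _ = _ * _
        rw [e2 ((τ:ℂ) * z.1, z.2) ⟨tau_mem hz.1 hτ, hz.2⟩]
      rw [e2 z hz, e3] at h1
      refine le_trans (le_of_eq (congrArg norm ?_)) h1
      show f0 z + _ - (f0 z + _) = _
      ring)
  exact ⟨ρ, hρ, r, hr0, v, fun z hz => (hB z (hsub z hz)).1, h1, fun z hz => (h3 z hz).symm⟩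

lemma D_nhds {ρ r : ℝ} (hρ : 0 < ρ) (hr : 0 < r) : ball (0:ℂ) ρ ×ˢ ball (0:F) r ∈ 𝓝 (0 : ℂ × F) :=
  (isOpen_ball.prod isOpen_ball).mem_nhds ⟨mem_ball_self hρ, mem_ball_self hr⟩

lemma D_sub {Q : ℂ × F → Prop} (h : ∀ᶠ z in 𝓝 0, Q z) : ∃ r > 0, ∀ z ∈ ball (0:ℂ) r ×ˢ ball (0:F) r, Q z := by
  obtain ⟨r, hr, hB⟩ := Metric.eventually_nhds_iff_ball.1 h
  refine ⟨r, hr, fun z hz => hB z ?_⟩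
  rw [mem_ball_zero_iff, Prod.norm_def]
  exact max_lt (by simpa using hz.1) (by simpa using hz.2)

lemma So_at {h : ℂ × F → ℂ} (hh : AnalyticAt ℂ h 0) : AnalyticAt ℂ (So h) 0 := by
  obtain ⟨r, hr, hB⟩ := D_sub hh.eventually_analyticAt
  exact So_an hB 0 ⟨mem_ball_self hr, mem_ball_self hr⟩

lemma at0 {h : ℂ × F → ℂ} (hh : AnalyticAt ℂ h 0) : AnalyticAt ℂ (fun y => h (0, y)) 0 :=
  AnalyticAt.comp (g := h) (f := fun y : F => ((0:ℂ), y)) hh (analyticAt_const.prod analyticAt_id)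

lemma evenodd (ℓ : F →L[ℂ] ℂ) {h : ℂ × F → ℂ} (hh : AnalyticAt ℂ h 0) :
    ∃ A B : F → ℂ, ∃ v : ℂ × F → ℂ, AnalyticAt ℂ A 0 ∧ AnalyticAt ℂ B 0 ∧
      ∀ᶠ z in 𝓝 (0 : ℂ × F), h z = A z.2 + z.1 * B z.2 + (z.1^2 - ℓ z.2) * v z := by
  obtain ⟨ρ, hρ, r, hr, v, -, hv, he⟩ := fp2 ℓ (So_at (So_at hh)) 0 0
  have hv0 := hv 0 ⟨mem_ball_self hρ, mem_ball_self hr⟩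
  refine ⟨fun y => h (0, y) + ℓ y * v (0, y), fun y => So h (0, y) + ℓ y * So v (0, y), v,
    (at0 hh).add ((ℓ.analyticAt _).mul (at0 hv0)), (at0 (So_at hh)).add ((ℓ.analyticAt _).mul (at0 (So_at hv0))), ?_⟩
  filter_upwards [D_nhds hρ hr] with z hz
  obtain ⟨s, y⟩ := z
  have h1 := he _ hz
  have h2 := So2_eq h s y
  have h3 := So2_eq v s y
  simp only [zero_mul, sub_zero] at h1 ⊢
  linear_combination (-s^2) * h1 - h2 - ℓ y * h3

lemma divl (ℓ : F →L[ℂ] ℂ) {h : ℂ × F → ℂ} (hh : AnalyticAt ℂ h 0) (k : ℕ) :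
    ∃ g : F → ℂ, ∃ v : ℂ × F → ℂ, AnalyticAt ℂ g 0 ∧ AnalyticAt ℂ v 0 ∧
      ∀ᶠ z in 𝓝 (0 : ℂ × F), h z = g z.2 + (ℓ z.2 - z.1^2) * fderiv ℂ v z (1, 0) - (k + 1) * z.1 * v z := by
  obtain ⟨r0, hr0, hB⟩ := D_sub hh.eventually_analyticAt
  have hS : AnalyticOnNhd ℂ (So h) _ := So_an hB
  have hI : AnalyticOnNhd ℂ (Io k (So h)) _ := Io_an k hS
  have hI0 : AnalyticAt ℂ (Io k (So h)) 0 := hI 0 ⟨mem_ball_self hr0, mem_ball_self hr0⟩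
  obtain ⟨ρ, hρ, r, hr, v, hf, hv, he⟩ := fp2 ℓ (f0 := fun z => -Io k (So h) z) hI0.neg ((k:ℂ) - 1) k
  have hv0 := hv 0 ⟨mem_ball_self hρ, mem_ball_self hr⟩
  refine ⟨fun y => h (0, y) - ℓ y * So v (0, y), v, (at0 hh).sub ((ℓ.analyticAt _).mul (at0 (So_at hv0))), hv0, ?_⟩
  filter_upwards [D_nhds hρ hr, D_nhds hr0 hr0] with z hz hz'
  obtain ⟨s, y⟩ := z
  have hN := So_an (So_an hv)
  have dN := slice (hN _ hz)
  have dI := slice (Io_an k hN _ hz)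
  have dF := slice (hI _ hz')
  have dv := slice (hv _ hz)
  have d1 := dF.neg.add ((dN.sub (dI.const_mul ((k:ℂ) - 1))).const_mul (ℓ y))
  have d2 := dv.congr_of_eventuallyEq (f₁ := fun s => -Io k (So h) (s, y) + ℓ y * (So (So v) (s, y) - ((k:ℂ) - 1) * Io k (So (So v)) (s, y))) (by
    filter_upwards [isOpen_ball.mem_nhds hz.1] with s' hs' using (he (s', y) ⟨hs', hz.2⟩).symm)
  have d3 := d1.unique d2
  have d4 := (dv.sub_const (v (0, y))).sub ((hasDerivAt_id s).mul_const (So v (0, y)))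
  have d5 := ((hasDerivAt_id s).pow 2).mul dN
  have d6 := d5.congr_of_eventuallyEq (f₁ := fun s => v (s, y) - v (0, y) - s * So v (0, y)) (Eventually.of_forall fun s => (So2_eq v s y).symm)
  have d7 := d4.unique d6
  have o1 := Io_ode k hS hz'
  have o2 := Io_ode k hN hz
  have h1 := he _ hz
  have h2 := So_eq h s y
  simp at d3 d7 h1 ⊢
  linear_combination (-s^2) * d3 + (k+1) * s * h1 - o1 - h2 - ℓ y * (k - 1) * o2 - ℓ y * d7

end Dv
section Vol
variable {n : ℕ}

noncomputable def pj (j : ℕ) (x : Fin n → ℂ) : ℂ := ∑ i ∈ Sm n j, x i ^ 2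

noncomputable def bj (n j : ℕ) : (Fin n → ℂ) →L[ℂ] (Fin n → ℂ) := bp (Sm n j)ᶜ

lemma bj_apply (j : ℕ) (x : Fin n → ℂ) (l : Fin n) : bj n j x l = if (l:ℕ) < j then 0 else x l := by
  rw [bj, bp_apply]
  by_cases hl : (l:ℕ) < j
  · rw [if_pos hl, if_neg]; simpa [mem_Sm] using hl
  · rw [if_neg hl, if_pos]; simpa [mem_Sm] using hl

lemma Sm_succ (c : Fin n) : Sm n ((c:ℕ) + 1) = insert c (Sm n c) := by
  ext i
  rw [mem_Sm, Finset.mem_insert, mem_Sm, Fin.ext_iff]; omega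

lemma c_notMem (c : Fin n) : c ∉ Sm n c := by rw [mem_Sm]; omega

lemma pj_succ (c : Fin n) (x : Fin n → ℂ) : pj ((c:ℕ) + 1) x = x c ^ 2 + pj c x := by
  rw [pj, Sm_succ, Finset.sum_insert (c_notMem c)]; rfl

lemma bj_succ (c : Fin n) (x : Fin n → ℂ) : x c • (Pi.single c 1 : Fin n → ℂ) + bj n (c + 1) x = bj n c x := by
  ext l
  rw [Pi.add_apply, Pi.smul_apply, bj_apply, bj_apply]
  by_cases hl : l = c
  · subst hl; simp
  · have : (l:ℕ) ≠ c := fun e => hl (Fin.ext e)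
    rw [Pi.single_eq_of_ne hl]
    by_cases h2 : (l:ℕ) < c
    · rw [if_pos (by omega), if_pos h2]; simp
    · rw [if_neg (by omega), if_neg h2]; simp

lemma bj_idem (j : ℕ) (x : Fin n → ℂ) : bj n j (bj n j x) = bj n j x := by
  ext l
  rw [bj_apply, bj_apply]; split_ifs <;> rfl

lemma pj_fd (j : ℕ) (x : Fin n → ℂ) : HasFDerivAt (pj (n := n) j) (∑ i ∈ Sm n j, (2 * x i) • ContinuousLinearMap.proj (R := ℂ) (φ := fun _ : Fin n => ℂ) i) x := by
  have : HasFDerivAt (fun x : Fin n → ℂ => ∑ i ∈ Sm n j, x i ^ 2) (∑ i ∈ Sm n j, (2 * x i) • ContinuousLinearMap.proj (R := ℂ) (φ := fun _ : Fin n => ℂ) i) x := by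
    apply HasFDerivAt.fun_sum
    intro i _
    have := (hasFDerivAt_apply (𝕜 := ℂ) i x).pow 2
    refine this.congr_fderiv ?_
    ext v; simp
  exact this

lemma pj_an (j : ℕ) (x : Fin n → ℂ) : AnalyticAt ℂ (pj (n := n) j) x := by
  have : AnalyticAt ℂ (fun x : Fin n → ℂ => ∑ i ∈ Sm n j, x i ^ 2) x :=
    Finset.analyticAt_fun_sum _ fun i _ => (an_coord i x).pow 2
  exact this

lemma pj_zero (j : ℕ) : pj (n := n) j 0 = 0 := by simp [pj]

/-- the vector field `x_a ∂_c - x_c ∂_a` kills `p_{c+1}` -/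
lemma pj_inv {a c : Fin n} (hac : (a:ℕ) < c) (x : Fin n → ℂ) :
    (∑ i ∈ Sm n (c + 1), (2 * x i) • ContinuousLinearMap.proj (R := ℂ) (φ := fun _ : Fin n => ℂ) i) ((Jm c a).mulVec x) = 0 := by
  have ha : a ∈ Sm n (c+1) := mem_Sm.2 (by omega)
  have hc : c ∈ Sm n (c+1) := mem_Sm.2 (by omega)
  simp only [_root_.sum_apply, _root_.smul_apply, ContinuousLinearMap.proj_apply, Jm_apply, smul_eq_mul, mul_sub, mul_ite, mul_zero]
  rw [Finset.sum_sub_distrib, Finset.sum_ite_eq', Finset.sum_ite_eq', if_pos ha, if_pos hc]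
  ring

lemma bj_inv {a c : Fin n} (hac : (a:ℕ) < c) (x : Fin n → ℂ) : bj n (c+1) ((Jm c a).mulVec x) = 0 := by
  ext l
  rw [bj_apply, Jm_apply]
  split_ifs with h1 h2 h3 h3
  · rfl
  · subst h2; omega
  · subst h2; omega
  · subst h3; omega
  · simp

lemma equ_refl {q : ℕ} {g g' : (Fin n → ℂ) → ℂ} (h : ∀ᶠ x in 𝓝 0, g x = g' x) : Equ n q g g' := by
  refine ⟨fun x => x, analyticAt_id, rfl, ⟨1, by rw [jac_id, one_mul]⟩, ?_⟩
  filter_upwards [h] with x hx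
  rw [jac_id, extPow_one, hx]

lemma rot_sum {q : ℕ} (h : q + 1 ≤ n) (c : Fin (q+1)) {g' : (Fin n → ℂ) → ℂ} (hg' : AnalyticAt ℂ g' 0) (hg0 : g' 0 ≠ 0)
    (W : Fin n → (Fin n → ℂ) → ℂ) (T : Finset (Fin (q+1))) : c ∉ T → (∀ a ∈ T, AnalyticAt ℂ (W (Fin.castLE h a)) 0) → 
    ∀ g : (Fin n → ℂ) → ℂ,
    (∀ᶠ x in 𝓝 0, g x = g' x + ∑ a ∈ T, fderiv ℂ (W (Fin.castLE h a)) x ((Jm (Fin.castLE h c) (Fin.castLE h a)).mulVec x)) →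
    Equ n q g g' := by
  induction T using Finset.induction_on with
  | empty =>
    intro _ _ g he
    exact equ_refl (by simpa using he)
  | insert a T ha ih =>
    intro hc hW g he
    set g1 : (Fin n → ℂ) → ℂ := fun x => g' x + ∑ a ∈ T, fderiv ℂ (W (Fin.castLE h a)) x ((Jm (Fin.castLE h c) (Fin.castLE h a)).mulVec x) with hg1
    have han : AnalyticAt ℂ g1 0 := by
      refine hg'.add (Finset.analyticAt_fun_sum _ fun b hb => ?_)
      have h1 := (hW b (Finset.mem_insert_of_mem hb)).fderiv
      have h2 := mv_an (Jm (Fin.castLE h c) (Fin.castLE h b)) (analyticAt_id (𝕜 := ℂ) (z := (0 : Fin n → ℂ)))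
      have h3 : (fun x => fderiv ℂ (W (Fin.castLE h b)) x ((Jm (Fin.castLE h c) (Fin.castLE h b)).mulVec x)) =
          fun x => ∑ l, (Jm (Fin.castLE h c) (Fin.castLE h b)).mulVec x l * fderiv ℂ (W (Fin.castLE h b)) x (Pi.single l 1) := by
        funext x
        conv_lhs => rw [pi_eq_sum_univ' ((Jm (Fin.castLE h c) (Fin.castLE h b)).mulVec x)]
        simp only [map_sum, map_smul, smul_eq_mul]
      rw [h3]
      refine Finset.analyticAt_fun_sum _ fun l _ => AnalyticAt.mul ?_ (an_fd (hW b (Finset.mem_insert_of_mem hb)) _)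
      exact analyticAt_pi_iff.1 h2 l
    have h10 : g1 0 = g' 0 := by simp [hg1]
    have hca : c ≠ a := fun e => hc (e ▸ Finset.mem_insert_self _ _)
    refine conj_trans (rot h hca han (hW a (Finset.mem_insert_self _ _)) (by rw [h10]; exact hg0) ?_) (ih (fun hh => hc (Finset.mem_insert_of_mem hh)) (fun b hb => hW b (Finset.mem_insert_of_mem hb)) g1 (Eventually.of_forall fun x => rfl))
    filter_upwards [he] with x hx
    rw [hx, Finset.sum_insert ha, hg1]
    ring
end Vol
section Steps
variable {n : ℕ}

lemma pb_an (j : ℕ) : AnalyticAt ℂ (fun x : Fin n → ℂ => (pj j x, bj n j x)) 0 :=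
  (pj_an j 0).prod ((bj n j).analyticAt 0)

lemma pb_zero (j : ℕ) : (pj j (0 : Fin n → ℂ), bj n j 0) = 0 := by
  rw [pj_zero, map_zero]; rfl

lemma Hpb_an (j : ℕ) {H : ℂ × (Fin n → ℂ) → ℂ} (hH : AnalyticAt ℂ H 0) :
    AnalyticAt ℂ (fun x : Fin n → ℂ => H (pj j x, bj n j x)) 0 := by
  refine AnalyticAt.comp (g := H) (f := fun x : Fin n → ℂ => (pj j x, bj n j x)) ?_ (pb_an j)
  rw [pb_zero]; exact hH

lemma stepj {q : ℕ} (h : q + 1 ≤ n) (c : Fin (q+1)) (hc : 1 ≤ (c:ℕ)) {H : ℂ × (Fin n → ℂ) → ℂ} (hH : AnalyticAt ℂ H 0)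
    (hH0 : H 0 ≠ 0) : ∃ H' : ℂ × (Fin n → ℂ) → ℂ, AnalyticAt ℂ H' 0 ∧ H' 0 ≠ 0 ∧
      Equ n q (fun x => H (pj (c:ℕ) x, bj n c x)) (fun x => H' (pj ((c:ℕ)+1) x, bj n (c+1) x)) := by
  set C : Fin n := Fin.castLE h c with hC
  have hCc : (C:ℕ) = c := rfl
  rw [← hCc]
  set hh : ℂ × (ℂ × (Fin n → ℂ)) → ℂ := fun z => H (z.2.1 - z.1 ^ 2, z.1 • (Pi.single C 1 : Fin n → ℂ) + bj n (C+1) z.2.2) with hhd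
  have hhan : AnalyticAt ℂ hh 0 := by
    have h1 : AnalyticAt ℂ (fun z : ℂ × (ℂ × (Fin n → ℂ)) => z.1) 0 := analyticAt_fst
    have h2 : AnalyticAt ℂ (fun z : ℂ × (ℂ × (Fin n → ℂ)) => z.2) 0 := analyticAt_snd
    have h3 : AnalyticAt ℂ (fun z : ℂ × (ℂ × (Fin n → ℂ)) => z.2.1) 0 := AnalyticAt.comp (g := Prod.fst) (f := Prod.snd) analyticAt_fst h2
    have h4 : AnalyticAt ℂ (fun z : ℂ × (ℂ × (Fin n → ℂ)) => z.2.2) 0 := AnalyticAt.comp (g := Prod.snd) (f := Prod.snd) analyticAt_snd h2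
    have h5 : AnalyticAt ℂ (fun z : ℂ × (ℂ × (Fin n → ℂ)) => bj n (C+1) z.2.2) 0 :=
      AnalyticAt.comp (g := fun y => bj n (C+1) y) (f := fun z : ℂ × (ℂ × (Fin n → ℂ)) => z.2.2) ((bj n (C+1)).analyticAt _) h4
    refine AnalyticAt.comp (g := H) (f := fun z : ℂ × (ℂ × (Fin n → ℂ)) => (z.2.1 - z.1 ^ 2, z.1 • (Pi.single C 1 : Fin n → ℂ) + bj n (C+1) z.2.2)) ?_ ((h3.sub (h1.pow 2)).prod ((h1.smul analyticAt_const).add h5))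
    have : ((0 : ℂ × (ℂ × (Fin n → ℂ))).2.1 - (0 : ℂ × (ℂ × (Fin n → ℂ))).1 ^ 2, (0 : ℂ × (ℂ × (Fin n → ℂ))).1 • (Pi.single C 1 : Fin n → ℂ) + bj n (C+1) (0 : ℂ × (ℂ × (Fin n → ℂ))).2.2) = 0 := by
      simp
    rw [this]; exact hH
  obtain ⟨G, v, hG, hv, he⟩ := divl (ContinuousLinearMap.fst ℂ ℂ (Fin n → ℂ)) hhan ((C:ℕ) - 1)
  set m : (Fin n → ℂ) → ℂ × (ℂ × (Fin n → ℂ)) := fun x => (x C, (pj (C+1) x, bj n (C+1) x)) with hm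
  have hman : AnalyticAt ℂ m 0 := (an_coord C 0).prod (pb_an _)
  have hm0 : m 0 = 0 := by simp only [hm]; rw [pb_zero]; rfl
  have hmt : Tendsto m (𝓝 0) (𝓝 0) := by have := hman.continuousAt.tendsto; rwa [hm0] at this
  have hge : ∀ᶠ x in 𝓝 (0 : Fin n → ℂ), H (pj (C:ℕ) x, bj n C x) = G (pj ((C:ℕ)+1) x, bj n (C+1) x) + pj (C:ℕ) x * fderiv ℂ v (m x) (1, 0) - C * x C * v (m x) := by
    filter_upwards [hmt.eventually he] with x hx
    have e1 : hh (m x) = H (pj (C:ℕ) x, bj n C x) := by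
      simp only [hhd, hm]
      rw [bj_idem, bj_succ, pj_succ]
      congr 2; ring
    rw [e1] at hx
    rw [hx]
    have e2 : (((C:ℕ) - 1 : ℕ) : ℂ) + 1 = C := by
      rw [Nat.cast_sub (by omega)]; simp
    rw [e2]
    have e3 : (ContinuousLinearMap.fst ℂ ℂ (Fin n → ℂ)) (m x).2 - (m x).1 ^ 2 = pj (C:ℕ) x := by
      show pj (C+1) x - x C ^ 2 = _
      rw [pj_succ]; ring
    rw [e3]
  have hG0 : G 0 ≠ 0 := by
    have := hge.self_of_nhds
    rw [pb_zero, pb_zero, pj_zero] at this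
    simp at this
    rwa [← this]
  refine ⟨G, hG, hG0, ?_⟩
  have hvm : AnalyticAt ℂ (fun x => v (m x)) 0 := AnalyticAt.comp (g := v) (f := m) (by rw [hm0]; exact hv) hman
  refine rot_sum h c (Hpb_an _ hG) (by rw [pb_zero]; exact hG0) (fun a x => x a * v (m x)) (Finset.univ.filter (fun a => a < c)) (by simp)
    (fun a _ => (an_coord _ 0).mul hvm) _ ?_
  filter_upwards [hge, hmt.eventually hv.eventually_analyticAt] with x hx hvx
  rw [hx]
  have hd : ∀ a : Fin (q+1), a < c → fderiv ℂ (fun x => x (Fin.castLE h a) * v (m x)) x ((Jm C (Fin.castLE h a)).mulVec x) = 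
      x (Fin.castLE h a) ^ 2 * fderiv ℂ v (m x) (1, 0) - x C * v (m x) := by
    intro a ha
    set A := Fin.castLE h a with hA
    have hAC : (A:ℕ) < C := ha
    have hAC' : A ≠ C := fun e => by rw [e] at hAC; omega
    have d1 := hasFDerivAt_apply (𝕜 := ℂ) C x
    have d2 := pj_fd (C+1) x
    have d3 : HasFDerivAt m _ x := d1.prodMk (d2.prodMk (bj n (C+1)).hasFDerivAt)
    have d4 := HasFDerivAt.comp (g := v) (f := m) x hvx.differentiableAt.hasFDerivAt d3
    have d5 := (hasFDerivAt_apply (𝕜 := ℂ) A x).mul d4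
    have d6 : fderiv ℂ (fun x => x A * v (m x)) x = _ := d5.fderiv
    rw [d6]
    simp only [_root_.add_apply, _root_.smul_apply, ContinuousLinearMap.comp_apply, ContinuousLinearMap.prod_apply, ContinuousLinearMap.proj_apply, smul_eq_mul, pj_inv hAC, bj_inv hAC, Function.comp]
    have e1 : (Jm C A).mulVec x C = x A := by rw [Jm_apply, if_pos rfl, if_neg hAC'.symm]; ring
    have e2 : (Jm C A).mulVec x A = - x C := by rw [Jm_apply, if_pos rfl, if_neg hAC']; ring
    rw [e1, e2]
    have e3 : ((x A, (0, 0)) : ℂ × (ℂ × (Fin n → ℂ))) = x A • (1, 0) := by simp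
    rw [e3, map_smul, smul_eq_mul]; ring
  have hsum : ∑ a ∈ Finset.univ.filter (fun a => a < c), fderiv ℂ (fun x => x (Fin.castLE h a) * v (m x)) x ((Jm C (Fin.castLE h a)).mulVec x) =
      pj (C:ℕ) x * fderiv ℂ v (m x) (1, 0) - C * x C * v (m x) := by
    rw [Finset.sum_congr rfl (fun a ha => hd a (Finset.mem_filter.1 ha).2), Finset.sum_sub_distrib, ← Finset.sum_mul]
    congr 1
    · congr 1
      rw [pj]
      refine Finset.sum_bij (fun a _ => Fin.castLE h a) ?_ ?_ ?_ ?_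
      · intro a ha; rw [mem_Sm]; exact (Finset.mem_filter.1 ha).2
      · intro a _ b _ e; exact Fin.castLE_injective h e
      · intro b hb
        rw [mem_Sm] at hb
        have := c.2
        refine ⟨⟨b, by omega⟩, ?_, rfl⟩
        simp only [Finset.mem_filter, Finset.mem_univ, true_and, Fin.lt_def]
        exact hb
      · intro a _; rfl
    · rw [Finset.sum_const, nsmul_eq_mul, show Finset.univ.filter (fun a => a < c) = Finset.Iio c by ext; simp, Fin.card_Iio, hCc]; ring
  rw [hsum]; ring

lemma step0 {q : ℕ} (h : q + 1 ≤ n) (hq : 1 ≤ q) {g : (Fin n → ℂ) → ℂ} (hg : AnalyticAt ℂ g 0)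
    (hg0 : g 0 ≠ 0) : ∃ H' : ℂ × (Fin n → ℂ) → ℂ, AnalyticAt ℂ H' 0 ∧ H' 0 ≠ 0 ∧
      Equ n q g (fun x => H' (pj 1 x, bj n 1 x)) := by
  set c0 : Fin n := Fin.castLE h ⟨0, by omega⟩ with hc0
  set c1 : Fin n := Fin.castLE h ⟨1, by omega⟩ with hc1
  have h01 : c0 ≠ c1 := fun e => by
    have := congrArg Fin.val e
    simp [hc0, hc1] at this
  have hp1 : ∀ x : Fin n → ℂ, pj 1 x = x c0 ^ 2 := by
    intro x
    have := pj_succ c0 x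
    rw [show (c0:ℕ) + 1 = 1 from rfl] at this
    rw [this]
    have : pj (c0:ℕ) x = 0 := by
      rw [pj]; apply Finset.sum_eq_zero; intro i hi; rw [mem_Sm] at hi; exact absurd hi (Nat.not_lt_zero _)
    rw [this, add_zero]
  have hp2 : ∀ x : Fin n → ℂ, pj (c1+1) x = x c1 ^ 2 + x c0 ^ 2 := by
    intro x
    rw [pj_succ c1 x, show (c1:ℕ) = 1 from rfl, hp1]
  have hb0 : ∀ x : Fin n → ℂ, x c0 • (Pi.single c0 1 : Fin n → ℂ) + bj n 1 x = x := by
    intro x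
    have := bj_succ c0 x
    rw [show (c0:ℕ) + 1 = 1 from rfl] at this
    rw [this]
    ext l; rw [bj_apply, if_neg]; exact Nat.not_lt_zero _
  set hh : ℂ × (ℂ × (Fin n → ℂ)) → ℂ := fun z => g (z.1 • (Pi.single c0 1 : Fin n → ℂ) + bj n 1 z.2.2) with hhd
  have hhan : AnalyticAt ℂ hh 0 := by
    have h1 : AnalyticAt ℂ (fun z : ℂ × (ℂ × (Fin n → ℂ)) => z.1) 0 := analyticAt_fst
    have h2 : AnalyticAt ℂ (fun z : ℂ × (ℂ × (Fin n → ℂ)) => z.2) 0 := analyticAt_snd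
    have h4 : AnalyticAt ℂ (fun z : ℂ × (ℂ × (Fin n → ℂ)) => z.2.2) 0 := AnalyticAt.comp (g := Prod.snd) (f := Prod.snd) analyticAt_snd h2
    have h5 : AnalyticAt ℂ (fun z : ℂ × (ℂ × (Fin n → ℂ)) => bj n 1 z.2.2) 0 :=
      AnalyticAt.comp (g := fun y => bj n 1 y) (f := fun z : ℂ × (ℂ × (Fin n → ℂ)) => z.2.2) ((bj n 1).analyticAt _) h4
    refine AnalyticAt.comp (g := g) (f := fun z : ℂ × (ℂ × (Fin n → ℂ)) => z.1 • (Pi.single c0 1 : Fin n → ℂ) + bj n 1 z.2.2) ?_ ((h1.smul analyticAt_const).add h5)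
    have : (0 : ℂ × (ℂ × (Fin n → ℂ))).1 • (Pi.single c0 1 : Fin n → ℂ) + bj n 1 (0 : ℂ × (ℂ × (Fin n → ℂ))).2.2 = 0 := by
      simp
    rw [this]; exact hg
  obtain ⟨A, B, v, hA, hB, he⟩ := evenodd (ContinuousLinearMap.fst ℂ ℂ (Fin n → ℂ)) hhan
  set m : (Fin n → ℂ) → ℂ × (ℂ × (Fin n → ℂ)) := fun x => (x c0, (pj 1 x, bj n 1 x)) with hm
  have hman : AnalyticAt ℂ m 0 := (an_coord c0 0).prod (pb_an _)
  have hm0 : m 0 = 0 := by simp only [hm]; rw [pb_zero]; rfl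
  have hmt : Tendsto m (𝓝 0) (𝓝 0) := by have := hman.continuousAt.tendsto; rwa [hm0] at this
  have hge : ∀ᶠ x in 𝓝 (0 : Fin n → ℂ), g x = A (pj 1 x, bj n 1 x) + x c0 * B (pj 1 x, bj n 1 x) := by
    filter_upwards [hmt.eventually he] with x hx
    have e1 : hh (m x) = g x := by
      simp only [hhd, hm]
      rw [bj_idem, hb0]
    have e3 : (m x).1 ^ 2 - (ContinuousLinearMap.fst ℂ ℂ (Fin n → ℂ)) (m x).2 = 0 := by
      show x c0 ^ 2 - pj 1 x = _
      rw [hp1]; ring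
    rw [e1, e3, zero_mul, add_zero] at hx
    exact hx
  have hA0 : A 0 ≠ 0 := by
    have := hge.self_of_nhds
    rw [pb_zero] at this
    simp at this
    rwa [← this]
  refine ⟨A, hA, hA0, ?_⟩
  -- primitive
  have hUan : AnalyticAt ℂ (fun z : ℂ × (Fin n → ℂ) => B (z.1 - z.2 c1 ^ 2, z.2)) 0 := by
    have h1 : AnalyticAt ℂ (fun z : ℂ × (Fin n → ℂ) => z.1) 0 := analyticAt_fst
    have h2 : AnalyticAt ℂ (fun z : ℂ × (Fin n → ℂ) => z.2) 0 := analyticAt_snd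
    have h3 : AnalyticAt ℂ (fun z : ℂ × (Fin n → ℂ) => z.2 c1) 0 := analyticAt_pi_iff.1 h2 c1
    refine AnalyticAt.comp (g := B) (f := fun z : ℂ × (Fin n → ℂ) => (z.1 - z.2 c1 ^ 2, z.2)) ?_ ((h1.sub (h3.pow 2)).prod h2)
    have : ((0 : ℂ × (Fin n → ℂ)).1 - (0 : ℂ × (Fin n → ℂ)).2 c1 ^ 2, (0 : ℂ × (Fin n → ℂ)).2) = 0 := by simp
    rw [this]; exact hB
  obtain ⟨Ω, hΩ, -, hΩd⟩ := prim ((ContinuousLinearMap.proj (R := ℂ) (φ := fun _ : Fin n => ℂ) c1).comp (ContinuousLinearMap.snd ℂ ℂ (Fin n → ℂ)))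
    (0, Pi.single c1 1) (by simp) hUan
  set m2 : (Fin n → ℂ) → ℂ × (Fin n → ℂ) := fun x => (pj (c1+1) x, bj n 1 x) with hm2
  have hm2an : AnalyticAt ℂ m2 0 := (pj_an _ 0).prod ((bj n 1).analyticAt 0)
  have hm20 : m2 0 = 0 := by simp only [hm2]; rw [pj_zero, map_zero]; rfl
  have hm2t : Tendsto m2 (𝓝 0) (𝓝 0) := by have := hm2an.continuousAt.tendsto; rwa [hm20] at this
  refine rot h (i := ⟨1, by omega⟩) (j := ⟨0, by omega⟩) (W := fun x => Ω (m2 x)) (by simp) (Hpb_an _ hA) (AnalyticAt.comp (g := Ω) (f := m2) (by rw [hm20]; exact hΩ) hm2an) (by rw [pb_zero]; exact hA0) ?_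
  filter_upwards [hge, hm2t.eventually hΩd, hm2t.eventually hΩ.eventually_analyticAt] with x hx hdx hax
  rw [hx]
  have d3 : HasFDerivAt m2 _ x := (pj_fd (c1+1) x).prodMk (bj n 1).hasFDerivAt
  have d4 := HasFDerivAt.comp (g := Ω) (f := m2) x hax.differentiableAt.hasFDerivAt d3
  have d6 : fderiv ℂ (fun x => Ω (m2 x)) x = _ := d4.fderiv
  rw [d6]
  have hlt : (c0:ℕ) < c1 := by simp [hc0, hc1]
  show _ = _ + (_ : _ →L[ℂ] _) ((Jm c1 c0).mulVec x)
  simp only [ContinuousLinearMap.comp_apply, ContinuousLinearMap.prod_apply, pj_inv hlt]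
  have e2 : bj n 1 ((Jm c1 c0).mulVec x) = x c0 • (Pi.single c1 1 : Fin n → ℂ) := by
    ext l
    rw [bj_apply, Jm_apply, Pi.smul_apply, Pi.single_apply]
    by_cases hl : l = c0
    · subst hl; rw [if_pos (by simp [hc0]), if_neg h01]; simp
    · have : (l:ℕ) ≠ 0 := fun e => hl (Fin.ext e)
      rw [if_neg (by omega), if_neg hl]; split_ifs <;> simp
  have e3 : ((0, x c0 • (Pi.single c1 1 : Fin n → ℂ)) : ℂ × (Fin n → ℂ)) = x c0 • (0, Pi.single c1 1) := by simp
  rw [e2, e3, map_smul, hdx, smul_eq_mul]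
  have e4 : bj n 1 x c1 = x c1 := by rw [bj_apply, if_neg]; simp [hc1]
  show _ = _ + x c0 * B (pj (c1+1) x - bj n 1 x c1 ^ 2, bj n 1 x)
  rw [e4, hp2, hp1]; congr 4; ring

theorem steps {q : ℕ} (h : q + 1 ≤ n) (hq : 1 ≤ q) {g : (Fin n → ℂ) → ℂ} (hg : AnalyticAt ℂ g 0)
    (hg0 : g 0 ≠ 0) : ∃ H' : ℂ × (Fin n → ℂ) → ℂ, AnalyticAt ℂ H' 0 ∧ H' 0 ≠ 0 ∧
      Equ n q g (fun x => H' (pj (q+1) x, bj n (q+1) x)) := by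
  have : ∀ j, j ≤ q → ∃ H' : ℂ × (Fin n → ℂ) → ℂ, AnalyticAt ℂ H' 0 ∧ H' 0 ≠ 0 ∧
      Equ n q g (fun x => H' (pj (j+1) x, bj n (j+1) x)) := by
    intro j
    induction j with
    | zero => intro _; exact step0 h hq hg hg0
    | succ j ih =>
      intro hj
      obtain ⟨H, h1, h2, h3⟩ := ih (by omega)
      obtain ⟨H', h1', h2', h3'⟩ := stepj h ⟨j+1, by omega⟩ (by simp) h1 h2
      exact ⟨H', h1', h2', conj_trans h3 h3'⟩
  exact this q le_rfl
end Steps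
section Scale

lemma root_an {E : Type*} [NormedAddCommGroup E] [NormedSpace ℂ E] {H : E → ℂ} {z : E} (hH : AnalyticAt ℂ H z) (h0 : H z ≠ 0) {m : ℕ} (hm : m ≠ 0) :
    ∃ r : E → ℂ, AnalyticAt ℂ r z ∧ r z ≠ 0 ∧ ∀ᶠ x in 𝓝 z, r x ^ m = H x := by
  obtain ⟨ρ, hρ⟩ := IsAlgClosed.exists_pow_nat_eq (H z) (Nat.pos_of_ne_zero hm)
  have hρ0 : ρ ≠ 0 := by rintro rfl; rw [zero_pow hm] at hρ; exact h0 hρ.symm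
  have h1 : AnalyticAt ℂ (fun x => H x / H z) z := hH.div_const
  have h2 : AnalyticAt ℂ (fun x => Complex.log (H x / H z)) z := by
    refine h1.clog ?_
    rw [div_self h0]; simp
  have h3 : AnalyticAt ℂ (fun x => Complex.exp (Complex.log (H x / H z) / m)) z := h2.div_const.cexp
  refine ⟨fun x => ρ * Complex.exp (Complex.log (H x / H z) / m), analyticAt_const.mul h3, mul_ne_zero hρ0 (Complex.exp_ne_zero _), ?_⟩
  filter_upwards [hH.continuousAt.eventually_ne h0] with x hx
  rw [mul_pow, ← Complex.exp_nat_mul, mul_div_cancel₀ _ (by exact_mod_cast hm), Complex.exp_log (div_ne_zero hx h0), hρ]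
  field_simp

variable {n : ℕ}

theorem scale {q : ℕ} (h : q + 1 ≤ n) (hq : 2 ≤ q) {H : ℂ × (Fin n → ℂ) → ℂ} (hH : AnalyticAt ℂ H 0) (hH0 : H 0 ≠ 0) :
    Conj (fun x => (H (pj (q+1) x, bj n (q+1) x))⁻¹ • modelPiC n q x) (modelPiC n q) := by
  obtain ⟨r, hr, hr0, hrH⟩ := root_an hH hH0 (m := q - 1) (by omega)
  set m : (Fin n → ℂ) → ℂ × (Fin n → ℂ) := fun x => (pj (q+1) x, bj n (q+1) x) with hm
  have hm0 : m 0 = 0 := pb_zero _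
  have hma : AnalyticAt ℂ m 0 := pb_an _
  have hmt : Tendsto m (𝓝 0) (𝓝 0) := by have := hma.continuousAt.tendsto; rwa [hm0] at this
  set α : (Fin n → ℂ) → ℂ := fun x => r (m x) with hα
  set β : (Fin n → ℂ) → ℂ := fun x => fderiv ℂ r (m x) (1, 0) with hβ
  have hαa : AnalyticAt ℂ α 0 := Hpb_an _ hr
  have hα0 : α 0 ≠ 0 := by simp only [hα]; rw [hm0]; exact hr0
  set φ : (Fin n → ℂ) → (Fin n → ℂ) := fun x l => if (l:ℕ) < q + 1 then α x * x l else x l with hφ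
  have hφa : AnalyticAt ℂ φ 0 := by
    refine analyticAt_pi_iff.2 fun l => ?_
    by_cases hl : (l:ℕ) < q + 1
    · simp only [hφ, if_pos hl]; exact hαa.mul (an_coord l 0)
    · simp only [hφ, if_neg hl]; exact an_coord l 0
  have hφ0 : φ 0 = 0 := by ext l; simp [hφ]
  have hfd : ∀ x, AnalyticAt ℂ φ x → AnalyticAt ℂ α x → ∀ v l, fderiv ℂ φ x v l = if (l:ℕ) < q + 1 then α x * v l + x l * fderiv ℂ α x v else v l := by
    intro x h1 h2 v l
    rw [← fd_coord h1.differentiableAt]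
    by_cases hl : (l:ℕ) < q + 1
    · simp only [hφ, if_pos hl]
      have := (h2.differentiableAt.hasFDerivAt.mul (hasFDerivAt_apply (𝕜 := ℂ) l x)).fderiv
      have e : fderiv ℂ (fun x => α x * x l) x = _ := this
      rw [e]; simp
    · simp only [hφ, if_neg hl]
      have e : fderiv ℂ (fun x : Fin n → ℂ => x l) x = _ := (hasFDerivAt_apply (𝕜 := ℂ) l x).fderiv
      rw [e]; simp
  have hGD : GD φ := by
    refine ⟨hφa, hφ0, fun v hv => ?_⟩
    ext l
    have := congrFun hv l
    rw [hfd 0 hφa hαa] at this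
    split_ifs at this with hl
    · simpa [hα0] using this
    · exact this
  refine ⟨φ, hφa, hφ0, hGD.jac, ?_⟩
  have hβc : ContinuousAt (fun x => α x + 2 * β x * pj (q+1) x) 0 := by
    have h1 : ContinuousAt (fun x => fderiv ℂ r (m x)) 0 := 
      ContinuousAt.comp (g := fderiv ℂ r) (f := m) (by rw [hm0]; exact hr.fderiv.continuousAt) hma.continuousAt
    have h2 : ContinuousAt β 0 := h1.clm_apply continuousAt_const
    exact hαa.continuousAt.add ((continuousAt_const.mul h2).mul (pj_an _ 0).continuousAt)
  have hb0 : ∀ᶠ x in 𝓝 0, α x + 2 * β x * pj (q+1) x ≠ 0 := hβc.eventually_ne (by rw [pj_zero]; simpa using hα0)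
  filter_upwards [hb0, hφa.eventually_analyticAt, hαa.eventually_analyticAt, hαa.continuousAt.eventually_ne hα0, hmt.eventually hrH, hmt.eventually hr.eventually_analyticAt] with x k1 k2 k3 k4 k5 k6
  have hdα : ∀ j : Fin n, (j:ℕ) < q + 1 → fderiv ℂ α x (Pi.single j 1) = 2 * β x * x j := by
    intro j hj
    have d3 : HasFDerivAt m _ x := (pj_fd (q+1) x).prodMk (bj n (q+1)).hasFDerivAt
    have d4 := HasFDerivAt.comp (g := r) (f := m) x k6.differentiableAt.hasFDerivAt d3
    have d6 : fderiv ℂ α x = _ := d4.fderiv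
    rw [d6]
    have e1 : bj n (q+1) (Pi.single j 1) = 0 := by
      ext l; rw [bj_apply, Pi.single_apply]
      split_ifs with h1 h2 
      · rfl
      · subst h2; exact absurd hj h1
      · rfl
    have e2 : (∑ i ∈ Sm n (q+1), (2 * x i) • ContinuousLinearMap.proj (R := ℂ) (φ := fun _ : Fin n => ℂ) i) (Pi.single j 1) = 2 * x j := by
      simp only [_root_.sum_apply, _root_.smul_apply, ContinuousLinearMap.proj_apply, smul_eq_mul, Pi.single_apply, mul_ite, mul_one, mul_zero]
      rw [Finset.sum_ite_eq', if_pos (mem_Sm.2 hj)]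
    simp only [ContinuousLinearMap.comp_apply, ContinuousLinearMap.prod_apply, e1, e2]
    have e3 : ((2 * x j, 0) : ℂ × (Fin n → ℂ)) = (2 * x j) • (1, 0) := by simp
    rw [e3, map_smul, smul_eq_mul]; simp only [hβ]; ring
  have hjac : ∀ (l : Fin n) (j : Fin (q+1)), jacC φ x l (Fin.castLE h j) = if (l:ℕ) < q + 1 then α x * (if l = Fin.castLE h j then 1 else 0) + x l * (2 * β x * x (Fin.castLE h j)) else 0 := by
    intro l j
    show fderiv ℂ φ x (Pi.single (Fin.castLE h j) 1) l = _
    rw [hfd x k2 k3, hdα _ (show ((Fin.castLE h j : Fin n) : ℕ) < q + 1 from j.2), Pi.single_apply]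
    split_ifs with h1 h2 h2
    · rfl
    · rfl
    · subst h2; exact absurd j.2 h1
    · rfl
  have hpj : pj (q+1) x = ∑ i : Fin (q+1), x (Fin.castLE h i) ^ 2 := by
    have e := block_sum h (fun l : Fin n => if (l:ℕ) < q + 1 then x l ^ 2 else 0) (fun l hl => if_neg (by omega))
    rw [Finset.sum_congr rfl (fun (i : Fin (q+1)) _ => if_pos (show ((Fin.castLE h i : Fin n) : ℕ) < q + 1 from i.2))] at e
    rw [← e, ← Finset.sum_filter, pj]
    refine Finset.sum_congr ?_ fun _ _ => rfl
    ext i; simp [mem_Sm]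
  rw [extPow_smul, extPow_model2 h (jacC φ x) x ((α x + 2 * β x * pj (q+1) x)⁻¹ • x)]
  · have hdet : ((jacC φ x).submatrix (Fin.castLE h) (Fin.castLE h)).det = α x ^ q * (α x + 2 * β x * pj (q+1) x) := by
      have e1 : (jacC φ x).submatrix (Fin.castLE h) (Fin.castLE h) = α x • (1 + Matrix.replicateCol Unit (fun a => (α x)⁻¹ * x (Fin.castLE h a)) * Matrix.replicateRow Unit (fun a => 2 * β x * x (Fin.castLE h a))) := by
        ext a b
        rw [Matrix.submatrix_apply, hjac, if_pos (show ((Fin.castLE h a : Fin n) : ℕ) < q + 1 from a.2)]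
        simp only [Matrix.smul_apply, Matrix.add_apply, Matrix.one_apply, Matrix.mul_apply, Matrix.replicateCol_apply, Matrix.replicateRow_apply, Finset.univ_unique, Finset.sum_singleton, smul_eq_mul, Fin.castLE_inj]
        field_simp
      rw [e1, Matrix.det_smul, Matrix.det_one_add_replicateCol_mul_replicateRow, Fintype.card_fin, hpj]
      have e2 : (fun a => 2 * β x * x (Fin.castLE h a)) ⬝ᵥ (fun a : Fin (q+1) => (α x)⁻¹ * x (Fin.castLE h a)) = 2 * β x * (α x)⁻¹ * ∑ i : Fin (q+1), x (Fin.castLE h i) ^ 2 := by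
        rw [dotProduct, Finset.mul_sum]
        exact Finset.sum_congr rfl fun i _ => by ring
      rw [e2, pow_succ]; field_simp
    rw [hdet, model_smul, smul_smul, smul_smul]
    have e3 : modelPiC n q (φ x) = α x • modelPiC n q x := by
      rw [← model_smul]; refine model_congr fun i hi => ?_
      simp only [hφ, if_pos hi]; rfl
    rw [e3]
    congr 1
    show (H (m x))⁻¹ * _ * _ = _
    rw [← k5]
    have e4 : α x ^ q = α x ^ (q - 1) * α x := by rw [← pow_succ]; congr 1; omega
    rw [e4]
    show (α x ^ (q - 1))⁻¹ * _ * _ = _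
    field_simp
  · intro l hl j
    rw [hjac, if_neg (by omega)]
  · intro j
    show ∑ l, ((α x + 2 * β x * pj (q+1) x)⁻¹ • x) l * jacC φ x l (Fin.castLE h j) = _
    rw [block_sum h _ (fun l hl => by rw [hjac, if_neg (by omega), mul_zero])]
    have : ∀ i : Fin (q+1), ((α x + 2 * β x * pj (q+1) x)⁻¹ • x) (Fin.castLE h i) * jacC φ x (Fin.castLE h i) (Fin.castLE h j) =
       (α x + 2 * β x * pj (q+1) x)⁻¹ * α x * (if i = j then x (Fin.castLE h i) else 0) + (α x + 2 * β x * pj (q+1) x)⁻¹ * (2 * β x * x (Fin.castLE h j)) * x (Fin.castLE h i) ^ 2 := by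
      intro i
      rw [hjac, if_pos (show ((Fin.castLE h i : Fin n) : ℕ) < q + 1 from i.2)]
      simp only [Fin.castLE_inj, Pi.smul_apply, smul_eq_mul]
      split_ifs <;> ring
    rw [Finset.sum_congr rfl fun i _ => this i, Finset.sum_add_distrib, ← Finset.mul_sum, ← Finset.mul_sum, ← hpj, Finset.sum_ite_eq', if_pos (Finset.mem_univ _)]
    field_simp
    try ring

theorem conj_model {k p : ℕ} (hpk : p ≤ k) {U : Set (Fin (k+3) → ℂ)} (hU : IsOpen U) (h0U : 0 ∈ U)
    {P : (Fin (k+3) → ℂ) → MultiVecC (k+3) (p+2)} (hN : IsNambuC (k+3) (p+2) P U) (hP0 : P 0 = 0)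
    (hlin : ∀ v, fderiv ℂ P 0 v = modelPiC (k+3) (p+2) v) :
    Conj P (modelPiC (k+3) (p+2)) := by
  obtain ⟨f, h1, h2, h3⟩ := step5 hpk hU h0U hN hP0 hlin
  have h : p + 2 + 1 ≤ k + 3 := by omega
  obtain ⟨H, g1, g2, g3⟩ := steps h (by omega) (h1.inv h2) (inv_ne_zero h2)
  refine conj_trans (conj_trans h3 ?_) (scale h (by omega) g1 g2)
  have e : (fun y => f y • modelPiC (k+3) (p+2) y) = fun y => ((f⁻¹) y)⁻¹ • modelPiC (k+3) (p+2) y := by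
    funext y; simp
  rw [e]; exact g3

theorem conj_biholo {n q : ℕ} {P P' : (Fin n → ℂ) → MultiVecC n q} (hc : Conj P P') {U : Set (Fin n → ℂ)} (hU : IsOpen U) (h0U : 0 ∈ U) :
    ∃ W : Set (Fin n → ℂ), W ⊆ U ∧ (0 : Fin n → ℂ) ∈ W ∧
      ∃ φ : (Fin n → ℂ) → (Fin n → ℂ), IsBiholoOn φ W ∧ φ 0 = 0 ∧
        ∀ x ∈ W, extPowC n q (jacC φ x) (P x) = P' (φ x) := by
  obtain ⟨φ, h1, h2, ⟨K, h3⟩, h4⟩ := hc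
  have hG := GD.of_jac h1 h2 h3
  obtain ⟨θ, hθ, a1, a2⟩ := hG.inv
  -- choose V open nhd of 0 for θ
  obtain ⟨V, hVs, hVo, hV0⟩ := _root_.mem_nhds_iff.1 (hθ.1.eventually_analyticAt.and a2)
  obtain ⟨S, hSs, hSo, hS0⟩ := _root_.mem_nhds_iff.1 (((h1.eventually_analyticAt.and a1).and h4).and (hU.mem_nhds h0U))
  have hφc : ContinuousOn φ S := fun x hx => ((hSs hx).1.1.1.continuousAt).continuousWithinAt
  have hθc : ContinuousOn θ V := fun x hx => ((hVs hx).1.continuousAt).continuousWithinAt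
  set W := S ∩ φ ⁻¹' V with hW
  have hWo : IsOpen W := hφc.isOpen_inter_preimage hSo hVo
  have him : φ '' W = V ∩ θ ⁻¹' S := by
    ext y; constructor
    · rintro ⟨x, ⟨hx, hx'⟩, rfl⟩
      refine ⟨hx', ?_⟩
      have : θ (φ x) = x := (hSs hx).1.1.2
      show θ (φ x) ∈ S
      rwa [this]
    · rintro ⟨hy, hy'⟩
      have : φ (θ y) = y := (hVs hy).2
      refine ⟨θ y, ⟨hy', ?_⟩, this⟩
      show φ (θ y) ∈ V
      rwa [this]
  refine ⟨W, fun x hx => (hSs hx.1).2, ⟨hS0, by show φ 0 ∈ V; rwa [h2]⟩, φ, ⟨hWo, ?_, fun x hx => (hSs hx.1).1.1.1, θ, ?_, fun x hx => (hSs hx.1).1.1.2, ?_⟩, h2, fun x hx => (hSs hx.1).1.2⟩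
  · rw [him]; exact hθc.isOpen_inter_preimage hVo hSo
  · rw [him]; exact fun y hy => (hVs hy.1).1
  · rw [him]; exact fun y hy => (hVs hy.1).2
end Scale
/-- Theorem 1.3 of the paper, complex case: holomorphic
linearization. A holomorphic Nambu structure of order `q ≥ 2` vanishing at `0`
whose linear part at `0` is the complex nondegenerate Type 1 model `Π_q^ℂ` is
locally holomorphically linearizable at `0`. -/
theorem holomorphic_linearization (n q : ℕ) (hq : 2 ≤ q) (hn : q < n)
    (U : Set (Fin n → ℂ)) (hU : IsOpen U) (h0U : (0 : Fin n → ℂ) ∈ U)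
    (P : (Fin n → ℂ) → MultiVecC n q) (hN : IsNambuC n q P U)
    (hP0 : P 0 = 0) (hlin : ∀ v : Fin n → ℂ, fderiv ℂ P 0 v = modelPiC n q v) :
    ∃ W : Set (Fin n → ℂ), W ⊆ U ∧ (0 : Fin n → ℂ) ∈ W ∧
      ∃ φ : (Fin n → ℂ) → (Fin n → ℂ), IsBiholoOn φ W ∧ φ 0 = 0 ∧
        ∀ x ∈ W, extPowC n q (jacC φ x) (P x) = modelPiC n q (φ x) := by
  obtain ⟨k, rfl⟩ : ∃ k, n = k + 3 := ⟨n - 3, by omega⟩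
  obtain ⟨p, rfl⟩ : ∃ p, q = p + 2 := ⟨q - 2, by omega⟩
  exact conj_biholo (conj_model (by omega) hU h0U hN hP0 hlin) hU h0U

end NambuLinC
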